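/- Let 0 < p < 1/2 and define h(x) = −x log₂ x − (1−x) log₂(1−x), A(ω) = ω log₂(2√(p(1−p))), and for 0 < λ ≤ ω < 1 with λ/2 < 1 − ω, B(ω,λ) = −ω − (1−ω)h(p) + max_{η ∈ [λp/2, min(λ/4, p(1−ω))]} [ λ h(2η/λ) + (ω − λ/2) h((ω − 2η)/(2ω − λ)) + (1 − ω − λ/2) h((p(1−ω) − η)/(1 − ω − λ/2)) ]. Let δ̄(R) = min { G(α, τ) : 0 ≤ α ≤ 1/2, h(α) ≥ 1 − R, τ = h^{-1}(h(α) − 1 + R) } with G(α, τ) = 2(α(1−α) − τ(1−τ))/(1 + 2√(τ(1−τ))) (the JPL bound). Let R ∈ (0, 1 − h(p)) be a rate such that 1 − R − h(δ̄(R)) − A(δ̄(R)) ≥ max_{0 ≤ λ ≤ ω ≤ δ̄(R)} ( B(ω, λ) − A(λ) ). Then the reliability function of the BSC satisfies E(R, p) ≤ 1 − R − h(δ̄(R)) − A(δ̄(R)); moreover, for any rate R ∈ (0, 1 − h(p)) for which the reverse inequality between the two expressions holds, E(R, p) ≤ max_{0 ≤ λ ≤ ω ≤ δ̄(R)} ( B(ω,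 λ) − A(λ) ). -/

import Mathlib

open Finset Filter

/-- The binary entropy function `h(x) = −x log₂ x − (1−x) log₂(1−x)`. -/
noncomputable def binEnt (x : ℝ) : ℝ :=
  -x * Real.logb 2 x - (1 - x) * Real.logb 2 (1 - x)

/-- The inverse of the binary entropy function taking values in `[0, 1/2]`. -/
noncomputable def binEntInv (y : ℝ) : ℝ :=
  sInf {x : ℝ | x ∈ Set.Icc (0 : ℝ) (1 / 2) ∧ binEnt x = y}

/-- The pairwise error exponent `A(ω) = ω log₂(2√(p(1−p)))`. -/
noncomputable def Aexp (p ω : ℝ) : ℝ := ω * Real.logb 2 (2 * Real.sqrt (p * (1 - p)))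

/-- The exponent `B(ω,λ)` of the conditional probability of a second half-space
event given a first one (Barg–McGregor). -/
noncomputable def Bexp (p ω l : ℝ) : ℝ :=
  -ω - (1 - ω) * binEnt p +
    sSup ((fun η => l * binEnt (2 * η / l)
        + (ω - l / 2) * binEnt ((ω - 2 * η) / (2 * ω - l))
        + (1 - ω - l / 2) * binEnt ((p * (1 - ω) - η) / (1 - ω - l / 2))) ''
      Set.Icc (l * p / 2) (min (l / 4) (p * (1 - ω))))

/-- `G(α,τ) = 2(α(1−α) − τ(1−τ)) / (1 + 2√(τ(1−τ)))`. -/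
noncomputable def Gfun (α τ : ℝ) : ℝ :=
  2 * (α * (1 - α) - τ * (1 - τ)) / (1 + 2 * Real.sqrt (τ * (1 - τ)))

/-- The JPL (McEliece–Rodemich–Rumsey–Welch) upper bound `δ̄(R)` on the asymptotic
relative minimum distance of codes of rate `R`:
`δ̄(R) = min {G(α,τ) : 0 ≤ α ≤ 1/2, h(α) ≥ 1 − R, τ = h⁻¹(h(α) − 1 + R)}`. -/
noncomputable def deltaJPL (R : ℝ) : ℝ :=
  sInf {d : ℝ | ∃ α ∈ Set.Icc (0 : ℝ) (1 / 2),
    1 - R ≤ binEnt α ∧ d = Gfun α (binEntInv (binEnt α - 1 + R))}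

/-- BSC transition probabilities `P(y|x) = p^{d(x,y)} (1-p)^{n-d(x,y)}`. -/
noncomputable def bscProb (n : ℕ) (p : ℝ) (x y : Fin n → Bool) : ℝ :=
  p ^ hammingDist x y * (1 - p) ^ (n - hammingDist x y)

/-- The (average) maximum-likelihood decoding error probability of a code `C`:
the minimum over all decoding maps `dec : X → C` of
`(1/|C|) ∑_{x ∈ C} ∑_{y : dec y ≠ x} P(y|x)`. -/
noncomputable def PeCode (n : ℕ) (p : ℝ) (C : Finset (Fin n → Bool)) : ℝ :=
  sInf {e : ℝ | ∃ dec : (Fin n → Bool) → (Fin n → Bool), (∀ y, dec y ∈ C) ∧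
    e = (C.card : ℝ)⁻¹ * ∑ x ∈ C,
      ∑ y ∈ Finset.univ.filter (fun y => dec y ≠ x), bscProb n p x y}

/-- The reliability function of the BSC:
`E(R,p) = limsup_{n→∞} max_{C ⊆ {0,1}ⁿ, |C| ≥ 2^{Rn}} (1/n) log₂ (1/P_e(C,p))`. -/
noncomputable def reliability (p R : ℝ) : ℝ :=
  limsup (fun n : ℕ =>
    sSup {e : ℝ | ∃ C : Finset (Fin n → Bool),
      (2 : ℝ) ^ (R * n) ≤ (C.card : ℝ) ∧
      e = (n : ℝ)⁻¹ * Real.logb 2 (1 / PeCode n p C)}) atTop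

theorem binEnt_eq_binEntropy_div (x : ℝ) : binEnt x = Real.binEntropy x / Real.log 2 := by
  rw [binEnt, Real.binEntropy, Real.logb, Real.logb, Real.log_inv, Real.log_inv]; ring

theorem binEntropy_eq_binEnt_mul (x : ℝ) : Real.binEntropy x = binEnt x * Real.log 2 := by
  have : Real.log 2 ≠ 0 := (Real.log_pos one_lt_two).ne'
  rw [binEnt_eq_binEntropy_div]; field_simp

/-- The perspective of the binary entropy function (in nats). -/
noncomputable def phi (m k : ℝ) : ℝ := m * Real.binEntropy (k / m)

theorem phi_zero_left (k : ℝ) : phi 0 k = 0 := by simp [phi]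

theorem phi_smul {s : ℝ} (m k : ℝ) : phi (s * m) (s * k) = s * phi m k := by
  rcases eq_or_ne s 0 with rfl | hs
  · simp [phi]
  · rw [phi, phi, mul_div_mul_left _ _ hs, mul_assoc]

theorem phi_symm (m k : ℝ) : phi m (m - k) = phi m k := by
  rcases eq_or_ne m 0 with rfl | hm
  · simp [phi]
  · rw [phi, phi, sub_div, div_self hm, Real.binEntropy_one_sub]

theorem phi_nonneg {m k : ℝ} (hk : 0 ≤ k) (hkm : k ≤ m) : 0 ≤ phi m k := by
  have hm : 0 ≤ m := hk.trans hkm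
  exact mul_nonneg hm (Real.binEntropy_nonneg (div_nonneg hk hm) (div_le_one_of_le₀ hkm hm))

theorem phi_le_log_two {m k : ℝ} (hm : 0 ≤ m) : phi m k ≤ m * Real.log 2 :=
  mul_le_mul_of_nonneg_left Real.binEntropy_le_log_two hm

theorem phi_eq_negMulLog {m k : ℝ} (hk : 0 ≤ k) (hkm : k ≤ m) :
    phi m k = Real.negMulLog k + Real.negMulLog (m - k) - Real.negMulLog m := by
  rcases eq_or_ne m 0 with rfl | hm
  · have : k = 0 := le_antisymm hkm hk
    subst this; simp [phi]
  have h1 : Real.negMulLog k = Real.negMulLog (m * (k / m)) := by rw [mul_div_cancel₀ _ hm]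
  have h2 : Real.negMulLog (m - k) = Real.negMulLog (m * (1 - k / m)) := by
    congr 1; field_simp
  rw [h1, h2, Real.negMulLog_mul, Real.negMulLog_mul, phi,
    Real.binEntropy_eq_negMulLog_add_negMulLog_one_sub]
  ring

theorem phi_add_le {m₁ m₂ k₁ k₂ : ℝ} (h₁ : 0 ≤ k₁) (h₁' : k₁ ≤ m₁) (h₂ : 0 ≤ k₂) (h₂' : k₂ ≤ m₂) :
    phi m₁ k₁ + phi m₂ k₂ ≤ phi (m₁ + m₂) (k₁ + k₂) := by
  have hm₁ : 0 ≤ m₁ := h₁.trans h₁'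
  have hm₂ : 0 ≤ m₂ := h₂.trans h₂'
  rcases hm₁.eq_or_lt with rfl | hm₁
  · have : k₁ = 0 := le_antisymm h₁' h₁
    subst this; simp [phi]
  rcases hm₂.eq_or_lt with rfl | hm₂
  · have : k₂ = 0 := le_antisymm h₂' h₂
    subst this; simp [phi]
  have hs : 0 < m₁ + m₂ := by positivity
  have hx : k₁ / m₁ ∈ Set.Icc (0 : ℝ) 1 := ⟨by positivity, div_le_one_of_le₀ h₁' hm₁.le⟩
  have hy : k₂ / m₂ ∈ Set.Icc (0 : ℝ) 1 := ⟨by positivity, div_le_one_of_le₀ h₂' hm₂.le⟩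
  have := Real.strictConcave_binEntropy.concaveOn.2 hx hy
    (show 0 ≤ m₁ / (m₁ + m₂) by positivity) (show 0 ≤ m₂ / (m₁ + m₂) by positivity) (by field_simp)
  simp only [smul_eq_mul] at this
  have e : m₁ / (m₁ + m₂) * (k₁ / m₁) + m₂ / (m₁ + m₂) * (k₂ / m₂) = (k₁ + k₂) / (m₁ + m₂) := by
    field_simp
  rw [e] at this
  have h := mul_le_mul_of_nonneg_left this hs.le
  calc _ = (m₁ + m₂) * (m₁ / (m₁ + m₂) * Real.binEntropy (k₁ / m₁) +
        m₂ / (m₁ + m₂) * Real.binEntropy (k₂ / m₂)) := by rw [phi, phi]; field_simp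
    _ ≤ _ := h

/-- Gibbs' inequality for the binary entropy. -/
theorem binEntropy_le_cross {x r : ℝ} (hx : 0 ≤ x) (hx' : x ≤ 1) (hr : 0 < r) (hr' : r < 1) :
    Real.binEntropy x ≤ x * (-Real.log r) + (1 - x) * (-Real.log (1 - r)) := by
  have key : ∀ a b : ℝ, 0 ≤ a → 0 < b → Real.negMulLog a ≤ a * (-Real.log b) + (b - a) := by
    intro a b ha hb
    rcases ha.eq_or_lt with rfl | ha
    · simp [hb.le]
    have := Real.log_le_sub_one_of_pos (div_pos hb ha)
    rw [Real.log_div hb.ne' ha.ne'] at this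
    have h2 := mul_le_mul_of_nonneg_left this ha.le
    have h3 : a * (b / a - 1) = b - a := by field_simp
    rw [Real.negMulLog]; linarith
  rw [Real.binEntropy_eq_negMulLog_add_negMulLog_one_sub]
  have h1 := key x r hx hr
  have h2 := key (1 - x) (1 - r) (by linarith) (by linarith)
  linarith

theorem phi_le_cross {m k r : ℝ} (hk : 0 ≤ k) (hkm : k ≤ m) (hr : 0 < r) (hr' : r < 1) :
    phi m k ≤ k * (-Real.log r) + (m - k) * (-Real.log (1 - r)) := by
  have hm : 0 ≤ m := hk.trans hkm
  rcases hm.eq_or_lt with rfl | hm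
  · have : k = 0 := le_antisymm hkm hk
    subst this; simp [phi]
  have := mul_le_mul_of_nonneg_left (binEntropy_le_cross (x := k / m) (by positivity)
    (div_le_one_of_le₀ hkm hm.le) hr hr') hm.le
  calc _ ≤ _ := this
    _ = _ := by field_simp

theorem phi_mono_right {m k k' : ℝ} (hk : 0 ≤ k) (hkk : k ≤ k') (hk' : k' ≤ m - k) :
    phi m k ≤ phi m k' := by
  rcases (show 0 ≤ m by linarith).eq_or_lt with rfl | hm
  · simp [phi]
  apply mul_le_mul_of_nonneg_left _ hm.le
  by_cases h : k' ≤ m / 2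
  · apply Real.binEntropy_strictMonoOn.monotoneOn
    · exact ⟨by positivity, by rw [div_le_iff₀ hm]; linarith⟩
    · exact ⟨by have := hk.trans hkk; positivity, by rw [div_le_iff₀ hm]; linarith⟩
    · gcongr
  · push Not at h
    rw [← Real.binEntropy_one_sub (k' / m)]
    apply Real.binEntropy_strictMonoOn.monotoneOn
    · exact ⟨by positivity, by rw [div_le_iff₀ hm]; linarith⟩
    · refine ⟨?_, ?_⟩
      · rw [sub_nonneg, div_le_one hm]; linarith
      · rw [sub_le_iff_le_add, ← sub_le_iff_le_add', le_div_iff₀ hm]; linarith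
    · rw [le_sub_iff_add_le, ← add_div, div_le_one hm]; linarith

/-- Among the terms of the binomial expansion of `(k + (m - k)) ^ m`, the `k`-th is the largest. -/
theorem choose_mul_pow_le (m k : ℕ) (hk : k ≤ m) (j : ℕ) (hj : j ≤ m) :
    m.choose j * (k ^ j * (m - k) ^ (m - j)) ≤ m.choose k * (k ^ k * (m - k) ^ (m - k)) := by
  set f : ℕ → ℕ := fun j => m.choose j * (k ^ j * (m - k) ^ (m - j)) with hf
  have step : ∀ j, j < m → (j + 1) * f (j + 1) * (m - k) = (m - j) * k * f j := by
    intro j hj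
    have h1 := Nat.choose_succ_right_eq m j
    have h2 : m - j = (m - (j + 1)) + 1 := by omega
    have h3 : (m - k) ^ (m - j) = (m - k) ^ (m - (j + 1)) * (m - k) := by rw [h2, pow_succ]
    simp only [hf]
    rw [h3, pow_succ]
    calc _ = (m.choose (j + 1) * (j + 1)) * (k ^ j * k * (m - k) ^ (m - (j + 1))) * (m - k) := by ring
      _ = _ := by rw [h1]; ring
  rcases hk.eq_or_lt with rfl | hkm
  · rcases hj.eq_or_lt with rfl | hj
    · exact le_rfl
    · rw [Nat.sub_self, zero_pow (by omega)]; simp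
  have up : ∀ d, d ≤ k → f (k - d) ≤ f k := by
    intro d
    induction d with
    | zero => intro _; simp
    | succ d ih =>
      intro hd
      refine le_trans ?_ (ih (by omega))
      have hs := step (k - (d + 1)) (by omega)
      have e : k - (d + 1) + 1 = k - d := by omega
      rw [e] at hs
      have hpos : 0 < (m - (k - (d + 1))) * k := Nat.mul_pos (by omega) (by omega)
      refine Nat.le_of_mul_le_mul_left ?_ hpos
      rw [← hs]
      calc (k - d) * f (k - d) * (m - k) = ((m - k) * (k - d)) * f (k - d) := by ring
        _ ≤ _ := Nat.mul_le_mul_right _ (Nat.mul_le_mul (by omega) (by omega))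
  have down : ∀ d, k + d ≤ m → f (k + d) ≤ f k := by
    intro d
    induction d with
    | zero => intro _; simp
    | succ d ih =>
      intro hd
      refine le_trans ?_ (ih (by omega))
      have hs := step (k + d) (by omega)
      have hpos : 0 < (k + d + 1) * (m - k) := Nat.mul_pos (by omega) (by omega)
      refine Nat.le_of_mul_le_mul_left ?_ hpos
      calc (k + d + 1) * (m - k) * f (k + (d + 1)) = (k + d + 1) * f (k + d + 1) * (m - k) := by
            rw [← add_assoc]; ring
        _ = (m - (k + d)) * k * f (k + d) := hs
        _ ≤ _ := Nat.mul_le_mul_right _ (by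
            rw [mul_comm]; exact Nat.mul_le_mul (by omega) (by omega))
  rcases le_total j k with h | h
  · have := up (k - j) (by omega)
    rwa [show k - (k - j) = j by omega] at this
  · have := down (j - k) (by omega)
    rwa [show k + (j - k) = j by omega] at this

theorem exp_phi_mul (m k : ℕ) (hk : k ≤ m) :
    Real.exp (phi m k) * ((k : ℝ) ^ k * ((m - k : ℕ) : ℝ) ^ (m - k)) = (m : ℝ) ^ m := by
  have hpow : ∀ a : ℕ, ((a : ℝ) ^ a) = Real.exp (-Real.negMulLog a) := by
    intro a
    rcases Nat.eq_zero_or_pos a with rfl | ha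
    · simp
    · have ha' : (0 : ℝ) < a := by exact_mod_cast ha
      rw [Real.negMulLog, neg_mul, neg_neg, ← Real.log_pow, Real.exp_log (by positivity)]
  rw [hpow k, hpow (m - k), hpow m, ← Real.exp_add, ← Real.exp_add,
    phi_eq_negMulLog (by positivity) (by exact_mod_cast hk), Nat.cast_sub hk]
  congr 1; ring

theorem choose_le_exp_phi (m k : ℕ) (hk : k ≤ m) : (m.choose k : ℝ) ≤ Real.exp (phi m k) := by
  have h1 : m.choose k * (k ^ k * (m - k) ^ (m - k)) ≤ m ^ m := by
    have := add_pow k (m - k) m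
    rw [show k + (m - k) = m by omega] at this
    rw [this]
    refine le_trans ?_ (Finset.single_le_sum (fun i _ => Nat.zero_le _)
      (Finset.mem_range.2 (show k < m + 1 by omega)))
    simp only [Nat.cast_id]
    exact le_of_eq (by ring)
  have h1' : (m.choose k : ℝ) * ((k : ℝ) ^ k * ((m - k : ℕ) : ℝ) ^ (m - k)) ≤ (m : ℝ) ^ m := by
    exact_mod_cast h1
  rw [← exp_phi_mul m k hk] at h1'
  refine le_of_mul_le_mul_right h1' ?_
  have : ∀ a : ℕ, 0 < ((a : ℝ) ^ a) := by
    intro a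
    rcases Nat.eq_zero_or_pos a with rfl | ha
    · simp
    · positivity
  exact mul_pos (this k) (this (m - k))

theorem exp_phi_le_choose (m k : ℕ) (hk : k ≤ m) :
    Real.exp (phi m k) ≤ (m + 1) * (m.choose k : ℝ) := by
  have h1 : m ^ m ≤ (m + 1) * (m.choose k * (k ^ k * (m - k) ^ (m - k))) := by
    have := add_pow k (m - k) m
    rw [show k + (m - k) = m by omega] at this
    rw [this]
    refine le_trans (Finset.sum_le_card_nsmul _ _ (m.choose k * (k ^ k * (m - k) ^ (m - k))) ?_) ?_
    · intro j hj
      have := choose_mul_pow_le m k hk j (by simpa [Nat.lt_succ_iff] using hj)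
      simp only [Nat.cast_id]
      linarith
    · simp
  have h1' : (m : ℝ) ^ m ≤
      (m + 1) * ((m.choose k : ℝ) * ((k : ℝ) ^ k * ((m - k : ℕ) : ℝ) ^ (m - k))) := by
    exact_mod_cast h1
  rw [← exp_phi_mul m k hk, ← mul_assoc ((m : ℝ) + 1)] at h1'
  refine le_of_mul_le_mul_right h1' ?_
  have : ∀ a : ℕ, 0 < ((a : ℝ) ^ a) := by
    intro a
    rcases Nat.eq_zero_or_pos a with rfl | ha
    · simp
    · positivity
  exact mul_pos (this k) (this (m - k))

/-- The Johnson space: `w`-subsets of `Fin n`. -/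
abbrev JSpace (n w : ℕ) := {s : Finset (Fin n) // s.card = w}

/-- The zonal kernel on the Johnson space attached to a function of `|x \ y|`. -/
def zonal (n w : ℕ) (f : ℕ → ℝ) : Matrix (JSpace n w) (JSpace n w) ℝ :=
  fun x y => f (x.1 \ y.1).card

theorem JSpace.card_sdiff_comm {n w : ℕ} (x y : JSpace n w) :
    (x.1 \ y.1).card = (y.1 \ x.1).card := by
  have h1 := Finset.card_sdiff_add_card_inter x.1 y.1
  have h2 := Finset.card_sdiff_add_card_inter y.1 x.1
  rw [Finset.inter_comm] at h2
  have := x.2; have := y.2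
  omega

theorem zonal_transpose (n w : ℕ) (f : ℕ → ℝ) : (zonal n w f).transpose = zonal n w f := by
  ext x y
  simp [zonal, Matrix.transpose_apply, JSpace.card_sdiff_comm x y]

theorem zonal_isHermitian (n w : ℕ) (f : ℕ → ℝ) : (zonal n w f).IsHermitian := by
  rw [Matrix.IsHermitian, Matrix.conjTranspose_eq_transpose_of_trivial, zonal_transpose]

/-- Two functions with equinumerous fibers differ by a permutation of the source. -/
theorem exists_perm_of_card_fiber {α β : Type*} [Fintype α] [DecidableEq α] [DecidableEq β]
    (f g : α → β)
    (h : ∀ b, Fintype.card {a // f a = b} = Fintype.card {a // g a = b}) :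
    ∃ σ : Equiv.Perm α, ∀ a, g (σ a) = f a := by
  have e := fun b => Fintype.equivOfCardEq (h b)
  refine ⟨(Equiv.sigmaFiberEquiv f).symm.trans
    ((Equiv.sigmaCongrRight e).trans (Equiv.sigmaFiberEquiv g)), fun a => ?_⟩
  simp only [Equiv.trans_apply]
  exact (e (f a) ⟨a, rfl⟩).2

theorem exists_perm_map_pair {n w : ℕ} (x y x' y' : JSpace n w)
    (h : (x.1 \ y.1).card = (x'.1 \ y'.1).card) :
    ∃ σ : Equiv.Perm (Fin n), x.1.map σ.toEmbedding = x'.1 ∧ y.1.map σ.toEmbedding = y'.1 := by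
  obtain ⟨σ, hσ⟩ := exists_perm_of_card_fiber
    (fun a : Fin n => (decide (a ∈ x.1), decide (a ∈ y.1)))
    (fun a : Fin n => (decide (a ∈ x'.1), decide (a ∈ y'.1))) (by
      have key : ∀ (s t : JSpace n w) (b : Bool × Bool),
          Fintype.card {a : Fin n // (decide (a ∈ s.1), decide (a ∈ t.1)) = b} =
          match b with
          | (true, true) => w - (s.1 \ t.1).card
          | (true, false) => (s.1 \ t.1).card
          | (false, true) => (s.1 \ t.1).card
          | (false, false) => n - w - (s.1 \ t.1).card := by
        intro s t b
        rw [Fintype.card_subtype]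
        have e0 := Finset.card_sdiff_add_card_inter s.1 t.1
        have e1 := JSpace.card_sdiff_comm s t
        have hs := s.2
        rcases b with ⟨_ | _, _ | _⟩
        · have e2 : (Finset.univ.filter fun a : Fin n =>
            (decide (a ∈ s.1), decide (a ∈ t.1)) = (false, false)) = (s.1 ∪ t.1)ᶜ := by
            ext a; simp
          have e3 := Finset.card_sdiff_add_card t.1 s.1
          rw [Finset.union_comm] at e3
          rw [e2, Finset.card_compl, Fintype.card_fin]
          dsimp only
          omega
        · have e2 : (Finset.univ.filter fun a : Fin n =>
            (decide (a ∈ s.1), decide (a ∈ t.1)) = (false, true)) = t.1 \ s.1 := by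
            ext a; simp [and_comm]
          rw [e2]; dsimp only; omega
        · have e2 : (Finset.univ.filter fun a : Fin n =>
            (decide (a ∈ s.1), decide (a ∈ t.1)) = (true, false)) = s.1 \ t.1 := by
            ext a; simp
          rw [e2]
        · have e2 : (Finset.univ.filter fun a : Fin n =>
            (decide (a ∈ s.1), decide (a ∈ t.1)) = (true, true)) = s.1 ∩ t.1 := by
            ext a; simp
          rw [e2]; dsimp only; omega
      intro b
      rw [key, key, h])
  refine ⟨σ, ?_, ?_⟩
  · apply Finset.eq_of_subset_of_card_le
    · intro a ha
      rw [Finset.mem_map] at ha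
      obtain ⟨b, hb, rfl⟩ := ha
      have := congrArg Prod.fst (hσ b)
      simpa [hb] using this
    · rw [Finset.card_map, x.2, x'.2]
  · apply Finset.eq_of_subset_of_card_le
    · intro a ha
      rw [Finset.mem_map] at ha
      obtain ⟨b, hb, rfl⟩ := ha
      have := congrArg Prod.snd (hσ b)
      simpa [hb] using this
    · rw [Finset.card_map, y.2, y'.2]

/-- Permutations act on the Johnson space. -/
def JSpace.perm {n w : ℕ} (σ : Equiv.Perm (Fin n)) : JSpace n w ≃ JSpace n w where
  toFun x := ⟨x.1.map σ.toEmbedding, by rw [Finset.card_map, x.2]⟩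
  invFun x := ⟨x.1.map σ.symm.toEmbedding, by rw [Finset.card_map, x.2]⟩
  left_inv x := by
    apply Subtype.ext; ext a; simp [Finset.mem_map_equiv]
  right_inv x := by
    apply Subtype.ext; ext a; simp [Finset.mem_map_equiv]

theorem JSpace.card_perm_sdiff {n w : ℕ} (σ : Equiv.Perm (Fin n)) (x y : JSpace n w) :
    ((JSpace.perm σ x).1 \ (JSpace.perm σ y).1).card = (x.1 \ y.1).card := by
  have : (JSpace.perm σ x).1 \ (JSpace.perm σ y).1 = (x.1 \ y.1).map σ.toEmbedding := by
    ext a; simp [JSpace.perm, Finset.mem_map_equiv]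
  rw [this, Finset.card_map]

theorem zonal_mul_zonal_eq (n w : ℕ) (f g : ℕ → ℝ) (x y x' y' : JSpace n w)
    (h : (x.1 \ y.1).card = (x'.1 \ y'.1).card) :
    (zonal n w f * zonal n w g) x y = (zonal n w f * zonal n w g) x' y' := by
  obtain ⟨σ, h1, h2⟩ := exists_perm_map_pair x y x' y' h
  have hx : x' = JSpace.perm σ x := Subtype.ext h1.symm
  have hy : y' = JSpace.perm σ y := Subtype.ext h2.symm
  rw [Matrix.mul_apply, Matrix.mul_apply, hx, hy,
    ← Equiv.sum_comp (JSpace.perm σ) (fun z => zonal n w f (JSpace.perm σ x) z * _)]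
  refine Finset.sum_congr rfl fun z _ => ?_
  simp only [zonal, JSpace.card_perm_sdiff]

theorem exists_zonal_mul (n w : ℕ) (f g : ℕ → ℝ) :
    ∃ κ, zonal n w f * zonal n w g = zonal n w κ := by
  classical
  refine ⟨fun i => if h : ∃ x y : JSpace n w, (x.1 \ y.1).card = i then
    (zonal n w f * zonal n w g) h.choose h.choose_spec.choose else 0, ?_⟩
  ext x y
  have h : ∃ x' y' : JSpace n w, (x'.1 \ y'.1).card = (x.1 \ y.1).card := ⟨x, y, rfl⟩
  simp only [zonal]
  rw [dif_pos h]
  exact zonal_mul_zonal_eq n w f g _ _ _ _ h.choose_spec.choose_spec.symm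

/-- Exchange adjacency in the Johnson space. -/
def jAdj (n w : ℕ) : Matrix (JSpace n w) (JSpace n w) ℝ :=
  fun y z => (((y.1 ×ˢ y.1ᶜ).filter fun ab => z.1 = insert ab.2 (y.1.erase ab.1)).card : ℝ)

theorem jAdj_transpose (n w : ℕ) : (jAdj n w).transpose = jAdj n w := by
  ext y z
  simp only [jAdj, Matrix.transpose_apply]
  norm_cast
  have key : ∀ (y z : JSpace n w) (ab : Fin n × Fin n),
      ab ∈ (y.1 ×ˢ y.1ᶜ).filter (fun ab => z.1 = insert ab.2 (y.1.erase ab.1)) →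
      ab.swap ∈ (z.1 ×ˢ z.1ᶜ).filter (fun ab => y.1 = insert ab.2 (z.1.erase ab.1)) := by
    rintro y z ⟨a, b⟩ h
    simp only [Finset.mem_filter, Finset.mem_product, Finset.mem_compl, Prod.swap] at h ⊢
    obtain ⟨⟨ha, hb⟩, hz⟩ := h
    have hab : a ≠ b := fun h => hb (h ▸ ha)
    refine ⟨⟨by rw [hz]; simp, by rw [hz]; simp [hab]⟩, ?_⟩
    rw [hz, Finset.erase_insert (by simp [hb]), Finset.insert_erase ha]
  exact Finset.card_nbij' Prod.swap Prod.swap (fun ab h => key _ _ ab h) (fun ab h => key _ _ ab h)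
    (fun _ _ => rfl) (fun _ _ => rfl)

theorem card_insert_erase {n : ℕ} {y : Finset (Fin n)} {a b : Fin n} (ha : a ∈ y) (hb : b ∉ y) :
    (insert b (y.erase a)).card = y.card := by
  rw [Finset.card_insert_of_notMem (by simp [hb]), Finset.card_erase_of_mem ha]
  have := Finset.card_pos.2 ⟨a, ha⟩
  omega

theorem jAdj_mul_zonal_apply (n w : ℕ) (f : ℕ → ℝ) (y x : JSpace n w) :
    (jAdj n w * zonal n w f) y x =
      ∑ a ∈ y.1, ∑ b ∈ y.1ᶜ, f (x.1 \ insert b (y.1.erase a)).card := by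
  rw [Matrix.mul_apply, ← Finset.sum_product']
  have : ∀ z : JSpace n w, jAdj n w y z * zonal n w f z x =
      ∑ ab ∈ y.1 ×ˢ y.1ᶜ, if z.1 = insert ab.2 (y.1.erase ab.1) then
        f (x.1 \ insert ab.2 (y.1.erase ab.1)).card else 0 := by
    intro z
    rw [← Finset.sum_filter, jAdj, ← nsmul_eq_mul, ← Finset.sum_const]
    refine Finset.sum_congr rfl fun ab hab => ?_
    rw [← (Finset.mem_filter.1 hab).2, ← JSpace.card_sdiff_comm z x, zonal]
  rw [Finset.sum_congr rfl fun z _ => this z, Finset.sum_comm]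
  refine Finset.sum_congr rfl fun ab hab => ?_
  rw [Finset.mem_product, Finset.mem_compl] at hab
  rw [Finset.sum_eq_single (⟨insert ab.2 (y.1.erase ab.1), by
    rw [card_insert_erase hab.1 hab.2, y.2]⟩ : JSpace n w)]
  · simp
  · intro z _ hz
    rw [if_neg]
    intro h
    exact hz (Subtype.ext h)
  · simp

theorem card_sdiff_insert_erase {n : ℕ} {x y : Finset (Fin n)} {a b : Fin n} (ha : a ∈ y)
    (hb : b ∉ y) :
    (x \ insert b (y.erase a)).card + (if b ∈ x then 1 else 0) =
      (x \ y).card + (if a ∈ x then 1 else 0) := by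
  have hab : a ≠ b := fun h => hb (h ▸ ha)
  have e1 : x \ insert b (y.erase a) = (x \ y.erase a).erase b := by
    ext c; simp; tauto
  have e2 : (x \ insert b (y.erase a)).card + (if b ∈ x then 1 else 0) = (x \ y.erase a).card := by
    rw [e1]
    split_ifs with h
    · rw [Finset.card_erase_add_one (by simp [h, hb])]
    · rw [Finset.erase_eq_of_notMem (by simp [h]), add_zero]
  rw [e2]
  split_ifs with h
  · have : x \ y.erase a = insert a (x \ y) := by
      ext c; simp only [Finset.mem_sdiff, Finset.mem_erase, Finset.mem_insert]
      constructor
      · rintro ⟨h1, h2⟩; by_cases hc : c = a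
        · exact Or.inl hc
        · exact Or.inr ⟨h1, fun h3 => h2 ⟨hc, h3⟩⟩
      · rintro (rfl | ⟨h1, h2⟩)
        · exact ⟨h, fun h => h.1 rfl⟩
        · exact ⟨h1, fun h => h2 h.2⟩
    rw [this, Finset.card_insert_of_notMem (by simp [ha])]
  · have : x \ y.erase a = x \ y := by
      ext c; simp only [Finset.mem_sdiff, Finset.mem_erase]
      constructor
      · rintro ⟨h1, h2⟩; exact ⟨h1, fun h3 => h2 ⟨fun h4 => h (h4 ▸ h1), h3⟩⟩
      · rintro ⟨h1, h2⟩; exact ⟨h1, fun h => h2 h.2⟩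
    rw [this, add_zero]

/-- The action of the exchange adjacency on functions of `|x \ y|`. -/
noncomputable def jOp (n w : ℕ) (f : ℕ → ℝ) (i : ℕ) : ℝ :=
  ((w : ℝ) - i) * ((n : ℝ) - w - i) * f (i + 1) + (i : ℝ) ^ 2 * f (i - 1)
    + (((w : ℝ) - i) * i + i * ((n : ℝ) - w - i)) * f i

theorem jAdj_mul_zonal (n w : ℕ) (f : ℕ → ℝ) :
    jAdj n w * zonal n w f = zonal n w (jOp n w f) := by
  ext y x
  rw [jAdj_mul_zonal_apply]
  set i := (x.1 \ y.1).card with hi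
  have hval : ∀ a ∈ y.1, ∀ b ∈ y.1ᶜ, f (x.1 \ insert b (y.1.erase a)).card =
      if a ∈ x.1 then (if b ∈ x.1 then f i else f (i + 1))
        else (if b ∈ x.1 then f (i - 1) else f i) := by
    intro a ha b hb
    have h := card_sdiff_insert_erase (x := x.1) ha (Finset.mem_compl.1 hb)
    split_ifs at h ⊢ <;> congr 1 <;> omega
  rw [Finset.sum_congr rfl fun a ha => Finset.sum_congr rfl fun b hb => hval a ha b hb]
  have c1 : ((y.1.filter fun a => a ∈ x.1).card : ℝ) = w - i := by
    rw [Finset.filter_mem_eq_inter]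
    have := Finset.card_sdiff_add_card_inter x.1 y.1
    rw [x.2, Finset.inter_comm] at this
    have h2 : ((x.1 \ y.1).card : ℝ) + ((y.1 ∩ x.1).card : ℝ) = w := by exact_mod_cast this
    rw [hi]; linarith
  have c2 : ((y.1.filter fun a => a ∉ x.1).card : ℝ) = i := by
    rw [Finset.filter_notMem_eq_sdiff, ← JSpace.card_sdiff_comm]
  have c3 : ((y.1ᶜ.filter fun a => a ∈ x.1).card : ℝ) = i := by
    have : y.1ᶜ.filter (fun a => a ∈ x.1) = x.1 \ y.1 := by ext a; simp [and_comm]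
    rw [this]
  have c4 : ((y.1ᶜ.filter fun a => a ∉ x.1).card : ℝ) = n - w - i := by
    have h1 := Finset.card_filter_add_card_filter_not (s := y.1ᶜ) (fun a => a ∈ x.1)
    rw [Finset.card_compl, y.2, Fintype.card_fin] at h1
    have h2 : w ≤ n := by
      have := Finset.card_le_univ y.1
      rw [y.2, Fintype.card_fin] at this; exact this
    have h3 : ((n - w : ℕ) : ℝ) = n - w := by push_cast [h2]; ring
    rw [← h3, ← h1]; push_cast; rw [c3]; ring
  have inner : ∀ u v : ℝ, ∑ b ∈ y.1ᶜ, (if b ∈ x.1 then u else v) = i * u + (n - w - i) * v := by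
    intro u v
    rw [Finset.sum_ite, Finset.sum_const, Finset.sum_const, nsmul_eq_mul, nsmul_eq_mul, c3, c4]
  have step : ∀ a, (∑ b ∈ y.1ᶜ, if a ∈ x.1 then (if b ∈ x.1 then f i else f (i + 1))
        else (if b ∈ x.1 then f (i - 1) else f i)) =
      if a ∈ x.1 then i * f i + (n - w - i) * f (i + 1) else i * f (i - 1) + (n - w - i) * f i := by
    intro a
    split_ifs
    · exact inner _ _
    · exact inner _ _
  rw [Finset.sum_congr rfl fun a _ => step a, Finset.sum_ite, Finset.sum_const, Finset.sum_const,
    nsmul_eq_mul, nsmul_eq_mul, c1, c2, zonal, ← JSpace.card_sdiff_comm x y, ← hi, jOp]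
  ring

/-- Coefficients of the Hahn polynomials in the binomial basis. -/
noncomputable def hahnCoeff (n w k : ℕ) : ℕ → ℝ
  | 0 => 1
  | j + 1 => -hahnCoeff n w k j * ((k : ℝ) - j) * ((n : ℝ) + 1 - k - j) /
      (((w : ℝ) - j) * ((n : ℝ) - w - j))

/-- Hahn polynomials, normalized to `1` at `0`. -/
noncomputable def hahn (n w k i : ℕ) : ℝ :=
  ∑ j ∈ range (k + 1), hahnCoeff n w k j * (i.choose j : ℝ)

theorem hahn_zero_right (n w k : ℕ) : hahn n w k 0 = 1 := by
  rw [hahn, Finset.sum_range_succ']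
  simp [hahnCoeff]

theorem hahn_zero_left (n w i : ℕ) : hahn n w 0 i = 1 := by
  simp [hahn, hahnCoeff]

theorem hahnCoeff_succ_mul {n w k j : ℕ} (hw : 2 * w ≤ n) (hj : j < w) :
    hahnCoeff n w k (j + 1) * (((w : ℝ) - j) * ((n : ℝ) - w - j)) =
      -hahnCoeff n w k j * ((k : ℝ) - j) * ((n : ℝ) + 1 - k - j) := by
  have h1 : (j : ℝ) < w := by exact_mod_cast hj
  have h2 : 2 * (w : ℝ) ≤ n := by exact_mod_cast hw
  rw [hahnCoeff, div_mul_cancel₀]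
  have : (0:ℝ) < (w - j) * (n - w - j) := mul_pos (by linarith) (by linarith)
  exact this.ne'

theorem hahnCoeff_self_succ (n w k : ℕ) : hahnCoeff n w k (k + 1) = 0 := by
  simp [hahnCoeff]

theorem hahnCoeff_ne_zero {n w k j : ℕ} (hw : 2 * w ≤ n) (hk : k ≤ w) (hj : j ≤ k) :
    hahnCoeff n w k j ≠ 0 := by
  induction j with
  | zero => simp [hahnCoeff]
  | succ j ih =>
    have h0 := ih (by omega)
    have h := hahnCoeff_succ_mul (k := k) hw (show j < w by omega)
    intro h'
    rw [h', zero_mul] at h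
    have h1 : (j : ℝ) + 1 ≤ k := by exact_mod_cast hj
    have h2 : 2 * (w : ℝ) ≤ n := by exact_mod_cast hw
    have h3 : (k : ℝ) ≤ w := by exact_mod_cast hk
    have h4 : ((k : ℝ) - j) ≠ 0 := by linarith
    have h5 : ((n : ℝ) + 1 - k - j) ≠ 0 := by
      have : (0:ℝ) < n + 1 - k - j := by linarith
      exact this.ne'
    exact mul_ne_zero (mul_ne_zero (neg_ne_zero.2 h0) h4) h5 h.symm

theorem jOp_choose_zero (n w i : ℕ) : jOp n w (fun i => (i.choose 0 : ℝ)) i = w * (n - w) := by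
  simp [jOp]; ring

theorem jOp_choose_succ (n w j i : ℕ) : jOp n w (fun i => (i.choose (j + 1) : ℝ)) i =
    (w * (n - w) - (j + 1) * (n - j)) * (i.choose (j + 1) : ℝ)
      + (w - j) * (n - w - j) * (i.choose j : ℝ) := by
  rcases i with _ | i
  · rcases j with _ | j
    · simp [jOp]
    · simp [jOp, Nat.choose_eq_zero_of_lt]
  · have e1 : ((i + 1 + 1).choose (j + 1) : ℝ) = (i + 1).choose j + (i + 1).choose (j + 1) := by
      rw [Nat.choose_succ_succ' (i + 1) j]; push_cast; ring
    have e2 : ((i + 1).choose (j + 1) : ℝ) = i.choose j + i.choose (j + 1) := by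
      rw [Nat.choose_succ_succ' i j]; push_cast; ring
    have e3 : ((i : ℝ) + 1) * i.choose j = (i + 1).choose (j + 1) * (j + 1) := by
      exact_mod_cast Nat.add_one_mul_choose_eq i j
    have e4 : (i.choose j : ℝ) * (i + 1) = (i + 1).choose j * (i + 1 - j) := by
      have := Nat.choose_mul_succ_eq i j
      rcases le_or_gt j (i + 1) with h | h
      · have h' : ((i + 1 - j : ℕ) : ℝ) = i + 1 - j := by push_cast [h]; ring
        rw [← h']; exact_mod_cast this
      · rw [Nat.choose_eq_zero_of_lt (by omega : i < j), Nat.choose_eq_zero_of_lt h]; simp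
    simp only [jOp, Nat.add_sub_cancel, e1]
    push_cast
    rw [e2] at e3 ⊢
    linear_combination (-(n:ℝ) + j) * e3 + (n - j - i - 1) * e4

theorem jOp_sum (n w : ℕ) (s : Finset ℕ) (c : ℕ → ℝ) (f : ℕ → ℕ → ℝ) (i : ℕ) :
    jOp n w (fun i => ∑ j ∈ s, c j * f j i) i = ∑ j ∈ s, c j * jOp n w (f j) i := by
  simp only [jOp, Finset.mul_sum, ← Finset.sum_add_distrib]
  refine Finset.sum_congr rfl fun j _ => ?_
  ring

/-- The eigenvalues of exchange adjacency. -/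
noncomputable def jEig (n w k : ℕ) : ℝ := w * (n - w) - k * (n + 1 - k)

theorem jOp_hahn {n w k : ℕ} (hw : 2 * w ≤ n) (hk : k ≤ w) (i : ℕ) :
    jOp n w (hahn n w k) i = jEig n w k * hahn n w k i := by
  have h0 : jOp n w (hahn n w k) i =
      ∑ j ∈ range (k + 1), hahnCoeff n w k j * jOp n w (fun i => (i.choose j : ℝ)) i :=
    jOp_sum n w (range (k + 1)) (hahnCoeff n w k) (fun j i => (i.choose j : ℝ)) i
  rw [h0, Finset.sum_range_succ']
  have h1 : ∀ j ∈ range k, hahnCoeff n w k (j + 1) * jOp n w (fun i => (i.choose (j + 1) : ℝ)) i =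
      hahnCoeff n w k (j + 1) * (w * (n - w) - (j + 1) * (n - j)) * (i.choose (j + 1) : ℝ)
        - hahnCoeff n w k j * ((k : ℝ) - j) * ((n : ℝ) + 1 - k - j) * (i.choose j : ℝ) := by
    intro j hj
    have := hahnCoeff_succ_mul (k := k) hw (show j < w by have := Finset.mem_range.1 hj; omega)
    rw [jOp_choose_succ]
    linear_combination (i.choose j : ℝ) * this
  rw [Finset.sum_congr rfl h1, Finset.sum_sub_distrib, jOp_choose_zero]
  have h2 : ∑ j ∈ range k, hahnCoeff n w k j * ((k : ℝ) - j) * ((n : ℝ) + 1 - k - j) * (i.choose j : ℝ)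
      = ∑ j ∈ range (k + 1),
        hahnCoeff n w k j * ((k : ℝ) - j) * ((n : ℝ) + 1 - k - j) * (i.choose j : ℝ) := by
    rw [Finset.sum_range_succ]; simp
  rw [h2, Finset.sum_range_succ' (fun j => hahnCoeff n w k j * ((k : ℝ) - j) * ((n : ℝ) + 1 - k - j) * (i.choose j : ℝ)),
    hahn, Finset.sum_range_succ' (fun j => hahnCoeff n w k j * (i.choose j : ℝ)), mul_add,
    Finset.mul_sum]
  have h3 : ∀ j ∈ range k, jEig n w k * (hahnCoeff n w k (j + 1) * (i.choose (j + 1) : ℝ)) =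
      hahnCoeff n w k (j + 1) * (w * (n - w) - (j + 1) * (n - j)) * (i.choose (j + 1) : ℝ) -
      hahnCoeff n w k (j + 1) * ((k : ℝ) - (j + 1 : ℕ)) * ((n : ℝ) + 1 - k - (j + 1 : ℕ))
        * (i.choose (j + 1) : ℝ) := by
    intro j _
    rw [jEig]; push_cast; ring
  rw [Finset.sum_congr rfl h3, Finset.sum_sub_distrib]
  simp only [hahnCoeff, Nat.choose_zero_right, jEig]
  push_cast
  ring

theorem zonal_congr {n w : ℕ} {f g : ℕ → ℝ} (h : ∀ i ≤ w, f i = g i) :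
    zonal n w f = zonal n w g := by
  ext x y
  refine h _ ?_
  have := Finset.card_le_card (Finset.sdiff_subset (s := x.1) (t := y.1))
  rwa [x.2] at this

theorem zonal_smul (n w : ℕ) (c : ℝ) (f : ℕ → ℝ) :
    c • zonal n w f = zonal n w (fun i => c * f i) := rfl

theorem zonal_add (n w : ℕ) (f g : ℕ → ℝ) :
    zonal n w f + zonal n w g = zonal n w (fun i => f i + g i) := rfl

theorem JSpace.exists_pair {n w i : ℕ} (hw : 2 * w ≤ n) (hi : i ≤ w) :
    ∃ x y : JSpace n w, (x.1 \ y.1).card = i := by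
  obtain ⟨x, hx⟩ : ∃ x : Finset (Fin n), x.card = w :=
    (Finset.exists_subset_card_eq (s := Finset.univ) (n := w) (by simp; omega)).imp fun _ h => h.2
  obtain ⟨u, hu, hu'⟩ := Finset.exists_subset_card_eq (s := x) (n := w - i) (by omega)
  obtain ⟨v, hv, hv'⟩ := Finset.exists_subset_card_eq (s := xᶜ) (n := i) (by
    rw [Finset.card_compl, Fintype.card_fin]; omega)
  have hxv : Disjoint x v := by
    rw [Finset.disjoint_left]; intro a ha ha'
    exact Finset.mem_compl.1 (hv ha') ha
  have huv : Disjoint u v := Finset.disjoint_of_subset_left hu hxv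
  refine ⟨⟨x, hx⟩, ⟨u ∪ v, by rw [Finset.card_union_of_disjoint huv]; omega⟩, ?_⟩
  have : x \ (u ∪ v) = x \ u := by
    ext a; simp only [Finset.mem_sdiff, Finset.mem_union]
    constructor
    · rintro ⟨h1, h2⟩; exact ⟨h1, fun h => h2 (Or.inl h)⟩
    · rintro ⟨h1, h2⟩; exact ⟨h1, fun h => h.elim h2 fun h => Finset.disjoint_left.1 hxv h1 h⟩
  show (x \ (u ∪ v)).card = i
  rw [this, Finset.card_sdiff_of_subset hu]; omega

theorem eq_of_zonal_eq {n w : ℕ} (hw : 2 * w ≤ n) {f g : ℕ → ℝ} (h : zonal n w f = zonal n w g)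
    {i : ℕ} (hi : i ≤ w) : f i = g i := by
  obtain ⟨x, y, rfl⟩ := JSpace.exists_pair hw hi
  exact congrFun (congrFun h x) y

theorem jAdj_mul_hahn {n w k : ℕ} (hw : 2 * w ≤ n) (hk : k ≤ w) :
    jAdj n w * zonal n w (hahn n w k) = jEig n w k • zonal n w (hahn n w k) := by
  rw [jAdj_mul_zonal, zonal_smul]
  exact zonal_congr fun i _ => jOp_hahn hw hk i

theorem hahn_mul_jAdj {n w k : ℕ} (hw : 2 * w ≤ n) (hk : k ≤ w) :
    zonal n w (hahn n w k) * jAdj n w = jEig n w k • zonal n w (hahn n w k) := by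
  have := congrArg Matrix.transpose (jAdj_mul_hahn hw hk)
  rwa [Matrix.transpose_mul, Matrix.transpose_smul, zonal_transpose, jAdj_transpose] at this

theorem hahn_mul_hahn_of_ne {n w k l : ℕ} (hw : 2 * w ≤ n) (hk : k ≤ w) (hl : l ≤ w) (hkl : k ≠ l) :
    zonal n w (hahn n w k) * zonal n w (hahn n w l) = 0 := by
  have h1 : jEig n w k • (zonal n w (hahn n w k) * zonal n w (hahn n w l)) =
      jEig n w l • (zonal n w (hahn n w k) * zonal n w (hahn n w l)) := by
    rw [← Matrix.smul_mul, ← hahn_mul_jAdj hw hk, Matrix.mul_assoc, jAdj_mul_hahn hw hl,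
      Matrix.mul_smul]
  have h2 : (jEig n w k - jEig n w l) ≠ 0 := by
    have : jEig n w k - jEig n w l = (l - k : ℝ) * (n + 1 - k - l) := by rw [jEig, jEig]; ring
    rw [this]
    refine mul_ne_zero (sub_ne_zero.2 (by exact_mod_cast hkl.symm)) ?_
    have h2 : 2 * (w : ℝ) ≤ n := by exact_mod_cast hw
    have h3 : (k : ℝ) ≤ w := by exact_mod_cast hk
    have h4 : (l : ℝ) ≤ w := by exact_mod_cast hl
    have : (0 : ℝ) < n + 1 - k - l := by linarith
    exact this.ne'
  rw [← sub_eq_zero, ← sub_smul] at h1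
  exact (smul_eq_zero.1 h1).resolve_left h2

theorem eq_smul_hahn {n w k : ℕ} (hw : 2 * w ≤ n) {f : ℕ → ℝ} (hk : k ≤ w)
    (h : ∀ i ≤ w, jOp n w f i = jEig n w k * f i) {i : ℕ} (hi : i ≤ w) :
    f i = f 0 * hahn n w k i := by
  induction i using Nat.strong_induction_on with
  | _ i ih =>
    rcases i with _ | i
    · simp [hahn_zero_right]
    · have e1 := h i (by omega)
      have e2 := jOp_hahn hw hk i
      have e3 := ih i (by omega) (by omega)
      have e4 := ih (i - 1) (by omega) (by omega)
      simp only [jOp] at e1 e2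
      have h1 : (i : ℝ) + 1 ≤ w := by exact_mod_cast hi
      have h2 : 2 * (w : ℝ) ≤ n := by exact_mod_cast hw
      have hb : (0:ℝ) < (w - i) * (n - w - i) := mul_pos (by linarith) (by linarith)
      rw [e3, e4] at e1
      have : ((w - i) * (n - w - i) : ℝ) * (f (i + 1) - f 0 * hahn n w k (i + 1)) = 0 := by
        linear_combination e1 - f 0 * e2
      rcases mul_eq_zero.1 this with h | h
      · exact absurd h hb.ne'
      · linarith

/-- The Hahn kernels are, up to a positive scalar, idempotent. -/
theorem exists_hahn_sq {n w k : ℕ} (hw : 2 * w ≤ n) (hk : k ≤ w) :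
    ∃ s : ℝ, 0 < s ∧ zonal n w (hahn n w k) * zonal n w (hahn n w k) =
      s • zonal n w (hahn n w k) := by
  obtain ⟨κ, hκ⟩ := exists_zonal_mul n w (hahn n w k) (hahn n w k)
  have h1 : jAdj n w * zonal n w κ = jEig n w k • zonal n w κ := by
    rw [← hκ, ← Matrix.mul_assoc, jAdj_mul_hahn hw hk, Matrix.smul_mul]
  rw [jAdj_mul_zonal, zonal_smul] at h1
  have h2 : ∀ i ≤ w, jOp n w κ i = jEig n w k * κ i := fun i hi => eq_of_zonal_eq hw h1 hi
  refine ⟨κ 0, ?_, ?_⟩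
  · obtain ⟨x, -, -⟩ := JSpace.exists_pair hw (Nat.zero_le w)
    have h3 : κ 0 = zonal n w κ x x := by simp [zonal]
    rw [h3, ← hκ, Matrix.mul_apply]
    refine Finset.sum_pos' (fun y _ => ?_) ⟨x, Finset.mem_univ _, ?_⟩
    · rw [zonal, zonal, ← JSpace.card_sdiff_comm x y]
      exact mul_self_nonneg _
    · simp [zonal, hahn_zero_right]
  · rw [hκ, zonal_smul]
    exact zonal_congr fun i hi => eq_smul_hahn hw hk h2 hi

theorem hahn_posSemidef {n w k : ℕ} (hw : 2 * w ≤ n) (hk : k ≤ w) :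
    (zonal n w (hahn n w k)).PosSemidef := by
  obtain ⟨s, hs, h⟩ := exists_hahn_sq hw hk
  have h1 : zonal n w (hahn n w k) = s⁻¹ • ((zonal n w (hahn n w k)).conjTranspose *
      zonal n w (hahn n w k)) := by
    rw [(zonal_isHermitian n w _).eq, h, smul_smul, inv_mul_cancel₀ hs.ne', one_smul]
  rw [h1]
  exact (Matrix.posSemidef_conjTranspose_mul_self _).smul (inv_nonneg.2 hs.le)

theorem exists_hahn_expansion {n w : ℕ} (hw : 2 * w ≤ n) (m : ℕ) (hm : m ≤ w) (c : ℕ → ℝ) :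
    ∃ t : ℕ → ℝ, (∀ j, m < j → t j = 0) ∧
      ∀ i, ∑ j ∈ range (m + 1), c j * (i.choose j : ℝ) =
        ∑ j ∈ range (m + 1), t j * hahn n w j i := by
  induction m generalizing c with
  | zero =>
    refine ⟨fun j => if j = 0 then c 0 else 0, fun j hj => if_neg (by omega), fun i => ?_⟩
    simp [hahn_zero_left]
  | succ m ih =>
    set l := hahnCoeff n w (m + 1) (m + 1) with hl
    have hl0 : l ≠ 0 := hahnCoeff_ne_zero hw hm le_rfl
    obtain ⟨t, ht, ht'⟩ := ih (by omega) (fun j => c j - c (m + 1) / l * hahnCoeff n w (m + 1) j)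
    refine ⟨fun j => if j = m + 1 then c (m + 1) / l else t j, fun j hj => ?_, fun i => ?_⟩
    · dsimp only
      rw [if_neg (by omega)]; exact ht j (by omega)
    · rw [Finset.sum_range_succ (fun j => (if j = m + 1 then c (m + 1) / l else t j) * hahn n w j i)]
      have : ∑ j ∈ range (m + 1), (if j = m + 1 then c (m + 1) / l else t j) * hahn n w j i =
          ∑ j ∈ range (m + 1), t j * hahn n w j i := by
        refine Finset.sum_congr rfl fun j hj => ?_
        rw [if_neg (by have := Finset.mem_range.1 hj; omega)]
      rw [this, ← ht', if_pos rfl, hahn, Finset.sum_range_succ, Finset.sum_range_succ _ (m + 1),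
        ← hl, mul_add, Finset.mul_sum]
      have h2 : ∑ j ∈ range (m + 1), (c j - c (m + 1) / l * hahnCoeff n w (m + 1) j) * (i.choose j : ℝ)
          = ∑ j ∈ range (m + 1), c j * (i.choose j : ℝ) -
            ∑ j ∈ range (m + 1), c (m + 1) / l * (hahnCoeff n w (m + 1) j * (i.choose j : ℝ)) := by
        rw [← Finset.sum_sub_distrib]
        exact Finset.sum_congr rfl fun j _ => by ring
      rw [h2]
      field_simp
      ring

theorem exists_hahn_three_term {n w k : ℕ} (hw : 2 * w ≤ n) (hk : k < w) :
    ∃ t : ℕ → ℝ, (∀ j, k + 1 < j → t j = 0) ∧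
      ∀ i, ((w : ℝ) - i) * hahn n w k i = ∑ j ∈ range (k + 2), t j * hahn n w j i := by
  have key : ∀ i j : ℕ, (i : ℝ) * (i.choose j : ℝ) = j * i.choose j + (j + 1) * i.choose (j + 1) := by
    intro i j
    have e1 : ((i + 1 : ℕ) : ℝ) * i.choose j = (i + 1).choose (j + 1) * ((j + 1 : ℕ) : ℝ) := by
      exact_mod_cast Nat.add_one_mul_choose_eq i j
    rw [Nat.choose_succ_succ' i j] at e1
    push_cast at e1
    linear_combination e1
  set a := hahnCoeff n w k with ha
  obtain ⟨t, ht, ht'⟩ := exists_hahn_expansion hw (k + 1) hk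
    (fun j => (if j = k + 1 then 0 else (w - j) * a j) - (if j = 0 then 0 else j * a (j - 1)))
  refine ⟨t, ht, fun i => ?_⟩
  rw [← ht']
  have e : ∀ j, ((if j = k + 1 then 0 else ((w:ℝ) - j) * a j) - (if j = 0 then 0 else j * a (j - 1)))
      * (i.choose j : ℝ) = (if j = k + 1 then 0 else ((w:ℝ) - j) * a j) * i.choose j -
        (if j = 0 then 0 else j * a (j - 1)) * i.choose j := fun j => by ring
  rw [Finset.sum_congr rfl fun j _ => e j, Finset.sum_sub_distrib, Finset.sum_range_succ,
    Finset.sum_range_succ' (fun j => (if j = 0 then 0 else (j:ℝ) * a (j - 1)) * (i.choose j : ℝ)),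
    if_pos rfl, if_pos rfl, hahn, Finset.mul_sum, zero_mul, add_zero, zero_mul, add_zero,
    ← Finset.sum_sub_distrib]
  refine Finset.sum_congr rfl fun j hj => ?_
  rw [if_neg (by have := Finset.mem_range.1 hj; omega), if_neg (by omega), Nat.add_sub_cancel]
  have := key i j
  push_cast
  linear_combination (-a j) * this

theorem Matrix.PosSemidef.sum_nonneg {ι : Type*} [Fintype ι] {M : Matrix ι ι ℝ} (h : M.PosSemidef)
    (v : ι → ℝ) : 0 ≤ ∑ x, ∑ y, v x * v y * M x y := by
  have := h.dotProduct_mulVec_nonneg v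
  simp only [dotProduct, Matrix.mulVec, Pi.star_apply, star_trivial, Finset.mul_sum] at this
  refine this.trans_eq (Finset.sum_congr rfl fun x _ => Finset.sum_congr rfl fun y _ => by ring)

theorem Matrix.trace_le_of_idempotent_of_factor {ι κ : Type*} [Fintype ι] [DecidableEq ι]
    [Fintype κ] (E : Matrix ι ι ℝ) (U : Matrix ι κ ℝ) (V : Matrix κ ι ℝ)
    (hE : E * E = E) (hUV : E = U * V) : E.trace ≤ Fintype.card κ := by
  have h1 : IsIdempotentElem (Matrix.toLin' E) := by
    rw [IsIdempotentElem, Module.End.mul_eq_comp, ← Matrix.toLin'_mul, hE]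
  have h2 := (LinearMap.IsIdempotentElem.isProj_range _ h1).trace
  rw [Matrix.trace_toLin'_eq] at h2
  rw [h2]
  have h3 : Module.finrank ℝ (LinearMap.range (Matrix.toLin' E)) = E.rank := rfl
  rw [h3, hUV]
  exact_mod_cast (Matrix.rank_mul_le_left U V).trans (Matrix.rank_le_card_width U)

theorem card_subtype_card_le (n t : ℕ) :
    Fintype.card {s : Finset (Fin n) // s.card ≤ t} = ∑ j ∈ range (t + 1), n.choose j := by
  rw [Fintype.card_subtype]
  have : (Finset.univ.filter fun s : Finset (Fin n) => s.card ≤ t) =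
      (range (t + 1)).biUnion fun j => Finset.powersetCard j Finset.univ := by
    ext s; simp [Finset.mem_powersetCard]
  rw [this, Finset.card_biUnion]
  · simp
  · intro i _ j _ hij
    rw [Function.onFun, Finset.disjoint_left]
    intro s hs hs'
    rw [Finset.mem_powersetCard] at hs hs'
    exact hij (hs.2.symm.trans hs'.2)

theorem sum_inv_mul_card_le {n w t : ℕ} (hw : 2 * w ≤ n) (ht : t ≤ w) (s : ℕ → ℝ)
    (hs : ∀ k ≤ t, 0 < s k ∧
      zonal n w (hahn n w k) * zonal n w (hahn n w k) = s k • zonal n w (hahn n w k)) :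
    (∑ k ∈ range (t + 1), (s k)⁻¹) * Fintype.card (JSpace n w) ≤
      ∑ j ∈ range (t + 1), (n.choose j : ℝ) := by
  classical
  set E : Matrix (JSpace n w) (JSpace n w) ℝ :=
    ∑ k ∈ range (t + 1), (s k)⁻¹ • zonal n w (hahn n w k) with hE
  have hle : ∀ k ∈ range (t + 1), k ≤ t := fun k hk => by
    have := Finset.mem_range.1 hk; omega
  have h1 : E * E = E := by
    rw [hE, Finset.sum_mul]
    refine Finset.sum_congr rfl fun k hk => ?_
    rw [Finset.mul_sum, Finset.sum_eq_single k]
    · rw [Matrix.smul_mul, Matrix.mul_smul, (hs k (hle k hk)).2, smul_smul, smul_smul,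
        mul_assoc, inv_mul_cancel₀ (hs k (hle k hk)).1.ne', mul_one]
    · intro l hl hlk
      rw [Matrix.smul_mul, Matrix.mul_smul, hahn_mul_hahn_of_ne hw ((hle k hk).trans ht)
        ((hle l hl).trans ht) hlk.symm, smul_zero, smul_zero]
    · intro h; exact absurd hk h
  have hEapp : ∀ x y, E x y = ∑ k ∈ range (t + 1), (s k)⁻¹ * hahn n w k (x.1 \ y.1).card := by
    intro x y
    rw [hE, Matrix.sum_apply]; rfl
  have htr : E.trace = (∑ k ∈ range (t + 1), (s k)⁻¹) * Fintype.card (JSpace n w) := by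
    rw [Matrix.trace]
    simp only [Matrix.diag_apply, hEapp, Finset.sdiff_self, Finset.card_empty, hahn_zero_right,
      mul_one, Finset.sum_const, Finset.card_univ, nsmul_eq_mul]
    ring
  set c : ℕ → ℝ := fun j => ∑ k ∈ range (t + 1), if j ≤ k then (s k)⁻¹ * hahnCoeff n w k j else 0
    with hc
  have hEc : ∀ x y, E x y = ∑ j ∈ range (t + 1), c j * ((x.1 \ y.1).card.choose j : ℝ) := by
    intro x y
    rw [hEapp]
    simp only [hc, Finset.sum_mul]
    rw [Finset.sum_comm]
    refine Finset.sum_congr rfl fun k hk => ?_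
    rw [hahn, Finset.mul_sum]
    have : range (k + 1) ⊆ range (t + 1) := by
      intro j hj; have := hle k hk; simp at hj ⊢; omega
    rw [← Finset.sum_subset this]
    · refine Finset.sum_congr rfl fun j hj => ?_
      rw [if_pos (by have := Finset.mem_range.1 hj; omega)]; ring
    · intro j _ hj
      rw [if_neg (by simp at hj; omega), zero_mul]
  let U : Matrix (JSpace n w) {u : Finset (Fin n) // u.card ≤ t} ℝ :=
    fun x u => if u.1 ⊆ x.1 then c u.1.card else 0
  let V : Matrix {u : Finset (Fin n) // u.card ≤ t} (JSpace n w) ℝ :=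
    fun u y => if Disjoint u.1 y.1 then 1 else 0
  have hUV : E = U * V := by
    ext x y
    rw [hEc, Matrix.mul_apply]
    have e1 : ∀ u : {u : Finset (Fin n) // u.card ≤ t}, U x u * V u y =
        if u.1 ⊆ x.1 \ y.1 then c u.1.card else 0 := by
      intro u
      simp only [U, V]
      by_cases h1 : u.1 ⊆ x.1 <;> by_cases h2 : Disjoint u.1 y.1 <;>
        simp [h1, h2, Finset.subset_sdiff]
    rw [Finset.sum_congr rfl fun u _ => e1 u,
      ← Finset.sum_subtype (Finset.univ.filter fun u : Finset (Fin n) => u.card ≤ t) (by simp)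
        (fun u => if u ⊆ x.1 \ y.1 then c u.card else 0),
      ← Finset.sum_fiberwise_of_maps_to (t := range (t + 1)) (g := Finset.card) (by
        intro u hu; simp at hu ⊢; omega)]
    refine Finset.sum_congr rfl fun j hj => ?_
    rw [← Finset.sum_filter, ← Finset.card_powersetCard, mul_comm, ← nsmul_eq_mul,
      ← Finset.sum_const]
    have : (((Finset.univ.filter fun u : Finset (Fin n) => u.card ≤ t).filter
        fun u => u.card = j).filter fun u => u ⊆ x.1 \ y.1) = powersetCard j (x.1 \ y.1) := by
      ext u
      simp only [Finset.mem_filter, Finset.mem_univ, true_and, Finset.mem_powersetCard]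
      have := Finset.mem_range.1 hj
      constructor
      · rintro ⟨⟨_, h2⟩, h3⟩; exact ⟨h3, h2⟩
      · rintro ⟨h3, h2⟩; exact ⟨⟨by omega, h2⟩, h3⟩
    rw [this]
    refine Finset.sum_congr rfl fun u hu => ?_
    rw [(Finset.mem_powersetCard.1 hu).2]
  rw [← htr]
  refine (Matrix.trace_le_of_idempotent_of_factor E U V h1 hUV).trans_eq ?_
  rw [card_subtype_card_le]; push_cast; rfl

theorem trace_zonal_mul {n w : ℕ} (f g : ℕ → ℝ) :
    (zonal n w f * zonal n w g).trace = ∑ x : JSpace n w, ∑ y : JSpace n w,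
      f (x.1 \ y.1).card * g (x.1 \ y.1).card := by
  rw [Matrix.trace]
  refine Finset.sum_congr rfl fun x _ => ?_
  rw [Matrix.diag_apply, Matrix.mul_apply]
  refine Finset.sum_congr rfl fun y _ => ?_
  rw [zonal, zonal, JSpace.card_sdiff_comm y x]

theorem trace_mul_nonneg_of_posSemidef {ι : Type*} [Fintype ι] [DecidableEq ι]
    {A B : Matrix ι ι ℝ} (hA : A.PosSemidef) (C : Matrix ι ι ℝ) (hB : B = C.conjTranspose * C) :
    0 ≤ (A * B).trace := by
  rw [hB, ← Matrix.mul_assoc, Matrix.trace_mul_comm, ← Matrix.mul_assoc]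
  exact (hA.mul_mul_conjTranspose_same C).trace_nonneg

/-- The common-intersection kernel is positive semidefinite. -/
theorem inter_posSemidef (n w : ℕ) : (zonal n w fun i => (w : ℝ) - i).PosSemidef := by
  have h : (zonal n w fun i => (w : ℝ) - i) =
      (Matrix.of fun (a : Fin n) (x : JSpace n w) => if a ∈ x.1 then (1 : ℝ) else 0).conjTranspose *
      (Matrix.of fun (a : Fin n) (x : JSpace n w) => if a ∈ x.1 then (1 : ℝ) else 0) := by
    ext x y
    rw [Matrix.mul_apply]
    simp only [Matrix.conjTranspose_apply, Matrix.of_apply, star_trivial]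
    have : ∀ a : Fin n, (if a ∈ x.1 then (1:ℝ) else 0) * (if a ∈ y.1 then 1 else 0) =
        if a ∈ x.1 ∩ y.1 then 1 else 0 := by
      intro a; by_cases h1 : a ∈ x.1 <;> by_cases h2 : a ∈ y.1 <;> simp [h1, h2]
    rw [Finset.sum_congr rfl fun a _ => this a, Finset.sum_ite_mem, Finset.univ_inter,
      Finset.sum_const, nsmul_eq_mul, mul_one, zonal]
    have h1 := Finset.card_sdiff_add_card_inter x.1 y.1
    rw [x.2] at h1
    have h2 : ((x.1 \ y.1).card : ℝ) + ((x.1 ∩ y.1).card : ℝ) = w := by exact_mod_cast h1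
    linarith
  rw [h]
  exact Matrix.posSemidef_conjTranspose_mul_self _

theorem zonal_hadamard {n w : ℕ} {f g : ℕ → ℝ} (hf : (zonal n w f).PosSemidef)
    (hg : (zonal n w g).PosSemidef) : (zonal n w fun i => f i * g i).PosSemidef :=
  hf.hadamard hg

/-- Nonnegativity and symmetry of the three-term coefficients. -/
theorem three_term_mul {n w k l : ℕ} (hw : 2 * w ≤ n) {m : ℕ} (hm : m ≤ w)
    (hl : l ≤ m) {s : ℝ} (hs : zonal n w (hahn n w l) * zonal n w (hahn n w l) =
      s • zonal n w (hahn n w l)) (t : ℕ → ℝ)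
    (ht : ∀ i, ((w : ℝ) - i) * hahn n w k i = ∑ j ∈ range (m + 1), t j * hahn n w j i) :
    ∑ x : JSpace n w, ∑ y : JSpace n w, ((w : ℝ) - (x.1 \ y.1).card) * hahn n w k (x.1 \ y.1).card *
      hahn n w l (x.1 \ y.1).card = t l * s * Fintype.card (JSpace n w) := by
  have h1 := trace_zonal_mul (n := n) (w := w) (fun i => ((w : ℝ) - i) * hahn n w k i) (hahn n w l)
  rw [← h1]
  have h2 : (zonal n w fun i => ((w : ℝ) - i) * hahn n w k i) =
      ∑ j ∈ range (m + 1), t j • zonal n w (hahn n w j) := by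
    ext x y
    rw [Matrix.sum_apply]
    exact ht _
  rw [h2, Finset.sum_mul, Finset.sum_eq_single l]
  · rw [Matrix.smul_mul, hs, smul_smul, Matrix.trace_smul, Matrix.trace]
    simp [zonal, hahn_zero_right]
  · intro j hj hjl
    have := Finset.mem_range.1 hj
    rw [Matrix.smul_mul, hahn_mul_hahn_of_ne hw (by omega) (by omega) hjl, smul_zero]
  · intro h; simp at h; omega

theorem three_term_nonneg {n w k l : ℕ} (hw : 2 * w ≤ n) (hk : k ≤ w) (hl : l ≤ w) :
    0 ≤ ∑ x : JSpace n w, ∑ y : JSpace n w, ((w : ℝ) - (x.1 \ y.1).card) *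
      hahn n w k (x.1 \ y.1).card * hahn n w l (x.1 \ y.1).card := by
  have h1 := trace_zonal_mul (n := n) (w := w) (fun i => ((w : ℝ) - i) * hahn n w k i) (hahn n w l)
  rw [← h1]
  obtain ⟨s, hs, h⟩ := exists_hahn_sq hw hl
  refine trace_mul_nonneg_of_posSemidef (zonal_hadamard (inter_posSemidef n w)
    (hahn_posSemidef hw hk)) (Real.sqrt s⁻¹ • zonal n w (hahn n w l)) ?_
  rw [Matrix.conjTranspose_smul, (zonal_isHermitian n w _).eq, Matrix.smul_mul, Matrix.mul_smul, h,
    smul_smul, smul_smul, star_trivial, Real.mul_self_sqrt (inv_nonneg.2 hs.le),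
    inv_mul_cancel₀ hs.ne', one_smul]

/-- Row sums of zonal kernels are constant. -/
theorem zonal_row_sum (n w : ℕ) (f : ℕ → ℝ) (x x' : JSpace n w) :
    ∑ y : JSpace n w, f (x.1 \ y.1).card = ∑ y : JSpace n w, f (x'.1 \ y.1).card := by
  have h := zonal_mul_zonal_eq n w f (fun _ => 1) x x x' x' (by simp)
  rw [Matrix.mul_apply, Matrix.mul_apply] at h
  simpa [zonal] using h

theorem posSemidef_row_sum_le {n w : ℕ} {f : ℕ → ℝ} (hf : (zonal n w f).PosSemidef)
    (S : ℝ) (hS : ∀ x : JSpace n w, ∑ y : JSpace n w, f (x.1 \ y.1).card = S)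
    (hJ : 0 < Fintype.card (JSpace n w)) (v : JSpace n w → ℝ) :
    S * (∑ x, v x) ^ 2 ≤ Fintype.card (JSpace n w) *
      ∑ x : JSpace n w, ∑ y : JSpace n w, v x * v y * f (x.1 \ y.1).card := by
  set N : ℝ := ((Fintype.card (JSpace n w) : ℕ) : ℝ) with hN
  have hN0 : 0 < N := by rw [hN]; exact_mod_cast hJ
  set V := ∑ x, v x with hV
  have h := hf.sum_nonneg (fun x => v x - V / N)
  have hS' : ∀ y : JSpace n w, ∑ x : JSpace n w, f (x.1 \ y.1).card = S := by
    intro y; rw [← hS y]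
    exact Finset.sum_congr rfl fun x _ => by rw [JSpace.card_sdiff_comm]
  have e : ∀ x y : JSpace n w, (v x - V / N) * (v y - V / N) * zonal n w f x y =
      v x * v y * f (x.1 \ y.1).card - V / N * (v x * f (x.1 \ y.1).card)
        - V / N * (v y * f (x.1 \ y.1).card) + (V / N) ^ 2 * f (x.1 \ y.1).card := by
    intro x y; rw [zonal]; ring
  simp only [e, Finset.sum_add_distrib, Finset.sum_sub_distrib, ← Finset.mul_sum] at h
  have e1 : ∑ x : JSpace n w, v x * ∑ y : JSpace n w, f (x.1 \ y.1).card = V * S := by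
    simp only [hS, ← Finset.sum_mul, hV]
  have e2 : ∑ x : JSpace n w, ∑ y : JSpace n w, v y * f (x.1 \ y.1).card = V * S := by
    rw [Finset.sum_comm]
    simp only [← Finset.mul_sum, hS', ← Finset.sum_mul, hV]
  have e3 : ∑ x : JSpace n w, ∑ y : JSpace n w, f (x.1 \ y.1).card = N * S := by
    simp only [hS, Finset.sum_const, Finset.card_univ, nsmul_eq_mul, hN]
  rw [e1, e2, e3] at h
  have : S * V ^ 2 / N ≤ ∑ x : JSpace n w, ∑ y : JSpace n w, v x * v y * f (x.1 \ y.1).card := by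
    have : (V / N) ^ 2 * (N * S) = V / N * (V * S) := by field_simp
    rw [this] at h
    have : S * V ^ 2 / N = V / N * (V * S) := by ring
    linarith
  rw [div_le_iff₀ hN0] at this
  linarith

set_option maxHeartbeats 400000 in
/-- The linear-programming test function. -/
theorem exists_lp_function {n w t i₁ : ℕ} (hw : 2 * w ≤ n) (ht : t < w)
    (hpos : ∀ k ≤ t, 0 < hahn n w k i₁) (hneg : hahn n w (t + 1) i₁ ≤ 0) :
    ∃ (g c : ℕ → ℝ) (S : ℝ), (∀ k, 0 ≤ c k) ∧
      (∀ i, g i = ∑ k ∈ range (t + 1), c k * hahn n w k i) ∧ 0 < S ∧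
      (∀ x : JSpace n w, ∑ y : JSpace n w, g (x.1 \ y.1).card ^ 2 = S) ∧
      g 0 ^ 2 * Fintype.card (JSpace n w) ≤ (∑ j ∈ range (t + 1), (n.choose j : ℝ)) * S ∧
      ∀ v : JSpace n w → ℝ, S * (∑ x, v x) ^ 2 ≤ Fintype.card (JSpace n w) *
        ∑ x : JSpace n w, ∑ y : JSpace n w, v x * v y *
          (((i₁ : ℝ) + 1 - (x.1 \ y.1).card) * g (x.1 \ y.1).card ^ 2) := by
  classical
  have hs0 : ∀ k, ∃ s : ℝ, 0 < s ∧ (k ≤ w → zonal n w (hahn n w k) * zonal n w (hahn n w k) =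
      s • zonal n w (hahn n w k)) := by
    intro k
    by_cases hk : k ≤ w
    · obtain ⟨s, hs, h⟩ := exists_hahn_sq hw hk; exact ⟨s, hs, fun _ => h⟩
    · exact ⟨1, one_pos, fun h => absurd h hk⟩
  choose s hs hs2 using hs0
  have htt0 : ∀ k, ∃ τ : ℕ → ℝ, (∀ j, k + 1 < j → τ j = 0) ∧ (k < w →
      ∀ i, ((w : ℝ) - i) * hahn n w k i = ∑ j ∈ range (k + 2), τ j * hahn n w j i) := by
    intro k
    by_cases hk : k < w
    · obtain ⟨τ, h1, h2⟩ := exists_hahn_three_term hw hk; exact ⟨τ, h1, fun _ => h2⟩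
    · exact ⟨fun _ => 0, fun _ _ => rfl, fun h => absurd h hk⟩
  choose τ hτ0 hτ using htt0
  obtain ⟨x₀, -, -⟩ := JSpace.exists_pair hw (Nat.zero_le w)
  have hJ : 0 < Fintype.card (JSpace n w) := Fintype.card_pos_iff.2 ⟨x₀⟩
  have hJ' : (0 : ℝ) < Fintype.card (JSpace n w) := by exact_mod_cast hJ
  -- the expansion with a common upper limit
  have hτ' : ∀ k ≤ t, ∀ i : ℕ, ((w : ℝ) - i) * hahn n w k i =
      ∑ j ∈ range (t + 2), τ k j * hahn n w j i := by
    intro k hk i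
    rw [hτ k (by omega)]
    refine Finset.sum_subset (fun j hj => by simp at hj ⊢; omega) fun j _ hj => ?_
    rw [hτ0 k j (by simp at hj; omega), zero_mul]
  have hval : ∀ k ≤ t, ∀ l ≤ t + 1, ∑ x : JSpace n w, ∑ y : JSpace n w,
      ((w : ℝ) - (x.1 \ y.1).card) * hahn n w k (x.1 \ y.1).card * hahn n w l (x.1 \ y.1).card =
      τ k l * s l * Fintype.card (JSpace n w) := fun k hk l hl =>
    three_term_mul hw (m := t + 1) (by omega) hl (hs2 l (by omega)) (τ k) (hτ' k hk)
  have hτnn : ∀ k ≤ t, ∀ l ≤ t + 1, 0 ≤ τ k l := by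
    intro k hk l hl
    have h1 := three_term_nonneg (n := n) (w := w) (k := k) (l := l) hw (by omega) (by omega)
    rw [hval k hk l hl] at h1
    by_contra hneg
    push Not at hneg
    have := mul_neg_of_neg_of_pos (mul_neg_of_neg_of_pos hneg (hs l)) hJ'
    linarith
  have hτsymm : ∀ k ≤ t, ∀ l ≤ t, τ k l * s l = τ l k * s k := by
    intro k hk l hl
    have h1 := hval k hk l (by omega)
    have h2 := hval l hl k (by omega)
    have h3 : τ k l * s l * Fintype.card (JSpace n w) = τ l k * s k * Fintype.card (JSpace n w) := by
      rw [← h1, ← h2]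
      exact Finset.sum_congr rfl fun x _ => Finset.sum_congr rfl fun y _ => by ring
    exact mul_right_cancel₀ hJ'.ne' h3
  set c : ℕ → ℝ := fun k => if k ≤ t then hahn n w k i₁ / s k else 0 with hc
  have hc0 : ∀ k, 0 ≤ c k := by
    intro k; simp only [hc]; split_ifs with h
    · exact (div_pos (hpos k h) (hs k)).le
    · exact le_rfl
  set g : ℕ → ℝ := fun i => ∑ k ∈ range (t + 1), c k * hahn n w k i with hg
  have hle : ∀ k ∈ range (t + 1), k ≤ t := fun k hk => by
    have := Finset.mem_range.1 hk; omega
  have hGsum : zonal n w g = ∑ k ∈ range (t + 1), c k • zonal n w (hahn n w k) := by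
    ext x y; rw [Matrix.sum_apply]; rfl
  have hGpsd : (zonal n w g).PosSemidef := by
    rw [hGsum]
    exact Matrix.posSemidef_sum _ fun k hk =>
      (hahn_posSemidef hw (by have := hle k hk; omega)).smul (hc0 k)
  -- the key identity
  have hkey : ∀ i : ℕ, ((i₁ : ℝ) - i) * g i =
      τ t (t + 1) * (-hahn n w (t + 1) i₁) / s t * hahn n w t i + c t * τ t (t + 1) * hahn n w (t + 1) i := by
    intro i
    have e1 : ((w : ℝ) - i) * g i = ∑ j ∈ range (t + 2), (∑ k ∈ range (t + 1), c k * τ k j) * hahn n w j i := by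
      simp only [hg, Finset.mul_sum, Finset.sum_mul]
      rw [Finset.sum_comm]
      refine Finset.sum_congr rfl fun k hk => ?_
      have := hτ' k (hle k hk) i
      calc ((w : ℝ) - i) * (c k * hahn n w k i) = c k * (((w : ℝ) - i) * hahn n w k i) := by ring
        _ = _ := by rw [this, Finset.mul_sum]; exact Finset.sum_congr rfl fun j _ => by ring
    have e2 : ∀ j ≤ t, ∑ k ∈ range (t + 1), c k * τ k j =
        (((w : ℝ) - i₁) * hahn n w j i₁ - τ j (t + 1) * hahn n w (t + 1) i₁) / s j := by
      intro j hj
      have : ((w : ℝ) - i₁) * hahn n w j i₁ - τ j (t + 1) * hahn n w (t + 1) i₁ =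
          ∑ k ∈ range (t + 1), τ j k * hahn n w k i₁ := by
        rw [hτ' j hj, Finset.sum_range_succ]; ring
      rw [this, Finset.sum_div]
      refine Finset.sum_congr rfl fun k hk => ?_
      simp only [hc]
      rw [if_pos (hle k hk)]
      have h3 := hτsymm j hj k (hle k hk)
      have := (hs k).ne'; have := (hs j).ne'
      field_simp
      linear_combination (-hahn n w k i₁) * h3
    have e3 : ∑ k ∈ range (t + 1), c k * τ k (t + 1) = c t * τ t (t + 1) := by
      rw [Finset.sum_range_succ, Finset.sum_eq_zero, zero_add]
      intro k hk
      rw [hτ0 k (t + 1) (by have := Finset.mem_range.1 hk; omega), mul_zero]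
    rw [Finset.sum_range_succ, e3] at e1
    have e4 : ∑ j ∈ range (t + 1), (∑ k ∈ range (t + 1), c k * τ k j) * hahn n w j i =
        ((w : ℝ) - i₁) * g i - τ t (t + 1) * hahn n w (t + 1) i₁ / s t * hahn n w t i := by
      have : ∀ j ∈ range (t + 1), (∑ k ∈ range (t + 1), c k * τ k j) * hahn n w j i =
          ((w : ℝ) - i₁) * (c j * hahn n w j i) -
            τ j (t + 1) * hahn n w (t + 1) i₁ / s j * hahn n w j i := by
        intro j hj
        rw [e2 j (hle j hj)]
        simp only [hc]; rw [if_pos (hle j hj)]; ring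
      rw [Finset.sum_congr rfl this, Finset.sum_sub_distrib, ← Finset.mul_sum]
      congr 1
      rw [Finset.sum_range_succ, Finset.sum_eq_zero, zero_add]
      intro k hk
      rw [hτ0 k (t + 1) (by have := Finset.mem_range.1 hk; omega)]; ring
    rw [e4] at e1
    linear_combination e1
  have hF1 : (zonal n w fun i => ((i₁ : ℝ) - i) * g i).PosSemidef := by
    have : (zonal n w fun i => ((i₁ : ℝ) - i) * g i) =
        (τ t (t + 1) * (-hahn n w (t + 1) i₁) / s t) • zonal n w (hahn n w t) +
        (c t * τ t (t + 1)) • zonal n w (hahn n w (t + 1)) := by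
      ext x y; exact hkey _
    rw [this]
    have h0 := hτnn t le_rfl (t + 1) le_rfl
    exact ((hahn_posSemidef hw (by omega)).smul (div_nonneg (mul_nonneg h0 (by linarith)) (hs t).le)).add
      ((hahn_posSemidef hw (by omega)).smul (mul_nonneg (hc0 t) h0))
  have hF2 := zonal_hadamard hF1 hGpsd
  have hF3 := zonal_hadamard hGpsd hGpsd
  set S := ∑ y : JSpace n w, g (x₀.1 \ y.1).card ^ 2 with hS
  have hrow : ∀ x : JSpace n w, ∑ y : JSpace n w, g (x.1 \ y.1).card ^ 2 = S := fun x =>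
    zonal_row_sum n w (fun i => g i ^ 2) x x₀
  have hg0 : 0 < g 0 := by
    simp only [hg, hahn_zero_right, mul_one]
    refine Finset.sum_pos' (fun k _ => hc0 k) ⟨0, by simp, ?_⟩
    simp only [hc]; rw [if_pos (Nat.zero_le t)]
    exact div_pos (hpos 0 (Nat.zero_le t)) (hs 0)
  refine ⟨g, c, S, hc0, fun i => rfl, ?_, hrow, ?_, ?_⟩
  · rw [hS]
    refine Finset.sum_pos' (fun _ _ => sq_nonneg _) ⟨x₀, Finset.mem_univ _, ?_⟩
    simp only [Finset.sdiff_self, Finset.card_empty]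
    positivity
  · have hS2 : S = ∑ k ∈ range (t + 1), hahn n w k i₁ ^ 2 / s k := by
      have e1 : (zonal n w g * zonal n w g) x₀ x₀ = S := by
        rw [Matrix.mul_apply, hS]
        refine Finset.sum_congr rfl fun y _ => ?_
        rw [zonal, zonal, JSpace.card_sdiff_comm y x₀]; ring
      have e2 : zonal n w g * zonal n w g =
          ∑ k ∈ range (t + 1), (c k ^ 2 * s k) • zonal n w (hahn n w k) := by
        rw [hGsum, Finset.sum_mul]
        refine Finset.sum_congr rfl fun k hk => ?_
        rw [Finset.mul_sum, Finset.sum_eq_single k]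
        · rw [Matrix.smul_mul, Matrix.mul_smul, hs2 k (by have := hle k hk; omega), smul_smul,
            smul_smul]
          congr 1; ring
        · intro l hl hlk
          rw [Matrix.smul_mul, Matrix.mul_smul, hahn_mul_hahn_of_ne hw
            (by have := hle k hk; omega) (by have := hle l hl; omega) hlk.symm, smul_zero, smul_zero]
        · intro h; exact absurd hk h
      rw [← e1, e2, Matrix.sum_apply]
      refine Finset.sum_congr rfl fun k hk => ?_
      rw [Matrix.smul_apply, zonal, Finset.sdiff_self, Finset.card_empty, hahn_zero_right,
        smul_eq_mul, mul_one]
      simp only [hc]; rw [if_pos (hle k hk)]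
      have := (hs k).ne'
      field_simp
    have hcs : g 0 ^ 2 ≤ (∑ k ∈ range (t + 1), (s k)⁻¹) * S := by
      have h1 := Finset.sum_mul_sq_le_sq_mul_sq (range (t + 1)) (fun k => Real.sqrt (s k)⁻¹)
        (fun k => hahn n w k i₁ / Real.sqrt (s k))
      have e1 : ∀ k, Real.sqrt (s k)⁻¹ * (hahn n w k i₁ / Real.sqrt (s k)) = hahn n w k i₁ / s k := by
        intro k
        rw [Real.sqrt_inv]
        have : Real.sqrt (s k) ≠ 0 := (Real.sqrt_pos.2 (hs k)).ne'
        have h2 := Real.mul_self_sqrt (hs k).le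
        field_simp
        rw [pow_two, h2, mul_div_assoc, mul_comm, div_mul_cancel₀ _ (hs k).ne']
      have e2 : ∀ k, Real.sqrt (s k)⁻¹ ^ 2 = (s k)⁻¹ := fun k =>
        Real.sq_sqrt (inv_nonneg.2 (hs k).le)
      have e3 : ∀ k, (hahn n w k i₁ / Real.sqrt (s k)) ^ 2 = hahn n w k i₁ ^ 2 / s k := by
        intro k; rw [div_pow, Real.sq_sqrt (hs k).le]
      simp only [e1, e2, e3] at h1
      rw [hS2]
      refine le_trans (le_of_eq ?_) h1
      simp only [hg, hahn_zero_right, mul_one]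
      congr 1
      refine Finset.sum_congr rfl fun k hk => ?_
      simp only [hc]; rw [if_pos (hle k hk)]
    have h2 := sum_inv_mul_card_le hw ht.le s fun k hk => ⟨hs k, hs2 k (by omega)⟩
    have hS0 : 0 ≤ S := Finset.sum_nonneg fun _ _ => sq_nonneg _
    calc g 0 ^ 2 * Fintype.card (JSpace n w)
        ≤ (∑ k ∈ range (t + 1), (s k)⁻¹) * S * Fintype.card (JSpace n w) :=
          mul_le_mul_of_nonneg_right hcs hJ'.le
      _ = ((∑ k ∈ range (t + 1), (s k)⁻¹) * Fintype.card (JSpace n w)) * S := by ring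
      _ ≤ _ := mul_le_mul_of_nonneg_right h2 hS0
  · intro v
    have h1 := posSemidef_row_sum_le hF3 S (fun x => by
      rw [← hrow x]; exact Finset.sum_congr rfl fun y _ => by ring) hJ v
    have h2 := hF2.sum_nonneg v
    refine h1.trans ?_
    refine mul_le_mul_of_nonneg_left ?_ hJ'.le
    rw [← sub_nonneg, ← Finset.sum_sub_distrib]
    refine h2.trans_eq (Finset.sum_congr rfl fun x _ => ?_)
    rw [← Finset.sum_sub_distrib]
    refine Finset.sum_congr rfl fun y _ => ?_
    rw [zonal]; ring

theorem card_JSpace (n w : ℕ) : Fintype.card (JSpace n w) = n.choose w := by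
  rw [Fintype.card_finset_len, Fintype.card_fin]

theorem card_JSpace_sphere {n w i : ℕ} (hi : i ≤ w) (x : JSpace n w) :
    (Finset.univ.filter fun y : JSpace n w => (x.1 \ y.1).card = i).card =
      w.choose i * (n - w).choose i := by
  have h1 : ((powersetCard i x.1) ×ˢ (powersetCard i x.1ᶜ)).card =
      w.choose i * (n - w).choose i := by
    rw [Finset.card_product, Finset.card_powersetCard, Finset.card_powersetCard, Finset.card_compl,
      x.2, Fintype.card_fin]
  rw [← h1]
  refine Finset.card_bij (fun y _ => (x.1 \ y.1, y.1 \ x.1)) ?_ ?_ ?_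
  · intro y hy
    have hy' := (Finset.mem_filter.1 hy).2
    simp only [Finset.mem_product, Finset.mem_powersetCard]
    refine ⟨⟨Finset.sdiff_subset, hy'⟩, ?_, by rw [← JSpace.card_sdiff_comm]; exact hy'⟩
    intro a ha; simp at ha ⊢; exact ha.2
  · intro y _ y' _ h
    simp only [Prod.mk.injEq, Finset.ext_iff, Finset.mem_sdiff] at h
    apply Subtype.ext; ext a
    have := h.1 a; have := h.2 a; tauto
  · rintro ⟨u, v⟩ h
    simp only [Finset.mem_product, Finset.mem_powersetCard] at h
    obtain ⟨⟨hu, hu'⟩, hv, hv'⟩ := h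
    have hv2 : ∀ a ∈ v, a ∉ x.1 := fun a ha => Finset.mem_compl.1 (hv ha)
    have hd : Disjoint (x.1 \ u) v := by
      rw [Finset.disjoint_left]; intro a ha ha'; exact hv2 a ha' (Finset.mem_sdiff.1 ha).1
    refine ⟨⟨(x.1 \ u) ∪ v, ?_⟩, ?_, ?_⟩
    · rw [Finset.card_union_of_disjoint hd, Finset.card_sdiff_of_subset hu, x.2, hu', hv']; omega
    · rw [Finset.mem_filter]; refine ⟨Finset.mem_univ _, ?_⟩
      have : x.1 \ ((x.1 \ u) ∪ v) = u := by
        ext a; have := hv2 a; have := @hu a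
        simp only [Finset.mem_sdiff, Finset.mem_union]; tauto
      show (x.1 \ ((x.1 \ u) ∪ v)).card = i
      rw [this, hu']
    · simp only [Prod.mk.injEq]
      constructor
      · ext a; have := hv2 a; have := @hu a
        simp only [Finset.mem_sdiff, Finset.mem_union]; tauto
      · ext a; have := hv2 a
        simp only [Finset.mem_sdiff, Finset.mem_union]; tauto

theorem card_sdiff_of_symmDiff_eq {n w : ℕ} {x y : JSpace n w} {D : Finset (Fin n)}
    (h : symmDiff x.1 y.1 = D) : D.card = 2 * (x.1 \ y.1).card := by
  rw [← h, symmDiff_def, Finset.sup_eq_union, Finset.card_union_of_disjoint disjoint_sdiff_sdiff,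
    ← JSpace.card_sdiff_comm x y]; ring

theorem card_symmDiff_pairs {n w i : ℕ} (hi : i ≤ w) (D : Finset (Fin n)) (hD : D.card = 2 * i) :
    (Finset.univ.filter fun p : JSpace n w × JSpace n w => symmDiff p.1.1 p.2.1 = D).card =
      (2 * i).choose i * (n - 2 * i).choose (w - i) := by
  have h1 : ((powersetCard i D) ×ˢ (powersetCard (w - i) Dᶜ)).card =
      (2 * i).choose i * (n - 2 * i).choose (w - i) := by
    rw [Finset.card_product, Finset.card_powersetCard, Finset.card_powersetCard, Finset.card_compl,
      hD, Fintype.card_fin]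
  rw [← h1]
  refine Finset.card_bij (fun p _ => (p.1.1 ∩ D, p.1.1 \ D)) ?_ ?_ ?_
  · rintro ⟨x, y⟩ hp
    have hp' := (Finset.mem_filter.1 hp).2
    dsimp only at hp' ⊢
    have h2 := card_sdiff_of_symmDiff_eq hp'
    have h3 : x.1 ∩ D = x.1 \ y.1 := by
      rw [← hp']; ext a; simp only [Finset.mem_inter, Finset.mem_symmDiff, Finset.mem_sdiff]; tauto
    have h4 := Finset.card_sdiff_add_card_inter x.1 D
    rw [x.2] at h4
    simp only [Finset.mem_product, Finset.mem_powersetCard]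
    refine ⟨⟨Finset.inter_subset_right, by rw [h3]; omega⟩, ?_, by rw [h3] at h4; omega⟩
    intro a ha; simp at ha ⊢; exact ha.2
  · rintro ⟨x, y⟩ hp ⟨x', y'⟩ hp' h
    have e1 := (Finset.mem_filter.1 hp).2
    have e2 := (Finset.mem_filter.1 hp').2
    dsimp only at e1 e2 h
    simp only [Prod.mk.injEq, Finset.ext_iff, Finset.mem_sdiff, Finset.mem_inter] at h
    have hx : x.1 = x'.1 := by
      ext a
      have h1 := h.1 a
      have h2 := h.2 a
      clear * - h1 h2
      tauto
    have hy : y.1 = y'.1 := by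
      have e3 := e1.trans e2.symm
      rw [hx] at e3
      exact symmDiff_right_injective _ e3
    rw [Prod.mk.injEq]
    exact ⟨Subtype.ext hx, Subtype.ext hy⟩
  · rintro ⟨u, v⟩ h
    simp only [Finset.mem_product, Finset.mem_powersetCard] at h
    obtain ⟨⟨hu, hu'⟩, hv, hv'⟩ := h
    have hv2 : ∀ a ∈ v, a ∉ D := fun a ha => Finset.mem_compl.1 (hv ha)
    have hd : Disjoint u v := by
      rw [Finset.disjoint_left]; intro a ha ha'; exact hv2 a ha' (hu ha)
    have hd' : Disjoint (D \ u) v := by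
      rw [Finset.disjoint_left]; intro a ha ha'; exact hv2 a ha' (Finset.mem_sdiff.1 ha).1
    refine ⟨(⟨u ∪ v, by rw [Finset.card_union_of_disjoint hd]; omega⟩,
      ⟨(D \ u) ∪ v, by
        rw [Finset.card_union_of_disjoint hd', Finset.card_sdiff_of_subset hu]; omega⟩), ?_, ?_⟩
    · rw [Finset.mem_filter]; refine ⟨Finset.mem_univ _, ?_⟩
      ext a; have h1 := hv2 a; have h2 := @hu a
      simp only [Finset.mem_symmDiff, Finset.mem_sdiff, Finset.mem_union]
      clear * - h1 h2
      tauto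
    · simp only [Prod.mk.injEq]
      constructor
      · ext a; have h1 := hv2 a; have h2 := @hu a
        simp only [Finset.mem_inter, Finset.mem_union]
        clear * - h1 h2
        tauto
      · ext a; have h1 := hv2 a; have h2 := @hu a
        simp only [Finset.mem_sdiff, Finset.mem_union]
        clear * - h1 h2
        tauto

/-- Translate a word by the indicator of a set. -/
def flipBy {n : ℕ} (u : Fin n → Bool) (x : Finset (Fin n)) : Fin n → Bool :=
  fun a => xor (u a) (decide (a ∈ x))

theorem flipBy_flipBy {n : ℕ} (u : Fin n → Bool) (x : Finset (Fin n)) :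
    flipBy (flipBy u x) x = u := by
  funext a; simp [flipBy]

theorem eq_flipBy_flipBy_iff {n : ℕ} (a b : Fin n → Bool) (x y : Finset (Fin n)) :
    b = flipBy (flipBy a x) y ↔ symmDiff x y = Finset.univ.filter fun k => a k ≠ b k := by
  rw [funext_iff, Finset.ext_iff]
  refine forall_congr' fun k => ?_
  simp only [flipBy, Finset.mem_symmDiff, Finset.mem_filter, Finset.mem_univ, true_and]
  by_cases h1 : k ∈ x <;> by_cases h2 : k ∈ y <;> cases h3 : a k <;> cases h4 : b k <;>
    simp [h1, h2]

theorem translate_sum {n w : ℕ} (C : Finset (Fin n → Bool)) (F : ℕ → ℝ) :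
    ∑ u : Fin n → Bool, ∑ x : JSpace n w, ∑ y : JSpace n w,
      (if flipBy u x.1 ∈ C then (1:ℝ) else 0) * (if flipBy u y.1 ∈ C then 1 else 0) *
        F (x.1 \ y.1).card =
    ∑ a ∈ C, ∑ b ∈ C, ∑ x : JSpace n w, ∑ y : JSpace n w,
      if symmDiff x.1 y.1 = Finset.univ.filter (fun k => a k ≠ b k) then F (x.1 \ y.1).card else 0 := by
  have flipEquiv : ∀ x : JSpace n w, ∀ f : (Fin n → Bool) → ℝ,
      ∑ u, f u = ∑ a, f (flipBy a x.1) := fun x f =>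
    (Equiv.sum_comp (⟨fun a => flipBy a x.1, fun a => flipBy a x.1,
      fun a => flipBy_flipBy a x.1, fun a => flipBy_flipBy a x.1⟩ : (Fin n → Bool) ≃ (Fin n → Bool)) f).symm
  have e1 : ∀ x : JSpace n w, (∑ u : Fin n → Bool, ∑ y : JSpace n w,
      (if flipBy u x.1 ∈ C then (1:ℝ) else 0) * (if flipBy u y.1 ∈ C then 1 else 0) *
        F (x.1 \ y.1).card) = ∑ a ∈ C, ∑ b ∈ C, ∑ y : JSpace n w,
      if symmDiff x.1 y.1 = Finset.univ.filter (fun k => a k ≠ b k) then F (x.1 \ y.1).card else 0 := by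
    intro x
    rw [flipEquiv x, ← Finset.sum_filter_add_sum_filter_not Finset.univ (fun a => a ∈ C)]
    rw [Finset.sum_eq_zero (s := Finset.univ.filter fun a => a ∉ C), add_zero]
    · rw [Finset.filter_mem_eq_inter, Finset.univ_inter]
      refine Finset.sum_congr rfl fun a ha => ?_
      rw [Finset.sum_comm]
      refine Finset.sum_congr rfl fun y _ => ?_
      rw [flipBy_flipBy, if_pos ha, one_mul]
      simp only [← eq_flipBy_flipBy_iff]
      rw [Finset.sum_ite_eq']
      split_ifs <;> simp
    · intro a ha
      refine Finset.sum_eq_zero fun y _ => ?_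
      rw [flipBy_flipBy, if_neg (Finset.mem_filter.1 ha).2]; ring
  rw [Finset.sum_comm, Finset.sum_congr rfl fun x _ => e1 x, Finset.sum_comm]
  refine Finset.sum_congr rfl fun a _ => ?_
  rw [Finset.sum_comm]

theorem sum_translate_indicator {n w : ℕ} (C : Finset (Fin n → Bool)) :
    ∑ u : Fin n → Bool, ∑ x : JSpace n w, (if flipBy u x.1 ∈ C then (1:ℝ) else 0) =
      C.card * Fintype.card (JSpace n w) := by
  rw [Finset.sum_comm]
  have : ∀ x : JSpace n w, ∑ u : Fin n → Bool, (if flipBy u x.1 ∈ C then (1:ℝ) else 0) = C.card := by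
    intro x
    refine (Equiv.sum_comp (⟨fun a => flipBy a x.1, fun a => flipBy a x.1,
      fun a => flipBy_flipBy a x.1, fun a => flipBy_flipBy a x.1⟩ : (Fin n → Bool) ≃ (Fin n → Bool))
      (fun u => if u ∈ C then (1:ℝ) else 0)).trans ?_
    simp
  simp only [this, Finset.sum_const, Finset.card_univ, nsmul_eq_mul]
  ring

/-- Number of ordered pairs of codewords at distance `2 i`. -/
def pairCount {n : ℕ} (C : Finset (Fin n → Bool)) (i : ℕ) : ℕ :=
  ((C ×ˢ C).filter fun p => hammingDist p.1 p.2 = 2 * i).card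

theorem pairCount_zero {n : ℕ} (C : Finset (Fin n → Bool)) : pairCount C 0 = C.card := by
  rw [pairCount]
  have : (C ×ˢ C).filter (fun p => hammingDist p.1 p.2 = 2 * 0) = C.map
      ⟨fun a => (a, a), fun a b h => (Prod.mk.inj h).1⟩ := by
    ext ⟨a, b⟩
    rw [Finset.mem_filter, Finset.mem_product, Finset.mem_map]
    constructor
    · rintro ⟨⟨h1, _⟩, h2⟩
      have h3 : a = b := hammingDist_eq_zero.1 h2
      exact ⟨a, h1, by rw [← h3]; rfl⟩
    · rintro ⟨c, hc, h⟩
      obtain ⟨h1, h2⟩ := Prod.mk.inj h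
      rw [← h1, ← h2]
      exact ⟨⟨hc, hc⟩, by simp⟩
  rw [this, Finset.card_map]

/-- The distance-distribution form of the second linear programming bound. -/
theorem exists_heavy_distance {n w t i₁ : ℕ} (hw : 2 * w ≤ n) (ht : t < w) (hi₁ : i₁ ≤ w)
    (hpos : ∀ k ≤ t, 0 < hahn n w k i₁) (hneg : hahn n w (t + 1) i₁ ≤ 0)
    (C : Finset (Fin n → Bool)) (hC : 0 < C.card)
    (hsize : 2 * ((i₁ : ℝ) + 1) * (∑ j ∈ range (t + 1), (n.choose j : ℝ)) * 2 ^ n ≤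
      C.card * n.choose w) :
    ∃ (g c : ℕ → ℝ), (∀ k, 0 ≤ c k) ∧
      (∀ i, g i = ∑ k ∈ range (t + 1), c k * hahn n w k i) ∧
      ∃ i, 1 ≤ i ∧ i ≤ i₁ ∧ g i ≠ 0 ∧ ∀ i', i' ≤ w →
        (n.choose w : ℝ) * (C.card : ℝ) ^ 2 * (w.choose i' * (n - w).choose i' * g i' ^ 2) ≤
          2 ^ (n + 1) * ((i₁ : ℝ) + 1) ^ 2 * (pairCount C i *
            ((2 * i).choose i * (n - 2 * i).choose (w - i)) * g i ^ 2) := by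
  obtain ⟨g, c, S, hc, hg, hS, hrow, hg0, hmain⟩ := exists_lp_function hw ht hpos hneg
  refine ⟨g, c, hc, hg, ?_⟩
  have hJ : (0:ℝ) < n.choose w := by exact_mod_cast Nat.choose_pos (by omega)
  have hCr : (0:ℝ) < C.card := by exact_mod_cast hC
  rw [card_JSpace] at hg0
  simp only [card_JSpace] at hmain
  set F : ℕ → ℝ := fun i => ((i₁ : ℝ) + 1 - i) * g i ^ 2 with hF
  set W : Finset (Fin n) → ℝ := fun D => ∑ x : JSpace n w, ∑ y : JSpace n w,
    if symmDiff x.1 y.1 = D then F (x.1 \ y.1).card else 0 with hW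
  set N : ℕ → ℝ := fun i => ((2 * i).choose i * (n - 2 * i).choose (w - i) : ℝ) with hN
  have hN0 : ∀ i, 0 ≤ N i := fun i => by simp only [hN]; positivity
  -- averaged lower bound
  have h1 : S * ((n.choose w : ℝ) * C.card ^ 2) ≤
      2 ^ n * ∑ a ∈ C, ∑ b ∈ C, W (Finset.univ.filter fun k => a k ≠ b k) := by
    rw [← translate_sum C F]
    have e1 := Finset.sum_le_sum fun (u : Fin n → Bool) (_ : u ∈ Finset.univ) =>
      hmain (fun x => if flipBy u x.1 ∈ C then (1:ℝ) else 0)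
    rw [← Finset.mul_sum, ← Finset.mul_sum] at e1
    have e2 := Finset.sum_mul_sq_le_sq_mul_sq (Finset.univ : Finset (Fin n → Bool)) (fun _ => (1:ℝ))
      (fun u => ∑ x : JSpace n w, if flipBy u x.1 ∈ C then (1:ℝ) else 0)
    simp only [one_mul, one_pow, Finset.sum_const, Finset.card_univ, nsmul_eq_mul, mul_one,
      Fintype.card_fun, Fintype.card_bool, Fintype.card_fin] at e2
    rw [sum_translate_indicator, card_JSpace] at e2
    push_cast at e2
    have e3 : S * ((C.card : ℝ) * n.choose w) ^ 2 ≤ 2 ^ n * ((n.choose w : ℝ) * _) :=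
      (mul_le_mul_of_nonneg_left e2 hS.le).trans
        (by rw [mul_left_comm]; exact mul_le_mul_of_nonneg_left e1 (by positivity))
    have e4 : (n.choose w : ℝ) * (S * ((n.choose w : ℝ) * C.card ^ 2)) ≤
      (n.choose w : ℝ) * (2 ^ n * ∑ u : Fin n → Bool, ∑ x : JSpace n w, ∑ y : JSpace n w,
      (if flipBy u x.1 ∈ C then (1:ℝ) else 0) * (if flipBy u y.1 ∈ C then 1 else 0) *
        F (x.1 \ y.1).card) := by
      refine le_trans (le_of_eq ?_) (e3.trans (le_of_eq ?_)) <;> ring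
    exact le_of_mul_le_mul_left e4 hJ
  -- pair weights
  have hWval : ∀ i ≤ w, ∀ D : Finset (Fin n), D.card = 2 * i → W D = N i * F i := by
    intro i hi D hD
    have : N i = ((Finset.univ.filter fun p : JSpace n w × JSpace n w =>
        symmDiff p.1.1 p.2.1 = D).card : ℝ) := by
      rw [card_symmDiff_pairs hi D hD]; push_cast; rfl
    rw [this, ← nsmul_eq_mul, ← Finset.sum_const, Finset.sum_filter, Fintype.sum_prod_type]
    refine Finset.sum_congr rfl fun x _ => Finset.sum_congr rfl fun y _ => ?_
    dsimp only
    split_ifs with h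
    · have := card_sdiff_of_symmDiff_eq h
      congr 1; omega
    · rfl
  have hWnp : ∀ D : Finset (Fin n), (∀ i ≤ i₁, D.card ≠ 2 * i) → W D ≤ 0 := by
    intro D hD
    show (∑ x : JSpace n w, ∑ y : JSpace n w,
      if symmDiff x.1 y.1 = D then F (x.1 \ y.1).card else 0 : ℝ) ≤ 0
    refine Finset.sum_nonpos (N := ℝ) fun x _ => Finset.sum_nonpos (N := ℝ) fun y _ => ?_
    split_ifs with h
    · have h2 := card_sdiff_of_symmDiff_eq h
      have h3 : i₁ < (x.1 \ y.1).card := by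
        by_contra h4
        exact hD _ (not_lt.1 h4) h2
      have h4 : (i₁ : ℝ) + 1 ≤ (x.1 \ y.1).card := by exact_mod_cast h3
      have h5 : (i₁ : ℝ) + 1 - ((x.1 \ y.1).card : ℝ) ≤ 0 := by linarith
      exact mul_nonpos_of_nonpos_of_nonneg h5 (sq_nonneg _)
    · exact le_rfl
  have h2 : ∑ a ∈ C, ∑ b ∈ C, W (Finset.univ.filter fun k => a k ≠ b k) ≤
      ∑ i ∈ range (i₁ + 1), pairCount C i * (N i * F i) := by
    have e1 : ∀ i ∈ range (i₁ + 1), (pairCount C i : ℝ) * (N i * F i) =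
        ∑ p ∈ C ×ˢ C, if hammingDist p.1 p.2 = 2 * i then N i * F i else 0 := by
      intro i _
      rw [← Finset.sum_filter, Finset.sum_const, nsmul_eq_mul, pairCount]
    rw [← Finset.sum_product', Finset.sum_congr rfl e1,
      Finset.sum_comm (s := range (i₁ + 1)) (t := C ×ˢ C)]
    refine Finset.sum_le_sum fun p _ => ?_
    by_cases h : ∃ i ≤ i₁, hammingDist p.1 p.2 = 2 * i
    · obtain ⟨i, hi, hd⟩ := h
      rw [Finset.sum_eq_single i]
      · rw [if_pos hd]
        exact (hWval i (hi.trans hi₁) _ hd).le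
      · intro j _ hj
        rw [if_neg (by omega)]
      · intro h; simp at h; omega
    · push Not at h
      rw [Finset.sum_eq_zero]
      · exact hWnp _ h
      · intro i hi
        rw [if_neg (h i (by have := Finset.mem_range.1 hi; omega))]
  rw [Finset.sum_range_succ'] at h2
  have h3 : (pairCount C 0 : ℝ) * (N 0 * F 0) ≤ S * ((n.choose w : ℝ) * C.card ^ 2) / 2 ^ (n + 1) := by
    rw [pairCount_zero]
    simp only [hN, hF]
    simp only [mul_zero, Nat.choose_self, Nat.cast_one, one_mul, Nat.sub_zero, Nat.cast_zero, sub_zero]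
    rw [le_div_iff₀ (by positivity)]
    have e1 : (C.card : ℝ) * ((n.choose w : ℝ) * (((i₁ : ℝ) + 1) * g 0 ^ 2)) * 2 ^ (n + 1) =
        (C.card : ℝ) * ((2 * ((i₁ : ℝ) + 1)) * (g 0 ^ 2 * n.choose w) * 2 ^ n) := by rw [pow_succ]; ring
    have e2 : (C.card : ℝ) * ((2 * ((i₁ : ℝ) + 1)) * (g 0 ^ 2 * n.choose w) * 2 ^ n) ≤
        (C.card : ℝ) * ((2 * ((i₁ : ℝ) + 1)) *
          ((∑ j ∈ range (t + 1), (n.choose j : ℝ)) * S) * 2 ^ n) := by gcongr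
    have e3 := mul_le_mul_of_nonneg_left hsize (mul_nonneg hCr.le hS.le)
    rw [e1]
    refine e2.trans (le_trans (le_of_eq ?_) (e3.trans (le_of_eq ?_))) <;> ring
  by_contra hcon
  push Not at hcon
  -- S is at least each shell contribution, and equals the sum of them
  have hSle : ∀ i' ≤ w, (w.choose i' * (n - w).choose i' * g i' ^ 2 : ℝ) ≤ S := by
    intro i' hi'
    obtain ⟨x, -, -⟩ := JSpace.exists_pair hw (Nat.zero_le w)
    rw [← hrow x]
    have : (w.choose i' * (n - w).choose i' * g i' ^ 2 : ℝ) =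
        ∑ y ∈ Finset.univ.filter (fun y : JSpace n w => (x.1 \ y.1).card = i'),
          g (x.1 \ y.1).card ^ 2 := by
      rw [Finset.sum_congr rfl (g := fun _ => g i' ^ 2) fun y hy => by rw [(Finset.mem_filter.1 hy).2],
        Finset.sum_const, card_JSpace_sphere hi', nsmul_eq_mul]
      push_cast; ring
    rw [this]
    exact Finset.sum_le_sum_of_subset_of_nonneg (Finset.filter_subset _ _)
      fun _ _ _ => sq_nonneg _
  have h4 : ∀ i ∈ range i₁, (pairCount C (i + 1) : ℝ) * (N (i + 1) * F (i + 1)) ≤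
      S * ((n.choose w : ℝ) * C.card ^ 2) / (2 ^ (n + 1) * (i₁ + 1)) := by
    intro i hi
    have hi' : i + 1 ≤ i₁ := by have := Finset.mem_range.1 hi; omega
    have e2 : (pairCount C (i + 1) : ℝ) * (N (i + 1) * F (i + 1)) ≤
        (i₁ + 1) * (pairCount C (i + 1) * N (i + 1) * g (i + 1) ^ 2) := by
      have e5 : (0:ℝ) ≤ pairCount C (i + 1) * N (i + 1) * g (i + 1) ^ 2 :=
        mul_nonneg (mul_nonneg (Nat.cast_nonneg _) (hN0 _)) (sq_nonneg _)
      have e6 : (pairCount C (i + 1) : ℝ) * (N (i + 1) * F (i + 1)) =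
        (i₁ + 1 - ((i + 1 : ℕ) : ℝ)) * (pairCount C (i + 1) * N (i + 1) * g (i + 1) ^ 2) := by
        simp only [hF]; ring
      rw [e6]
      exact mul_le_mul_of_nonneg_right (by have : (0:ℝ) ≤ ((i + 1 : ℕ) : ℝ) := Nat.cast_nonneg _; linarith) e5
    by_cases hgi : g (i + 1) = 0
    · simp only [hF, hgi]
      have : (0:ℝ) ≤ S * ((n.choose w : ℝ) * C.card ^ 2) / (2 ^ (n + 1) * (i₁ + 1)) := by positivity
      simpa using this
    obtain ⟨i', hi'w, e1⟩ := hcon (i + 1) (by omega) hi' hgi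
    have e3 := mul_le_mul_of_nonneg_left (hSle i' hi'w) (by positivity :
      (0:ℝ) ≤ (n.choose w : ℝ) * (C.card : ℝ) ^ 2)
    have e4 := e1.le.trans e3
    refine e2.trans ?_
    rw [le_div_iff₀ (by positivity)]
    simp only [hN]
    refine le_trans (le_of_eq ?_) (e4.trans (le_of_eq ?_)) <;> ring
  have h5 := Finset.sum_le_sum h4
  rw [Finset.sum_const, Finset.card_range, nsmul_eq_mul] at h5
  have h6 : (i₁ : ℝ) * (S * ((n.choose w : ℝ) * C.card ^ 2) / (2 ^ (n + 1) * (i₁ + 1))) <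
      S * ((n.choose w : ℝ) * C.card ^ 2) / 2 ^ (n + 1) := by
    have e1 : S * ((n.choose w : ℝ) * C.card ^ 2) / (2 ^ (n + 1) * (i₁ + 1)) =
      S * ((n.choose w : ℝ) * C.card ^ 2) / 2 ^ (n + 1) / (i₁ + 1) := by rw [div_div]
    have e2 : 0 < S * ((n.choose w : ℝ) * C.card ^ 2) / 2 ^ (n + 1) := by positivity
    rw [e1, ← mul_div_assoc, div_lt_iff₀ (by positivity)]
    nlinarith
  have h7 := h2.trans (add_le_add h5 h3)
  have h8 : 2 ^ n * (S * ((n.choose w : ℝ) * C.card ^ 2) / 2 ^ (n + 1) * 2) =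
    S * ((n.choose w : ℝ) * C.card ^ 2) := by rw [pow_succ]; field_simp; try ring
  have h9 : (2:ℝ) ^ n * ∑ a ∈ C, ∑ b ∈ C, W (Finset.univ.filter fun k => a k ≠ b k) <
      2 ^ n * (S * ((n.choose w : ℝ) * C.card ^ 2) / 2 ^ (n + 1) * 2) :=
    mul_lt_mul_of_pos_left (by linarith) (by positivity)
  linarith

theorem hahn_recurrence {n w k : ℕ} (hw : 2 * w ≤ n) (hk : k ≤ w) (i : ℕ) :
    ((w : ℝ) - i) * (n - w - i) * hahn n w k (i + 1) =
      (((w : ℝ) - i) * (n - w - i) + (i : ℝ) ^ 2 - k * (n + 1 - k)) * hahn n w k i -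
        (i : ℝ) ^ 2 * hahn n w k (i - 1) := by
  have := jOp_hahn hw hk i
  simp only [jOp, jEig] at this
  linear_combination this

theorem hahn_growth {n w k i₀ : ℕ} (hw : 2 * w ≤ n) (hk : k ≤ w) (hi₀ : i₀ < w) {r : ℝ} (hr : 1 ≤ r)
    (hK : (k : ℝ) * (n + 1 - k) ≤
      (r - 1) * (((w : ℝ) - i₀) * (n - w - i₀) / r - (i₀ : ℝ) ^ 2)) :
    ∀ i ≤ i₀, 0 < hahn n w k i ∧ hahn n w k i ≤ r * hahn n w k (i + 1) := by
  have hwn : 2 * (w : ℝ) ≤ n := by exact_mod_cast hw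
  have hr0 : 0 < r := by linarith
  have key : ∀ i ≤ i₀, 0 < ((w : ℝ) - i) * (n - w - i) ∧ (k : ℝ) * (n + 1 - k) ≤
      (r - 1) * (((w : ℝ) - i) * (n - w - i) / r - (i : ℝ) ^ 2) := by
    intro i hi
    have h1 : (i : ℝ) ≤ i₀ := by exact_mod_cast hi
    have h2 : (i₀ : ℝ) < w := by exact_mod_cast hi₀
    have h0 : (0:ℝ) ≤ i := Nat.cast_nonneg i
    refine ⟨mul_pos (by linarith) (by linarith), hK.trans ?_⟩
    refine mul_le_mul_of_nonneg_left ?_ (by linarith)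
    have h3 : ((w : ℝ) - i₀) * (n - w - i₀) ≤ (w - i) * (n - w - i) :=
      mul_le_mul (by linarith) (by linarith) (by linarith) (by linarith)
    have h4 := div_le_div_of_nonneg_right h3 hr0.le
    have h5 : (i : ℝ) ^ 2 ≤ (i₀ : ℝ) ^ 2 := by gcongr
    linarith
  intro i
  induction i with
  | zero =>
    intro _
    obtain ⟨hb, h⟩ := key 0 (Nat.zero_le _)
    refine ⟨by rw [hahn_zero_right]; exact one_pos, ?_⟩
    have hrec := hahn_recurrence hw hk 0
    rw [hahn_zero_right] at hrec ⊢
    simp only [Nat.cast_zero, sub_zero] at *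
    set b := (w : ℝ) * (n - w) with hbdef
    have h1 : b * hahn n w k (0 + 1) = b - k * (n + 1 - k) := by rw [hrec]; ring
    have h2 : b ≤ b * (r * hahn n w k (0 + 1)) := by
      have h3 : r * (k * (n + 1 - k)) ≤ r * ((r - 1) * (b / r - 0 ^ 2)) :=
        mul_le_mul_of_nonneg_left h hr0.le
      have h4 : r * ((r - 1) * (b / r - 0 ^ 2)) = (r - 1) * b := by field_simp; ring
      have h5 : b * (r * hahn n w k (0 + 1)) = r * (b * hahn n w k (0 + 1)) := by ring
      rw [h5, h1]; linarith
    nlinarith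
  | succ i ih =>
    intro hi
    obtain ⟨hp, hle⟩ := ih (by omega)
    obtain ⟨hb, h⟩ := key (i + 1) hi
    have hrec := hahn_recurrence hw hk (i + 1)
    rw [Nat.add_sub_cancel] at hrec
    have hpos : 0 < hahn n w k (i + 1) := pos_of_mul_pos_right (lt_of_lt_of_le hp hle) hr0.le
    refine ⟨hpos, ?_⟩
    set b := ((w : ℝ) - (i + 1 : ℕ)) * (n - w - (i + 1 : ℕ)) with hbdef
    set c := (((i + 1 : ℕ) : ℝ)) ^ 2 with hc
    have hc0 : 0 ≤ c := sq_nonneg _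
    have h1 : b * hahn n w k (i + 1) ≤ b * (r * hahn n w k (i + 1 + 1)) := by
      have h2 : b * (r * hahn n w k (i + 1 + 1)) = r * (b * hahn n w k (i + 1 + 1)) := by ring
      rw [h2, hrec]
      have h3 := mul_le_mul_of_nonneg_left hle hc0
      have h4 : r * (k * (n + 1 - k)) ≤ r * ((r - 1) * (b / r - c)) :=
        mul_le_mul_of_nonneg_left h hr0.le
      have h5 : r * ((r - 1) * (b / r - c)) = (r - 1) * b - r * (r - 1) * c := by field_simp
      rw [h5] at h4
      have h6 : b ≤ r * (b + c - k * (n + 1 - k) - c * r) := by linarith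
      have h7 := mul_le_mul_of_nonneg_right h6 hpos.le
      have h8 := mul_le_mul_of_nonneg_left h3 hr0.le
      linarith
    exact le_of_mul_le_mul_left h1 hb

theorem exists_hahn_nonpos {n w k I J : ℕ} (hw : 2 * w ≤ n) (hk : k ≤ w) {A γ : ℝ} (hA : 0 < A)
    (hγ : 0 < γ) (hAJ : A ^ 2 ≤ J * γ)
    (hiw : I + J < w)
    (h1 : ∀ i, I ≤ i → i ≤ I + J → ((w : ℝ) - i) * (n - w - i) + (i : ℝ) ^ 2 - k * (n + 1 - k) ≤
      A * (((w : ℝ) - i) * (n - w - i)))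
    (h2 : ∀ i, I ≤ i → i ≤ I + J → 4 * γ * (((w : ℝ) - i) * (n - w - i)) ^ 2 ≤
      4 * (((w : ℝ) - i) * (n - w - i)) * (i : ℝ) ^ 2 -
        (((w : ℝ) - i) * (n - w - i) + (i : ℝ) ^ 2 - k * (n + 1 - k)) ^ 2) :
    ∃ i ≤ I + J + 1, hahn n w k i ≤ 0 := by
  by_contra! hcon
  have hwn : 2 * (w : ℝ) ≤ n := by exact_mod_cast hw
  have key : ∀ j ≤ J, hahn n w k (I + j + 1) ≤ (A - j * (γ / A)) * hahn n w k (I + j) := by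
    intro j
    induction j with
    | zero =>
      intro _
      have hrec := hahn_recurrence hw hk I
      have hb : 0 < ((w : ℝ) - I) * (n - w - I) := by
        have : (I : ℝ) < w := by exact_mod_cast (by omega : I < w)
        exact mul_pos (by linarith) (by linarith)
      have e1 := mul_le_mul_of_nonneg_right (h1 I le_rfl (by omega)) (hcon I (by omega)).le
      have e2 : 0 ≤ (I : ℝ) ^ 2 * hahn n w k (I - 1) :=
        mul_nonneg (sq_nonneg _) (hcon (I - 1) (by omega)).le
      simp only [add_zero, Nat.cast_zero, zero_mul, sub_zero]
      refine le_of_mul_le_mul_left ?_ hb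
      linarith
    | succ j ih =>
      intro hj
      have ih' := ih (by omega)
      have hrec := hahn_recurrence hw hk (I + j + 1)
      rw [Nat.add_sub_cancel] at hrec
      have p0 := hcon (I + j) (by omega)
      have p1 := hcon (I + j + 1) (by omega)
      have hb : 0 < ((w : ℝ) - (I + j + 1 : ℕ)) * (n - w - (I + j + 1 : ℕ)) := by
        have : ((I + j + 1 : ℕ) : ℝ) < w := by exact_mod_cast (by omega : I + j + 1 < w)
        exact mul_pos (by linarith) (by linarith)
      have e2 := h2 (I + j + 1) (by omega) (by omega)
      rw [show I + (j + 1) + 1 = I + j + 1 + 1 by ring, show I + (j + 1) = I + j + 1 by ring]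
      set b := ((w : ℝ) - (I + j + 1 : ℕ)) * (n - w - (I + j + 1 : ℕ)) with hbdef
      set c := (((I + j + 1 : ℕ) : ℝ)) ^ 2 with hc
      set P := b + c - k * (n + 1 - k) with hP
      set f0 := hahn n w k (I + j)
      set f1 := hahn n w k (I + j + 1)
      set f2 := hahn n w k (I + j + 1 + 1)
      set y := f1 / f0 with hy
      have hy0 : 0 < y := div_pos p1 p0
      have hyY : y ≤ A - j * (γ / A) := (div_le_iff₀ p0).2 ih'
      have hγA : 0 < γ / A := div_pos hγ hA
      have hyA : y ≤ A := by
        have : 0 ≤ (j : ℝ) * (γ / A) := by positivity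
        linarith
      have hf1 : f1 = y * f0 := by rw [hy]; field_simp
      have q1 : γ * b ≤ b * y ^ 2 - P * y + c := by
        have : 4 * b * (γ * b) ≤ 4 * b * (b * y ^ 2 - P * y + c) := by
          have e3 : 4 * b * (b * y ^ 2 - P * y + c) = (2 * b * y - P) ^ 2 + (4 * b * c - P ^ 2) := by
            ring
          have e4 : 4 * b * (γ * b) = 4 * γ * b ^ 2 := by ring
          have := sq_nonneg (2 * b * y - P)
          linarith
        exact le_of_mul_le_mul_left this (by linarith)
      have q2 : γ / A * b * y ≤ γ * b := by
        have : γ / A * b * y ≤ γ / A * b * A := mul_le_mul_of_nonneg_left hyA (by positivity)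
        refine this.trans (le_of_eq ?_); field_simp
      have q3 : b * f2 ≤ b * ((y - γ / A) * f1) := by
        rw [hrec, hf1]
        have : 0 ≤ (b * y ^ 2 - P * y + c - γ / A * b * y) * f0 := mul_nonneg (by linarith) p0.le
        have e : b * ((y - γ / A) * (y * f0)) - (P * (y * f0) - c * f0) =
          (b * y ^ 2 - P * y + c - γ / A * b * y) * f0 := by ring
        linarith
      have q4 : f2 ≤ (y - γ / A) * f1 := le_of_mul_le_mul_left q3 hb
      refine q4.trans (mul_le_mul_of_nonneg_right ?_ p1.le)
      push_cast
      linarith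
  have h3 := key J le_rfl
  have h4 := hcon (I + J + 1) le_rfl
  have h5 := hcon (I + J) (by omega)
  have h6 : A - J * (γ / A) ≤ 0 := by
    have : A ^ 2 / A ≤ J * γ / A := div_le_div_of_nonneg_right hAJ hA.le
    have e : A ^ 2 / A = A := by field_simp
    rw [e, mul_div_assoc] at this; linarith
  have := mul_nonpos_of_nonpos_of_nonneg h6 h5.le
  linarith

theorem choose_mul_choose_mul_choose {n w i : ℕ} (hw : 2 * w ≤ n) (hi : i ≤ w) :
    n.choose w * (w.choose i * (n - w).choose i) =
      n.choose (2 * i) * ((2 * i).choose i * (n - 2 * i).choose (w - i)) := by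
  have e1 := Nat.choose_mul (n := n) (k := 2 * i) (s := i) (by omega)
  have e2 := Nat.choose_mul (n := n) (k := w) (s := i) hi
  have e3 := Nat.choose_mul (n := n - i) (k := n - w) (s := i) (by omega)
  have e4 : (n - i).choose (n - w) = (n - i).choose (w - i) := by
    rw [← Nat.choose_symm (by omega : w - i ≤ n - i)]; congr 1; omega
  have e5 : (n - i - i).choose (n - w - i) = (n - 2 * i).choose (w - i) := by
    rw [← Nat.choose_symm (by omega : w - i ≤ n - 2 * i)]; congr 1 <;> omega
  have e6 : 2 * i - i = i := by omega
  rw [e4, e5] at e3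
  rw [e6] at e1
  calc n.choose w * (w.choose i * (n - w).choose i)
      = (n.choose w * w.choose i) * (n - w).choose i := by ring
    _ = n.choose i * ((n - i).choose (w - i) * (n - w).choose i) := by rw [e2]; ring
    _ = n.choose (2 * i) * (2 * i).choose i * (n - 2 * i).choose (w - i) := by rw [e3, e1]; ring
    _ = _ := by ring

theorem exists_pairs_of_nonpos {n w T i₀ m : ℕ} (hw : 2 * w ≤ n) (hT : T ≤ w) (hi₀ : i₀ < w)
    {r : ℝ} (hr : 1 ≤ r) (hm : m ≤ w)
    (hK : (T : ℝ) * (n + 1 - T) ≤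
      (r - 1) * (((w : ℝ) - i₀) * (n - w - i₀) / r - (i₀ : ℝ) ^ 2))
    (hz : ∃ i ≤ m, hahn n w T i ≤ 0)
    (C : Finset (Fin n → Bool)) (hC : 0 < C.card)
    (hsize : 2 * ((n : ℝ) + 1) * (∑ j ∈ range (T + 1), (n.choose j : ℝ)) * 2 ^ n ≤
      C.card * n.choose w) :
    ∃ i, 1 ≤ i ∧ i ≤ m ∧ 0 < pairCount C i ∧
      ((i ≤ i₀ ∧ (C.card : ℝ) ^ 2 * (n.choose (2 * i₀) *
          ((2 * i₀).choose i₀ * (n - 2 * i₀).choose (w - i₀))) ≤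
          2 ^ (n + 1) * ((n : ℝ) + 1) ^ 2 * (pairCount C i *
            ((2 * i).choose i * (n - 2 * i).choose (w - i)) * r ^ (2 * (i₀ - i)))) ∨
        (i₀ < i ∧ (C.card : ℝ) ^ 2 * n.choose (2 * i) ≤
          2 ^ (n + 1) * ((n : ℝ) + 1) ^ 2 * pairCount C i)) := by
  classical
  have hCr : (0:ℝ) < C.card := by exact_mod_cast hC
  have hwn : 2 * (w : ℝ) ≤ n := by exact_mod_cast hw
  have hex : ∃ i, ∃ k ≤ T, hahn n w k i ≤ 0 := by
    obtain ⟨i, _, h⟩ := hz; exact ⟨i, T, le_rfl, h⟩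
  obtain ⟨i₁, hi₁, hmin⟩ : ∃ i₁, (∃ k ≤ T, hahn n w k i₁ ≤ 0) ∧
      ∀ i < i₁, ∀ k ≤ T, 0 < hahn n w k i := by
    refine ⟨Nat.find hex, Nat.find_spec hex, fun i hi k hk => ?_⟩
    have := Nat.find_min hex hi
    push Not at this
    exact this k hk
  have hi₁m : i₁ ≤ m := by
    by_contra h
    obtain ⟨i, hi, h'⟩ := hz
    exact absurd (hmin i (by omega) T le_rfl) (not_lt.2 h')
  obtain ⟨k₀, ⟨hk₀T, hk₀⟩, hk₀min⟩ : ∃ k₀, (k₀ ≤ T ∧ hahn n w k₀ i₁ ≤ 0) ∧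
      ∀ k < k₀, 0 < hahn n w k i₁ := by
    refine ⟨Nat.find hi₁, Nat.find_spec hi₁, fun k hk => ?_⟩
    have := Nat.find_min hi₁ hk
    push Not at this
    exact this (by have := (Nat.find_spec hi₁).1; omega)
  obtain ⟨t, rfl⟩ : ∃ t, k₀ = t + 1 := by
    refine ⟨k₀ - 1, ?_⟩
    rcases k₀ with _ | k
    · rw [hahn_zero_left] at hk₀; linarith
    · omega
  have hi₁n : (i₁ : ℝ) ≤ n := by exact_mod_cast (by omega : i₁ ≤ n)
  have hsum : (∑ j ∈ range (t + 1), (n.choose j : ℝ)) ≤ ∑ j ∈ range (T + 1), (n.choose j : ℝ) :=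
    Finset.sum_le_sum_of_subset_of_nonneg (Finset.range_mono (by omega))
      fun _ _ _ => Nat.cast_nonneg _
  have hsize' : 2 * ((i₁ : ℝ) + 1) * (∑ j ∈ range (t + 1), (n.choose j : ℝ)) * 2 ^ n ≤
      C.card * n.choose w := by
    refine le_trans ?_ hsize
    gcongr
  obtain ⟨g, c, hc, hg, i, hi1, hii₁, hgi, hmain⟩ := exists_heavy_distance hw (by omega)
    (hi₁m.trans hm) (fun k hk => hk₀min k (by omega)) hk₀ C hC hsize'
  have hgrow : ∀ k ≤ t, ∀ i ≤ i₀, 0 < hahn n w k i ∧ hahn n w k i ≤ r * hahn n w k (i + 1) := by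
    intro k hk
    refine hahn_growth hw (by omega) hi₀ hr (le_trans ?_ hK)
    have h1 : (k : ℝ) ≤ T := by exact_mod_cast (by omega : k ≤ T)
    have h2 : (T : ℝ) ≤ w := by exact_mod_cast hT
    nlinarith
  have hJ : (0:ℝ) < n.choose w := by exact_mod_cast Nat.choose_pos (by omega)
  have hgnn : ∀ i ≤ i₁, 0 ≤ g i := by
    intro i hi
    rw [hg]
    refine Finset.sum_nonneg fun k hk => mul_nonneg (hc k) ?_
    have hk' := Finset.mem_range.1 hk
    rcases hi.lt_or_eq with h | rfl
    · exact (hmin i h k (by omega)).le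
    · exact (hk₀min k (by omega)).le
  have hgpos : 0 < g i := lt_of_le_of_ne (hgnn i hii₁) (Ne.symm hgi)
  have hfac : (2:ℝ) ^ (n + 1) * ((i₁ : ℝ) + 1) ^ 2 ≤ 2 ^ (n + 1) * ((n : ℝ) + 1) ^ 2 := by gcongr
  have hident : ∀ i ≤ w, (n.choose w : ℝ) * (w.choose i * (n - w).choose i) =
      n.choose (2 * i) * ((2 * i).choose i * (n - 2 * i).choose (w - i)) := by
    intro i hi
    exact_mod_cast choose_mul_choose_mul_choose hw hi
  have hNpos : ∀ i ≤ w, (0:ℝ) < (2 * i).choose i * (n - 2 * i).choose (w - i) := by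
    intro i hi
    have h1 := Nat.choose_pos (by omega : i ≤ 2 * i)
    have h2 := Nat.choose_pos (by omega : w - i ≤ n - 2 * i)
    exact_mod_cast Nat.mul_pos h1 h2
  have hself := hmain i (by omega)
  have hN := hNpos i (by omega)
  have hself' : (C.card : ℝ) ^ 2 * n.choose (2 * i) ≤
          2 ^ (n + 1) * ((n : ℝ) + 1) ^ 2 * pairCount C i := by
    have e1 : (n.choose w : ℝ) * (C.card : ℝ) ^ 2 * (w.choose i * (n - w).choose i * g i ^ 2) =
      ((C.card : ℝ) ^ 2 * n.choose (2 * i)) *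
        (((2 * i).choose i * (n - 2 * i).choose (w - i)) * g i ^ 2) := by
      have := hident i (by omega)
      calc _ = (C.card : ℝ) ^ 2 * ((n.choose w : ℝ) * (w.choose i * (n - w).choose i)) * g i ^ 2 := by
            ring
        _ = _ := by rw [this]; ring
    have e2 : 2 ^ (n + 1) * ((i₁ : ℝ) + 1) ^ 2 * (pairCount C i *
            ((2 * i).choose i * (n - 2 * i).choose (w - i)) * g i ^ 2) =
        (2 ^ (n + 1) * ((i₁ : ℝ) + 1) ^ 2 * pairCount C i) *
        (((2 * i).choose i * (n - 2 * i).choose (w - i)) * g i ^ 2) := by ring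
    rw [e1, e2] at hself
    refine (le_of_mul_le_mul_right hself (by positivity)).trans ?_
    exact mul_le_mul_of_nonneg_right hfac (Nat.cast_nonneg _)
  have hpc : 0 < pairCount C i := by
    have h1 : (0:ℝ) < n.choose (2 * i) := by exact_mod_cast Nat.choose_pos (by omega : 2 * i ≤ n)
    have h2 : (0:ℝ) < 2 ^ (n + 1) * ((n : ℝ) + 1) ^ 2 * pairCount C i :=
      lt_of_lt_of_le (by positivity) hself'
    have h3 := pos_of_mul_pos_right h2 (by positivity)
    exact_mod_cast h3
  refine ⟨i, hi1, hii₁.trans hi₁m, hpc, ?_⟩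
  by_cases hi : i ≤ i₀
  swap
  · exact Or.inr ⟨by omega, hself'⟩
  refine Or.inl ⟨hi, ?_⟩
  have hgr : ∀ j, j + i ≤ i₀ → g i ≤ r ^ j * g (i + j) := by
    intro j
    induction j with
    | zero => intro _; simp
    | succ j ih =>
      intro hj
      refine (ih (by omega)).trans ?_
      rw [pow_succ, mul_assoc]
      refine mul_le_mul_of_nonneg_left ?_ (by positivity)
      rw [hg, hg, Finset.mul_sum]
      refine Finset.sum_le_sum fun k hk => ?_
      have := (hgrow k (by have := Finset.mem_range.1 hk; omega) (i + j) (by omega)).2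
      rw [mul_left_comm, ← add_assoc]
      exact mul_le_mul_of_nonneg_left this (hc k)
  have hg0 := hgr (i₀ - i) (by omega)
  rw [Nat.add_sub_cancel' hi] at hg0
  have hg0pos : 0 < g i₀ := pos_of_mul_pos_right (lt_of_lt_of_le hgpos hg0) (by positivity)
  have hm0 := hmain i₀ hi₀.le
  have hsq : g i ^ 2 ≤ r ^ (2 * (i₀ - i)) * g i₀ ^ 2 := by
    have := pow_le_pow_left₀ hgpos.le hg0 2
    rwa [mul_pow, ← pow_mul, mul_comm (i₀ - i) 2] at this
  have e1 : (n.choose w : ℝ) * (C.card : ℝ) ^ 2 * (w.choose i₀ * (n - w).choose i₀ * g i₀ ^ 2) =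
      ((C.card : ℝ) ^ 2 * (n.choose (2 * i₀) *
          ((2 * i₀).choose i₀ * (n - 2 * i₀).choose (w - i₀)))) * g i₀ ^ 2 := by
    rw [← hident i₀ hi₀.le]; ring
  rw [e1] at hm0
  refine le_of_mul_le_mul_right (hm0.trans ?_) (by positivity : 0 < g i₀ ^ 2)
  calc 2 ^ (n + 1) * ((i₁ : ℝ) + 1) ^ 2 * (pairCount C i *
            ((2 * i).choose i * (n - 2 * i).choose (w - i)) * g i ^ 2)
      ≤ 2 ^ (n + 1) * ((n : ℝ) + 1) ^ 2 * (pairCount C i *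
            ((2 * i).choose i * (n - 2 * i).choose (w - i)) * (r ^ (2 * (i₀ - i)) * g i₀ ^ 2)) := by
        gcongr
    _ = _ := by ring

theorem tendsto_floor_mul_div {a : ℝ} (ha : 0 ≤ a) :
    Tendsto (fun n : ℕ => (⌊a * n⌋₊ : ℝ) / n) atTop (nhds a) :=
  (tendsto_nat_floor_mul_div_atTop ha).comp tendsto_natCast_atTop_atTop

theorem tendsto_floor_mul_add_div {a : ℝ} (ha : 0 ≤ a) (j : ℕ) :
    Tendsto (fun n : ℕ => ((⌊a * n⌋₊ + j : ℕ) : ℝ) / n) atTop (nhds a) := by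
  have h1 : Tendsto (fun n : ℕ => (j : ℝ) / n) atTop (nhds 0) :=
    tendsto_const_div_atTop_nhds_zero_nat _
  have := (tendsto_floor_mul_div ha).add h1
  rw [add_zero] at this
  refine this.congr fun n => ?_
  push_cast; ring

theorem growth_rate_lt {α β s b₀ : ℝ} (hs : 0 < s) (hb₀ : 0 < b₀) (hb : b₀ < β) (hβ : β < 1 / 2)
    (h : β * (1 + 2 * s) = α * (1 - α) - s ^ 2) :
    s ^ 2 < ((1 + s / β) - 1) * ((α - b₀) * (1 - α - b₀) / (1 + s / β) - b₀ ^ 2) := by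
  have hβ0 : 0 < β := hb₀.trans hb
  have e1 : (1 + s / β) - 1 = s / β := by ring
  have e2 : (1 + s / β) = (β + s) / β := by field_simp
  have h1 : (β + s) ^ 2 < (α - b₀) * (1 - α - b₀) := by
    have : (α - b₀) * (1 - α - b₀) - (β + s) ^ 2 = (β - b₀) * (1 - b₀ - β) := by linear_combination -h
    have h3 : 0 < (β - b₀) * (1 - b₀ - β) := mul_pos (by linarith) (by linarith)
    linarith
  have h2 : b₀ ^ 2 < β ^ 2 := by nlinarith
  rw [e1, e2, div_div_eq_mul_div]
  have h3 : (β + s) * β < (α - b₀) * (1 - α - b₀) * β / (β + s) := by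
    rw [lt_div_iff₀ (by linarith)]
    nlinarith
  have h4 : s / β * ((β + s) * β - β ^ 2) = s ^ 2 := by field_simp; ring
  rw [← h4]
  exact mul_lt_mul_of_pos_left (by linarith) (div_pos hs hβ0)

theorem oscillation_discriminant {α β s e : ℝ}
    (h : β * (1 + 2 * s) = α * (1 - α) - s ^ 2) :
    4 * ((α - (β + e)) * (1 - α - (β + e))) * (β + e) ^ 2 -
      ((α - (β + e)) * (1 - α - (β + e)) + (β + e) ^ 2 - s ^ 2) ^ 2 =
      (1 + 2 * s) * e * (4 * (β + e) * s - (1 + 2 * s) * e) := by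
  have h' : α * (1 - α) = β * (1 + 2 * s) + s ^ 2 := by linarith
  have e1 : (α - (β + e)) * (1 - α - (β + e)) =
      β * (1 + 2 * s) + s ^ 2 - (β + e) + (β + e) ^ 2 := by
    rw [← h']; ring
  rw [e1]; ring

theorem eventually_growth {α τ β b₀ s : ℝ} (hα : 0 < α) (hτ : 0 ≤ τ) (hs : 0 < s)
    (hs2 : s ^ 2 = τ * (1 - τ)) (hb₀ : 0 < b₀) (hb : b₀ < β) (hβ : β < 1 / 2)
    (h : β * (1 + 2 * s) = α * (1 - α) - s ^ 2) :
    ∀ᶠ n : ℕ in atTop, (⌊τ * n⌋₊ : ℝ) * (n + 1 - ⌊τ * n⌋₊) ≤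
      ((1 + s / β) - 1) * (((⌊α * n⌋₊ : ℝ) - ⌊b₀ * n⌋₊) * (n - ⌊α * n⌋₊ - ⌊b₀ * n⌋₊) / (1 + s / β) -
        (⌊b₀ * n⌋₊ : ℝ) ^ 2) := by
  have t1 := tendsto_floor_mul_div hτ
  have t2 := tendsto_floor_mul_div hα.le
  have t3 := tendsto_floor_mul_div hb₀.le
  have t4 : Tendsto (fun n : ℕ => (1 : ℝ) / n) atTop (nhds 0) :=
    tendsto_const_div_atTop_nhds_zero_nat _
  have l1 : Tendsto (fun n : ℕ => (⌊τ * n⌋₊ : ℝ) / n * (1 + 1 / n - (⌊τ * n⌋₊ : ℝ) / n)) atTop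
      (nhds (τ * (1 + 0 - τ))) := t1.mul ((tendsto_const_nhds.add t4).sub t1)
  have l2 : Tendsto (fun n : ℕ => ((1 + s / β) - 1) * (((⌊α * n⌋₊ : ℝ) / n - ⌊b₀ * n⌋₊ / n) *
      (1 - ⌊α * n⌋₊ / n - ⌊b₀ * n⌋₊ / n) / (1 + s / β) - ((⌊b₀ * n⌋₊ : ℝ) / n) ^ 2)) atTop
      (nhds (((1 + s / β) - 1) * ((α - b₀) * (1 - α - b₀) / (1 + s / β) - b₀ ^ 2))) :=
    tendsto_const_nhds.mul ((((t2.sub t3).mul ((tendsto_const_nhds.sub t2).sub t3)).div_const _).sub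
      (t3.pow 2))
  have hlt := growth_rate_lt hs hb₀ hb hβ h
  have e0 : τ * (1 + 0 - τ) = s ^ 2 := by rw [hs2]; ring
  rw [e0] at l1
  filter_upwards [l1.eventually_lt l2 hlt, eventually_gt_atTop 0] with n hn hn0
  have hn' : (0:ℝ) < n := by exact_mod_cast hn0
  have := mul_le_mul_of_nonneg_right hn.le (by positivity : (0:ℝ) ≤ (n:ℝ) ^ 2)
  refine le_trans (le_of_eq ?_) (this.trans (le_of_eq ?_))
  · field_simp
  · field_simp

theorem eventually_exists_hahn_nonpos {α τ β e s : ℝ} (hα : 0 < α) (hα2 : α < 1 / 2) (hτ : 0 ≤ τ)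
    (hτα : τ < α) (hs : 0 < s) (hs2 : s ^ 2 = τ * (1 - τ)) (hβ : 0 < β) (he : 0 < e)
    (hβe : β + e < α) (he' : (1 + 2 * s) * e < 4 * β * s)
    (h : β * (1 + 2 * s) = α * (1 - α) - s ^ 2) :
    ∃ J : ℕ, ∀ᶠ n : ℕ in atTop, ∃ i ≤ ⌊(β + e) * n⌋₊ + J + 1, hahn n ⌊α * n⌋₊ ⌊τ * n⌋₊ i ≤ 0 := by
  set b := (α - (β + e)) * (1 - α - (β + e)) with hb
  have hb0 : 0 < b := mul_pos (by linarith) (by linarith)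
  set P := b + (β + e) ^ 2 - s ^ 2 with hP
  have hdisc : 0 < 4 * b * (β + e) ^ 2 - P ^ 2 := by
    rw [hP, hb, oscillation_discriminant h]
    have : 0 < 4 * (β + e) * s - (1 + 2 * s) * e := by nlinarith
    positivity
  set γ := (4 * b * (β + e) ^ 2 - P ^ 2) / (8 * b ^ 2) with hγ
  have hγ0 : 0 < γ := by positivity
  set A := |P| / b + 1 with hA
  have hA0 : 0 < A := by positivity
  obtain ⟨J, hJ⟩ := exists_nat_ge (A ^ 2 / γ)
  refine ⟨J, ?_⟩
  have t1 := tendsto_floor_mul_div hτ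
  have t2 := tendsto_floor_mul_div hα.le
  have t4 : Tendsto (fun n : ℕ => (1 : ℝ) / n) atTop (nhds 0) :=
    tendsto_const_div_atTop_nhds_zero_nat _
  have tK : Tendsto (fun n : ℕ => (⌊τ * n⌋₊ : ℝ) / n * (1 + 1 / n - (⌊τ * n⌋₊ : ℝ) / n)) atTop
      (nhds (s ^ 2)) := by
    have := t1.mul ((tendsto_const_nhds (x := (1:ℝ)).add t4).sub t1)
    have e0 : τ * (1 + 0 - τ) = s ^ 2 := by rw [hs2]; ring
    rwa [e0] at this
  have key : ∀ j ∈ Finset.range (J + 1), ∀ᶠ n : ℕ in atTop,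
      (⌊(β + e) * n⌋₊ + j < ⌊α * n⌋₊) ∧
      (((⌊α * n⌋₊ : ℝ) - (⌊(β + e) * n⌋₊ + j : ℕ)) * (n - ⌊α * n⌋₊ - (⌊(β + e) * n⌋₊ + j : ℕ)) +
        ((⌊(β + e) * n⌋₊ + j : ℕ) : ℝ) ^ 2 - ⌊τ * n⌋₊ * (n + 1 - ⌊τ * n⌋₊) ≤
        A * (((⌊α * n⌋₊ : ℝ) - (⌊(β + e) * n⌋₊ + j : ℕ)) *
          (n - ⌊α * n⌋₊ - (⌊(β + e) * n⌋₊ + j : ℕ)))) ∧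
      (4 * γ * (((⌊α * n⌋₊ : ℝ) - (⌊(β + e) * n⌋₊ + j : ℕ)) *
          (n - ⌊α * n⌋₊ - (⌊(β + e) * n⌋₊ + j : ℕ))) ^ 2 ≤
        4 * (((⌊α * n⌋₊ : ℝ) - (⌊(β + e) * n⌋₊ + j : ℕ)) *
          (n - ⌊α * n⌋₊ - (⌊(β + e) * n⌋₊ + j : ℕ))) * ((⌊(β + e) * n⌋₊ + j : ℕ) : ℝ) ^ 2 -
        (((⌊α * n⌋₊ : ℝ) - (⌊(β + e) * n⌋₊ + j : ℕ)) * (n - ⌊α * n⌋₊ - (⌊(β + e) * n⌋₊ + j : ℕ)) +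
        ((⌊(β + e) * n⌋₊ + j : ℕ) : ℝ) ^ 2 - ⌊τ * n⌋₊ * (n + 1 - ⌊τ * n⌋₊)) ^ 2) := by
    intro j _
    have t3 := tendsto_floor_mul_add_div (by positivity : 0 ≤ β + e) j
    have tb : Tendsto (fun n : ℕ => ((⌊α * n⌋₊ : ℝ) / n - ((⌊(β + e) * n⌋₊ + j : ℕ) : ℝ) / n) *
        (1 - ⌊α * n⌋₊ / n - ((⌊(β + e) * n⌋₊ + j : ℕ) : ℝ) / n)) atTop (nhds b) :=
      (t2.sub t3).mul ((tendsto_const_nhds.sub t2).sub t3)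
    have tP := (tb.add (t3.pow 2)).sub tK
    have c1 : P < A * b := by
      have : A * b = |P| + b := by rw [hA]; field_simp
      rw [this]; linarith [le_abs_self P]
    have c2 : 4 * γ * b ^ 2 < 4 * b * (β + e) ^ 2 - P ^ 2 := by
      have : 4 * γ * b ^ 2 = (4 * b * (β + e) ^ 2 - P ^ 2) / 2 := by rw [hγ]; field_simp; norm_num
      rw [this]; linarith
    have l1 := tP.eventually_lt (tb.const_mul A) c1
    have l2 := ((tb.pow 2).const_mul (4 * γ)).eventually_lt
      (((tb.const_mul 4).mul (t3.pow 2)).sub (tP.pow 2)) c2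
    filter_upwards [l1, l2, t3.eventually_lt t2 hβe, eventually_gt_atTop 0] with n h1 h2 h3 hn0
    have hn' : (0:ℝ) < n := by exact_mod_cast hn0
    refine ⟨?_, ?_, ?_⟩
    · rw [div_lt_div_iff_of_pos_right hn'] at h3
      exact_mod_cast h3
    · have := mul_le_mul_of_nonneg_right h1.le (by positivity : (0:ℝ) ≤ (n:ℝ) ^ 2)
      refine le_trans (le_of_eq ?_) (this.trans (le_of_eq ?_))
      · field_simp
      · field_simp
    · have := mul_le_mul_of_nonneg_right h2.le (by positivity : (0:ℝ) ≤ (n:ℝ) ^ 4)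
      refine le_trans (le_of_eq ?_) (this.trans (le_of_eq ?_))
      · field_simp
      · field_simp
  have key2 := (Finset.eventually_all (Finset.range (J + 1))).2 key
  filter_upwards [key2] with n hn
  have hw : 2 * ⌊α * n⌋₊ ≤ n := by
    have h1 := Nat.floor_le (by positivity : 0 ≤ α * n)
    have h2 : (2 * ⌊α * n⌋₊ : ℝ) ≤ n := by
      have : (0:ℝ) ≤ n := Nat.cast_nonneg n
      nlinarith
    exact_mod_cast h2
  have hT : ⌊τ * n⌋₊ ≤ ⌊α * n⌋₊ := Nat.floor_le_floor (by gcongr)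
  refine exists_hahn_nonpos hw hT hA0 hγ0 (by rwa [div_le_iff₀ hγ0] at hJ)
    (hn J (by simp)).1 ?_ ?_
  · intro i h1 h2
    obtain ⟨j, rfl⟩ := Nat.exists_eq_add_of_le h1
    exact (hn j (by simp; omega)).2.1
  · intro i h1 h2
    obtain ⟨j, rfl⟩ := Nat.exists_eq_add_of_le h1
    exact (hn j (by simp; omega)).2.2

/-- Derivative of the natural-logarithm binary entropy. -/
noncomputable def entSlope (x : ℝ) : ℝ := Real.log (1 - x) - Real.log x

theorem tendsto_log_succ_div : Tendsto (fun n : ℕ => Real.log (n + 1) / n) atTop (nhds 0) := by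
  have h := (Real.isLittleO_log_id_atTop).tendsto_div_nhds_zero
  have h1 : Tendsto (fun n : ℕ => (n : ℝ) + 1) atTop atTop :=
    tendsto_atTop_add_const_right _ _ tendsto_natCast_atTop_atTop
  have h2 := h.comp h1
  have h3 : Tendsto (fun n : ℕ => ((n : ℝ) + 1) / n) atTop (nhds 1) := by
    have t4 : Tendsto (fun n : ℕ => (1 : ℝ) / n) atTop (nhds 0) :=
      tendsto_const_div_atTop_nhds_zero_nat _
    have := (tendsto_const_nhds (x := (1:ℝ))).add t4
    rw [add_zero] at this
    refine this.congr' ?_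
    filter_upwards [eventually_gt_atTop 0] with n hn
    have hn' : (0:ℝ) < n := by exact_mod_cast hn
    field_simp
  have h4 := h2.mul h3
  rw [zero_mul] at h4
  refine h4.congr' ?_
  filter_upwards [eventually_gt_atTop 0] with n hn
  have hn' : (0:ℝ) < n := by exact_mod_cast hn
  simp only [Function.comp, id]
  field_simp

theorem phi_div {n k : ℝ} (hn : n ≠ 0) : phi n k / n = Real.binEntropy (k / n) := by
  rw [phi]; field_simp

theorem exp_phi_le_succ_mul_choose {n m k : ℕ} (hmn : m ≤ n) (hk : k ≤ m) :
    Real.exp (phi m k) ≤ (n + 1) * (m.choose k : ℝ) :=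
  (exp_phi_le_choose m k hk).trans (by
    have : (m : ℝ) ≤ n := by exact_mod_cast hmn
    gcongr)

theorem sum_choose_le {n T : ℕ} (hT : 2 * T ≤ n) :
    (∑ j ∈ range (T + 1), (n.choose j : ℝ)) ≤ (n + 1) * Real.exp (phi n T) := by
  have h1 : ∀ j ∈ range (T + 1), (n.choose j : ℝ) ≤ Real.exp (phi n T) := by
    intro j hj
    have hj' : j ≤ T := by have := Finset.mem_range.1 hj; omega
    refine (choose_le_exp_phi n j (by omega)).trans (Real.exp_le_exp.2 ?_)
    refine phi_mono_right (Nat.cast_nonneg _) (by exact_mod_cast hj') ?_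
    have : (T : ℝ) + j ≤ n := by exact_mod_cast (by omega : T + j ≤ n)
    linarith
  refine (Finset.sum_le_sum h1).trans ?_
  rw [Finset.sum_const, Finset.card_range, nsmul_eq_mul]
  have : ((T + 1 : ℕ) : ℝ) ≤ n + 1 := by exact_mod_cast (by omega : T + 1 ≤ n + 1)
  gcongr

theorem eventually_size {α τ R : ℝ} (hα : 0 < α) (hα2 : α < 1 / 2) (hτ : 0 ≤ τ) (hτ2 : τ ≤ 1 / 2)
    (hR : Real.log 2 - Real.binEntropy α + Real.binEntropy τ < R) :
    ∀ᶠ n : ℕ in atTop, 2 * ((n : ℝ) + 1) *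
      (∑ j ∈ range (⌊τ * n⌋₊ + 1), (n.choose j : ℝ)) * 2 ^ n ≤
      Real.exp (R * n) * n.choose ⌊α * n⌋₊ := by
  have t1 := (Real.binEntropy_continuous.tendsto τ).comp (tendsto_floor_mul_div hτ)
  have t2 := (Real.binEntropy_continuous.tendsto α).comp (tendsto_floor_mul_div hα.le)
  have t3 : Tendsto (fun n : ℕ => (Real.log 2 : ℝ) / n) atTop (nhds 0) :=
    tendsto_const_div_atTop_nhds_zero_nat _
  have l1 := (((t3.add (tendsto_log_succ_div.const_mul 3)).add_const (Real.log 2)).sub t2).add t1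
  have := l1.eventually_lt_const (u := R) (by linarith)
  filter_upwards [this, eventually_gt_atTop 0] with n hn hn0
  have hn' : (0:ℝ) < n := by exact_mod_cast hn0
  have hT : 2 * ⌊τ * n⌋₊ ≤ n := by
    have h1 := Nat.floor_le (by positivity : 0 ≤ τ * n)
    have h2 : (2 * ⌊τ * n⌋₊ : ℝ) ≤ n := by nlinarith
    exact_mod_cast h2
  have hw : ⌊α * n⌋₊ ≤ n := by
    have h1 := Nat.floor_le (by positivity : 0 ≤ α * n)
    have h2 : (⌊α * n⌋₊ : ℝ) ≤ n := by nlinarith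
    exact_mod_cast h2
  simp only [Function.comp, ← phi_div hn'.ne'] at hn
  have h1 := mul_lt_mul_of_pos_right hn hn'
  have h2 : (Real.log 2 / n + 3 * (Real.log (n + 1) / n) + Real.log 2 - phi n ⌊α * n⌋₊ / n +
      phi n ⌊τ * n⌋₊ / n) * n = Real.log 2 + 3 * Real.log (n + 1) + n * Real.log 2 -
        phi n ⌊α * n⌋₊ + phi n ⌊τ * n⌋₊ := by field_simp
  rw [h2] at h1
  have h3 := exp_phi_le_choose n ⌊α * n⌋₊ hw
  have h4 := sum_choose_le hT
  have e1 : Real.exp (Real.log 2 + 3 * Real.log (n + 1) + n * Real.log 2 + phi n ⌊τ * n⌋₊) =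
      2 * ((n:ℝ) + 1) ^ 3 * 2 ^ n * Real.exp (phi n ⌊τ * n⌋₊) := by
    rw [Real.exp_add, Real.exp_add, Real.exp_add, Real.exp_log two_pos, Real.exp_nat_mul,
      Real.exp_log two_pos, show 3 * Real.log ((n:ℝ) + 1) = (3:ℕ) * Real.log ((n:ℝ) + 1) by norm_num,
      Real.exp_nat_mul, Real.exp_log (by positivity)]
  have e2 : Real.exp (Real.log 2 + 3 * Real.log (n + 1) + n * Real.log 2 + phi n ⌊τ * n⌋₊) ≤
      Real.exp (R * n) * Real.exp (phi n ⌊α * n⌋₊) := by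
    rw [← Real.exp_add]; exact Real.exp_le_exp.2 (by linarith)
  rw [e1] at e2
  have e3 : 2 * ((n : ℝ) + 1) * (∑ j ∈ range (⌊τ * n⌋₊ + 1), (n.choose j : ℝ)) * 2 ^ n * (n + 1) ≤
      2 * ((n:ℝ) + 1) ^ 3 * 2 ^ n * Real.exp (phi n ⌊τ * n⌋₊) := by
    calc _ ≤ 2 * ((n : ℝ) + 1) * ((n + 1) * Real.exp (phi n ⌊τ * n⌋₊)) * 2 ^ n * (n + 1) := by gcongr
      _ = _ := by ring
  have e4 : Real.exp (R * n) * Real.exp (phi n ⌊α * n⌋₊) ≤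
      Real.exp (R * n) * n.choose ⌊α * n⌋₊ * (n + 1) := by
    calc _ ≤ Real.exp (R * n) * ((n + 1) * n.choose ⌊α * n⌋₊) := by gcongr
      _ = _ := by ring
  exact le_of_mul_le_mul_right (e3.trans (e2.trans e4)) (by positivity)

theorem exp_two_pow_mul (n : ℕ) (a : ℕ) : (2:ℝ) ^ (n + 1) * ((n : ℝ) + 1) ^ a =
    Real.exp (n * Real.log 2 + Real.log 2 + a * Real.log (n + 1)) := by
  rw [Real.exp_add, Real.exp_add, Real.exp_nat_mul, Real.exp_nat_mul, Real.exp_log two_pos,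
    Real.exp_log (by positivity), pow_succ]

theorem pairs_lower_of_le {n w i i₀ : ℕ} {r ρ M c : ℝ} (hr : 0 < r) (hρ : 0 < ρ) (hρ1 : ρ < 1)
    (hw : 2 * w ≤ n) (hi₀ : i₀ < w) (hi : i ≤ i₀) (hM : 0 ≤ M) (hc : 0 < c)
    (h : c ^ 2 * (n.choose (2 * i₀) * ((2 * i₀).choose i₀ * (n - 2 * i₀).choose (w - i₀))) ≤
          2 ^ (n + 1) * ((n : ℝ) + 1) ^ 2 * (M *
            ((2 * i).choose i * (n - 2 * i).choose (w - i)) * r ^ (2 * (i₀ - i)))) :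
    c ^ 2 * Real.exp (phi n (2 * i₀) + 2 * i₀ * Real.log 2 + phi (n - 2 * i₀) (w - i₀)
      - (2 * i * Real.log 2 + ((w - i) * (-Real.log ρ) + (n - w - i) * (-Real.log (1 - ρ))) +
        2 * (i₀ - i) * Real.log r)
      - (n * Real.log 2 + Real.log 2 + 5 * Real.log (n + 1))) ≤ M := by
  have a1 := exp_phi_le_succ_mul_choose (n := n) (m := n) (k := 2 * i₀) le_rfl (by omega)
  have a2 := exp_phi_le_succ_mul_choose (n := n) (m := 2 * i₀) (k := i₀) (by omega) (by omega)
  have a3 := exp_phi_le_succ_mul_choose (n := n) (m := n - 2 * i₀) (k := w - i₀) (by omega) (by omega)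
  have b1 := choose_le_exp_phi (2 * i) i (by omega)
  have b2 := choose_le_exp_phi (n - 2 * i) (w - i) (by omega)
  rw [Nat.cast_sub (by omega), Nat.cast_sub (by omega)] at a3 b2
  push_cast at a1 a2 a3 b1 b2
  have c1 : phi (2 * (i₀ : ℝ)) i₀ = 2 * i₀ * Real.log 2 := by
    rw [phi]
    rcases Nat.eq_zero_or_pos i₀ with h0 | h0
    · simp [h0]
    · have : (0:ℝ) < i₀ := by exact_mod_cast h0
      rw [show (i₀ : ℝ) / (2 * i₀) = 2⁻¹ by field_simp, Real.binEntropy_two_inv]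
  have c2 := b1.trans (Real.exp_le_exp.2 (phi_le_log_two (m := 2 * (i : ℝ)) (k := i) (by positivity)))
  have c3 := b2.trans (Real.exp_le_exp.2 (phi_le_cross (m := (n:ℝ) - 2 * i) (k := (w:ℝ) - i) (r := ρ)
    (by have : (i:ℝ) ≤ w := by exact_mod_cast (by omega : i ≤ w)
        linarith)
    (by have : (w:ℝ) + i ≤ n := by exact_mod_cast (by omega : w + i ≤ n)
        linarith) hρ hρ1))
  rw [c1] at a2
  have hrp : r ^ (2 * (i₀ - i)) = Real.exp (2 * ((i₀:ℝ) - i) * Real.log r) := by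
    rw [← Nat.cast_sub hi, show 2 * ((i₀ - i : ℕ) : ℝ) = ((2 * (i₀ - i) : ℕ) : ℝ) by push_cast; ring,
      Real.exp_nat_mul, Real.exp_log hr]
  rw [hrp] at h
  set E1 := Real.exp (phi n (2 * i₀))
  set E2 := Real.exp (2 * i₀ * Real.log 2)
  set E3 := Real.exp (phi (n - 2 * i₀) (w - i₀))
  have l1 : c ^ 2 * (E1 * (E2 * E3)) ≤ (n + 1) ^ 3 *
      (c ^ 2 * (n.choose (2 * i₀) * ((2 * i₀).choose i₀ * (n - 2 * i₀).choose (w - i₀)))) := by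
    calc c ^ 2 * (E1 * (E2 * E3)) ≤ c ^ 2 * (((n + 1) * n.choose (2 * i₀)) *
          (((n + 1) * (2 * i₀).choose i₀) * ((n + 1) * (n - 2 * i₀).choose (w - i₀)))) := by
          gcongr
      _ = _ := by ring
  have l2 : (n + 1 : ℝ) ^ 3 * (2 ^ (n + 1) * ((n : ℝ) + 1) ^ 2 * (M *
            ((2 * i).choose i * (n - 2 * i).choose (w - i)) *
              Real.exp (2 * ((i₀:ℝ) - i) * Real.log r))) ≤
      M * (Real.exp (n * Real.log 2 + Real.log 2 + 5 * Real.log (n + 1)) *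
        (Real.exp (2 * i * Real.log 2) * Real.exp ((w - i) * (-Real.log ρ) +
          (n - 2 * i - (w - i)) * (-Real.log (1 - ρ))) *
          Real.exp (2 * ((i₀:ℝ) - i) * Real.log r))) := by
    have := exp_two_pow_mul n 5
    push_cast at this
    rw [← this]
    calc _ = M * (2 ^ (n + 1) * (n + 1) ^ 5 * (((2 * i).choose i * (n - 2 * i).choose (w - i)) *
              Real.exp (2 * ((i₀:ℝ) - i) * Real.log r))) := by ring
      _ ≤ _ := by gcongr
  have l3 := l1.trans ((mul_le_mul_of_nonneg_left h (by positivity)).trans l2)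
  rw [Real.exp_sub, Real.exp_sub, Real.exp_add, Real.exp_add, div_div, mul_div_assoc',
    div_le_iff₀ (by positivity)]
  refine le_trans (le_of_eq ?_) (l3.trans (le_of_eq ?_))
  · ring
  · rw [← Real.exp_add, ← Real.exp_add, ← Real.exp_add, ← Real.exp_add]
    congr 2; ring

theorem pairs_lower_of_gt {n i : ℕ} {M c : ℝ} (hi : 2 * i ≤ n) (hc : 0 < c)
    (h : c ^ 2 * n.choose (2 * i) ≤ 2 ^ (n + 1) * ((n : ℝ) + 1) ^ 2 * M) :
    c ^ 2 * Real.exp (phi n (2 * i) - (n * Real.log 2 + Real.log 2 + 3 * Real.log (n + 1))) ≤ M := by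
  have a1 := exp_phi_le_choose n (2 * i) hi
  have e := exp_two_pow_mul n 3
  push_cast at e a1
  rw [Real.exp_sub, ← e, mul_div_assoc', div_le_iff₀ (by positivity)]
  calc c ^ 2 * Real.exp (phi n (2 * i)) ≤ c ^ 2 * ((n + 1) * n.choose (2 * i)) := by gcongr
    _ = (n + 1) * (c ^ 2 * n.choose (2 * i)) := by ring
    _ ≤ (n + 1) * (2 ^ (n + 1) * ((n : ℝ) + 1) ^ 2 * M) := by gcongr
    _ = _ := by ring

set_option maxHeartbeats 1600000 in
theorem exists_many_pairs {α τ R ε : ℝ} (hτ : 0 < τ) (hτα : τ < α) (hα2 : α < 1 / 2)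
    (hR : Real.log 2 - Real.binEntropy α + Real.binEntropy τ < R) (hε : 0 < ε) :
    ∃ N : ℕ, ∀ n ≥ N, ∀ C : Finset (Fin n → Bool), Real.exp (R * n) ≤ C.card →
      ∃ i : ℕ, 1 ≤ i ∧ 2 * (i : ℝ) ≤ (Gfun α τ + ε) * n ∧ 0 < pairCount C i ∧
        (C.card : ℝ) * Real.exp (n * (R - Real.log 2 + Real.binEntropy (Gfun α τ) - ε) +
          entSlope (Gfun α τ) * (2 * i - Gfun α τ * n)) ≤ pairCount C i := by
  have hα : 0 < α := hτ.trans hτα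
  obtain ⟨s, hs, hs2, hsd⟩ : ∃ s : ℝ, 0 < s ∧ s ^ 2 = τ * (1 - τ) ∧ s = Real.sqrt (τ * (1 - τ)) :=
    ⟨_, Real.sqrt_pos.2 (mul_pos hτ (by linarith)),
      Real.sq_sqrt (mul_nonneg hτ.le (by linarith)), rfl⟩
  obtain ⟨β, hβd⟩ : ∃ β, Gfun α τ = 2 * β := ⟨Gfun α τ / 2, by ring⟩
  rw [hβd]
  have hβ : β * (1 + 2 * s) = α * (1 - α) - s ^ 2 := by
    have : 2 * β * (1 + 2 * s) = 2 * (α * (1 - α) - τ * (1 - τ)) := by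
      rw [← hβd, Gfun, ← hsd]; field_simp
    rw [hs2]; linarith
  have hpos : 0 < α * (1 - α) - s ^ 2 := by
    rw [hs2]
    have : α * (1 - α) - τ * (1 - τ) = (α - τ) * (1 - α - τ) := by ring
    rw [this]; exact mul_pos (by linarith) (by linarith)
  have hβ0 : 0 < β := by
    rw [← hβ] at hpos; exact pos_of_mul_pos_left hpos (by linarith)
  have hβα : β < α * (1 - α) := by nlinarith
  have hβα' : β < α := by nlinarith
  have hβ4 : β < 1 / 4 := by nlinarith [sq_nonneg (α - 1 / 2)]
  set ρ := (α - β) / (1 - 2 * β) with hρ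
  have hρ0 : 0 < ρ := div_pos (by linarith) (by linarith)
  have hρ1 : ρ < 1 := by rw [hρ, div_lt_one (by linarith)]; linarith
  set r := 1 + s / β with hr
  have hr1 : 1 ≤ r := by have := div_pos hs hβ0; rw [hr]; linarith
  have hr0 : 0 < r := by linarith
  have hd0 : 0 < entSlope (2 * β) := by
    rw [entSlope]
    have := Real.log_lt_log (by linarith : 0 < 2 * β) (by linarith : 2 * β < 1 - 2 * β)
    linarith
  set d := entSlope (2 * β) with hd
  have hslope : 2 * Real.log 2 + Real.log ρ + Real.log (1 - ρ) - 2 * Real.log r = -2 * d := by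
    have e1 : (2 * (2 * β)) ^ 2 * (ρ * (1 - ρ)) * (1 - 2 * β) ^ 2 = (2 * (2 * β) * (r * β)) ^ 2 := by
      have hne : (1 - 2 * β) ≠ 0 := by linarith
      have h1 : 1 - ρ = (1 - α - β) / (1 - 2 * β) := by
        rw [hρ, one_sub_div hne]; congr 1; ring
      have h2 : r * β = β + s := by rw [hr]; field_simp
      have h3 : ρ * (1 - ρ) * (1 - 2 * β) ^ 2 = (β + s) ^ 2 := by
        have : ρ * (1 - ρ) * (1 - 2 * β) ^ 2 = (α - β) * (1 - α - β) := by
          rw [h1, hρ, div_mul_div_comm, ← pow_two, div_mul_cancel₀ _ (pow_ne_zero 2 hne)]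
        rw [this]; linear_combination -hβ
      rw [h2]
      linear_combination (2 * (2 * β)) ^ 2 * h3
    have e2 : 4 * (ρ * (1 - ρ)) * (1 - 2 * β) ^ 2 = r ^ 2 * (2 * β) ^ 2 := by
      have : (2 * β) ^ 2 * (4 * (ρ * (1 - ρ)) * (1 - 2 * β) ^ 2) =
        (2 * β) ^ 2 * (r ^ 2 * (2 * β) ^ 2) := by linear_combination e1
      exact mul_left_cancel₀ (by positivity) this
    have h1ρ : 0 < 1 - ρ := by linarith
    have h2β : 0 < 1 - 2 * β := by linarith
    have e3 := congrArg Real.log e2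
    rw [Real.log_mul (by positivity) (by positivity), Real.log_mul (by norm_num) (by positivity),
      Real.log_mul (by positivity) (by positivity), Real.log_mul (by positivity) (by positivity),
      Real.log_pow, Real.log_pow, Real.log_pow, show (4:ℝ) = 2 ^ 2 by norm_num, Real.log_pow] at e3
    push_cast at e3
    rw [hd, entSlope]
    linarith
  -- choice of the slack
  have hcH := Real.binEntropy_continuous
  have hcross : (1 - 2 * β) * Real.binEntropy ρ =
      (α - β) * (-Real.log ρ) + (1 - α - β) * (-Real.log (1 - ρ)) := by
    rw [Real.binEntropy, Real.log_inv, Real.log_inv]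
    have h1 : (1 - 2 * β) * ρ = α - β := by rw [hρ]; field_simp [show (1 - 2 * β) ≠ 0 by linarith]
    linear_combination (-Real.log ρ + Real.log (1 - ρ)) * h1
  have hev : ∀ᶠ e in nhds (0:ℝ), e < β ∧ β + e < α ∧ β + e < 1 / 4 ∧ 2 * e < ε / 2 ∧
      (1 + 2 * s) * e < 4 * β * s ∧
      0 < Real.binEntropy (2 * (β - e)) + ((1 - 2 * (β - e)) *
        Real.binEntropy ((α - (β - e)) / (1 - 2 * (β - e))) - ((α - (β - e)) * (-Real.log ρ) +
          (1 - α - (β - e)) * (-Real.log (1 - ρ)))) + 2 * d * e - Real.binEntropy (2 * β) + ε ∧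
      0 < Real.binEntropy (2 * (β - e)) - Real.binEntropy (2 * β) - 2 * d * e + ε := by
    have c1 : ContinuousAt (fun e : ℝ => Real.binEntropy (2 * (β - e)) + ((1 - 2 * (β - e)) *
        Real.binEntropy ((α - (β - e)) / (1 - 2 * (β - e))) - ((α - (β - e)) * (-Real.log ρ) +
          (1 - α - (β - e)) * (-Real.log (1 - ρ)))) + 2 * d * e - Real.binEntropy (2 * β) + ε) 0 := by
      have : ContinuousAt (fun e : ℝ => Real.binEntropy ((α - (β - e)) / (1 - 2 * (β - e)))) 0 := by
        refine hcH.continuousAt.comp (ContinuousAt.div (by fun_prop) (by fun_prop) ?_)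
        simp; linarith
      have h2 : Continuous (fun e : ℝ => Real.binEntropy (2 * (β - e))) := by fun_prop
      have := h2.continuousAt (x := 0)
      fun_prop
    have c2 : Continuous (fun e : ℝ => Real.binEntropy (2 * (β - e)) - Real.binEntropy (2 * β) -
        2 * d * e + ε) := by fun_prop
    have v1 : ∀ f : ℝ → ℝ, Continuous f → ∀ v, f 0 < v → ∀ᶠ e in nhds (0:ℝ), f e < v :=
      fun f hf v hv => hf.continuousAt.eventually_lt continuousAt_const hv
    refine (v1 (fun e => e) (by fun_prop) _ hβ0).and ((v1 (fun e => β + e) (by fun_prop) _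
      (by simpa using hβα')).and ((v1 (fun e => β + e) (by fun_prop) _
      (by simpa using hβ4)).and ((v1 (fun e => 2 * e) (by fun_prop) _
      (by simpa using hε)).and ((v1 (fun e => (1 + 2 * s) * e) (by fun_prop) _
      (by simp; positivity)).and (?_)))))
    refine (continuousAt_const.eventually_lt c1 ?_).and
      (continuousAt_const.eventually_lt c2.continuousAt ?_)
    · simp only [sub_zero, mul_zero, add_zero]
      rw [← hρ, hcross]
      linarith
    · simp only [sub_zero, mul_zero]; linarith
  obtain ⟨e, ⟨h1, h2, h2', h3, h4, h5, h6⟩, he⟩ :=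
    ((hev.filter_mono nhdsWithin_le_nhds).and (self_mem_nhdsWithin (a := (0:ℝ)) (s := Set.Ioi 0))).exists
  have he0 : 0 < e := he
  have hb0 : 0 < β - e := by linarith
  obtain ⟨J, hJ⟩ := eventually_exists_hahn_nonpos hα hα2 hτ.le hτα hs hs2 hβ0 he0 h2 h4 hβ
  have hgr := eventually_growth hα hτ.le hs hs2 hb0 (by linarith : β - e < β) (by linarith) hβ
  have hsz := eventually_size hα hα2 hτ.le (by linarith) hR
  have ti := tendsto_floor_mul_div hb0.le
  have tw := tendsto_floor_mul_div hα.le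
  have tm := tendsto_floor_mul_add_div (by positivity : 0 ≤ β + e) (J + 1)
  have tl := tendsto_log_succ_div
  have t2 : Tendsto (fun n : ℕ => (Real.log 2 : ℝ) / n) atTop (nhds 0) :=
    tendsto_const_div_atTop_nhds_zero_nat _
  have l1 : ∀ᶠ n : ℕ in atTop, 0 < Real.binEntropy (2 * (⌊(β - e) * n⌋₊ / n)) +
      ((1 - 2 * (⌊(β - e) * n⌋₊ / n)) *
        Real.binEntropy ((⌊α * n⌋₊ / n - ⌊(β - e) * n⌋₊ / n) / (1 - 2 * (⌊(β - e) * n⌋₊ / n))) -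
        ((⌊α * n⌋₊ / n - ⌊(β - e) * n⌋₊ / n) * (-Real.log ρ) +
          (1 - ⌊α * n⌋₊ / n - ⌊(β - e) * n⌋₊ / n) * (-Real.log (1 - ρ)))) +
      2 * d * (β - ⌊(β - e) * n⌋₊ / n) - Real.binEntropy (2 * β) + ε -
        (Real.log 2 / n + 5 * (Real.log (n + 1) / n)) := by
    have q1 := (hcH.tendsto _).comp (ti.const_mul 2)
    have q2 := ((hcH.tendsto _).comp ((tw.sub ti).div ((tendsto_const_nhds (x := (1:ℝ))).sub
      (ti.const_mul 2)) (by linarith)))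
    have q3 := ((tendsto_const_nhds (x := (1:ℝ))).sub (ti.const_mul 2)).mul q2
    have q4 := ((tw.sub ti).mul_const (-Real.log ρ)).add
      ((((tendsto_const_nhds (x := (1:ℝ))).sub tw).sub ti).mul_const (-Real.log (1 - ρ)))
    have q5 := ((((q1.add (q3.sub q4)).add (((tendsto_const_nhds (x := β)).sub ti).const_mul
      (2 * d))).sub_const (Real.binEntropy (2 * β))).add_const ε).sub (t2.add (tl.const_mul 5))
    refine (tendsto_const_nhds (x := (0:ℝ))).eventually_lt q5 ?_
    rw [show β - (β - e) = e by ring]; linarith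
  have l2 : ∀ᶠ n : ℕ in atTop, 0 < Real.binEntropy (2 * (⌊(β - e) * n⌋₊ / n)) -
      Real.binEntropy (2 * β) - d * (2 * (((⌊(β + e) * n⌋₊ + (J + 1) : ℕ) : ℝ) / n) - 2 * β) + ε -
        (Real.log 2 / n + 3 * (Real.log (n + 1) / n)) := by
    have q1 := (hcH.tendsto _).comp (ti.const_mul 2)
    have q5 := (((q1.sub_const (Real.binEntropy (2 * β))).sub (((tm.const_mul 2).sub_const
      (2 * β)).const_mul d)).add_const ε).sub (t2.add (tl.const_mul 3))
    refine (tendsto_const_nhds (x := (0:ℝ))).eventually_lt q5 ?_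
    linarith
  have l3 := (tm.const_mul 2).eventually_lt_const (u := 2 * β + ε) (by linarith)
  have l4 := tm.eventually_lt tw h2
  have l5 := tm.eventually_lt_const (u := 1 / 4) h2'
  have l6 := ti.eventually_lt tw (by linarith)
  obtain ⟨N, hN⟩ := eventually_atTop.1 (hJ.and (hgr.and (hsz.and (l1.and (l2.and (l3.and (l4.and
    (l5.and (l6.and (eventually_gt_atTop 0))))))))))
  refine ⟨N, fun n hn C hC => ?_⟩
  obtain ⟨hz, hK, hsize, k1, k2, k3, k4, k5, k6, hn0⟩ := hN n hn
  have hn' : (0:ℝ) < n := by exact_mod_cast hn0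
  have hw : 2 * ⌊α * n⌋₊ ≤ n := by
    have h1 := Nat.floor_le (by positivity : 0 ≤ α * n)
    have h3 := mul_le_mul_of_nonneg_right hα2.le hn'.le
    have h2 : (2 * ⌊α * n⌋₊ : ℝ) ≤ n := by linarith
    exact_mod_cast h2
  have hT : ⌊τ * n⌋₊ ≤ ⌊α * n⌋₊ := Nat.floor_le_floor (by gcongr)
  have hm : ⌊(β + e) * n⌋₊ + (J + 1) ≤ ⌊α * n⌋₊ := by
    rw [div_lt_div_iff_of_pos_right hn'] at k4
    exact_mod_cast k4.le
  have hi0w : ⌊(β - e) * n⌋₊ < ⌊α * n⌋₊ := by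
    rw [div_lt_div_iff_of_pos_right hn'] at k6
    exact_mod_cast k6
  have hi0m : ⌊(β - e) * n⌋₊ ≤ ⌊(β + e) * n⌋₊ + (J + 1) := by
    have h0 : (β - e) * n ≤ (β + e) * n := mul_le_mul_of_nonneg_right (by linarith) hn'.le
    have := Nat.floor_le_floor h0
    omega
  have hCpos : (0:ℝ) < C.card := lt_of_lt_of_le (Real.exp_pos _) hC
  have hC0 : 0 < C.card := by exact_mod_cast hCpos
  obtain ⟨i, hi1, him, hpc, hor⟩ := exists_pairs_of_nonpos hw hT hi0w hr1 hm hK hz C hC0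
    (hsize.trans (mul_le_mul_of_nonneg_right hC (Nat.cast_nonneg _)))
  have him' : (i : ℝ) ≤ (⌊(β + e) * n⌋₊ + (J + 1) : ℕ) := by exact_mod_cast him
  refine ⟨i, hi1, ?_, hpc, ?_⟩
  · rw [← mul_div_assoc, div_lt_iff₀ hn'] at k3
    linarith
  have hfin : ∀ X Y : ℝ, X ≤ Y + R * n → (C.card : ℝ) ^ 2 * Real.exp Y ≤ pairCount C i →
      (C.card : ℝ) * Real.exp X ≤ pairCount C i := by
    intro X Y hXY h
    refine le_trans ?_ h
    have : Real.exp X ≤ C.card * Real.exp Y := by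
      calc Real.exp X ≤ Real.exp (Y + R * n) := Real.exp_le_exp.2 hXY
        _ = Real.exp (R * n) * Real.exp Y := by rw [← Real.exp_add]; ring_nf
        _ ≤ _ := by gcongr
    rw [pow_two, mul_assoc]
    exact mul_le_mul_of_nonneg_left this hCpos.le
  have hf0 : 2 * ((⌊(β - e) * n⌋₊ : ℝ) / n) = (2 * ⌊(β - e) * n⌋₊) / n := by ring
  have k1' : 0 < phi n (2 * ⌊(β - e) * n⌋₊) + (phi (n - 2 * ⌊(β - e) * n⌋₊)
      (⌊α * n⌋₊ - ⌊(β - e) * n⌋₊) - ((⌊α * n⌋₊ - ⌊(β - e) * n⌋₊) * (-Real.log ρ) +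
          (n - ⌊α * n⌋₊ - ⌊(β - e) * n⌋₊) * (-Real.log (1 - ρ)))) +
      2 * d * (β * n - ⌊(β - e) * n⌋₊) - n * Real.binEntropy (2 * β) + n * ε -
        (Real.log 2 + 5 * Real.log (n + 1)) := by
    have := mul_pos k1 hn'
    refine lt_of_lt_of_eq this ?_
    rw [phi, phi, hf0]
    have e1 : ((⌊α * n⌋₊ : ℝ) / n - ⌊(β - e) * n⌋₊ / n) / (1 - (2 * ⌊(β - e) * n⌋₊) / n) =
      (⌊α * n⌋₊ - ⌊(β - e) * n⌋₊) / (n - 2 * ⌊(β - e) * n⌋₊) := by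
      rw [← sub_div, one_sub_div hn'.ne', div_div_div_cancel_right₀ hn'.ne']
    rw [e1]
    field_simp
  have k2' : 0 < phi n (2 * ⌊(β - e) * n⌋₊) - n * Real.binEntropy (2 * β) -
      d * (2 * ((⌊(β + e) * n⌋₊ + (J + 1) : ℕ) : ℝ) - 2 * β * n) + n * ε -
        (Real.log 2 + 3 * Real.log (n + 1)) := by
    have := mul_pos k2 hn'
    refine lt_of_lt_of_eq this ?_
    rw [phi, hf0]
    field_simp
  rcases hor with ⟨hi, h⟩ | ⟨hi, h⟩
  · have := pairs_lower_of_le hr0 hρ0 hρ1 hw hi0w hi (Nat.cast_nonneg _) hCpos h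
    refine hfin _ _ ?_ this
    have hx : (⌊(β - e) * n⌋₊ - (i:ℝ)) * (2 * Real.log 2 + Real.log ρ + Real.log (1 - ρ) -
      2 * Real.log r) = (⌊(β - e) * n⌋₊ - (i:ℝ)) * (-2 * d) := by rw [hslope]
    linarith
  · have hin : 2 * i ≤ n := by omega
    have := pairs_lower_of_gt hin hCpos h
    refine hfin _ _ ?_ this
    have hmono : phi n (2 * ⌊(β - e) * n⌋₊) ≤ phi n (2 * i) := by
      refine phi_mono_right (by positivity) (by have : (⌊(β - e) * n⌋₊ : ℝ) ≤ i := by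
                                                  exact_mod_cast hi.le
                                                linarith) ?_
      rw [div_lt_iff₀ hn'] at k5
      have : (⌊(β - e) * n⌋₊ : ℝ) ≤ i := by exact_mod_cast hi.le
      linarith
    have hdm := mul_le_mul_of_nonneg_left him' hd0.le
    linarith

/-- The set of coordinates in which two binary words differ. -/
def diffSet {n : ℕ} (x y : Fin n → Bool) : Finset (Fin n) := univ.filter fun j => x j ≠ y j

theorem card_diffSet {n : ℕ} (x y : Fin n → Bool) : (diffSet x y).card = hammingDist x y := rfl

theorem diffSet_injective {n : ℕ} (x : Fin n → Bool) : Function.Injective (diffSet x) := by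
  intro y y' h
  funext j
  have := congrArg (fun s => j ∈ s) h
  simp only [diffSet, mem_filter, mem_univ, true_and, ne_eq, eq_iff_iff] at this
  revert this
  cases x j <;> cases y j <;> cases y' j <;> simp

theorem diffSet_symmDiff {n : ℕ} (x x' y : Fin n → Bool) :
    diffSet x' y = symmDiff (diffSet x x') (diffSet x y) := by
  ext j
  simp only [diffSet, mem_symmDiff, mem_filter, mem_univ, true_and]
  cases x j <;> cases x' j <;> cases y j <;> simp

theorem diffSet_surjective {n : ℕ} (x : Fin n → Bool) (e : Finset (Fin n)) :
    ∃ y, diffSet x y = e := by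
  refine ⟨fun j => if j ∈ e then !(x j) else x j, ?_⟩
  ext j
  simp only [diffSet, mem_filter, mem_univ, true_and]
  split_ifs with h <;> simp [h]

theorem card_symmDiff_add {α : Type*} [DecidableEq α] (A B : Finset α) :
    (symmDiff A B).card + 2 * (A ∩ B).card = A.card + B.card := by
  have h1 := card_sdiff_add_card_inter A B
  have h2 := card_sdiff_add_card_inter B A
  have h3 : (symmDiff A B).card = (A \ B).card + (B \ A).card := by
    rw [symmDiff_def, sup_eq_union, card_union_of_disjoint disjoint_sdiff_sdiff]
  rw [inter_comm B A] at h2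
  omega

/-- Words at distance `r` from both `x` and `x'`. -/
def equidistant {n : ℕ} (r : ℕ) (x x' : Fin n → Bool) : Finset (Fin n → Bool) :=
  univ.filter fun y => hammingDist x y = r ∧ hammingDist x' y = r

theorem card_inter_of_mem_equidistant {n i k : ℕ} {x x' y : Fin n → Bool}
    (hd : hammingDist x x' = 2 * i) (hy : y ∈ equidistant (i + k) x x') :
    (diffSet x x' ∩ diffSet x y).card = i ∧ (diffSet x y).card = i + k := by
  simp only [equidistant, mem_filter, mem_univ, true_and] at hy
  have h := card_symmDiff_add (diffSet x x') (diffSet x y)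
  rw [← diffSet_symmDiff, card_diffSet, card_diffSet, card_diffSet, hy.1, hy.2, hd] at h
  exact ⟨by omega, by rw [card_diffSet, hy.1]⟩

theorem card_equidistant {n i k : ℕ} {x x' : Fin n → Bool} (hd : hammingDist x x' = 2 * i) :
    (equidistant (i + k) x x').card = (2 * i).choose i * (n - 2 * i).choose k := by
  have hA : (diffSet x x').card = 2 * i := hd
  have hA' : (diffSet x x')ᶜ.card = n - 2 * i := by rw [card_compl, hA, Fintype.card_fin]
  rw [← hA', ← hA, ← card_powersetCard, ← card_powersetCard, ← card_product]
  refine card_nbij (fun y => (diffSet x x' ∩ diffSet x y, (diffSet x x')ᶜ ∩ diffSet x y)) ?_ ?_ ?_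
  · intro y hy
    obtain ⟨h1, h2⟩ := card_inter_of_mem_equidistant hd hy
    simp only [coe_product, Set.mem_prod, mem_coe, mem_powersetCard]
    have h3 := card_inter_add_card_sdiff (diffSet x y) (diffSet x x')
    rw [inter_comm, h1, h2] at h3
    refine ⟨⟨inter_subset_left, h1⟩, inter_subset_left, ?_⟩
    have : (diffSet x x')ᶜ ∩ diffSet x y = diffSet x y \ diffSet x x' := by
      ext j; simp [and_comm]
    rw [this]; omega
  · intro y _ y' _ h
    simp only [Prod.mk.injEq] at h
    apply diffSet_injective x
    ext j
    have h1 := congrArg (fun s => j ∈ s) h.1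
    have h2 := congrArg (fun s => j ∈ s) h.2
    simp only [mem_inter, mem_compl, eq_iff_iff] at h1 h2
    tauto
  · rintro ⟨a, b⟩ hab
    simp only [coe_product, Set.mem_prod, mem_coe, mem_powersetCard] at hab
    obtain ⟨⟨ha, ha'⟩, hb, hb'⟩ := hab
    obtain ⟨y, hy⟩ := diffSet_surjective x (a ∪ b)
    have hAa : diffSet x x' ∩ (a ∪ b) = a := by
      ext j
      have h1 := @ha j
      have h2 := @hb j
      simp only [mem_inter, mem_union, mem_compl] at *
      tauto
    have hAb : (diffSet x x')ᶜ ∩ (a ∪ b) = b := by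
      ext j
      have h1 := @ha j
      have h2 := @hb j
      simp only [mem_inter, mem_union, mem_compl] at *
      tauto
    have hdis : Disjoint a b := by
      rw [disjoint_left]
      intro j h1 h2
      exact (mem_compl.1 (hb h2)) (ha h1)
    refine ⟨y, ?_, by simp only [hy, hAa, hAb]⟩
    have hc : (diffSet x y).card = i + k := by rw [hy, card_union_of_disjoint hdis, ha', hb']
    have h := card_symmDiff_add (diffSet x x') (diffSet x y)
    rw [← diffSet_symmDiff, hc, hA, hy, hAa, ha', card_diffSet] at h
    simp only [equidistant, mem_coe, mem_filter, mem_univ, true_and]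
    rw [← card_diffSet, hc]
    exact ⟨rfl, by omega⟩

theorem card_equidistant_inter_le {n i k l : ℕ} {x x' x'' : Fin n → Bool}
    (hd : hammingDist x x' = 2 * i) (hd' : hammingDist x x'' = 2 * i)
    (hl : hammingDist x' x'' = 2 * l) :
    (equidistant (i + k) x x' ∩ equidistant (i + k) x x'').card ≤
      ∑ η ∈ (range (n + 1)).filter (fun η => η ≤ l ∧ η ≤ i ∧ η ≤ k ∧ i + l ≤ 2 * i + η ∧
        l ≤ 2 * i ∧ 2 * i + l ≤ n ∧ k + 2 * i + l ≤ n + η),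
        l.choose η * l.choose η * (2 * i - l).choose (i - η) * (n - 2 * i - l).choose (k - η) := by
  set A := diffSet x x' with hAdef
  set A' := diffSet x x'' with hA'def
  have hA : A.card = 2 * i := hd
  have hA' : A'.card = 2 * i := hd'
  have hs := card_symmDiff_add A A'
  have : symmDiff A A' = diffSet x' x'' := by rw [diffSet_symmDiff x x' x'']
  rw [this, card_diffSet, hl, hA, hA'] at hs
  have h1 := card_sdiff_add_card_inter A A'
  have h2 := card_sdiff_add_card_inter A' A
  rw [inter_comm A' A] at h2
  have c1 : (A \ A').card = l := by omega
  have c2 : (A' \ A).card = l := by omega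
  have c3 : (A ∩ A').card = 2 * i - l := by omega
  have c4 : (A ∪ A')ᶜ.card = n - 2 * i - l := by
    have := card_union_add_card_inter A A'
    rw [card_compl, Fintype.card_fin]; omega
  have c5 : (A ∪ A').card ≤ n := by simpa using card_le_univ (A ∪ A')
  have c5' := card_union_add_card_inter A A'
  have key : ∀ y ∈ equidistant (i + k) x x' ∩ equidistant (i + k) x x'', ∀ η,
      ((A \ A') ∩ diffSet x y).card = η → ((A' \ A) ∩ diffSet x y).card = η ∧
      ((A ∩ A') ∩ diffSet x y).card + η = i ∧ ((A ∪ A')ᶜ ∩ diffSet x y).card + η = k := by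
    intro y hy η hη
    rw [mem_inter] at hy
    obtain ⟨a1, a2⟩ := card_inter_of_mem_equidistant hd hy.1
    obtain ⟨b1, b2⟩ := card_inter_of_mem_equidistant hd' hy.2
    rw [← hAdef] at a1
    rw [← hA'def] at b1
    have e1 : A ∩ diffSet x y = (A \ A' ∩ diffSet x y) ∪ (A ∩ A' ∩ diffSet x y) := by
      ext j; simp only [mem_inter, mem_union, Finset.mem_sdiff]; tauto
    have e2 : A' ∩ diffSet x y = (A' \ A ∩ diffSet x y) ∪ (A ∩ A' ∩ diffSet x y) := by
      ext j; simp only [mem_inter, mem_union, Finset.mem_sdiff]; tauto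
    have e3 : diffSet x y = (A ∩ diffSet x y) ∪ ((A' \ A ∩ diffSet x y) ∪ ((A ∪ A')ᶜ ∩ diffSet x y)) := by
      ext j; simp only [mem_inter, mem_union, Finset.mem_sdiff, mem_compl]; tauto
    have f1 : (A ∩ diffSet x y).card =
        (A \ A' ∩ diffSet x y).card + (A ∩ A' ∩ diffSet x y).card := by
      rw [e1, card_union_of_disjoint]
      rw [disjoint_left]; intro j; simp only [mem_inter, Finset.mem_sdiff]; tauto
    have f2 : (A' ∩ diffSet x y).card =
        (A' \ A ∩ diffSet x y).card + (A ∩ A' ∩ diffSet x y).card := by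
      rw [e2, card_union_of_disjoint]
      rw [disjoint_left]; intro j; simp only [mem_inter, Finset.mem_sdiff]; tauto
    have f3 : (diffSet x y).card = (A ∩ diffSet x y).card + ((A' \ A ∩ diffSet x y).card +
        ((A ∪ A')ᶜ ∩ diffSet x y).card) := by
      conv_lhs => rw [e3]
      rw [card_union_of_disjoint, card_union_of_disjoint]
      · rw [disjoint_left]; intro j; simp only [mem_inter, Finset.mem_sdiff, mem_compl, mem_union]; tauto
      · rw [disjoint_left]; intro j; simp only [mem_inter, Finset.mem_sdiff, mem_compl, mem_union]; tauto
    omega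
  rw [card_eq_sum_card_fiberwise (f := fun y => ((A \ A') ∩ diffSet x y).card)
    (t := (range (n + 1)).filter (fun η => η ≤ l ∧ η ≤ i ∧ η ≤ k ∧ i + l ≤ 2 * i + η ∧
        l ≤ 2 * i ∧ 2 * i + l ≤ n ∧ k + 2 * i + l ≤ n + η))]
  · refine sum_le_sum fun η hη => ?_
    rw [← c1]
    conv_rhs => rw [c1]
    have : l.choose η * l.choose η * (2 * i - l).choose (i - η) * (n - 2 * i - l).choose (k - η) =
      (((powersetCard η (A \ A') ×ˢ powersetCard η (A' \ A)) ×ˢ powersetCard (i - η) (A ∩ A')) ×ˢ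
        powersetCard (k - η) (A ∪ A')ᶜ).card := by
      simp only [card_product, card_powersetCard, c1, c2, c3, c4]
    rw [this]
    refine card_le_card_of_injOn (fun y => (((((A \ A') ∩ diffSet x y), ((A' \ A) ∩ diffSet x y)),
      ((A ∩ A') ∩ diffSet x y)), ((A ∪ A')ᶜ ∩ diffSet x y))) ?_ ?_
    · intro y hy
      rw [mem_coe, mem_filter] at hy
      obtain ⟨d1, d2, d3⟩ := key y hy.1 η hy.2
      simp only [coe_product, Set.mem_prod, mem_coe, mem_powersetCard]
      exact ⟨⟨⟨⟨inter_subset_left, hy.2⟩, inter_subset_left, d1⟩, inter_subset_left, by omega⟩,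
        inter_subset_left, by omega⟩
    · intro y _ y' _ h
      simp only [Prod.mk.injEq] at h
      obtain ⟨⟨⟨h1, h2⟩, h3⟩, h4⟩ := h
      apply diffSet_injective x
      ext j
      have h1 := congrArg (fun s => j ∈ s) h1
      have h2 := congrArg (fun s => j ∈ s) h2
      have h3 := congrArg (fun s => j ∈ s) h3
      have h4 := congrArg (fun s => j ∈ s) h4
      simp only [mem_inter, mem_compl, eq_iff_iff, Finset.mem_sdiff, mem_union] at h1 h2 h3 h4
      clear_value A A'
      by_cases q1 : j ∈ A <;> by_cases q2 : j ∈ A' <;>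
        simp only [q1, q2, true_and, not_true, not_false_iff, false_and, or_self, true_or, or_true]
          at h1 h2 h3 h4 <;> assumption
  · intro y hy
    obtain ⟨d1, d2, d3⟩ := key y hy _ rfl
    have g1 := card_le_card (inter_subset_left : (A \ A') ∩ diffSet x y ⊆ A \ A')
    have g2 := card_le_card (inter_subset_left : (A ∩ A') ∩ diffSet x y ⊆ A ∩ A')
    have g3 := card_le_card (inter_subset_left : (A ∪ A')ᶜ ∩ diffSet x y ⊆ (A ∪ A')ᶜ)
    rw [c1] at g1; rw [c3] at g2; rw [c4] at g3
    simp only [coe_filter, mem_range, Set.mem_ofPred_eq]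
    omega

theorem bscProb_nonneg {n : ℕ} {p : ℝ} (hp0 : 0 ≤ p) (hp1 : p ≤ 1) (x y : Fin n → Bool) :
    0 ≤ bscProb n p x y :=
  mul_nonneg (pow_nonneg hp0 _) (pow_nonneg (by linarith) _)

theorem le_PeCode {n : ℕ} {p : ℝ} {C : Finset (Fin n → Bool)} (hC : C.Nonempty) {a : ℝ}
    (h : ∀ dec : (Fin n → Bool) → (Fin n → Bool), (∀ y, dec y ∈ C) →
      a * C.card ≤ ∑ x ∈ C, ∑ y ∈ univ.filter (fun y => dec y ≠ x), bscProb n p x y) :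
    a ≤ PeCode n p C := by
  obtain ⟨x₀, hx₀⟩ := hC
  refine le_csInf ⟨_, fun _ => x₀, fun _ => hx₀, rfl⟩ ?_
  rintro _ ⟨dec, hdec, rfl⟩
  have hpos : (0:ℝ) < C.card := by exact_mod_cast card_pos.2 ⟨x₀, hx₀⟩
  rw [inv_mul_eq_div, le_div_iff₀ hpos]
  exact h dec hdec

theorem PeCode_le {n : ℕ} {p : ℝ} (hp0 : 0 ≤ p) (hp1 : p ≤ 1) {C : Finset (Fin n → Bool)}
    (dec : (Fin n → Bool) → (Fin n → Bool)) (hdec : ∀ y, dec y ∈ C) :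
    PeCode n p C ≤ (C.card : ℝ)⁻¹ * ∑ x ∈ C,
      ∑ y ∈ univ.filter (fun y => dec y ≠ x), bscProb n p x y := by
  refine csInf_le ⟨0, ?_⟩ ⟨dec, hdec, rfl⟩
  rintro _ ⟨dec, _, rfl⟩
  exact mul_nonneg (by positivity) (sum_nonneg fun x _ => sum_nonneg fun y _ =>
    bscProb_nonneg hp0 hp1 x y)

/-- Every word at distance `r` from two or more codewords causes errors. -/
theorem confusable_le_PeCode {n : ℕ} {p : ℝ} (hp0 : 0 ≤ p) (hp1 : p ≤ 1) {C : Finset (Fin n → Bool)}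
    (hC : C.Nonempty) (r : ℕ) :
    (2 * C.card : ℝ)⁻¹ * (p ^ r * (1 - p) ^ (n - r)) * ∑ x ∈ C, ((univ.filter fun y =>
      hammingDist x y = r ∧ ∃ x' ∈ C, x' ≠ x ∧ hammingDist x' y = r).card : ℝ) ≤ PeCode n p C := by
  refine le_PeCode hC fun dec _ => ?_
  have hpos : (0:ℝ) < C.card := by exact_mod_cast card_pos.2 hC
  set P := p ^ r * (1 - p) ^ (n - r) with hP
  have hP0 : 0 ≤ P := mul_nonneg (pow_nonneg hp0 _) (pow_nonneg (by linarith) _)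
  set U : (Fin n → Bool) → (Fin n → Bool) → Prop := fun x y =>
    hammingDist x y = r ∧ ∃ x' ∈ C, x' ≠ x ∧ hammingDist x' y = r
  have h1 : ∀ x ∈ C, ∑ y, (if hammingDist x y = r ∧ dec y ≠ x then P else 0) ≤
      ∑ y ∈ univ.filter (fun y => dec y ≠ x), bscProb n p x y := by
    intro x _
    rw [sum_filter]
    refine sum_le_sum fun y _ => ?_
    by_cases h : dec y ≠ x <;> by_cases h' : hammingDist x y = r
    · simp [h, h', bscProb, hP]
    · simp only [h, h', false_and, if_false, if_true, ne_eq, not_false_eq_true]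
      exact bscProb_nonneg hp0 hp1 x y
    · simp [h]
    · simp [h]
  refine le_trans ?_ (sum_le_sum h1)
  have e : (2 * C.card : ℝ)⁻¹ * P * ∑ x ∈ C, ((univ.filter fun y => U x y).card : ℝ) * C.card
      = ∑ x ∈ C, ∑ y, (if U x y then P / 2 else 0) := by
    have : ∀ x, ∑ y, (if U x y then P / 2 else 0) = ((univ.filter fun y => U x y).card : ℝ) * (P / 2) := by
      intro x; rw [← sum_filter, sum_const, nsmul_eq_mul]
    rw [sum_congr rfl fun x _ => this x, ← sum_mul, ← sum_mul, mul_inv]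
    have hh : (C.card : ℝ)⁻¹ * C.card = 1 := inv_mul_cancel₀ hpos.ne'
    linear_combination (2⁻¹ * P * ∑ x ∈ C, ((univ.filter fun y => U x y).card : ℝ)) * hh
  have e' : (2 * C.card : ℝ)⁻¹ * P * (∑ x ∈ C, ((univ.filter fun y => U x y).card : ℝ)) * C.card =
      (2 * C.card : ℝ)⁻¹ * P * ∑ x ∈ C, ((univ.filter fun y => U x y).card : ℝ) * C.card := by
    rw [← sum_mul]; ring
  rw [e', e, sum_comm, sum_comm (s := C)]
  refine sum_le_sum fun y _ => ?_
  by_cases hex : ∃ x ∈ C, U x y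
  · obtain ⟨x₁, hx₁, hd₁, x₂, hx₂, hne, hd₂⟩ := hex
    have hcard : 2 ≤ (C.filter fun x => hammingDist x y = r).card := by
      have : ({x₁, x₂} : Finset _) ⊆ C.filter fun x => hammingDist x y = r := by
        intro z hz
        simp only [mem_insert, mem_singleton] at hz
        rcases hz with rfl | rfl <;> simp [*]
      calc 2 = ({x₁, x₂} : Finset _).card := (card_pair hne.symm).symm
        _ ≤ _ := card_le_card this
    have l : ∑ x ∈ C, (if U x y then P / 2 else 0) ≤
        ((C.filter fun x => hammingDist x y = r).card : ℝ) * (P / 2) := by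
      rw [← sum_filter, sum_const, nsmul_eq_mul]
      refine mul_le_mul_of_nonneg_right ?_ (by positivity)
      exact_mod_cast card_le_card fun x hx => by
        rw [mem_filter] at hx ⊢; exact ⟨hx.1, hx.2.1⟩
    refine l.trans ?_
    rw [← sum_filter, sum_const, nsmul_eq_mul]
    have hsub : (C.filter fun x => hammingDist x y = r).card - 1 ≤
        (C.filter fun x => hammingDist x y = r ∧ dec y ≠ x).card := by
      refine (pred_card_le_card_erase (a := dec y)).trans (card_le_card fun x hx => ?_)
      rw [mem_erase, mem_filter] at hx
      rw [mem_filter]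
      exact ⟨hx.2.1, hx.2.2, hx.1.symm⟩
    have : ((C.filter fun x => hammingDist x y = r).card : ℝ) ≤
        2 * (C.filter fun x => hammingDist x y = r ∧ dec y ≠ x).card := by
      exact_mod_cast (by omega : (C.filter fun x => hammingDist x y = r).card ≤
        2 * (C.filter fun x => hammingDist x y = r ∧ dec y ≠ x).card)
    nlinarith
  · push Not at hex
    refine le_trans (sum_nonpos fun x hx => by rw [if_neg (hex x hx)]) (sum_nonneg fun x _ => ?_)
    split_ifs <;> simp [hP0]

theorem card_mul_le_card_biUnion {ι α : Type*} [DecidableEq α] [Fintype α] (S : Finset ι) (Y : ι → Finset α)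
    (v : ℕ) (K : ℝ) (hv : ∀ j ∈ S, (Y j).card = v)
    (hK : ∀ j ∈ S, ∑ j' ∈ S, ((Y j ∩ Y j').card : ℝ) ≤ K * v) :
    (S.card : ℝ) * v ≤ K * (S.biUnion Y).card := by
  rcases S.eq_empty_or_nonempty with rfl | ⟨j₀, hj₀⟩
  · simp
  rcases Nat.eq_zero_or_pos v with rfl | hv0
  · have : S.biUnion Y = ∅ := by
      rw [eq_empty_iff_forall_notMem]
      intro a ha
      obtain ⟨j, hj, haj⟩ := mem_biUnion.1 ha
      rw [card_eq_zero.1 (hv j hj)] at haj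
      simp at haj
    simp [this]
  set U := S.biUnion Y
  set f : α → ℝ := fun y => ∑ j ∈ S, if y ∈ Y j then 1 else 0
  have hind : ∀ (j : ι), j ∈ S → ∑ y ∈ U, (if y ∈ Y j then (1:ℝ) else 0) = (Y j).card := by
    intro j hj
    rw [← sum_filter, filter_mem_eq_inter, inter_eq_right.2 (subset_biUnion_of_mem Y hj)]
    simp
  have h1 : ∑ y ∈ U, f y = S.card * v := by
    simp only [f]
    rw [sum_comm, sum_congr rfl fun j hj => (hind j hj).trans (by rw [hv j hj]), sum_const,
      nsmul_eq_mul]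
  have h2 : ∑ y ∈ U, f y ^ 2 = ∑ j ∈ S, ∑ j' ∈ S, ((Y j ∩ Y j').card : ℝ) := by
    simp only [f, pow_two, sum_mul_sum]
    rw [sum_comm]
    refine sum_congr rfl fun j hj => ?_
    rw [sum_comm]
    refine sum_congr rfl fun j' hj' => ?_
    rw [card_eq_sum_ones, Nat.cast_sum]
    have : Y j ∩ Y j' = U.filter fun y => y ∈ Y j ∧ y ∈ Y j' := by
      ext y
      simp only [mem_inter, mem_filter, U, mem_biUnion]
      exact ⟨fun h => ⟨⟨j, hj, h.1⟩, h⟩, fun h => h.2⟩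
    rw [this, sum_filter]
    refine sum_congr rfl fun y _ => ?_
    by_cases a : y ∈ Y j <;> by_cases b : y ∈ Y j' <;> simp [a, b]
  have h3 : ∑ y ∈ U, f y ^ 2 ≤ S.card * (K * v) := by
    rw [h2, ← nsmul_eq_mul, ← sum_const]; exact sum_le_sum hK
  have h4 : (∑ y ∈ U, f y) ^ 2 ≤ U.card * ∑ y ∈ U, f y ^ 2 := sq_sum_le_card_mul_sum_sq
  rw [h1] at h4
  have hs : (0:ℝ) < S.card := by exact_mod_cast card_pos.2 ⟨j₀, hj₀⟩
  have hv' : (0:ℝ) < v := by exact_mod_cast hv0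
  have h5 : ((S.card : ℝ) * v) * (S.card * v) ≤ (S.card * v) * (K * U.card) := by
    have := mul_le_mul_of_nonneg_left h3 (Nat.cast_nonneg (α := ℝ) U.card)
    nlinarith
  exact le_of_mul_le_mul_left h5 (by positivity)

/-- Either some stage `i ≤ m` meets many elements of large degree, or most of the set survives
with small degrees at all stages. -/
theorem exists_stage_or_survivors {α : Type*} [DecidableEq α] (C : Finset α) (N : Finset α → ℕ → α → ℕ)
    (hN : ∀ C' C'' i x, C' ⊆ C'' → N C' i x ≤ N C'' i x) (D : ℕ → ℝ) (T : ℝ) (m : ℕ) :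
    (∃ i, 1 ≤ i ∧ i ≤ m ∧ ∃ C' ⊆ C, (∀ l, 1 ≤ l → l < i → ∀ x ∈ C', (N C' l x : ℝ) < D l) ∧
      T ≤ (C'.filter fun x => D i ≤ N C' i x).card) ∨
    ∃ C' ⊆ C, (∀ l, 1 ≤ l → l ≤ m → ∀ x ∈ C', (N C' l x : ℝ) < D l) ∧ (C.card : ℝ) ≤ C'.card + m * T := by
  induction m with
  | zero => exact Or.inr ⟨C, Subset.rfl, fun l h1 h0 => by omega, by simp⟩
  | succ m ih =>
    rcases ih with ⟨i, h1, h2, h3⟩ | ⟨C', hC', h1, h2⟩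
    · exact Or.inl ⟨i, h1, by omega, h3⟩
    by_cases hT : T ≤ (C'.filter fun x => D (m + 1) ≤ N C' (m + 1) x).card
    · exact Or.inl ⟨m + 1, by omega, le_rfl, C', hC', fun l hl hl' => h1 l hl (by omega), hT⟩
    · refine Or.inr ⟨C'.filter fun x => ¬ D (m + 1) ≤ N C' (m + 1) x, (filter_subset _ _).trans hC',
        fun l hl hl' x hx => ?_, ?_⟩
      · rw [mem_filter, not_le] at hx
        have hle : ∀ l, (N (C'.filter fun x => ¬ D (m + 1) ≤ N C' (m + 1) x) l x : ℝ) ≤ N C' l x :=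
          fun l => by exact_mod_cast hN _ _ l x (filter_subset _ _)
        rcases Nat.lt_or_ge m l with h | h
        · obtain rfl : l = m + 1 := by omega
          exact (hle _).trans_lt hx.2
        · exact (hle _).trans_lt (h1 l hl h x hx.1)
      · have := card_filter_add_card_filter_not (s := C') (fun x => D (m + 1) ≤ N C' (m + 1) x)
        have h' : ((C'.filter fun x => D (m + 1) ≤ N C' (m + 1) x).card : ℝ) +
          (C'.filter fun x => ¬ D (m + 1) ≤ N C' (m + 1) x).card = C'.card := by exact_mod_cast this
        push Not at hT
        push_cast
        linarith

/-- The number of words of `C` at distance `2 * l` from `x`. -/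
def degreeAt {n : ℕ} (C : Finset (Fin n → Bool)) (l : ℕ) (x : Fin n → Bool) : ℕ :=
  (C.filter fun x' => hammingDist x x' = 2 * l).card

/-- Upper bound for the size of the intersection of two sets of equidistant words. -/
def interBound (n i k l : ℕ) : ℕ :=
  ∑ η ∈ (range (n + 1)).filter (fun η => η ≤ l ∧ η ≤ i ∧ η ≤ k ∧ i + l ≤ 2 * i + η ∧
    l ≤ 2 * i ∧ 2 * i + l ≤ n ∧ k + 2 * i + l ≤ n + η),
    l.choose η * l.choose η * (2 * i - l).choose (i - η) * (n - 2 * i - l).choose (k - η)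

theorem even_hammingDist {n i : ℕ} {x x' x'' : Fin n → Bool}
    (hd : hammingDist x x' = 2 * i) (hd' : hammingDist x x'' = 2 * i) :
    ∃ l ≤ 2 * i, hammingDist x' x'' = 2 * l := by
  have h := card_symmDiff_add (diffSet x x') (diffSet x x'')
  rw [← diffSet_symmDiff, card_diffSet, card_diffSet, card_diffSet, hd, hd'] at h
  exact ⟨2 * i - (diffSet x x' ∩ diffSet x x'').card, by omega, by omega⟩

theorem PeCode_ge_of_stage {n : ℕ} {p : ℝ} (hp0 : 0 ≤ p) (hp1 : p ≤ 1)
    {C C' : Finset (Fin n → Bool)} (hC : C.Nonempty) (hC' : C' ⊆ C) {i k : ℕ} (hi : 1 ≤ i)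
    (hin : 2 * i ≤ n) {D : ℕ → ℝ} (hD : ∀ l, 1 ≤ D l)
    (hdeg : ∀ l, 1 ≤ l → l < i → ∀ x ∈ C', (degreeAt C' l x : ℝ) < D l) {K : ℝ} (hK0 : 0 ≤ K)
    (hK : ∀ l, 1 ≤ l → l ≤ 2 * i → 2 * D (min l i) * interBound n i k l ≤
      K * ((2 * i).choose i * (n - 2 * i).choose k : ℕ)) :
    (2 * C.card : ℝ)⁻¹ * (p ^ (i + k) * (1 - p) ^ (n - (i + k))) *
      ((C'.filter fun x => D i ≤ degreeAt C' i x).card *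
        (D i * ((2 * i).choose i * (n - 2 * i).choose k : ℕ) / (1 + n * K))) ≤ PeCode n p C := by
  set v := (2 * i).choose i * (n - 2 * i).choose k with hv
  have hpos : (0:ℝ) < C.card := by exact_mod_cast card_pos.2 hC
  refine le_trans (mul_le_mul_of_nonneg_left ?_ (mul_nonneg (by positivity)
    (mul_nonneg (pow_nonneg hp0 _) (pow_nonneg (by linarith) _))))
    (confusable_le_PeCode hp0 hp1 hC (i + k))
  set Hv := C'.filter fun x => D i ≤ degreeAt C' i x
  have hHC : Hv ⊆ C := (filter_subset _ _).trans hC'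
  rw [← nsmul_eq_mul, ← sum_const]
  refine le_trans (sum_le_sum fun x hx => ?_) (sum_le_sum_of_subset_of_nonneg hHC
    fun x _ _ => Nat.cast_nonneg _)
  rw [mem_filter] at hx
  have hcl : ⌈D i⌉₊ ≤ (C'.filter fun x' => hammingDist x x' = 2 * i).card := Nat.ceil_le.2 hx.2
  obtain ⟨S, hS, hScard⟩ := exists_subset_card_eq hcl
  have hSmem : ∀ x' ∈ S, x' ∈ C' ∧ hammingDist x x' = 2 * i := fun x' h => by
    simpa using hS h
  have hDi := hD i
  have hS1 : D i ≤ S.card := by rw [hScard]; exact Nat.le_ceil _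
  have hS2 : (S.card : ℝ) ≤ 2 * D i := by
    rw [hScard]; have := Nat.ceil_lt_add_one (by linarith : 0 ≤ D i); linarith
  have hnK : (0:ℝ) < 1 + n * K := by positivity
  have hpair : ∀ x' ∈ S, ∑ x'' ∈ S, ((equidistant (i + k) x x' ∩ equidistant (i + k) x x'').card : ℝ)
      ≤ (1 + n * K) * v := by
    intro x' hx'
    obtain ⟨h1, h2⟩ := hSmem x' hx'
    have hmaps : ∀ x'' ∈ S, hammingDist x' x'' / 2 ∈ range (2 * i + 1) := by
      intro x'' hx''
      obtain ⟨l, hl, hl'⟩ := even_hammingDist h2 (hSmem x'' hx'').2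
      rw [mem_range, hl']; omega
    rw [← sum_fiberwise_of_maps_to hmaps, sum_range_succ']
    have hzero : ∑ x'' ∈ S with hammingDist x' x'' / 2 = 0,
        ((equidistant (i + k) x x' ∩ equidistant (i + k) x x'').card : ℝ) ≤ v := by
      have : (S.filter fun x'' => hammingDist x' x'' / 2 = 0) ⊆ {x'} := by
        intro x'' hx''
        rw [mem_filter] at hx''
        obtain ⟨l, hl, hl'⟩ := even_hammingDist h2 (hSmem x'' hx''.1).2
        have : hammingDist x' x'' = 0 := by omega
        rw [mem_singleton, hammingDist_eq_zero.1 this]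
      refine (sum_le_sum_of_subset_of_nonneg this fun _ _ _ => Nat.cast_nonneg _).trans ?_
      rw [sum_singleton, inter_self, card_equidistant h2]
    have hrest : ∀ l ∈ range (2 * i), ∑ x'' ∈ S with hammingDist x' x'' / 2 = l + 1,
        ((equidistant (i + k) x x' ∩ equidistant (i + k) x x'').card : ℝ) ≤ K * v := by
      intro l hl
      rw [mem_range] at hl
      have hcount : ((S.filter fun x'' => hammingDist x' x'' / 2 = l + 1).card : ℝ) ≤
          2 * D (min (l + 1) i) := by
        rcases Nat.lt_or_ge (l + 1) i with h | h
        · rw [min_eq_left h.le]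
          have := hdeg (l + 1) (by omega) h x' h1
          have hsub : (S.filter fun x'' => hammingDist x' x'' / 2 = l + 1).card ≤
              degreeAt C' (l + 1) x' := card_le_card fun x'' hx'' => by
            rw [mem_filter] at hx'' ⊢
            obtain ⟨l', hl, hl'⟩ := even_hammingDist h2 (hSmem x'' hx''.1).2
            exact ⟨(hSmem x'' hx''.1).1, by omega⟩
          have hsub' : ((S.filter fun x'' => hammingDist x' x'' / 2 = l + 1).card : ℝ) ≤
              degreeAt C' (l + 1) x' := by exact_mod_cast hsub
          have := hD (l + 1)
          linarith
        · rw [min_eq_right h]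
          refine le_trans ?_ hS2
          exact_mod_cast card_filter_le _ _
      calc _ ≤ ∑ x'' ∈ S with hammingDist x' x'' / 2 = l + 1, (interBound n i k (l + 1) : ℝ) := by
            refine sum_le_sum fun x'' hx'' => ?_
            rw [mem_filter] at hx''
            obtain ⟨l', hl, hl'⟩ := even_hammingDist h2 (hSmem x'' hx''.1).2
            have : hammingDist x' x'' = 2 * (l + 1) := by omega
            exact_mod_cast card_equidistant_inter_le h2 (hSmem x'' hx''.1).2 this
        _ = ((S.filter fun x'' => hammingDist x' x'' / 2 = l + 1).card : ℝ) *
            interBound n i k (l + 1) := by rw [sum_const, nsmul_eq_mul]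
        _ ≤ 2 * D (min (l + 1) i) * interBound n i k (l + 1) :=
            mul_le_mul_of_nonneg_right hcount (Nat.cast_nonneg _)
        _ ≤ _ := hK (l + 1) (by omega) (by omega)
    have h3 := sum_le_sum hrest
    rw [sum_const, card_range, nsmul_eq_mul] at h3
    have h4 : ((2 * i : ℕ) : ℝ) * (K * v) ≤ n * (K * v) := by
      refine mul_le_mul_of_nonneg_right (by exact_mod_cast hin) (by positivity)
    linarith
  have hunion := card_mul_le_card_biUnion S (fun x' => equidistant (i + k) x x') v (1 + n * K)
    (fun x' hx' => card_equidistant (hSmem x' hx').2) hpair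
  rw [div_le_iff₀ hnK]
  have hle : (S.biUnion fun x' => equidistant (i + k) x x').card ≤ (univ.filter fun y =>
      hammingDist x y = i + k ∧ ∃ x' ∈ C, x' ≠ x ∧ hammingDist x' y = i + k).card := by
    refine card_le_card fun y hy => ?_
    rw [mem_biUnion] at hy
    obtain ⟨x', hx', hy⟩ := hy
    rw [equidistant, mem_filter] at hy
    rw [mem_filter]
    refine ⟨mem_univ _, hy.2.1, x', hC' (hSmem x' hx').1, ?_, hy.2.2⟩
    rintro rfl
    have := (hSmem _ hx').2
    rw [hammingDist_self] at this
    omega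
  have hle' : ((S.biUnion fun x' => equidistant (i + k) x x').card : ℝ) ≤ (univ.filter fun y =>
      hammingDist x y = i + k ∧ ∃ x' ∈ C, x' ≠ x ∧ hammingDist x' y = i + k).card := by
    exact_mod_cast hle
  have h1 : D i * v ≤ S.card * v := mul_le_mul_of_nonneg_right hS1 (Nat.cast_nonneg _)
  have h2 := mul_le_mul_of_nonneg_left hle' hnK.le
  linarith

/-- The Bhattacharyya distance of the channel, in nats. -/
noncomputable def bhat (p : ℝ) : ℝ := -Real.log (2 * Real.sqrt (p * (1 - p)))

/-- The exponent (in nats) of the conditional probability of being equidistant from a second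
word, for a given overlap `η`. -/
noncomputable def overlapExp (p ω l η : ℝ) : ℝ :=
  -ω * Real.log 2 - (1 - ω) * Real.binEntropy p + 2 * phi (l / 2) η + phi (ω - l / 2) (ω / 2 - η) +
    phi (1 - ω - l / 2) (p * (1 - ω) - η)

theorem phi_half (m : ℝ) : phi m (m / 2) = m * Real.log 2 := by
  rcases eq_or_ne m 0 with rfl | h
  · simp [phi_zero_left]
  · rw [phi, show m / 2 / m = 2⁻¹ by field_simp, Real.binEntropy_two_inv]

theorem phi_mul_right {m : ℝ} (p : ℝ) : phi m (p * m) = m * Real.binEntropy p := by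
  rcases eq_or_ne m 0 with rfl | h
  · simp [phi_zero_left]
  · rw [phi, mul_div_cancel_right₀ _ h]

theorem overlapExp_nonpos {p ω l η : ℝ} (hη : 0 ≤ η) (hηl : η ≤ l / 2)
    (h1 : η ≤ ω / 2) (h2 : ω / 2 - η ≤ ω - l / 2) (h3 : η ≤ p * (1 - ω))
    (h4 : p * (1 - ω) - η ≤ 1 - ω - l / 2) : overlapExp p ω l η ≤ 0 := by
  have a := phi_add_le hη hηl (by linarith : 0 ≤ ω / 2 - η) h2
  have b := phi_add_le hη hηl (by linarith : 0 ≤ p * (1 - ω) - η) h4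
  rw [show l / 2 + (ω - l / 2) = ω by ring, show η + (ω / 2 - η) = ω / 2 by ring, phi_half] at a
  rw [show l / 2 + (1 - ω - l / 2) = 1 - ω by ring,
    show η + (p * (1 - ω) - η) = p * (1 - ω) by ring, phi_mul_right] at b
  rw [overlapExp]
  linarith

theorem overlapExp_smul_le {p ω l η κ : ℝ} (hp0 : 0 ≤ p) (hp1 : p ≤ 1) (hκ : 0 ≤ κ) (hκ1 : κ ≤ 1)
    (h3 : η ≤ p * (1 - ω)) (h4 : p * (1 - ω) - η ≤ 1 - ω - l / 2) :
    κ * overlapExp p ω l η ≤ overlapExp p (κ * ω) (κ * l) (κ * η) := by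
  have a := phi_add_le (mul_nonneg hκ (by linarith : 0 ≤ p * (1 - ω) - η))
    (mul_le_mul_of_nonneg_left h4 hκ) (mul_nonneg hp0 (by linarith : 0 ≤ 1 - κ))
    (by nlinarith : p * (1 - κ) ≤ 1 - κ)
  rw [phi_smul, phi_mul_right, show κ * (1 - ω - l / 2) + (1 - κ) = 1 - κ * ω - κ * l / 2 by ring,
    show κ * (p * (1 - ω) - η) + p * (1 - κ) = p * (1 - κ * ω) - κ * η by ring] at a
  rw [overlapExp, overlapExp, show κ * l / 2 = κ * (l / 2) by ring,
    show κ * ω - κ * (l / 2) = κ * (ω - l / 2) by ring,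
    show κ * ω / 2 - κ * η = κ * (ω / 2 - η) by ring, phi_smul, phi_smul]
  rw [show κ * l / 2 = κ * (l / 2) by ring] at a
  linarith

/-- Conflicts at a larger distance are dominated by those at a smaller distance. -/
theorem overlapExp_le_shrink {p ω l η s : ℝ} (hs1 : s ≤ 1) (hη : 0 ≤ η)
    (hηl : η ≤ l / 2) (h1 : η ≤ ω / 2) (h2 : ω / 2 - η ≤ ω - l / 2) (h3 : η ≤ p * (1 - ω))
    (h4 : p * (1 - ω) - η ≤ 1 - ω - l / 2) :
    overlapExp p ω l η ≤ overlapExp p ω (s * l) (s * η) := by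
  have hs' : 0 ≤ 1 - s := by linarith
  have a := phi_add_le (mul_nonneg hs' hη) (mul_le_mul_of_nonneg_left hηl hs')
    (by linarith : 0 ≤ ω / 2 - η) h2
  have b := phi_add_le (mul_nonneg hs' hη) (mul_le_mul_of_nonneg_left hηl hs')
    (by linarith : 0 ≤ p * (1 - ω) - η) h4
  rw [phi_smul, show (1 - s) * (l / 2) + (ω - l / 2) = ω - s * l / 2 by ring,
    show (1 - s) * η + (ω / 2 - η) = ω / 2 - s * η by ring] at a
  rw [phi_smul, show (1 - s) * (l / 2) + (1 - ω - l / 2) = 1 - ω - s * l / 2 by ring,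
    show (1 - s) * η + (p * (1 - ω) - η) = p * (1 - ω) - s * η by ring] at b
  have c : phi (s * l / 2) (s * η) = s * phi (l / 2) η := by
    rw [show s * l / 2 = s * (l / 2) by ring, phi_smul]
  rw [overlapExp, overlapExp, c]
  linarith

theorem phi_ceil_ge {p : ℝ} (hp0 : 0 < p) (hp : p < 1 / 2) (m : ℕ) :
    m * Real.binEntropy p - Real.log 2 / (1 / 2 - p) ≤ phi m ⌈p * m⌉₊ := by
  have hpm : 0 ≤ p * m := by positivity
  have h2p : 0 < 1 / 2 - p := by linarith
  have hl2 := Real.log_pos one_lt_two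
  have hc := Nat.ceil_lt_add_one hpm
  by_cases hm : 1 / (1 / 2 - p) ≤ m
  · rw [div_le_iff₀ h2p] at hm
    have := phi_mono_right hpm (Nat.le_ceil (p * m)) (m := m) (by linarith)
    rw [phi_mul_right] at this
    have : 0 ≤ Real.log 2 / (1 / 2 - p) := by positivity
    linarith
  · push Not at hm
    have hk : ⌈p * m⌉₊ ≤ m := Nat.ceil_le.2 (by nlinarith [Nat.cast_nonneg (α := ℝ) m])
    have h1 : 0 ≤ phi m ⌈p * m⌉₊ := phi_nonneg (by positivity) (by exact_mod_cast hk)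
    have h2 : m * Real.binEntropy p ≤ m * Real.log 2 :=
      mul_le_mul_of_nonneg_left Real.binEntropy_le_log_two (by positivity)
    have h3 := mul_le_mul_of_nonneg_right hm.le hl2.le
    rw [div_mul_eq_mul_div, one_mul] at h3
    linarith

theorem pow_ceil_ge {p : ℝ} (hp0 : 0 < p) (hp : p < 1 / 2) (m : ℕ) :
    p * Real.exp (-(m * Real.binEntropy p)) ≤ p ^ ⌈p * m⌉₊ * (1 - p) ^ (m - ⌈p * m⌉₊) := by
  have hpm : 0 ≤ p * m := by positivity
  have hc := Nat.ceil_lt_add_one hpm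
  have hc' := Nat.le_ceil (p * m)
  have hk : ⌈p * m⌉₊ ≤ m := Nat.ceil_le.2 (by nlinarith [Nat.cast_nonneg (α := ℝ) m])
  have hq : 0 < 1 - p := by linarith
  rw [← Real.log_le_log_iff (by positivity) (by positivity), Real.log_mul (by positivity) (by positivity),
    Real.log_exp, Real.log_mul (by positivity) (by positivity), Real.log_pow, Real.log_pow,
    Nat.cast_sub hk, Real.binEntropy, Real.log_inv, Real.log_inv]
  have h1 : Real.log p < Real.log (1 - p) := Real.log_lt_log hp0 (by linarith)
  have h2 : Real.log (1 - p) ≤ 0 := Real.log_nonpos hq.le (by linarith)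
  nlinarith

theorem bhat_pos {p : ℝ} (hp0 : 0 < p) (hp : p < 1 / 2) : 0 < bhat p := by
  rw [bhat, neg_pos]
  have h1 : 0 < Real.sqrt (p * (1 - p)) := Real.sqrt_pos.2 (mul_pos hp0 (by linarith))
  refine Real.log_neg (by positivity) ?_
  have : Real.sqrt (p * (1 - p)) < 1 / 2 := by
    rw [Real.sqrt_lt' (by norm_num)]; nlinarith [sq_pos_of_pos (by linarith : 0 < 1 / 2 - p)]
  linarith

theorem four_mul_pow_eq_exp {p : ℝ} (hp0 : 0 < p) (hp : p < 1 / 2) (i : ℕ) :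
    (4 * (p * (1 - p))) ^ i = Real.exp (-(2 * bhat p * i)) := by
  have h1 : 0 < p * (1 - p) := mul_pos hp0 (by linarith)
  have h2 : 0 < Real.sqrt (p * (1 - p)) := Real.sqrt_pos.2 h1
  have : -(2 * bhat p * i) = i * (2 * Real.log (2 * Real.sqrt (p * (1 - p)))) := by rw [bhat]; ring
  have e : (2:ℝ) * Real.log (2 * Real.sqrt (p * (1 - p))) = Real.log (4 * (p * (1 - p))) := by
    rw [show 4 * (p * (1 - p)) = (2 * Real.sqrt (p * (1 - p))) ^ 2 by
      rw [mul_pow, Real.sq_sqrt h1.le]; norm_num, Real.log_pow]; norm_num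
  rw [this, e, Real.exp_nat_mul, Real.exp_log (by positivity)]

/-- All overlap exponents up to relative distance `g` are dominated by `X`. -/
def OverlapBound (p g X : ℝ) : Prop := ∀ ω l η : ℝ, 0 < l → l ≤ ω → ω ≤ g → 0 ≤ η → η ≤ l / 2 →
  η ≤ p * (1 - ω) → overlapExp p ω l η + bhat p * l ≤ X

theorem OverlapBound.mono {p g X X' : ℝ} (h : OverlapBound p g X) (hX : X ≤ X') :
    OverlapBound p g X' :=
  fun ω l η a b c d e f => (h ω l η a b c d e f).trans hX

theorem OverlapBound.anti {p g g' X : ℝ} (h : OverlapBound p g X) (hg : g' ≤ g) :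
    OverlapBound p g' X :=
  fun ω l η a b c d e f => h ω l η a b (c.trans hg) d e f

theorem OverlapBound.scale {p g X κ : ℝ} (h : OverlapBound p g X) (hp0 : 0 < p) (hp : p < 1 / 2)
    (hκ : 0 < κ) (hκ1 : κ ≤ 1) (hgκ : g / κ ≤ 1 / 2) : OverlapBound p (g / κ) (X / κ) := by
  intro ω l η hl hlω hω hη hηl h3
  have h4 : p * (1 - ω) - η ≤ 1 - ω - l / 2 := by nlinarith
  have a := overlapExp_smul_le hp0.le (by linarith : p ≤ 1) hκ.le hκ1 h3 h4
  have hg : κ * ω ≤ g := by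
    rw [le_div_iff₀ hκ] at hω; linarith
  have b := h (κ * ω) (κ * l) (κ * η) (by positivity) (by gcongr) hg (by positivity)
    (by nlinarith) (by nlinarith [mul_nonneg hp0.le (by linarith : 0 ≤ 1 - κ)])
  rw [le_div_iff₀ hκ]
  linarith

theorem interBound_term_le {p : ℝ} (hp0 : 0 < p) (hp : p < 1 / 2) {n i l k η : ℕ} (hi : 1 ≤ i)
    (hk : (p * ((n - 2 * i : ℕ) : ℝ)) ≤ k) (h1 : η ≤ l) (h2 : η ≤ i) (h3 : η ≤ k) (h4 : i + l ≤ 2 * i + η)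
    (h5 : l ≤ 2 * i) (h6 : 2 * i + l ≤ n) (h7 : k + 2 * i + l ≤ n + η) :
    let n' : ℝ := 2 * i + k / p
    ((l.choose η * l.choose η * (2 * i - l).choose (i - η) * (n - 2 * i - l).choose (k - η) : ℕ) : ℝ) ≤
      Real.exp (2 * i * Real.log 2 + k / p * Real.binEntropy p +
        n' * overlapExp p (2 * i / n') (2 * l / n') (η / n')) := by
  intro n'
  have hi' : (1:ℝ) ≤ i := by exact_mod_cast hi
  have hn' : 0 < n' := by positivity
  have hkp : n' - 2 * i = k / p := by simp only [n']; ring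
  have hnn' : (n:ℝ) ≤ n' := by
    rw [Nat.cast_sub (by omega)] at hk
    have : (n:ℝ) - 2 * i ≤ k / p := by rw [le_div_iff₀ hp0]; push_cast at hk; linarith
    linarith
  have e1 : n' * overlapExp p (2 * i / n') (2 * l / n') (η / n') =
      -(2 * i) * Real.log 2 - k / p * Real.binEntropy p + 2 * phi l η + phi (2 * i - l) (i - η) +
        phi (n' - 2 * i - l) (k - η) := by
    rw [overlapExp]
    have a1 : phi (l:ℝ) η = n' * phi (2 * l / n' / 2) (η / n') := by
      rw [← phi_smul]; congr 1 <;> field_simp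
    have a2 : phi (2 * i - l : ℝ) (i - η) = n' * phi (2 * i / n' - 2 * l / n' / 2) (2 * i / n' / 2 - η / n') := by
      rw [← phi_smul]; congr 1 <;> field_simp
    have a3 : phi (n' - 2 * i - l) (k - η) = n' * phi (1 - 2 * i / n' - 2 * l / n' / 2)
        (p * (1 - 2 * i / n') - η / n') := by
      rw [← phi_smul]; congr 1
      · field_simp
      · have : (k:ℝ) = p * (n' - 2 * i) := by rw [hkp]; field_simp
        rw [this]; field_simp
    rw [a1, a2, a3, ← hkp]
    field_simp
  have b1 := choose_le_exp_phi l η h1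
  have b2 := choose_le_exp_phi (2 * i - l) (i - η) (by omega)
  have b3 := choose_le_exp_phi (n - 2 * i - l) (k - η) (by omega)
  have b4 : phi ((n - 2 * i - l : ℕ) : ℝ) ((k - η : ℕ) : ℝ) ≤ phi (n' - 2 * i - l) (k - η) := by
    have c1 : ((n - 2 * i - l : ℕ) : ℝ) = n - 2 * i - l := by
      rw [Nat.cast_sub (by omega), Nat.cast_sub (by omega)]; push_cast; ring
    have c2 : ((k - η : ℕ) : ℝ) = k - η := by rw [Nat.cast_sub h3]
    have c3 : (k:ℝ) - η ≤ n - 2 * i - l := by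
      rw [← c1, ← c2]; exact_mod_cast (by omega : k - η ≤ n - 2 * i - l)
    rw [c1, c2]
    have := phi_add_le (by rw [← c2]; positivity : (0:ℝ) ≤ k - η) c3 le_rfl (by linarith : 0 ≤ n' - n)
    have z := phi_nonneg le_rfl (by linarith : 0 ≤ n' - n)
    rw [add_zero, show (n - 2 * i - l : ℝ) + (n' - n) = n' - 2 * i - l by ring] at this
    linarith
  have c4 : ((2 * i - l : ℕ) : ℝ) = 2 * i - l := by rw [Nat.cast_sub h5]; push_cast; ring
  have c5 : ((i - η : ℕ) : ℝ) = i - η := by rw [Nat.cast_sub h2]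
  rw [c4, c5] at b2
  rw [e1]
  push_cast
  calc (l.choose η : ℝ) * l.choose η * (2 * i - l).choose (i - η) * (n - 2 * i - l).choose (k - η)
      ≤ Real.exp (phi l η) * Real.exp (phi l η) * Real.exp (phi (2 * i - l) (i - η)) *
        Real.exp (phi (n' - 2 * i - l) (k - η)) := by
        gcongr
        exact b3.trans (Real.exp_le_exp.2 b4)
    _ = _ := by
        rw [← Real.exp_add, ← Real.exp_add, ← Real.exp_add]; congr 1; ring

theorem interBound_le {p : ℝ} (hp0 : 0 < p) (hp : p < 1 / 2) {n i l k : ℕ} (hi : 1 ≤ i) (hl1 : 1 ≤ l)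
    (hin : 2 * i ≤ n)
    (hk : (p * ((n - 2 * i : ℕ) : ℝ)) ≤ k) {g X : ℝ} (hX : OverlapBound p g X)
    (hig : 2 * i ≤ g * n) :
    (interBound n i k l : ℝ) ≤ (n + 1) * Real.exp (2 * i * Real.log 2 + k / p * Real.binEntropy p +
      min 0 ((2 * i + k / p) * X - 2 * bhat p * (min l i : ℕ))) := by
  have hi' : (1:ℝ) ≤ i := by exact_mod_cast hi
  have hl' : (1:ℝ) ≤ l := by exact_mod_cast hl1
  obtain ⟨n', hn'd⟩ : ∃ n' : ℝ, n' = 2 * i + k / p := ⟨_, rfl⟩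
  have hn' : 0 < n' := by rw [hn'd]; positivity
  have hnn' : (n:ℝ) ≤ n' := by
    rw [Nat.cast_sub hin] at hk
    have : (n:ℝ) - 2 * i ≤ k / p := by rw [le_div_iff₀ hp0]; push_cast at hk; linarith
    rw [hn'd]; linarith
  rw [interBound, Nat.cast_sum, ← hn'd]
  have hterm : ∀ η ∈ (range (n + 1)).filter (fun η => η ≤ l ∧ η ≤ i ∧ η ≤ k ∧ i + l ≤ 2 * i + η ∧
    l ≤ 2 * i ∧ 2 * i + l ≤ n ∧ k + 2 * i + l ≤ n + η),
    ((l.choose η * l.choose η * (2 * i - l).choose (i - η) * (n - 2 * i - l).choose (k - η) : ℕ) : ℝ) ≤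
    Real.exp (2 * i * Real.log 2 + k / p * Real.binEntropy p +
      min 0 (n' * X - 2 * bhat p * (min l i : ℕ))) := by
    intro η hη
    rw [mem_filter] at hη
    obtain ⟨-, h1, h2, h3, h4, h5, h6, h7⟩ := hη
    refine (interBound_term_le hp0 hp hi hk h1 h2 h3 h4 h5 h6 h7).trans (Real.exp_le_exp.2 ?_)
    rw [← hn'd]
    have r1 : (η:ℝ) ≤ l := by exact_mod_cast h1
    have r2 : (η:ℝ) ≤ i := by exact_mod_cast h2
    have r3 : (η:ℝ) ≤ k := by exact_mod_cast h3
    have r4 : (i:ℝ) + l ≤ 2 * i + η := by exact_mod_cast h4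
    have r5 : (l:ℝ) ≤ 2 * i := by exact_mod_cast h5
    have r6 : 2 * (i:ℝ) + l ≤ n := by exact_mod_cast h6
    have r7 : (k:ℝ) + 2 * i + l ≤ n + η := by exact_mod_cast h7
    have hkn : (k:ℝ) = p * (n' - 2 * i) := by rw [hn'd]; field_simp; ring
    have s0 : (0:ℝ) ≤ η / n' := by positivity
    have s1 : (η:ℝ) / n' ≤ 2 * l / n' / 2 := by
      rw [show 2 * (l:ℝ) / n' / 2 = l / n' by field_simp]
      gcongr
    have s2 : (η:ℝ) / n' ≤ 2 * i / n' / 2 := by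
      rw [show 2 * (i:ℝ) / n' / 2 = i / n' by field_simp]
      gcongr
    have s3 : (η:ℝ) / n' ≤ p * (1 - 2 * i / n') := by
      rw [div_le_iff₀ hn', mul_assoc, sub_mul, div_mul_cancel₀ _ hn'.ne', one_mul, ← hkn]; exact r3
    have s4 : 2 * (i:ℝ) / n' / 2 - η / n' ≤ 2 * i / n' - 2 * l / n' / 2 := by
      rw [show 2 * (l:ℝ) / n' / 2 = l / n' by field_simp, show 2 * (i:ℝ) / n' / 2 = i / n' by
        field_simp, ← sub_div, ← sub_div]
      exact div_le_div_of_nonneg_right (by linarith) hn'.le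
    have s5 : p * (1 - 2 * i / n') - η / n' ≤ 1 - 2 * i / n' - 2 * l / n' / 2 := by
      have : 1 - 2 * i / n' - 2 * l / n' / 2 = (n' - 2 * i - l) / n' := by field_simp
      rw [this, le_div_iff₀ hn', sub_mul, mul_assoc, sub_mul, div_mul_cancel₀ _ hn'.ne',
        div_mul_cancel₀ _ hn'.ne', one_mul, ← hkn]
      linarith
    have hωg : 2 * (i:ℝ) / n' ≤ g := by
      have hg0 : 0 ≤ g := by
        by_contra h
        push Not at h
        have := mul_nonpos_of_nonpos_of_nonneg h.le (Nat.cast_nonneg (α := ℝ) n)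
        linarith
      rw [div_le_iff₀ hn']
      nlinarith
    have hmain : n' * overlapExp p (2 * i / n') (2 * l / n') (η / n') ≤
        n' * X - 2 * bhat p * (min l i : ℕ) := by
      rcases le_total l i with hli | hli
      · rw [min_eq_left hli]
        have hli' : (l:ℝ) ≤ i := by exact_mod_cast hli
        have := hX (2 * i / n') (2 * l / n') (η / n') (by positivity) (by gcongr) hωg s0 s1 s3
        have := mul_le_mul_of_nonneg_left this hn'.le
        have e : n' * (bhat p * (2 * l / n')) = 2 * bhat p * l := by field_simp
        rw [mul_add, e] at this
        linarith
      · rw [min_eq_right hli]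
        have hli' : (i:ℝ) ≤ l := by exact_mod_cast hli
        have hs1 : (i:ℝ) / l ≤ 1 := by rw [div_le_one (by linarith)]; exact hli'
        have hs0 : (0:ℝ) ≤ i / l := by positivity
        have a := overlapExp_le_shrink hs1 s0 s1 s2 s4 s3 s5
        have e0 : (i:ℝ) / l * (2 * l / n') = 2 * i / n' := by field_simp
        rw [e0] at a
        have := hX (2 * i / n') (2 * i / n') (i / l * (η / n')) (by positivity) le_rfl hωg
          (by positivity) (by rw [← e0, mul_div_assoc]; exact mul_le_mul_of_nonneg_left s1 hs0)
          (le_trans (mul_le_of_le_one_left s0 hs1) s3)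
        have := mul_le_mul_of_nonneg_left (add_le_of_le_sub_right (a.trans (le_sub_iff_add_le.2 this)))
          hn'.le
        have e : n' * (bhat p * (2 * i / n')) = 2 * bhat p * i := by field_simp
        rw [mul_add, e] at this
        linarith
    have hnon : n' * overlapExp p (2 * i / n') (2 * l / n') (η / n') ≤ 0 :=
      mul_nonpos_of_nonneg_of_nonpos hn'.le (overlapExp_nonpos s0 s1 s2 s4 s3 s5)
    have := le_min hnon hmain
    linarith
  refine (sum_le_card_nsmul _ _ _ hterm).trans ?_
  rw [nsmul_eq_mul]
  refine mul_le_mul_of_nonneg_right ?_ (Real.exp_pos _).le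
  exact_mod_cast (card_filter_le _ _).trans (by rw [card_range])

/-- At rate `R` (in nats) the error probability of long codes is at least `exp (-n (X + o(1)))`. -/
def ErrorLowerBound (p R X : ℝ) : Prop := ∀ ε > 0, ∃ N : ℕ, ∀ n ≥ N, ∀ C : Finset (Fin n → Bool),
  Real.exp (R * n) ≤ C.card → Real.exp (-(n * (X + ε))) ≤ PeCode n p C

theorem sum_degreeAt {n : ℕ} (C : Finset (Fin n → Bool)) (i : ℕ) :
    ∑ x ∈ C, degreeAt C i x = pairCount C i := by
  rw [pairCount, card_filter, sum_product]
  refine sum_congr rfl fun x _ => ?_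
  rw [degreeAt, card_filter]

theorem degreeAt_mono {n : ℕ} (C C' : Finset (Fin n → Bool)) (i : ℕ) (x : Fin n → Bool)
    (h : C ⊆ C') : degreeAt C i x ≤ degreeAt C' i x :=
  card_le_card (filter_subset_filter _ h)

theorem exists_poly_ge_exp {A : ℝ} (hA : 0 < A) (d : ℕ) {ε : ℝ} (hε : 0 < ε) :
    ∃ N : ℕ, ∀ n ≥ N, Real.exp (-(n * ε)) ≤ A / ((n:ℝ) + 1) ^ d := by
  have h1 := (tendsto_log_succ_div.const_mul (d:ℝ)).sub
    (tendsto_const_div_atTop_nhds_zero_nat (Real.log A))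
  rw [mul_zero, sub_zero] at h1
  obtain ⟨N, hN⟩ := eventually_atTop.1 ((h1.eventually (gt_mem_nhds hε)).and (eventually_gt_atTop 0))
  refine ⟨N, fun n hn => ?_⟩
  obtain ⟨h2, h3⟩ := hN n hn
  have hn0 : (0:ℝ) < n := by exact_mod_cast h3
  rw [← mul_div_assoc, ← sub_div, div_lt_iff₀ hn0] at h2
  rw [← Real.le_log_iff_exp_le (by positivity), Real.log_div hA.ne' (by positivity), Real.log_pow]
  linarith

theorem volume_ge {p : ℝ} (hp0 : 0 < p) (hp : p < 1 / 2) {n i : ℕ} (hin : 2 * i ≤ n) :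
    Real.exp (2 * i * Real.log 2 + ((n - 2 * i : ℕ) : ℝ) * Real.binEntropy p -
      Real.log 2 / (1 / 2 - p)) ≤
      ((n:ℝ) + 1) ^ 2 * ((2 * i).choose i * (n - 2 * i).choose ⌈p * (n - 2 * i : ℕ)⌉₊ : ℕ) := by
  have h1 := exp_phi_le_choose (2 * i) i (by omega)
  have hk : ⌈p * ((n - 2 * i : ℕ) : ℝ)⌉₊ ≤ n - 2 * i :=
    Nat.ceil_le.2 (by nlinarith [Nat.cast_nonneg (α := ℝ) (n - 2 * i)])
  have h2 := exp_phi_le_choose (n - 2 * i) _ hk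
  have h3 := phi_ceil_ge hp0 hp (n - 2 * i)
  have e1 : phi ((2 * i : ℕ) : ℝ) i = 2 * i * Real.log 2 := by
    rw [← phi_half]; congr 1 <;> push_cast <;> ring
  rw [e1] at h1
  have h4 : ((2 * i : ℕ) : ℝ) + 1 ≤ n + 1 := by exact_mod_cast (by omega : 2 * i + 1 ≤ n + 1)
  have h5 : ((n - 2 * i : ℕ) : ℝ) + 1 ≤ n + 1 := by
    exact_mod_cast (by omega : n - 2 * i + 1 ≤ n + 1)
  calc _ ≤ Real.exp (2 * i * Real.log 2) *
        Real.exp (phi ((n - 2 * i : ℕ) : ℝ) ⌈p * ((n - 2 * i : ℕ) : ℝ)⌉₊) := by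
        rw [← Real.exp_add, Real.exp_le_exp]; linarith
    _ ≤ (((n:ℝ) + 1) * (2 * i).choose i) * ((n + 1) * (n - 2 * i).choose ⌈p * (n - 2 * i : ℕ)⌉₊) := by
        gcongr
        · exact h1.trans (by gcongr)
        · exact h2.trans (by gcongr)
    _ = _ := by push_cast; ring

theorem prob_volume_ge {p : ℝ} (hp0 : 0 < p) (hp : p < 1 / 2) {n i : ℕ} (hin : 2 * i ≤ n) :
    p * Real.exp (-(Real.log 2 / (1 / 2 - p))) * Real.exp (-(2 * bhat p * i)) ≤ ((n:ℝ) + 1) ^ 2 *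
      ((p ^ (i + ⌈p * (n - 2 * i : ℕ)⌉₊) * (1 - p) ^ (n - (i + ⌈p * (n - 2 * i : ℕ)⌉₊))) *
      ((2 * i).choose i * (n - 2 * i).choose ⌈p * (n - 2 * i : ℕ)⌉₊ : ℕ)) := by
  have hk : ⌈p * ((n - 2 * i : ℕ) : ℝ)⌉₊ ≤ n - 2 * i :=
    Nat.ceil_le.2 (by nlinarith [Nat.cast_nonneg (α := ℝ) (n - 2 * i)])
  have h1 := volume_ge hp0 hp hin
  have h2 := pow_ceil_ge hp0 hp (n - 2 * i)
  set k := ⌈p * ((n - 2 * i : ℕ) : ℝ)⌉₊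
  have e : n - (i + k) = i + (n - 2 * i - k) := by omega
  have h3 := four_mul_pow_eq_exp hp0 hp i
  have hq : 0 ≤ p * (1 - p) := mul_nonneg hp0.le (by linarith)
  have e2 : Real.exp (2 * i * Real.log 2) = 4 ^ i := by
    rw [show (2:ℝ) * i * Real.log 2 = i * (2 * Real.log 2) by ring,
      show 2 * Real.log 2 = Real.log (2 ^ 2) by rw [Real.log_pow]; norm_num, mul_comm,
      Real.exp_mul, Real.exp_log (by norm_num), Real.rpow_natCast]; norm_num
  rw [e]
  calc _ = (p * (1 - p)) ^ i * (p * Real.exp (-(((n - 2 * i : ℕ) : ℝ) * Real.binEntropy p))) *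
        Real.exp (2 * i * Real.log 2 + ((n - 2 * i : ℕ) : ℝ) * Real.binEntropy p -
          Real.log 2 / (1 / 2 - p)) := by
        rw [← h3, mul_pow, ← e2, show (2 * i * Real.log 2 + ((n - 2 * i : ℕ) : ℝ) * Real.binEntropy p -
          Real.log 2 / (1 / 2 - p)) = 2 * i * Real.log 2 + ((n - 2 * i : ℕ) : ℝ) * Real.binEntropy p +
          (-(Real.log 2 / (1 / 2 - p))) by ring, Real.exp_add, Real.exp_add]
        have : Real.exp (-(((n - 2 * i : ℕ) : ℝ) * Real.binEntropy p)) *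
          Real.exp (((n - 2 * i : ℕ) : ℝ) * Real.binEntropy p) = 1 := by
          rw [← Real.exp_add, neg_add_cancel, Real.exp_zero]
        linear_combination (- p * Real.exp (-(Real.log 2 / (1 / 2 - p))) * (p * (1 - p)) ^ i *
          Real.exp (2 * i * Real.log 2)) * this
    _ ≤ (p * (1 - p)) ^ i * (p ^ k * (1 - p) ^ (n - 2 * i - k)) * (((n:ℝ) + 1) ^ 2 *
        ((2 * i).choose i * (n - 2 * i).choose k : ℕ)) := by
        gcongr
        · exact mul_nonneg (pow_nonneg hq _) (mul_nonneg (pow_nonneg hp0.le _)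
            (pow_nonneg (by linarith) _))
    _ = _ := by rw [mul_pow, pow_add, pow_add]; ring

theorem PeCode_ge_of_heavy {p : ℝ} (hp0 : 0 < p) (hp : p < 1 / 2) {g X X' : ℝ}
    (hX0 : 0 ≤ X) (hX : OverlapBound p g X) (hXX : X ≤ X') :
    ∃ A > 0, ∀ n : ℕ, 1 ≤ n → ∀ C C' : Finset (Fin n → Bool), C.Nonempty → C' ⊆ C → ∀ i : ℕ, 1 ≤ i →
      2 * i ≤ n → 2 * (i:ℝ) ≤ g * n →
      (∀ l, 1 ≤ l → l < i → ∀ x ∈ C', (degreeAt C' l x : ℝ) < max 1 (Real.exp (2 * bhat p * l - n * X'))) →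
      (C.card : ℝ) / n ≤ (C'.filter fun x => max 1 (Real.exp (2 * bhat p * i - n * X')) ≤
        (degreeAt C' i x : ℝ)).card →
      Real.exp (-(n * X')) * (A / ((n:ℝ) + 1) ^ 7) ≤ PeCode n p C := by
  have hl2 := Real.log_pos one_lt_two
  have hH := Real.binEntropy_pos hp0 (by linarith : p < 1)
  obtain ⟨C0, hC0⟩ : ∃ C0, C0 = Real.log 2 / (1 / 2 - p) := ⟨_, rfl⟩
  have hC0' : 0 ≤ C0 := by rw [hC0]; exact div_nonneg hl2.le (by linarith)
  obtain ⟨C1, hC1⟩ : ∃ C1, C1 = C0 + (Real.binEntropy p + X) / p := ⟨_, rfl⟩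
  have hC1' : 0 ≤ C1 := by rw [hC1]; positivity
  refine ⟨p * Real.exp (-C0) / (6 * Real.exp C1), by positivity, ?_⟩
  intro n hn C C' hC hCC i hi hin hig hdeg hT
  have hn' : (1:ℝ) ≤ n := by exact_mod_cast hn
  have hcard : (0:ℝ) < C.card := by exact_mod_cast card_pos.2 hC
  obtain ⟨m, hm⟩ : ∃ m, m = n - 2 * i := ⟨_, rfl⟩
  have hmc : (m:ℝ) = n - 2 * i := by rw [hm, Nat.cast_sub hin]; push_cast; ring
  have hvol := volume_ge hp0 hp hin
  have hpv := prob_volume_ge hp0 hp hin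
  have hck := Nat.ceil_lt_add_one (by positivity : 0 ≤ p * ((n - 2 * i : ℕ) : ℝ))
  have hck' := Nat.le_ceil (p * ((n - 2 * i : ℕ) : ℝ))
  rw [← hC0] at hvol hpv
  set k := ⌈p * ((n - 2 * i : ℕ) : ℝ)⌉₊ with hk
  obtain ⟨v, hv⟩ : ∃ v, v = ((2 * i).choose i * (n - 2 * i).choose k : ℕ) := ⟨_, rfl⟩
  rw [← hv] at hvol hpv
  set D : ℕ → ℝ := fun l => max 1 (Real.exp (2 * bhat p * l - n * X')) with hD
  have hkp : (k:ℝ) / p ≤ m + 1 / p := by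
    rw [← hm] at hck
    rw [div_le_iff₀ hp0, add_mul, one_div, inv_mul_cancel₀ hp0.ne']
    linarith
  have hK : ∀ l, 1 ≤ l → l ≤ 2 * i → 2 * D (min l i) * interBound n i k l ≤
      (2 * ((n:ℝ) + 1) ^ 3 * Real.exp C1) * ((2 * i).choose i * (n - 2 * i).choose k : ℕ) := by
    intro l hl hl2
    rw [← hv]
    have a := interBound_le hp0 hp hi hl hin hck' hX hig
    set mm := min l i
    have hDe : D mm * Real.exp (min 0 ((2 * i + k / p) * X - 2 * bhat p * (mm : ℕ))) ≤
        Real.exp (X / p) := by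
      simp only [hD]
      rw [max_mul_of_nonneg _ _ (Real.exp_pos _).le]
      refine max_le ?_ ?_
      · rw [one_mul, Real.exp_le_exp]
        exact (min_le_left _ _).trans (by positivity)
      · rw [← Real.exp_add, Real.exp_le_exp]
        have b1 : (2 * i + k / p) * X ≤ (n + 1 / p) * X :=
          mul_le_mul_of_nonneg_right (by linarith) hX0
        have b2 : (n:ℝ) * X ≤ n * X' := by gcongr
        have b3 := min_le_right 0 ((2 * i + k / p) * X - 2 * bhat p * (mm : ℕ))
        have b4 : (n + 1 / p) * X = n * X + X / p := by ring
        linarith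
    have hD0 : 0 ≤ D mm := le_trans zero_le_one (le_max_left _ _)
    calc 2 * D mm * interBound n i k l ≤ 2 * D mm * ((n + 1) * Real.exp (2 * i * Real.log 2 +
          k / p * Real.binEntropy p + min 0 ((2 * i + k / p) * X - 2 * bhat p * (mm : ℕ)))) := by
          gcongr
      _ = 2 * (n + 1) * Real.exp (2 * i * Real.log 2 + k / p * Real.binEntropy p) *
          (D mm * Real.exp (min 0 ((2 * i + k / p) * X - 2 * bhat p * (mm : ℕ)))) := by
          rw [Real.exp_add]; ring
      _ ≤ 2 * (n + 1) * Real.exp (2 * i * Real.log 2 + (m + 1 / p) * Real.binEntropy p) *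
          Real.exp (X / p) := by gcongr
      _ = 2 * (n + 1) * Real.exp C1 *
          Real.exp (2 * i * Real.log 2 + (m:ℝ) * Real.binEntropy p - C0) := by
          rw [mul_assoc, ← Real.exp_add, mul_assoc (2 * ((n:ℝ) + 1)), ← Real.exp_add, hC1]
          congr 2; ring
      _ ≤ 2 * (n + 1) * Real.exp C1 * (((n:ℝ) + 1) ^ 2 * v) := by
          rw [hm]; gcongr
      _ = _ := by ring
  have main := PeCode_ge_of_stage hp0.le (by linarith : p ≤ 1) hC hCC hi hin (D := D)
    (fun l => le_max_left _ _) hdeg (by positivity) hK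
  rw [← hv] at main
  refine le_trans ?_ main
  set P := p ^ (i + k) * (1 - p) ^ (n - (i + k)) with hP
  have hP0 : 0 ≤ P := mul_nonneg (pow_nonneg hp0.le _) (pow_nonneg (by linarith) _)
  have hDi : Real.exp (2 * bhat p * i - n * X') ≤ D i := le_max_right _ _
  have hden : 1 + n * (2 * ((n:ℝ) + 1) ^ 3 * Real.exp C1) ≤ 3 * (n + 1) ^ 4 * Real.exp C1 := by
    have e1 : (1:ℝ) ≤ Real.exp C1 := Real.one_le_exp hC1'
    have e2 : (1:ℝ) ≤ (n + 1) ^ 4 := one_le_pow₀ (by linarith)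
    have e3 : (1:ℝ) ≤ (n + 1) ^ 4 * Real.exp C1 := one_le_mul_of_one_le_of_one_le e2 e1
    have e4 : n * (2 * ((n:ℝ) + 1) ^ 3 * Real.exp C1) ≤ (n + 1) * (2 * ((n:ℝ) + 1) ^ 3 * Real.exp C1) := by
      gcongr; linarith
    have e5 : (n + 1) * (2 * ((n:ℝ) + 1) ^ 3 * Real.exp C1) = 2 * ((n + 1) ^ 4 * Real.exp C1) := by ring
    linarith
  have hPv : p * Real.exp (-C0) * Real.exp (-(2 * bhat p * i)) / ((n:ℝ) + 1) ^ 2 ≤ P * v := by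
    rw [div_le_iff₀ (by positivity)]; linarith
  calc Real.exp (-(n * X')) * (p * Real.exp (-C0) / (6 * Real.exp C1) / ((n:ℝ) + 1) ^ 7)
      = (p * Real.exp (-C0) * Real.exp (-(2 * bhat p * i)) / ((n:ℝ) + 1) ^ 2) *
        Real.exp (2 * bhat p * i - n * X') / (2 * (n + 1)) / (3 * (n + 1) ^ 4 * Real.exp C1) := by
        have : Real.exp (-(n * X')) = Real.exp (-(2 * bhat p * i)) *
          Real.exp (2 * bhat p * i - n * X') := by rw [← Real.exp_add]; congr 1; ring
        rw [this]
        have h1 : (n:ℝ) + 1 ≠ 0 := by positivity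
        field_simp
        ring
    _ ≤ (P * v) * D i / (2 * n) / (1 + n * (2 * ((n:ℝ) + 1) ^ 3 * Real.exp C1)) := by
        have hD0 : 0 ≤ D i := le_trans zero_le_one (le_max_left _ _)
        gcongr
        linarith
    _ = (2 * C.card : ℝ)⁻¹ * P * ((C.card / n) * (D i * v /
          (1 + n * (2 * ((n:ℝ) + 1) ^ 3 * Real.exp C1)))) := by
        field_simp
    _ ≤ _ := by
        have hD0 : 0 ≤ D i := le_trans zero_le_one (le_max_left _ _)
        gcongr

theorem ErrorLowerBound.mono {p R X X' : ℝ} (h : ErrorLowerBound p R X) (hX : X ≤ X') :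
    ErrorLowerBound p R X' := by
  intro ε hε
  obtain ⟨N, hN⟩ := h ε hε
  refine ⟨N, fun n hn C hC => le_trans (Real.exp_le_exp.2 ?_) (hN n hn C hC)⟩
  have : (0:ℝ) ≤ n := n.cast_nonneg
  nlinarith

set_option maxHeartbeats 1000000 in
theorem errorLowerBound_of_overlapBound {p α τ R X : ℝ} (hp0 : 0 < p) (hp : p < 1 / 2)
    (hτ : 0 < τ) (hτα : τ < α) (hα2 : α < 1 / 2)
    (hR : Real.log 2 - Real.binEntropy α + Real.binEntropy τ < R)
    (hg0 : 0 < Gfun α τ) (hg : Gfun α τ < 1 / 2) (hX0 : 0 ≤ X)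
    (hX : OverlapBound p (Gfun α τ) X)
    (hXc : ∀ ω, 0 ≤ ω → ω ≤ Gfun α τ → bhat p * ω - max 0 (R - Real.log 2 +
      Real.binEntropy (Gfun α τ) + entSlope (Gfun α τ) * (ω - Gfun α τ)) ≤ X) :
    ErrorLowerBound p R X := by
  intro ε hε
  obtain ⟨g, hgd⟩ : ∃ g, g = Gfun α τ := ⟨_, rfl⟩
  rw [← hgd] at hg0 hg hX hXc
  have hc := bhat_pos hp0 hp
  set c := bhat p with hcd
  have hs : 0 < entSlope g := by
    rw [entSlope, sub_pos]; exact Real.log_lt_log hg0 (by linarith)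
  set s := entSlope g with hsd
  set r0 := R - (Real.log 2 - Real.binEntropy α + Real.binEntropy τ) with hr0
  have hr0' : 0 < r0 := by linarith
  set κ := min (r0 / 2) (ε / 16) with hκ
  have hκ0 : 0 < κ := by positivity
  have hκ1 : κ ≤ r0 / 2 := min_le_left _ _
  have hκ2 : κ ≤ ε / 16 := min_le_right _ _
  obtain ⟨e, he0, he1, he2, he3, he4⟩ : ∃ e : ℝ, 0 < e ∧ e ≤ ε / 16 ∧ c * e ≤ ε / 16 ∧
      e ≤ 1 / 2 - g ∧ X * e ≤ g * (ε / 4) := by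
    refine ⟨min (min (ε / 16) (ε / 16 / c)) (min (1 / 2 - g) (g * (ε / 4) / (X + 1))), ?_, ?_, ?_, ?_, ?_⟩
    · have : 0 < 1 / 2 - g := by linarith
      have : 0 < X + 1 := by linarith
      positivity
    · exact (min_le_left _ _).trans (min_le_left _ _)
    · have := (min_le_left _ _ : min (min (ε / 16) (ε / 16 / c))
        (min (1 / 2 - g) (g * (ε / 4) / (X + 1))) ≤ _).trans (min_le_right _ _)
      rw [le_div_iff₀ hc] at this; linarith
    · exact (min_le_right _ _).trans (min_le_left _ _)
    · have h1 := (min_le_right _ _ : min (min (ε / 16) (ε / 16 / c))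
        (min (1 / 2 - g) (g * (ε / 4) / (X + 1))) ≤ _).trans (min_le_right _ _)
      have h2 : X * min (min (ε / 16) (ε / 16 / c)) (min (1 / 2 - g) (g * (ε / 4) / (X + 1))) ≤
        X * (g * (ε / 4) / (X + 1)) := by gcongr
      refine h2.trans ?_
      rw [← mul_div_assoc, div_le_iff₀ (by linarith)]
      have : 0 ≤ g * (ε / 4) := by positivity
      nlinarith
  have hge : 0 < g + e := by linarith
  have hgκ : g / (g / (g + e)) = g + e := by field_simp
  have hX1 : OverlapBound p (g + e) (X / (g / (g + e))) := by
    have := hX.scale hp0 hp (κ := g / (g + e)) (by positivity) (by rw [div_le_one hge]; linarith)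
      (by rw [hgκ]; linarith)
    rwa [hgκ] at this
  have hX1' : X / (g / (g + e)) ≤ X + ε / 2 := by
    rw [div_div_eq_mul_div, div_le_iff₀ hg0]
    nlinarith
  have hX10 : 0 ≤ X / (g / (g + e)) := by positivity
  obtain ⟨A, hA, hstage⟩ := PeCode_ge_of_heavy hp0 hp hX10 hX1 hX1'
  obtain ⟨N1, hN1⟩ := exists_many_pairs (R := R - κ) hτ hτα hα2 (by linarith) he0
  obtain ⟨N2, hN2⟩ := exists_poly_ge_exp hA 7 (by positivity : 0 < ε / 2)
  obtain ⟨N3, hN3⟩ := exists_nat_ge (Real.log 2 / κ)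
  refine ⟨max (max N1 N2) (max N3 1), fun n hn C hC => ?_⟩
  have hnN1 : N1 ≤ n := le_trans (by simp) hn
  have hnN2 : N2 ≤ n := le_trans (by simp) hn
  have hnN3 : N3 ≤ n := le_trans (by simp) hn
  have hn1 : 1 ≤ n := le_trans (by simp) hn
  have hn0 : (0:ℝ) < n := by exact_mod_cast hn1
  have hCpos : (0:ℝ) < C.card := (Real.exp_pos _).trans_le hC
  have hCne : C.Nonempty := card_pos.1 (by exact_mod_cast hCpos)
  set X' := X + ε / 2 with hX'
  set D : ℕ → ℝ := fun l => max 1 (Real.exp (2 * c * l - n * X')) with hD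
  set m := ⌊(g + e) * n / 2⌋₊ with hm
  have hm2 : 2 * (m:ℝ) ≤ (g + e) * n := by
    have := Nat.floor_le (by positivity : 0 ≤ (g + e) * n / 2); linarith
  have hmn : 2 * m ≤ n := by
    have : 2 * (m:ℝ) ≤ n := hm2.trans (by nlinarith)
    exact_mod_cast this
  rcases exists_stage_or_survivors C degreeAt degreeAt_mono D (C.card / n) m with
    ⟨i, hi1, him, C', hCC, hlow, hT⟩ | ⟨C', hCC, hlow, hcard⟩
  · have him' : (i:ℝ) ≤ m := by exact_mod_cast him
    have h1 := hstage n hn1 C C' hCne hCC i hi1 (by omega) (by linarith) hlow hT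
    refine le_trans ?_ h1
    have h2 := hN2 n hnN2
    calc Real.exp (-(n * (X + ε))) = Real.exp (-(n * X')) * Real.exp (-(n * (ε / 2))) := by
          rw [← Real.exp_add, hX']; congr 1; ring
      _ ≤ _ := by gcongr
  · exfalso
    have h1 : (C.card : ℝ) ≤ 2 * C'.card := by
      have : (m:ℝ) * (C.card / n) ≤ C.card / 2 := by
        have : 2 * (m:ℝ) ≤ n := by exact_mod_cast hmn
        rw [mul_div_assoc', div_le_iff₀ hn0]; nlinarith
      linarith
    have h2 : Real.exp ((R - κ) * n) ≤ C'.card := by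
      have a : Real.log 2 ≤ κ * n := by
        have : Real.log 2 / κ ≤ n := hN3.trans (by exact_mod_cast hnN3)
        rw [div_le_iff₀ hκ0] at this; linarith
      have b : 2 * Real.exp ((R - κ) * n) ≤ Real.exp (R * n) := by
        rw [show R * n = κ * n + (R - κ) * n by ring, Real.exp_add]
        gcongr
        rw [← Real.log_le_iff_le_exp (by norm_num)]; exact a
      linarith
    obtain ⟨i, hi1, hi2, hi3, hi4⟩ := hN1 n hnN1 C' h2
    rw [← hgd] at hi2 hi4
    rw [← hsd] at hi4
    have him : i ≤ m := Nat.le_floor (by linarith)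
    have hlow' := hlow i hi1 him
    rw [← sum_degreeAt] at hi3 hi4
    have hC'pos : (0:ℝ) < C'.card := (Real.exp_pos _).trans_le h2
    have hC'ne : C'.Nonempty := card_pos.1 (by exact_mod_cast hC'pos)
    obtain ⟨x, hx, hx0⟩ := exists_ne_zero_of_sum_ne_zero hi3.ne'
    have hx1 : (1:ℝ) ≤ degreeAt C' i x := by exact_mod_cast Nat.one_le_iff_ne_zero.2 hx0
    have hD1 : 1 < D i := hx1.trans_lt (hlow' x hx)
    have hD2 : 1 < Real.exp (2 * c * i - n * X') := by
      rcases lt_max_iff.1 hD1 with h | h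
      · exact absurd h (lt_irrefl _)
      · exact h
    have hDi : D i = Real.exp (2 * c * i - n * X') := max_eq_right hD2.le
    have hsum : ((∑ x ∈ C', degreeAt C' i x : ℕ) : ℝ) < C'.card * D i := by
      push_cast
      have := sum_lt_sum_of_nonempty hC'ne hlow'
      rwa [sum_const, nsmul_eq_mul] at this
    have h5 := lt_of_mul_lt_mul_left (hi4.trans_lt hsum) hC'pos.le
    rw [hDi, Real.exp_lt_exp] at h5
    have h6 := Real.one_lt_exp_iff.1 hD2
    set w := 2 * (i:ℝ) / n with hw
    have hwn : 2 * (i:ℝ) = w * n := by rw [hw]; field_simp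
    have hw0 : 0 ≤ w := by positivity
    have hwge : w ≤ g + e := by rw [hw, div_le_iff₀ hn0]; exact hi2
    have h7 : X' < c * w := by
      have : 0 < n * (c * w - X') := by
        have : 2 * c * (i:ℝ) = c * (w * n) := by rw [← hwn]; ring
        nlinarith
      linarith [pos_of_mul_pos_right this hn0.le]
    have h8 : R - κ - Real.log 2 + Real.binEntropy g - e + s * (w - g) < c * w - X' := by
      have : 0 < n * ((c * w - X') - (R - κ - Real.log 2 + Real.binEntropy g - e + s * (w - g))) := by
        have : 2 * c * (i:ℝ) = c * (w * n) := by rw [← hwn]; ring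
        have : s * (2 * (i:ℝ) - g * n) = n * (s * (w - g)) := by rw [hwn]; ring
        linarith
      linarith [pos_of_mul_pos_right this hn0.le]
    rcases le_total w g with hwg | hwg
    · have h9 := hXc w hw0 hwg
      rcases le_total 0 (R - Real.log 2 + Real.binEntropy g + s * (w - g)) with h | h
      · rw [max_eq_right h] at h9; linarith
      · rw [max_eq_left h] at h9; linarith
    · have h9 := hXc g hg0.le le_rfl
      have h10 : 0 ≤ s * (w - g) := mul_nonneg hs.le (by linarith)
      have h11 : c * w ≤ c * g + c * e := by nlinarith
      rw [sub_self, mul_zero, add_zero] at h9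
      rcases le_total 0 (R - Real.log 2 + Real.binEntropy g) with h | h
      · rw [max_eq_right h] at h9; linarith
      · rw [max_eq_left h] at h9; linarith

theorem bscProb_eq_prod {n : ℕ} (p : ℝ) (x y : Fin n → Bool) :
    bscProb n p x y = ∏ i, if x i ≠ y i then p else 1 - p := by
  rw [prod_ite, prod_const, prod_const, bscProb, hammingDist]
  congr 2
  have := card_filter_add_card_filter_not (s := (univ : Finset (Fin n))) (fun i => x i ≠ y i)
  rw [card_univ, Fintype.card_fin] at this
  omega

theorem sum_bscProb {n : ℕ} (p : ℝ) (x : Fin n → Bool) : ∑ y, bscProb n p x y = 1 := by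
  simp_rw [bscProb_eq_prod]
  have := prod_univ_sum (fun _ : Fin n => (univ : Finset Bool))
    (fun i b => if x i ≠ b then p else 1 - p)
  rw [Fintype.piFinset_univ] at this
  rw [← this]
  refine prod_eq_one fun i _ => ?_
  rw [Fintype.sum_bool]
  cases x i <;> simp

theorem bscProb_append {n₁ n₂ : ℕ} (p : ℝ) (x : Fin (n₁ + n₂) → Bool) (y₁ : Fin n₁ → Bool)
    (y₂ : Fin n₂ → Bool) :
    bscProb (n₁ + n₂) p x (Fin.append y₁ y₂) =
      bscProb n₁ p (fun i => x (Fin.castAdd n₂ i)) y₁ *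
      bscProb n₂ p (fun i => x (Fin.natAdd n₁ i)) y₂ := by
  rw [bscProb_eq_prod, bscProb_eq_prod, bscProb_eq_prod, Fin.prod_univ_add]
  simp

/-- Few codewords can have a small conditional error probability given the initial part of the
received word. -/
theorem card_small_error_le {n₁ n₂ : ℕ} {p : ℝ} (hp0 : 0 ≤ p) (hp1 : p ≤ 1) {ε K : ℝ}
    (hε : ε ≤ 1 / 2) (hK0 : 0 ≤ K)
    (hK : ∀ C₂ : Finset (Fin n₂ → Bool), C₂.Nonempty → K ≤ C₂.card → ε ≤ PeCode n₂ p C₂)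
    (G : Finset (Fin (n₁ + n₂) → Bool)) (d : (Fin n₂ → Bool) → (Fin (n₁ + n₂) → Bool))
    (hG : ∀ x ∈ G, ∑ y ∈ univ.filter (fun y => d y ≠ x),
      bscProb n₂ p (fun i => x (Fin.natAdd n₁ i)) y < ε) : (G.card : ℝ) ≤ K := by
  by_contra hcon
  push Not at hcon
  have hGne : G.Nonempty := by
    rw [nonempty_iff_ne_empty]; rintro rfl
    rw [card_empty, Nat.cast_zero] at hcon; linarith
  set π : (Fin (n₁ + n₂) → Bool) → (Fin n₂ → Bool) := fun x i => x (Fin.natAdd n₁ i) with hπ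
  have hnn := fun (x y : Fin n₂ → Bool) => bscProb_nonneg hp0 hp1 x y
  have hinj : Set.InjOn π G := by
    intro x hx x' hx' hxx
    by_contra hne
    have h1 := hG x hx
    have h2 := hG x' hx'
    change ∑ y ∈ univ.filter (fun y => d y ≠ x), bscProb n₂ p (π x) y < ε at h1
    change ∑ y ∈ univ.filter (fun y => d y ≠ x'), bscProb n₂ p (π x') y < ε at h2
    rw [← hxx] at h2
    have h3 := sum_bscProb p (π x)
    rw [← sum_filter_add_sum_filter_not univ (fun y => d y ≠ x)] at h3
    have h4 : ∑ y ∈ univ.filter (fun y => ¬ d y ≠ x), bscProb n₂ p (π x) y ≤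
        ∑ y ∈ univ.filter (fun y => d y ≠ x'), bscProb n₂ p (π x) y := by
      refine sum_le_sum_of_subset_of_nonneg (fun y hy => ?_) fun y _ _ => hnn _ _
      rw [mem_filter] at hy ⊢
      refine ⟨mem_univ _, fun h => hne ?_⟩
      rw [← h]; exact (not_not.1 hy.2).symm
    linarith
  obtain ⟨x₀, hx₀⟩ := hGne
  have hcard : (G.image π).card = G.card := card_image_of_injOn hinj
  have h1 := hK (G.image π) ⟨π x₀, mem_image_of_mem _ hx₀⟩ (by rw [hcard]; exact hcon.le)
  set dec : (Fin n₂ → Bool) → (Fin n₂ → Bool) :=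
    fun y => if π (d y) ∈ G.image π then π (d y) else π x₀ with hdec
  have h2 := PeCode_le hp0 hp1 (C := G.image π) dec (fun y => by
    by_cases h : π (d y) ∈ G.image π
    · simp only [hdec, if_pos h]; exact h
    · simp only [hdec, if_neg h]; exact mem_image_of_mem _ hx₀)
  rw [hcard, sum_image hinj] at h2
  have h3 : ∑ x ∈ G, ∑ y ∈ univ.filter (fun y => dec y ≠ π x), bscProb n₂ p (π x) y <
      ∑ x ∈ G, ε := by
    refine sum_lt_sum_of_nonempty ⟨x₀, hx₀⟩ fun x hx => lt_of_le_of_lt ?_ (hG x hx)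
    refine sum_le_sum_of_subset_of_nonneg (fun y hy => ?_) fun y _ _ => hnn _ _
    rw [mem_filter] at hy ⊢
    refine ⟨mem_univ _, fun h => hy.2 ?_⟩
    simp only [hdec, h, if_pos (mem_image_of_mem π hx)]
  rw [sum_const, nsmul_eq_mul] at h3
  have hpos : (0:ℝ) < G.card := lt_of_le_of_lt hK0 hcon
  rw [inv_mul_eq_div, le_div_iff₀ hpos] at h2
  nlinarith

theorem card_hammingDist_eq {n : ℕ} (x : Fin n → Bool) (r : ℕ) :
    (univ.filter fun y => hammingDist x y = r).card = n.choose r := by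
  have := card_powersetCard r (univ : Finset (Fin n))
  rw [card_univ, Fintype.card_fin] at this
  rw [← this]
  refine card_bij' (fun y _ => univ.filter fun i => x i ≠ y i)
    (fun S _ => fun i => if i ∈ S then !(x i) else x i) ?_ ?_ ?_ ?_
  · intro y hy
    rw [mem_filter] at hy
    rw [mem_powersetCard]
    exact ⟨subset_univ _, hy.2⟩
  · intro S hS
    rw [mem_powersetCard] at hS
    rw [mem_filter, hammingDist]
    refine ⟨mem_univ _, ?_⟩
    rw [← hS.2]
    congr 1
    ext i
    by_cases h : i ∈ S <;> simp [h]
  · intro y _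
    ext i
    by_cases h : x i = y i
    · simp [h]
    · have : y i = !(x i) := by cases hx : x i <;> cases hy : y i <;> simp_all
      simp [this]
  · intro S _
    ext i
    by_cases h : i ∈ S <;> simp [h]

/-- Shannon–Gallager–Berlekamp type bound: splitting the word into two parts. -/
theorem PeCode_append_ge {n₁ n₂ : ℕ} {p : ℝ} (hp0 : 0 ≤ p) (hp1 : p ≤ 1) {ε K : ℝ}
    (hε0 : 0 ≤ ε) (hε : ε ≤ 1 / 2) (hK0 : 0 ≤ K)
    (hK : ∀ C₂ : Finset (Fin n₂ → Bool), C₂.Nonempty → K ≤ C₂.card → ε ≤ PeCode n₂ p C₂)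
    {C : Finset (Fin (n₁ + n₂) → Bool)} (hC : C.Nonempty) (r : ℕ) :
    p ^ r * (1 - p) ^ (n₁ - r) * (ε * (n₁.choose r - 2 ^ n₁ * K / C.card)) ≤
      PeCode (n₁ + n₂) p C := by
  classical
  refine le_PeCode hC fun dec _ => ?_
  have hpos : (0:ℝ) < C.card := by exact_mod_cast card_pos.2 hC
  set P := p ^ r * (1 - p) ^ (n₁ - r) with hP
  have hP0 : 0 ≤ P := mul_nonneg (pow_nonneg hp0 _) (pow_nonneg (by linarith) _)
  set π₁ : (Fin (n₁ + n₂) → Bool) → (Fin n₁ → Bool) := fun x i => x (Fin.castAdd n₂ i) with hπ₁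
  set π₂ : (Fin (n₁ + n₂) → Bool) → (Fin n₂ → Bool) := fun x i => x (Fin.natAdd n₁ i) with hπ₂
  set e : (Fin (n₁ + n₂) → Bool) → (Fin n₁ → Bool) → ℝ := fun x y₁ =>
    ∑ y₂ ∈ univ.filter (fun y₂ => dec (Fin.append y₁ y₂) ≠ x), bscProb n₂ p (π₂ x) y₂ with he
  have he0 : ∀ x y₁, 0 ≤ e x y₁ := fun x y₁ => sum_nonneg fun y _ => bscProb_nonneg hp0 hp1 _ _
  have hsplit : ∀ x, ∑ y ∈ univ.filter (fun y => dec y ≠ x), bscProb (n₁ + n₂) p x y =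
      ∑ y₁, bscProb n₁ p (π₁ x) y₁ * e x y₁ := by
    intro x
    rw [sum_filter, ← (Fin.appendEquiv n₁ n₂).sum_comp, Fintype.sum_prod_type]
    refine sum_congr rfl fun y₁ _ => ?_
    simp only [he]
    rw [sum_filter, mul_sum]
    refine sum_congr rfl fun y₂ _ => ?_
    change (if dec (Fin.append y₁ y₂) ≠ x then bscProb (n₁ + n₂) p x (Fin.append y₁ y₂) else 0) = _
    rw [bscProb_append, mul_ite, mul_zero]
  simp_rw [hsplit]
  rw [sum_comm]
  have hrow : ∀ y₁, P * (ε * ((C.filter fun x => hammingDist (π₁ x) y₁ = r).card - K)) ≤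
      ∑ x ∈ C, bscProb n₁ p (π₁ x) y₁ * e x y₁ := by
    intro y₁
    set S := C.filter fun x => hammingDist (π₁ x) y₁ = r with hS
    have h1 : ∑ x ∈ S, P * e x y₁ ≤ ∑ x ∈ C, bscProb n₁ p (π₁ x) y₁ * e x y₁ := by
      have : ∑ x ∈ S, P * e x y₁ = ∑ x ∈ S, bscProb n₁ p (π₁ x) y₁ * e x y₁ := by
        refine sum_congr rfl fun x hx => ?_
        rw [hS, mem_filter] at hx
        rw [bscProb, hx.2]
      rw [this]
      exact sum_le_sum_of_subset_of_nonneg (filter_subset _ _)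
        fun x _ _ => mul_nonneg (bscProb_nonneg hp0 hp1 _ _) (he0 _ _)
    refine le_trans ?_ h1
    rw [← mul_sum]
    refine mul_le_mul_of_nonneg_left ?_ hP0
    have h2 := card_small_error_le hp0 hp1 hε hK0 hK (S.filter fun x => e x y₁ < ε)
      (fun y₂ => dec (Fin.append y₁ y₂)) (fun x hx => (mem_filter.1 hx).2)
    have h3 := card_filter_add_card_filter_not (s := S) (fun x => e x y₁ < ε)
    have h4 : ∑ x ∈ S.filter (fun x => ¬ e x y₁ < ε), ε ≤ ∑ x ∈ S, e x y₁ :=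
      (sum_le_sum fun x hx => not_lt.1 (mem_filter.1 hx).2).trans
        (sum_le_sum_of_subset_of_nonneg (filter_subset _ _) fun x _ _ => he0 _ _)
    rw [sum_const, nsmul_eq_mul] at h4
    have h5 : (S.card : ℝ) = (S.filter fun x => e x y₁ < ε).card +
      (S.filter fun x => ¬ e x y₁ < ε).card := by exact_mod_cast h3.symm
    nlinarith
  refine le_trans (le_of_eq ?_) (sum_le_sum fun y₁ _ => hrow y₁)
  rw [← mul_sum, ← mul_sum, sum_sub_distrib, sum_const, card_univ]
  have h6 : ∑ y₁ : Fin n₁ → Bool, ((C.filter fun x => hammingDist (π₁ x) y₁ = r).card : ℝ) =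
      C.card * n₁.choose r := by
    simp_rw [card_filter, Nat.cast_sum]
    rw [sum_comm]
    have : ∀ x ∈ C, ∑ y₁ : Fin n₁ → Bool, ((if hammingDist (π₁ x) y₁ = r then 1 else 0 : ℕ) : ℝ) =
        n₁.choose r := by
      intro x _
      rw [← card_hammingDist_eq (π₁ x) r, card_filter, Nat.cast_sum]
    rw [sum_congr rfl this, sum_const, nsmul_eq_mul]
  rw [h6, Fintype.card_fun, Fintype.card_bool, Fintype.card_fin, nsmul_eq_mul]
  push_cast
  field_simp

/-- Relative entropy (in nats) between two binary distributions. -/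
noncomputable def klBin (r p : ℝ) : ℝ :=
  -r * Real.log p - (1 - r) * Real.log (1 - p) - Real.binEntropy r

theorem PeCode_nonneg {n : ℕ} {p : ℝ} (hp0 : 0 ≤ p) (hp1 : p ≤ 1) (C : Finset (Fin n → Bool)) :
    0 ≤ PeCode n p C := by
  refine Real.sInf_nonneg ?_
  rintro _ ⟨dec, _, rfl⟩
  exact mul_nonneg (by positivity) (sum_nonneg fun x _ => sum_nonneg fun y _ =>
    bscProb_nonneg hp0 hp1 x y)

theorem klBin_nonneg {r p : ℝ} (hr0 : 0 ≤ r) (hr1 : r ≤ 1) (hp0 : 0 < p) (hp1 : p < 1) :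
    0 ≤ klBin r p := by
  have := phi_le_cross hr0 hr1 hp0 hp1
  rw [phi, div_one, one_mul] at this
  rw [klBin]; linarith

theorem shell_prob_ge {p ρ : ℝ} (hp0 : 0 < p) (hp : p < 1 / 2) (hρ0 : 0 < ρ) (hρ : ρ < 1 / 2)
    (n : ℕ) :
    p * Real.exp (-(Real.log 2 / (1 / 2 - ρ))) * Real.exp (-(n * klBin ρ p)) ≤
      (n + 1) * (p ^ ⌈ρ * n⌉₊ * (1 - p) ^ (n - ⌈ρ * n⌉₊) * n.choose ⌈ρ * n⌉₊) := by
  have hpm : 0 ≤ ρ * n := by positivity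
  have hc := Nat.ceil_lt_add_one hpm
  have hk : ⌈ρ * n⌉₊ ≤ n := Nat.ceil_le.2 (by nlinarith [Nat.cast_nonneg (α := ℝ) n])
  have h1 := exp_phi_le_choose n _ hk
  have h2 := phi_ceil_ge hρ0 hρ n
  set k := ⌈ρ * n⌉₊
  have hq : 0 < 1 - p := by linarith
  have e1 : p ^ k * (1 - p) ^ (n - k) = Real.exp (k * Real.log p + (n - k) * Real.log (1 - p)) := by
    rw [Real.exp_add, mul_comm (k:ℝ), mul_comm ((n:ℝ) - k), Real.exp_mul, Real.exp_log hp0,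
      Real.rpow_natCast, Real.exp_mul, Real.exp_log hq, ← Nat.cast_sub hk, Real.rpow_natCast]
  have h3 : -(n * (klBin ρ p + Real.binEntropy ρ)) + Real.log p ≤
      k * Real.log p + (n - k) * Real.log (1 - p) := by
    have h5 : Real.log p ≤ Real.log (1 - p) := Real.log_le_log hp0 (by linarith)
    have h6 : Real.log (1 - p) ≤ 0 := Real.log_nonpos hq.le (by linarith)
    rw [klBin]
    nlinarith
  calc _ = Real.exp (-(n * (klBin ρ p + Real.binEntropy ρ)) + Real.log p) *
        Real.exp (n * Real.binEntropy ρ - Real.log 2 / (1 / 2 - ρ)) := by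
        rw [Real.exp_add, Real.exp_log hp0, mul_comm _ p, mul_assoc, mul_assoc, ← Real.exp_add,
          ← Real.exp_add]
        congr 2; ring
    _ ≤ (p ^ k * (1 - p) ^ (n - k)) * ((n + 1) * n.choose k) := by
        rw [e1]
        gcongr
        exact (Real.exp_le_exp.2 h2).trans h1
    _ = _ := by ring

set_option maxHeartbeats 1000000 in
theorem ErrorLowerBound.straight_line {p ρ θ R₁ X₁ R : ℝ} (hp0 : 0 < p) (hp : p < 1 / 2)
    (hρ0 : 0 < ρ) (hρ : ρ < 1 / 2) (hθ0 : 0 ≤ θ) (hθ1 : θ < 1) (hX₁ : 0 ≤ X₁)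
    (h : ErrorLowerBound p R₁ X₁)
    (hR : θ * (Real.log 2 - Real.binEntropy ρ) + (1 - θ) * R₁ < R) :
    ErrorLowerBound p R (θ * klBin ρ p + (1 - θ) * X₁) := by
  intro ε hε
  have hkl : 0 ≤ klBin ρ p := klBin_nonneg hρ0.le (by linarith) hp0 (by linarith)
  have hHlt : Real.binEntropy ρ < Real.log 2 := by
    rcases lt_or_eq_of_le (Real.binEntropy_le_log_two (p := ρ)) with h | h
    · exact h
    · rw [Real.binEntropy_eq_log_two] at h; norm_num at h; linarith
  set r0 := R - (θ * (Real.log 2 - Real.binEntropy ρ) + (1 - θ) * R₁) with hr0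
  have hr0' : 0 < r0 := by linarith
  set Cρ := Real.log 2 / (1 / 2 - ρ) with hCρ
  have hl2 := Real.log_pos one_lt_two
  have hCρ0 : 0 ≤ Cρ := div_nonneg hl2.le (by linarith)
  obtain ⟨N1, hN1⟩ := h (ε / 2) (by positivity)
  -- eventually the junk terms are small
  set A1 := Real.exp (-Cρ) / (2 * Real.exp (Real.log 2 + |R₁|)) with hA1
  obtain ⟨N2, hN2⟩ := exists_poly_ge_exp (A := A1) (by positivity) 1 hr0'
  set A2 := p * Real.exp (-Cρ) * Real.exp (-(X₁ + ε / 2)) / 4 with hA2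
  obtain ⟨N3, hN3⟩ := exists_poly_ge_exp (A := A2) (by positivity) 1 (by positivity : 0 < ε / 2)
  obtain ⟨N4, hN4⟩ := exists_nat_ge ((N1 + 1 : ℝ) / (1 - θ))
  refine ⟨max (max N2 N3) (max N4 1), fun n hn C hC => ?_⟩
  have hnN2 : N2 ≤ n := le_trans (by simp) hn
  have hnN3 : N3 ≤ n := le_trans (by simp) hn
  have hnN4 : N4 ≤ n := le_trans (by simp) hn
  have hn1 : 1 ≤ n := le_trans (by simp) hn
  have hn0 : (0:ℝ) < n := by exact_mod_cast hn1
  have hCpos : (0:ℝ) < C.card := (Real.exp_pos _).trans_le hC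
  have hCne : C.Nonempty := card_pos.1 (by exact_mod_cast hCpos)
  obtain ⟨n₁, hn₁⟩ : ∃ n₁, n₁ = ⌊θ * n⌋₊ := ⟨_, rfl⟩
  have hn₁a : (n₁:ℝ) ≤ θ * n := by rw [hn₁]; exact Nat.floor_le (by positivity)
  have hn₁b : θ * n < n₁ + 1 := by rw [hn₁]; exact Nat.lt_floor_add_one _
  have hn₁n : n₁ ≤ n := by
    have : (n₁:ℝ) ≤ n := hn₁a.trans (by nlinarith)
    exact_mod_cast this
  obtain ⟨n₂, rfl⟩ := Nat.exists_eq_add_of_le hn₁n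
  push_cast at *
  have hn₂N1 : N1 ≤ n₂ := by
    have h1 : (N1 + 1 : ℝ) / (1 - θ) ≤ n₁ + n₂ := hN4.trans (by exact_mod_cast hnN4)
    rw [div_le_iff₀ (by linarith)] at h1
    have : (N1:ℝ) ≤ n₂ := by nlinarith
    exact_mod_cast this
  have hbase : ∀ C₂ : Finset (Fin n₂ → Bool), C₂.Nonempty → Real.exp (R₁ * n₂) ≤ C₂.card →
      Real.exp (-(n₂ * (X₁ + ε / 2))) / 2 ≤ PeCode n₂ p C₂ := fun C₂ _ hcard =>
    le_trans (by linarith [Real.exp_pos (-(n₂ * (X₁ + ε / 2)))]) (hN1 n₂ hn₂N1 C₂ hcard)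
  have hε1 : Real.exp (-(n₂ * (X₁ + ε / 2))) / 2 ≤ 1 / 2 := by
    have : Real.exp (-(n₂ * (X₁ + ε / 2))) ≤ 1 := Real.exp_le_one_iff.2 (by
      have : 0 ≤ (n₂:ℝ) * (X₁ + ε / 2) := by positivity
      linarith)
    linarith
  have main := PeCode_append_ge (n₁ := n₁) hp0.le (by linarith : p ≤ 1) (by positivity) hε1
    (Real.exp_pos _).le hbase hCne ⌈ρ * n₁⌉₊
  refine le_trans ?_ main
  have hsh := shell_prob_ge hp0 hp hρ0 hρ n₁
  have hk : ⌈ρ * n₁⌉₊ ≤ n₁ := Nat.ceil_le.2 (by nlinarith [Nat.cast_nonneg (α := ℝ) n₁])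
  have hch := (Real.exp_le_exp.2 (phi_ceil_ge hρ0 hρ n₁)).trans (exp_phi_le_choose n₁ _ hk)
  set k := ⌈ρ * n₁⌉₊
  set P := p ^ k * (1 - p) ^ (n₁ - k) with hP
  have hP0 : 0 ≤ P := mul_nonneg (pow_nonneg hp0.le _) (pow_nonneg (by linarith) _)
  have hhalf : 2 ^ n₁ * Real.exp (R₁ * n₂) / C.card ≤ (n₁.choose k : ℝ) / 2 := by
    have h1 := hN2 _ hnN2
    push_cast at h1
    rw [pow_one, le_div_iff₀ (by positivity), hA1, le_div_iff₀ (by positivity)] at h1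
    have e2 : (2:ℝ) ^ n₁ = Real.exp (n₁ * Real.log 2) := by
      rw [mul_comm, Real.exp_mul, Real.exp_log (by norm_num), Real.rpow_natCast]
    have h2 : (n₁:ℝ) * Real.log 2 + R₁ * n₂ - R * (n₁ + n₂) ≤
        n₁ * Real.binEntropy ρ - (n₁ + n₂) * r0 + (Real.log 2 + |R₁|) := by
      have : (n₁ + n₂) * r0 = R * (n₁ + n₂) - ((θ * (n₁ + n₂)) * (Real.log 2 - Real.binEntropy ρ) +
        (n₁ + n₂ - θ * (n₁ + n₂)) * R₁) := by rw [hr0]; ring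
      rw [this]
      have hH0 : 0 < Real.binEntropy ρ := Real.binEntropy_pos hρ0 (by linarith)
      obtain ⟨t, ht⟩ : ∃ t, t = θ * (n₁ + n₂) - n₁ := ⟨_, rfl⟩
      have ht0 : 0 ≤ t := by linarith
      have ht1 : t ≤ 1 := by linarith
      rw [show θ * ((n₁:ℝ) + n₂) = n₁ + t by linarith]

      have h4 : t * R₁ ≤ |R₁| := by
        have h6 : t * R₁ ≤ t * |R₁| := mul_le_mul_of_nonneg_left (le_abs_self _) ht0
        have h7 : t * |R₁| ≤ |R₁| := mul_le_of_le_one_left (abs_nonneg _) ht1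
        linarith
      have h5 : 0 ≤ t * (Real.log 2 - Real.binEntropy ρ) := mul_nonneg ht0 (by linarith)
      rw [show (n₁:ℝ) + n₂ - (n₁ + t) = n₂ - t by ring, add_mul, sub_mul]
      linarith
    have h3 : 2 ^ n₁ * Real.exp (R₁ * n₂) / C.card ≤
        Real.exp (n₁ * Real.log 2 + R₁ * n₂ - R * (n₁ + n₂)) := by
      rw [div_le_iff₀ hCpos, e2, ← Real.exp_add]
      calc _ = Real.exp (n₁ * Real.log 2 + R₁ * n₂ - R * (n₁ + n₂)) * Real.exp (R * (n₁ + n₂)) := by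
            rw [← Real.exp_add]; congr 1; ring
        _ ≤ _ := by gcongr
    have h4 : Real.exp (n₁ * Real.binEntropy ρ - (n₁ + n₂) * r0 + (Real.log 2 + |R₁|)) * (2 * (n₁ + n₂ + 1)) ≤
        Real.exp (n₁ * Real.binEntropy ρ - Cρ) := by
      rw [sub_eq_add_neg, sub_eq_add_neg, Real.exp_add, Real.exp_add, Real.exp_add _ (-Cρ)]
      calc _ = Real.exp (n₁ * Real.binEntropy ρ) * (Real.exp (-((n₁ + n₂) * r0)) * (n₁ + n₂ + 1) *
            (2 * Real.exp (Real.log 2 + |R₁|))) := by ring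
        _ ≤ _ := by gcongr
    have h6 := Real.exp_le_exp.2 h2
    set Y := Real.exp (n₁ * Real.log 2 + R₁ * n₂ - R * (n₁ + n₂))
    have hn₁0 : (0:ℝ) ≤ n₁ := n₁.cast_nonneg
    have hn₂0 : (0:ℝ) ≤ n₂ := n₂.cast_nonneg
    have h7 : Y * (2 * (n₁ + n₂ + 1)) ≤ (n₁ + 1) * n₁.choose k :=
      ((mul_le_mul_of_nonneg_right h6 (by positivity)).trans h4).trans hch
    have h8 : (n₁ + 1) * (n₁.choose k : ℝ) ≤ (n₁ + n₂ + 1) * n₁.choose k := by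
      gcongr; linarith
    have h9 : (2 * Y) * (n₁ + n₂ + 1) ≤ n₁.choose k * (n₁ + n₂ + 1) := by linarith
    have := le_of_mul_le_mul_right h9 (by positivity)
    linarith
  have hPch : p * Real.exp (-Cρ) * Real.exp (-(n₁ * klBin ρ p)) / (n₁ + n₂ + 1) ≤ P * n₁.choose k := by
    rw [div_le_iff₀ (by positivity)]
    refine hsh.trans ?_
    rw [mul_comm]
    have : (0:ℝ) ≤ n₂ := n₂.cast_nonneg
    gcongr
    linarith
  have h1 := hN3 _ hnN3
  push_cast at h1
  rw [pow_one] at h1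
  calc Real.exp (-((n₁ + n₂) * (θ * klBin ρ p + (1 - θ) * X₁ + ε)))
      = Real.exp (-((n₁ + n₂) * (θ * klBin ρ p + (1 - θ) * (X₁ + ε / 2) + θ * (ε / 2)))) *
        Real.exp (-((n₁ + n₂) * (ε / 2))) := by rw [← Real.exp_add]; congr 1; ring
    _ ≤ (Real.exp (-(n₁ * klBin ρ p)) * Real.exp (-(n₂ * (X₁ + ε / 2))) * Real.exp (X₁ + ε / 2)) *
        (A2 / (n₁ + n₂ + 1)) := by
        gcongr
        rw [← Real.exp_add, ← Real.exp_add, Real.exp_le_exp]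
        have a1 : n₁ * klBin ρ p ≤ θ * (n₁ + n₂) * klBin ρ p := by gcongr
        have a2 : n₂ * (X₁ + ε / 2) ≤ ((1 - θ) * (n₁ + n₂) + 1) * (X₁ + ε / 2) := by
          gcongr; linarith
        have a3 : 0 ≤ (n₁ + n₂) * (θ * (ε / 2)) := by positivity
        nlinarith
    _ = (p * Real.exp (-Cρ) * Real.exp (-(n₁ * klBin ρ p)) / (n₁ + n₂ + 1)) *
        (Real.exp (-(n₂ * (X₁ + ε / 2))) / 2) * (1 / 2) := by
        rw [hA2]
        have : Real.exp (X₁ + ε / 2) * Real.exp (-(X₁ + ε / 2)) = 1 := by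
          rw [← Real.exp_add, add_neg_cancel, Real.exp_zero]
        generalize Real.exp (X₁ + ε / 2) = u at this ⊢
        generalize Real.exp (-(X₁ + ε / 2)) = w at this ⊢
        field_simp
        linear_combination 4 * this
    _ ≤ (P * n₁.choose k) * (Real.exp (-(n₂ * (X₁ + ε / 2))) / 2) * (1 / 2) := by gcongr
    _ = P * (Real.exp (-(n₂ * (X₁ + ε / 2))) / 2 * (n₁.choose k / 2)) := by ring
    _ ≤ _ := by
        gcongr
        linarith

/-- Sphere packing bound. -/
theorem errorLowerBound_sphere_packing {p ρ R : ℝ} (hp0 : 0 < p) (hp : p < 1 / 2)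
    (hρ0 : 0 < ρ) (hρ : ρ < 1 / 2) (hR : Real.log 2 - Real.binEntropy ρ < R) :
    ErrorLowerBound p R (klBin ρ p) := by
  have h0 : ErrorLowerBound p (Real.log 2 + 1) 0 := by
    intro ε hε
    refine ⟨1, fun n hn C hC => ?_⟩
    exfalso
    have h1 : (C.card : ℝ) ≤ 2 ^ n := by
      have := card_le_univ C
      rw [Fintype.card_fun, Fintype.card_bool, Fintype.card_fin] at this
      exact_mod_cast this
    have h2 : (2:ℝ) ^ n < Real.exp ((Real.log 2 + 1) * n) := by
      rw [Real.exp_mul, Real.rpow_natCast]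
      refine pow_lt_pow_left₀ ?_ (by norm_num) (by omega)
      rw [Real.exp_add, Real.exp_log (by norm_num)]
      have := Real.add_one_lt_exp (one_ne_zero (α := ℝ))
      linarith
    linarith
  set A := Real.log 2 - Real.binEntropy ρ with hA
  have hH : 0 ≤ Real.binEntropy ρ := Real.binEntropy_nonneg hρ0.le (by linarith)
  obtain ⟨δ, hδ0, hδ1, hδ⟩ : ∃ δ : ℝ, 0 < δ ∧ δ ≤ 1 ∧ δ * (Real.binEntropy ρ + 1) < R - A := by
    refine ⟨min 1 ((R - A) / 2 / (Real.binEntropy ρ + 1)), by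
      have : 0 < R - A := by linarith
      positivity, min_le_left _ _, ?_⟩
    have : 0 < R - A := by linarith
    calc _ ≤ (R - A) / 2 / (Real.binEntropy ρ + 1) * (Real.binEntropy ρ + 1) := by
          gcongr; exact min_le_right _ _
      _ = (R - A) / 2 := by field_simp
      _ < _ := by linarith
  have := ErrorLowerBound.straight_line (θ := 1 - δ) (R := R) hp0 hp hρ0 hρ (by linarith) (by linarith) le_rfl h0
    (by rw [← hA]; have : Real.log 2 = A + Real.binEntropy ρ := by rw [hA]; ring
        rw [this]; linarith)
  refine this.mono ?_
  have hkl : 0 ≤ klBin ρ p := klBin_nonneg hρ0.le (by linarith) hp0 (by linarith)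
  nlinarith

theorem PeCode_le_one {n : ℕ} {p : ℝ} (hp0 : 0 ≤ p) (hp1 : p ≤ 1) (C : Finset (Fin n → Bool)) :
    PeCode n p C ≤ 1 := by
  rcases C.eq_empty_or_nonempty with rfl | ⟨x₀, hx₀⟩
  · rw [PeCode]
    convert zero_le_one (α := ℝ)
    convert Real.sInf_empty
    ext e
    simp
  · refine (PeCode_le hp0 hp1 (fun _ => x₀) fun _ => hx₀).trans ?_
    have hpos : (0:ℝ) < C.card := by exact_mod_cast card_pos.2 ⟨x₀, hx₀⟩
    rw [inv_mul_eq_div, div_le_one hpos]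
    calc _ ≤ ∑ x ∈ C, (1:ℝ) := by
          refine sum_le_sum fun x _ => ?_
          rw [← sum_bscProb p x]
          exact sum_le_sum_of_subset_of_nonneg (subset_univ _)
            fun y _ _ => bscProb_nonneg hp0 hp1 x y
      _ = C.card := by simp

theorem reliability_le_of_errorLowerBound {p R X : ℝ} (hp0 : 0 < p) (hp : p < 1 / 2)
    (hX : 0 ≤ X) (h : ErrorLowerBound p (R * Real.log 2) X) :
    reliability p R ≤ X / Real.log 2 := by
  have hl2 := Real.log_pos one_lt_two
  refine le_of_forall_pos_le_add fun ε hε => ?_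
  obtain ⟨N, hN⟩ := h (ε * Real.log 2) (by positivity)
  have hcob : IsCoboundedUnder (· ≤ ·) atTop (fun n : ℕ =>
    sSup {e : ℝ | ∃ C : Finset (Fin n → Bool), (2 : ℝ) ^ (R * n) ≤ (C.card : ℝ) ∧
      e = (n : ℝ)⁻¹ * Real.logb 2 (1 / PeCode n p C)}) := by
    refine isCoboundedUnder_le_of_le atTop (x := 0) fun n => Real.sSup_nonneg ?_
    rintro _ ⟨C, _, rfl⟩
    refine mul_nonneg (by positivity) ?_
    have h0 := PeCode_nonneg hp0.le (by linarith : p ≤ 1) C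
    rcases h0.eq_or_lt with h0 | h0
    · rw [← h0]; simp
    · refine Real.logb_nonneg one_lt_two ?_
      rw [le_div_iff₀ h0, one_mul]
      exact PeCode_le_one hp0.le (by linarith) C
  refine limsup_le_of_le hcob ?_
  filter_upwards [eventually_ge_atTop N, eventually_gt_atTop 0] with n hn hn0
  have hn0' : (0:ℝ) < n := by exact_mod_cast hn0
  refine Real.sSup_le ?_ (by positivity)
  rintro _ ⟨C, hC, rfl⟩
  rw [show (2:ℝ) ^ (R * n) = Real.exp (R * Real.log 2 * n) by
    rw [Real.rpow_def_of_pos (by norm_num)]; congr 1; ring] at hC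
  have h1 := hN n hn C hC
  have h2 : 0 < PeCode n p C := (Real.exp_pos _).trans_le h1
  have h3 := (Real.le_log_iff_exp_le h2).2 h1
  rw [one_div, Real.logb_inv, Real.logb, inv_mul_le_iff₀ hn0', ← neg_div, div_le_iff₀ hl2]
  have : n * (X / Real.log 2 + ε) * Real.log 2 = n * (X + ε * Real.log 2) := by field_simp
  rw [this]; linarith

theorem overlapExp_eq {p ω l η : ℝ} (hω : ω < 1) (hlω : l ≤ ω) (hω2 : ω ≤ 1 / 2) :
    -ω - (1 - ω) * binEnt p + (l * binEnt (2 * η / l)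
        + (ω - l / 2) * binEnt ((ω - 2 * η) / (2 * ω - l))
        + (1 - ω - l / 2) * binEnt ((p * (1 - ω) - η) / (1 - ω - l / 2))) =
      overlapExp p ω l η / Real.log 2 := by
  have hl2 := Real.log_pos one_lt_two
  rw [overlapExp, phi, phi, phi]
  simp only [binEnt_eq_binEntropy_div]
  have e1 : η / (l / 2) = 2 * η / l := by rw [div_div_eq_mul_div]; ring
  have e2 : (ω / 2 - η) / (ω - l / 2) = (ω - 2 * η) / (2 * ω - l) := by
    rw [← mul_div_mul_left _ _ (two_ne_zero (α := ℝ))]; congr 1 <;> ring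
  rw [e1, e2]
  field_simp
  ring_nf

theorem overlapExp_reflect_le {p ω l η : ℝ} (hp : p < 1 / 2) (hω : ω ≤ 1 / 2) (h : l / 4 ≤ η)
    (h3 : η ≤ p * (1 - ω)) : overlapExp p ω l η ≤ overlapExp p ω l (l / 2 - η) := by
  rw [overlapExp, overlapExp]
  have a1 : phi (l / 2) η = phi (l / 2) (l / 2 - η) := (phi_symm _ _).symm
  have a2 : phi (ω - l / 2) (ω / 2 - η) = phi (ω - l / 2) (ω / 2 - (l / 2 - η)) := by
    rw [← phi_symm]; congr 1; ring
  have a3 : phi (1 - ω - l / 2) (p * (1 - ω) - η) ≤ phi (1 - ω - l / 2) (p * (1 - ω) - (l / 2 - η)) :=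
    phi_mono_right (by linarith) (by linarith) (by nlinarith)
  rw [a1, a2]; linarith

theorem overlapExp_le_of_lt {p ω l η : ℝ} (hp0 : 0 < p) (hp : p < 1 / 2) (hl : 0 < l) (hlω : l ≤ ω)
    (hω : ω ≤ 1 / 2) (hη0 : 0 ≤ η) (h : η ≤ l * p / 2) :
    overlapExp p ω l η ≤ overlapExp p ω l (l * p / 2) := by
  rw [overlapExp, overlapExp]
  have hlp : l * p / 2 ≤ l / 4 := by nlinarith
  have a1 : phi (l / 2) η ≤ η * (-Real.log p) + (l / 2 - η) * (-Real.log (1 - p)) :=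
    phi_le_cross hη0 (by linarith) hp0 (by linarith)
  have b1 : phi (l / 2) (l * p / 2) = l / 2 * Real.binEntropy p := by
    rw [← phi_mul_right]; congr 1; ring
  have a2 : phi (ω - l / 2) (ω / 2 - η) ≤ phi (ω - l / 2) (ω / 2 - l * p / 2) := by
    rw [← phi_symm, ← phi_symm _ (ω / 2 - l * p / 2)]
    exact phi_mono_right (by linarith) (by linarith) (by linarith)
  have a3 : phi (1 - ω - l / 2) (p * (1 - ω) - η) ≤ (p * (1 - ω) - η) * (-Real.log p) +
      (1 - ω - l / 2 - (p * (1 - ω) - η)) * (-Real.log (1 - p)) :=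
    phi_le_cross (by nlinarith) (by nlinarith) hp0 (by linarith)
  have b3 : phi (1 - ω - l / 2) (p * (1 - ω) - l * p / 2) = (1 - ω - l / 2) * Real.binEntropy p := by
    rw [← phi_mul_right]; congr 1; ring
  rw [b1, b3]
  have hH : Real.binEntropy p = p * (-Real.log p) + (1 - p) * (-Real.log (1 - p)) := by
    rw [Real.binEntropy, Real.log_inv, Real.log_inv]
  rw [hH]
  have hS : Real.log p ≤ Real.log (1 - p) := Real.log_le_log hp0 (by linarith)
  nlinarith [mul_nonneg (by linarith : 0 ≤ l * p / 2 - η) (sub_nonneg.2 hS)]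

theorem overlapBound_sSup {p δ : ℝ} (hp0 : 0 < p) (hp : p < 1 / 2) (hδ0 : 0 ≤ δ) (hδ : δ ≤ 1 / 2) :
    0 ≤ sSup {e : ℝ | ∃ l ω : ℝ, 0 ≤ l ∧ l ≤ ω ∧ ω ≤ δ ∧ e = Bexp p ω l - Aexp p l} ∧
    OverlapBound p δ (Real.log 2 *
      sSup {e : ℝ | ∃ l ω : ℝ, 0 ≤ l ∧ l ≤ ω ∧ ω ≤ δ ∧ e = Bexp p ω l - Aexp p l}) := by
  have hl2 := Real.log_pos one_lt_two
  have hc := bhat_pos hp0 hp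
  have hA : ∀ l, Aexp p l = -(bhat p * l) / Real.log 2 := by
    intro l; rw [Aexp, Real.logb, bhat]; ring
  have hnp : ∀ l ω η, 0 ≤ l → l ≤ ω → ω ≤ δ → l * p / 2 ≤ η → η ≤ l / 4 → η ≤ p * (1 - ω) →
      overlapExp p ω l η ≤ 0 := by
    intro l ω η h0 h1 h2 h3 h4 h5
    have hη : 0 ≤ η := le_trans (by positivity) h3
    exact overlapExp_nonpos hη (by linarith) (by linarith) (by linarith) h5
      (by nlinarith)
  have hset : ∀ l ω, 0 ≤ l → l ≤ ω → ω ≤ δ → Bexp p ω l = sSup ((fun η => overlapExp p ω l η / Real.log 2) ''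
      Set.Icc (l * p / 2) (min (l / 4) (p * (1 - ω)))) := by
    intro l ω h0 h1 h2
    have hne : (Set.Icc (l * p / 2) (min (l / 4) (p * (1 - ω)))).Nonempty :=
      ⟨l * p / 2, le_rfl, le_min (by nlinarith) (by nlinarith)⟩
    have hfun : (fun η => overlapExp p ω l η / Real.log 2) = (fun η => -ω - (1 - ω) * binEnt p +
        (l * binEnt (2 * η / l)
        + (ω - l / 2) * binEnt ((ω - 2 * η) / (2 * ω - l))
        + (1 - ω - l / 2) * binEnt ((p * (1 - ω) - η) / (1 - ω - l / 2)))) := by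
      funext η; exact (overlapExp_eq (by linarith) h1 (by linarith)).symm
    have hbd : BddAbove ((fun η => l * binEnt (2 * η / l)
        + (ω - l / 2) * binEnt ((ω - 2 * η) / (2 * ω - l))
        + (1 - ω - l / 2) * binEnt ((p * (1 - ω) - η) / (1 - ω - l / 2))) ''
        Set.Icc (l * p / 2) (min (l / 4) (p * (1 - ω)))) := by
      refine ⟨-(-ω - (1 - ω) * binEnt p), ?_⟩
      rintro _ ⟨η, ⟨a, b⟩, rfl⟩
      have h3 := div_nonpos_of_nonpos_of_nonneg (hnp l ω η h0 h1 h2 a (b.trans (min_le_left _ _))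
        (b.trans (min_le_right _ _))) hl2.le
      rw [← overlapExp_eq (by linarith) h1 (by linarith)] at h3
      simp only
      linarith
    rw [hfun, Bexp]
    apply le_antisymm
    · rw [← le_sub_iff_add_le']
      refine csSup_le (hne.image _) ?_
      rintro _ ⟨η, hη, rfl⟩
      rw [le_sub_iff_add_le']
      refine le_csSup ⟨0, ?_⟩ ⟨η, hη, rfl⟩
      rintro _ ⟨η', hη', rfl⟩
      have h3 := div_nonpos_of_nonpos_of_nonneg (hnp l ω η' h0 h1 h2 hη'.1
        (hη'.2.trans (min_le_left _ _)) (hη'.2.trans (min_le_right _ _))) hl2.le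
      rwa [← overlapExp_eq (by linarith) h1 (by linarith)] at h3
    · refine csSup_le (hne.image _) ?_
      rintro _ ⟨η, hη, rfl⟩
      have := le_csSup hbd ⟨η, hη, rfl⟩
      simp only at this ⊢
      linarith
  have hB0 : ∀ l ω, 0 ≤ l → l ≤ ω → ω ≤ δ → Bexp p ω l ≤ 0 := by
    intro l ω h0 h1 h2
    rw [hset l ω h0 h1 h2]
    refine Real.sSup_nonpos ?_
    rintro _ ⟨η, hη, rfl⟩
    obtain ⟨a, b⟩ := hη
    exact div_nonpos_of_nonpos_of_nonneg (hnp l ω η h0 h1 h2 a (b.trans (min_le_left _ _))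
      (b.trans (min_le_right _ _))) hl2.le
  have hbdd : BddAbove {e : ℝ | ∃ l ω : ℝ, 0 ≤ l ∧ l ≤ ω ∧ ω ≤ δ ∧ e = Bexp p ω l - Aexp p l} := by
    refine ⟨bhat p * δ / Real.log 2, ?_⟩
    rintro _ ⟨l, ω, h0, h1, h2, rfl⟩
    have := hB0 l ω h0 h1 h2
    have h3 : bhat p * l / Real.log 2 ≤ bhat p * δ / Real.log 2 := by gcongr; linarith
    rw [hA, neg_div]; linarith
  have hge : ∀ l ω η, 0 ≤ l → l ≤ ω → ω ≤ δ → l * p / 2 ≤ η → η ≤ l / 4 → η ≤ p * (1 - ω) →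
      overlapExp p ω l η + bhat p * l ≤ Real.log 2 *
      sSup {e : ℝ | ∃ l ω : ℝ, 0 ≤ l ∧ l ≤ ω ∧ ω ≤ δ ∧ e = Bexp p ω l - Aexp p l} := by
    intro l ω η h0 h1 h2 h3 h4 h5
    have a : overlapExp p ω l η / Real.log 2 ≤ Bexp p ω l := by
      rw [hset l ω h0 h1 h2]
      refine le_csSup ⟨0, ?_⟩ ⟨η, ⟨h3, le_min h4 h5⟩, rfl⟩
      rintro _ ⟨η', ⟨a, b⟩, rfl⟩
      exact div_nonpos_of_nonpos_of_nonneg (hnp l ω η' h0 h1 h2 a (b.trans (min_le_left _ _))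
        (b.trans (min_le_right _ _))) hl2.le
    have b := le_csSup hbdd ⟨l, ω, h0, h1, h2, rfl⟩
    rw [hA, neg_div] at b
    have e : overlapExp p ω l η + bhat p * l = Real.log 2 * (overlapExp p ω l η / Real.log 2 -
      -(bhat p * l / Real.log 2)) := by field_simp; ring
    rw [e]
    gcongr
    linarith
  constructor
  · have := hge 0 0 0 le_rfl le_rfl hδ0 (by simp) (by simp) (by simpa using hp0.le)
    have e : overlapExp p 0 0 0 = 0 := by
      rw [overlapExp]
      simp only [zero_div, sub_zero, mul_one, phi_zero_left]
      rw [← mul_one p, phi_mul_right]; simp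
    rw [e, mul_zero, add_zero] at this
    exact nonneg_of_mul_nonneg_right this hl2
  · intro ω l η hl hlω hω hη hηl h3
    have key : ∀ η, 0 ≤ η → η ≤ l / 4 → η ≤ p * (1 - ω) → overlapExp p ω l η + bhat p * l ≤ Real.log 2 *
      sSup {e : ℝ | ∃ l ω : ℝ, 0 ≤ l ∧ l ≤ ω ∧ ω ≤ δ ∧ e = Bexp p ω l - Aexp p l} := by
      intro η h0 h1 h2
      rcases le_total (l * p / 2) η with h | h
      · exact hge l ω η hl.le hlω hω h h1 h2
      · have a := overlapExp_le_of_lt hp0 hp hl hlω (by linarith) h0 h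
        have b := hge l ω (l * p / 2) hl.le hlω hω le_rfl (by nlinarith) (by nlinarith)
        linarith
    rcases le_total η (l / 4) with h | h
    · exact key η hη h h3
    · have a := overlapExp_reflect_le hp (by linarith) h h3
      have b := key (l / 2 - η) (by linarith) (by linarith) (by linarith)
      linarith

theorem continuous_Gfun : Continuous fun x : ℝ × ℝ => Gfun x.1 x.2 := by
  unfold Gfun
  refine Continuous.div (by fun_prop) (by fun_prop) fun x => ?_
  have := Real.sqrt_nonneg (x.2 * (1 - x.2))
  positivity

theorem Gfun_le_Gfun {α τ α' τ' : ℝ} (hτ : 0 ≤ τ) (h1 : τ ≤ τ') (h2 : τ' ≤ α') (h3 : α' ≤ α)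
    (hα : α ≤ 1 / 2) : Gfun α' τ' ≤ Gfun α τ := by
  rw [Gfun, Gfun]
  have a : α' * (1 - α') ≤ α * (1 - α) := by nlinarith
  have b : τ * (1 - τ) ≤ τ' * (1 - τ') := by nlinarith
  have b' : τ' * (1 - τ') ≤ α' * (1 - α') := by nlinarith
  have c : Real.sqrt (τ * (1 - τ)) ≤ Real.sqrt (τ' * (1 - τ')) := Real.sqrt_le_sqrt b
  have d := Real.sqrt_nonneg (τ * (1 - τ))
  gcongr
  linarith

theorem Gfun_half_zero : Gfun (1 / 2) 0 = 1 / 2 := by norm_num [Gfun]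

theorem binEntropy_le_binEntropy {x y : ℝ} (hx : 0 ≤ x) (hxy : x ≤ y) (hy : y ≤ 1 / 2) :
    Real.binEntropy x ≤ Real.binEntropy y :=
  Real.binEntropy_strictMonoOn.monotoneOn ⟨hx, by linarith⟩ ⟨hx.trans hxy, by linarith⟩ hxy

theorem binEntropy_lt_binEntropy {x y : ℝ} (hx : 0 ≤ x) (hxy : x < y) (hy : y ≤ 1 / 2) :
    Real.binEntropy x < Real.binEntropy y :=
  Real.binEntropy_strictMonoOn ⟨hx, by linarith⟩ ⟨hx.trans hxy.le, by linarith⟩ hxy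

theorem lt_of_binEntropy_lt {x y : ℝ} (hx : x ≤ 1 / 2) (hy : 0 ≤ y)
    (h : Real.binEntropy x < Real.binEntropy y) : x < y := by
  by_contra! hc
  exact absurd (binEntropy_le_binEntropy hy hc hx) (not_le.2 h)

theorem exists_Gfun_eq_of_lt {α τ δ r : ℝ} (hτ : 0 ≤ τ) (hτα : τ ≤ α) (hα : α ≤ 1 / 2)
    (hL : Real.log 2 - Real.binEntropy α + Real.binEntropy τ < r) (hr : r ≤ Real.log 2)
    (hG : Gfun α τ ≤ δ) (hδ : δ < 1 / 2) :
    ∃ α' τ', 0 < τ' ∧ τ' < α' ∧ α' < 1 / 2 ∧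
      Real.log 2 - Real.binEntropy α' + Real.binEntropy τ' < r ∧ Gfun α' τ' = δ := by
  have hlt : τ < α := lt_of_binEntropy_lt (by linarith) (by linarith) (by linarith)
  obtain ⟨η, hη0, hη1, hη2⟩ : ∃ η, 0 < η ∧ τ + η < α - η ∧
      Real.log 2 - Real.binEntropy (α - η) + Real.binEntropy (τ + η) < r := by
    have c1 : Continuous fun η => Real.log 2 - Real.binEntropy (α - η) + Real.binEntropy (τ + η) := by
      have := Real.binEntropy_continuous
      fun_prop
    have e1 : ∀ᶠ η in nhds (0 : ℝ),
        Real.log 2 - Real.binEntropy (α - η) + Real.binEntropy (τ + η) < r :=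
      (c1.tendsto 0).eventually_lt_const (by simpa using hL)
    have c2 : Continuous fun η => (τ + η) - (α - η) := by fun_prop
    have e2 : ∀ᶠ η in nhds (0 : ℝ), (τ + η) - (α - η) < 0 :=
      (c2.tendsto 0).eventually_lt_const (by simpa using hlt)
    have e3 : ∀ᶠ η in nhdsWithin (0 : ℝ) (Set.Ioi 0), 0 < η := eventually_mem_nhdsWithin
    obtain ⟨η, h1, h2, h3⟩ := ((e1.filter_mono nhdsWithin_le_nhds).and
      ((e2.filter_mono nhdsWithin_le_nhds).and e3)).exists
    exact ⟨η, h3, by linarith, h1⟩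
  set a := α - η with ha
  set t := τ + η with ht
  have hGa : Gfun a t ≤ δ := (Gfun_le_Gfun hτ (by linarith) hη1.le (by linarith) hα).trans hG
  have hcont : ContinuousOn (fun s : ℝ => Gfun (a + (1 / 2 - a) * s) (t * (1 - s))) (Set.Icc 0 1) := by
    apply Continuous.continuousOn
    exact continuous_Gfun.comp (by fun_prop : Continuous fun s : ℝ => (a + (1 / 2 - a) * s, t * (1 - s)))
  have hivt := intermediate_value_Icc zero_le_one hcont
  obtain ⟨s, ⟨hs0, hs1⟩, hs⟩ := hivt (⟨by simpa using hGa, by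
    have : a + (1 / 2 - a) * 1 = 1 / 2 := by ring
    simp only [this, sub_self, mul_zero, Gfun_half_zero]
    exact hδ.le⟩ : δ ∈ Set.Icc _ _)
  simp only at hs
  have hs1' : s < 1 := by
    refine lt_of_le_of_ne hs1 fun h => ?_
    subst h
    have : a + (1 / 2 - a) * 1 = 1 / 2 := by ring
    rw [this, sub_self, mul_zero, Gfun_half_zero] at hs
    linarith
  have x1 : 0 < t * (1 - s) := mul_pos (by linarith) (by linarith)
  have x2 : t * (1 - s) ≤ t := by nlinarith
  have x3 : a ≤ a + (1 / 2 - a) * s := by nlinarith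
  have x4 : a + (1 / 2 - a) * s < 1 / 2 := by nlinarith
  refine ⟨_, _, x1, by linarith, x4, ?_, hs⟩
  have y1 := binEntropy_le_binEntropy x1.le x2 (by linarith)
  have y2 := binEntropy_le_binEntropy (by linarith) x3 x4.le
  linarith

theorem exists_Gfun_eq_of_le {α τ δ r : ℝ} (hτ : 0 ≤ τ) (hτα : τ ≤ α) (hα : α ≤ 1 / 2)
    (hL : Real.log 2 - Real.binEntropy α + Real.binEntropy τ ≤ r) (hr : r < Real.log 2)
    (hG : Gfun α τ < δ) (hδ : δ < 1 / 2) :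
    ∃ α' τ', 0 < τ' ∧ τ' < α' ∧ α' < 1 / 2 ∧
      Real.log 2 - Real.binEntropy α' + Real.binEntropy τ' < r ∧ Gfun α' τ' = δ := by
  have hlt : τ < α := lt_of_binEntropy_lt (by linarith) (by linarith) (by linarith)
  obtain ⟨s, hs0, hs1, hs⟩ : ∃ s, 0 < s ∧ s < 1 ∧ Gfun (α + (1 / 2 - α) * s) (τ * (1 - s)) < δ := by
    have c1 : Continuous fun s : ℝ => Gfun (α + (1 / 2 - α) * s) (τ * (1 - s)) :=
      continuous_Gfun.comp (by fun_prop : Continuous fun s : ℝ => (α + (1 / 2 - α) * s, τ * (1 - s)))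
    have e1 : ∀ᶠ s in nhds (0 : ℝ), Gfun (α + (1 / 2 - α) * s) (τ * (1 - s)) < δ :=
      (c1.tendsto 0).eventually_lt_const (by simpa using hG)
    have e2 : ∀ᶠ s in nhds (0 : ℝ), s < 1 := eventually_lt_nhds zero_lt_one
    have e3 : ∀ᶠ η in nhdsWithin (0 : ℝ) (Set.Ioi 0), 0 < η := eventually_mem_nhdsWithin
    obtain ⟨η, h1, h2, h3⟩ := ((e1.filter_mono nhdsWithin_le_nhds).and
      ((e2.filter_mono nhdsWithin_le_nhds).and e3)).exists
    exact ⟨η, h3, h2, h1⟩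
  have x1 : 0 ≤ τ * (1 - s) := mul_nonneg hτ (by linarith)
  have x2 : τ * (1 - s) ≤ τ := by nlinarith
  have x3 : α ≤ α + (1 / 2 - α) * s := by nlinarith
  have x4 : α + (1 / 2 - α) * s ≤ 1 / 2 := by nlinarith
  refine exists_Gfun_eq_of_lt x1 (by linarith) x4 ?_ hr.le hs.le hδ
  have y1 := binEntropy_le_binEntropy x1 x2 (by linarith)
  have y2 := binEntropy_le_binEntropy (by linarith) x3 x4
  rcases eq_or_lt_of_le hα with h | h
  · rcases eq_or_lt_of_le hτ with h' | h'
    · rw [← h', h, Gfun_half_zero] at hG; linarith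
    · have := binEntropy_lt_binEntropy x1 (by nlinarith : τ * (1 - s) < τ) (by linarith)
      linarith
  · have := binEntropy_lt_binEntropy (by linarith) (by nlinarith : α < α + (1 / 2 - α) * s) x4
    linarith

theorem exists_binEntropy_eq {y : ℝ} (h0 : 0 ≤ y) (h1 : y ≤ Real.log 2) :
    ∃ t, 0 ≤ t ∧ t ≤ 1 / 2 ∧ Real.binEntropy t = y := by
  obtain ⟨t, ⟨a, b⟩, h⟩ := intermediate_value_Icc (by norm_num : (0 : ℝ) ≤ 1 / 2)
    Real.binEntropy_continuous.continuousOn (⟨by simpa using h0, by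
      have : (1 / 2 : ℝ) = 2⁻¹ := by norm_num
      rw [this, Real.binEntropy_two_inv]; exact h1⟩ : y ∈ Set.Icc _ _)
  exact ⟨t, a, b, h⟩

theorem binEntInv_eq {t y : ℝ} (h0 : 0 ≤ t) (h1 : t ≤ 1 / 2) (h : binEnt t = y) : binEntInv y = t := by
  have : {x : ℝ | x ∈ Set.Icc (0 : ℝ) (1 / 2) ∧ binEnt x = y} = {t} := by
    ext x
    simp only [Set.mem_ofPred_eq, Set.mem_singleton_iff]
    constructor
    · rintro ⟨⟨a, b⟩, hx⟩
      refine Real.binEntropy_strictMonoOn.injOn ⟨a, by linarith⟩ ⟨h0, by linarith⟩ ?_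
      rw [binEntropy_eq_binEnt_mul, binEntropy_eq_binEnt_mul, hx, h]
    · rintro rfl; exact ⟨⟨h0, h1⟩, h⟩
  rw [binEntInv, this, csInf_singleton]

theorem exists_of_mem_deltaJPL {R d : ℝ} (hR0 : 0 < R) (hR1 : R < 1)
    (h : ∃ α ∈ Set.Icc (0 : ℝ) (1 / 2),
      1 - R ≤ binEnt α ∧ d = Gfun α (binEntInv (binEnt α - 1 + R))) :
    ∃ α τ, 0 ≤ τ ∧ τ ≤ α ∧ α ≤ 1 / 2 ∧
      Real.log 2 - Real.binEntropy α + Real.binEntropy τ = R * Real.log 2 ∧ d = Gfun α τ := by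
  obtain ⟨α, ⟨ha0, ha1⟩, hα, rfl⟩ := h
  have hl2 := Real.log_pos one_lt_two
  have e := binEntropy_eq_binEnt_mul α
  have hle := Real.binEntropy_le_log_two (p := α)
  obtain ⟨t, ht0, ht1, ht⟩ := exists_binEntropy_eq (y := Real.binEntropy α - Real.log 2 + R * Real.log 2)
    (by rw [e]; nlinarith) (by nlinarith)
  have hb : binEnt t = binEnt α - 1 + R := by
    rw [binEnt_eq_binEntropy_div, binEnt_eq_binEntropy_div, ht]; field_simp
  refine ⟨α, t, ht0, ?_, ha1, by rw [ht]; ring, by rw [binEntInv_eq ht0 ht1 hb]⟩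
  exact (lt_of_binEntropy_lt ht1 ha0 (by rw [ht]; nlinarith)).le

theorem Gfun_pos {α τ : ℝ} (h : τ < α) (hα : α ≤ 1 / 2) : 0 < Gfun α τ := by
  have := Real.sqrt_nonneg (τ * (1 - τ))
  rw [Gfun]
  have : 0 < α * (1 - α) - τ * (1 - τ) := by nlinarith
  positivity

theorem Gfun_half {τ : ℝ} (h0 : 0 ≤ τ) (h1 : τ ≤ 1 / 2) :
    Gfun (1 / 2) τ = 1 / 2 - Real.sqrt (τ * (1 - τ)) := by
  have a := Real.sqrt_nonneg (τ * (1 - τ))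
  have b := Real.sq_sqrt (by nlinarith : 0 ≤ τ * (1 - τ))
  rw [Gfun]
  set σ := Real.sqrt (τ * (1 - τ))
  rw [← b]
  field_simp
  ring

theorem deltaJPL_spec {R : ℝ} (hR0 : 0 < R) (hR1 : R < 1) :
    ∃ α τ, 0 ≤ τ ∧ τ ≤ α ∧ α ≤ 1 / 2 ∧
      Real.log 2 - Real.binEntropy α + Real.binEntropy τ = R * Real.log 2 ∧
      Gfun α τ = deltaJPL R ∧ 0 < deltaJPL R ∧ deltaJPL R < 1 / 2 := by
  have hl2 := Real.log_pos one_lt_two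
  set D := {d : ℝ | ∃ α ∈ Set.Icc (0 : ℝ) (1 / 2),
    1 - R ≤ binEnt α ∧ d = Gfun α (binEntInv (binEnt α - 1 + R))} with hD
  set K := {x : ℝ × ℝ | 0 ≤ x.2 ∧ x.2 ≤ x.1 ∧ x.1 ≤ 1 / 2 ∧
    Real.log 2 - Real.binEntropy x.1 + Real.binEntropy x.2 = R * Real.log 2} with hK
  have hKc : IsCompact K := by
    have hsub : K ⊆ Set.Icc 0 (1 / 2) ×ˢ Set.Icc 0 (1 / 2) := by
      rintro ⟨a, b⟩ ⟨h1, h2, h3, -⟩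
      simp only at h1 h2 h3
      exact ⟨⟨by simp only; linarith, h3⟩, ⟨h1, by simp only; linarith⟩⟩
    refine (isCompact_Icc.prod isCompact_Icc).of_isClosed_subset ?_ hsub
    have := Real.binEntropy_continuous
    have c1 : IsClosed {x : ℝ × ℝ | 0 ≤ x.2} := isClosed_le (by fun_prop) (by fun_prop)
    have c2 : IsClosed {x : ℝ × ℝ | x.2 ≤ x.1} := isClosed_le (by fun_prop) (by fun_prop)
    have c3 : IsClosed {x : ℝ × ℝ | x.1 ≤ 1 / 2} := isClosed_le (by fun_prop) (by fun_prop)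
    have c4 : IsClosed {x : ℝ × ℝ |
        Real.log 2 - Real.binEntropy x.1 + Real.binEntropy x.2 = R * Real.log 2} :=
      isClosed_eq (by fun_prop) (by fun_prop)
    exact c1.inter (c2.inter (c3.inter c4))
  obtain ⟨t, ht0, ht1, ht⟩ := exists_binEntropy_eq (y := R * Real.log 2) (by positivity) (by nlinarith)
  have hhalf : Real.binEntropy (1 / 2) = Real.log 2 := by
    rw [one_div, Real.binEntropy_two_inv]
  have hmem : ((1 / 2 : ℝ), t) ∈ K := ⟨ht0, ht1, le_rfl, by simp only; rw [hhalf, ht]; ring⟩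
  have hDK : D = (fun x : ℝ × ℝ => Gfun x.1 x.2) '' K := by
    ext d
    constructor
    · intro h
      obtain ⟨α, τ, h1, h2, h3, h4, rfl⟩ := exists_of_mem_deltaJPL hR0 hR1 h
      exact ⟨(α, τ), ⟨h1, h2, h3, h4⟩, rfl⟩
    · rintro ⟨⟨α, τ⟩, ⟨h1, h2, h3, h4⟩, rfl⟩
      simp only at h1 h2 h3 h4
      have h0 := Real.binEntropy_nonneg h1 (by linarith : τ ≤ 1)
      refine ⟨α, ⟨by linarith, h3⟩, ?_, ?_⟩
      · rw [binEnt_eq_binEntropy_div, le_div_iff₀ hl2]; linarith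
      · simp only
        rw [binEntInv_eq h1 (by linarith) ?_]
        rw [binEnt_eq_binEntropy_div, binEnt_eq_binEntropy_div]
        field_simp
        linarith
  have hsInf : sInf D ∈ (fun x : ℝ × ℝ => Gfun x.1 x.2) '' K := by
    rw [hDK]
    exact (hKc.image continuous_Gfun).sInf_mem ⟨_, _, hmem, rfl⟩
  obtain ⟨⟨α, τ⟩, ⟨h1, h2, h3, h4⟩, h5⟩ := hsInf
  simp only at h1 h2 h3 h4 h5
  have hlt : τ < α := lt_of_binEntropy_lt (by linarith) (by linarith) (by nlinarith)
  refine ⟨α, τ, h1, h2, h3, h4, h5, ?_, ?_⟩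
  · change 0 < sInf D
    rw [← h5]; exact Gfun_pos hlt h3
  · change sInf D < 1 / 2
    refine lt_of_le_of_lt (csInf_le ?_ (?_ : Gfun (1 / 2) t ∈ D)) ?_
    · rw [hDK]; exact (hKc.image continuous_Gfun).bddBelow
    · rw [hDK]; exact ⟨_, hmem, rfl⟩
    · have htp : 0 < t := by
        rcases ht0.eq_or_lt with h | h
        · rw [← h, Real.binEntropy_zero] at ht
          have : 0 < R * Real.log 2 := by positivity
          linarith
        · exact h
      rw [Gfun_half ht0 ht1]
      have : 0 < Real.sqrt (t * (1 - t)) := Real.sqrt_pos.2 (mul_pos htp (by linarith))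
      linarith

theorem exists_sq_div {p : ℝ} (hp0 : 0 < p) (hp : p < 1 / 2) :
    ∃ x, 0 < x ∧ x < 1 ∧ p = x ^ 2 / (1 + x ^ 2) := by
  have h : 0 < p / (1 - p) := div_pos hp0 (by linarith)
  refine ⟨Real.sqrt (p / (1 - p)), Real.sqrt_pos.2 h, ?_, ?_⟩
  · rw [Real.sqrt_lt' one_pos, one_pow, div_lt_one (by linarith)]; linarith
  · rw [Real.sq_sqrt h.le]
    have : 1 - p ≠ 0 := by linarith
    field_simp
    ring

theorem bhat_eq {x : ℝ} (hx : 0 < x) :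
    bhat (x ^ 2 / (1 + x ^ 2)) = Real.log (1 + x ^ 2) - Real.log 2 - Real.log x := by
  have h : x ^ 2 / (1 + x ^ 2) * (1 - x ^ 2 / (1 + x ^ 2)) = (x / (1 + x ^ 2)) ^ 2 := by
    field_simp; ring
  rw [bhat, h, Real.sqrt_sq (by positivity), Real.log_mul (by norm_num) (by positivity),
    Real.log_div (by positivity) (by positivity)]
  ring

/-- The distance at which the union-bound exponent is critical, for `p = x² / (1 + x²)`. -/
noncomputable def critDist (x : ℝ) : ℝ := 2 * x / (1 + x) ^ 2

theorem critDist_pos {x : ℝ} (hx : 0 < x) : 0 < critDist x := by rw [critDist]; positivity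

theorem one_sub_critDist {x : ℝ} (hx : 0 < x) : 1 - critDist x = (1 + x ^ 2) / (1 + x) ^ 2 := by
  rw [critDist]; field_simp; ring

theorem critDist_lt {x : ℝ} (hx : 0 < x) (hx1 : x < 1) : critDist x < 1 / 2 := by
  rw [critDist, div_lt_div_iff₀ (by positivity) (by norm_num)]; nlinarith

theorem neg_log_critDist {x : ℝ} (hx : 0 < x) : -Real.log (critDist x) =
    -Real.log (1 - critDist x) + bhat (x ^ 2 / (1 + x ^ 2)) := by
  rw [one_sub_critDist hx, critDist, bhat_eq hx, Real.log_div (by positivity) (by positivity),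
    Real.log_div (by positivity) (by positivity), Real.log_mul (by norm_num) (by positivity)]
  ring

/-- The exponent of the union bound at rate `r` and distance `δ`, in nats. -/
noncomputable def unionExp (p r δ : ℝ) : ℝ := Real.log 2 - r - Real.binEntropy δ + bhat p * δ

theorem unionExp_critDist {x : ℝ} (hx : 0 < x) (r : ℝ) :
    unionExp (x ^ 2 / (1 + x ^ 2)) r (critDist x) = Real.log 2 - r + Real.log (1 - critDist x) := by
  rw [unionExp, Real.binEntropy, Real.log_inv, Real.log_inv, neg_log_critDist hx]
  ring

theorem unionExp_critDist_le {x : ℝ} (hx : 0 < x) (hx1 : x < 1) (r : ℝ) {δ : ℝ} (h0 : 0 ≤ δ)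
    (h1 : δ ≤ 1) :
    unionExp (x ^ 2 / (1 + x ^ 2)) r (critDist x) ≤ unionExp (x ^ 2 / (1 + x ^ 2)) r δ := by
  have := binEntropy_le_cross h0 h1 (critDist_pos hx) ((critDist_lt hx hx1).trans (by norm_num))
  rw [unionExp_critDist hx, unionExp]
  rw [neg_log_critDist hx] at this
  linarith

theorem entSlope_le_bhat {x δ : ℝ} (hx : 0 < x) (h : critDist x ≤ δ) (hδ : δ < 1) :
    entSlope δ ≤ bhat (x ^ 2 / (1 + x ^ 2)) := by
  have := neg_log_critDist hx
  have h1 := Real.log_le_log (critDist_pos hx) h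
  have h2 := Real.log_le_log (by linarith : 0 < 1 - δ) (by linarith : 1 - δ ≤ 1 - critDist x)
  rw [entSlope]; linarith

theorem bhat_le_entSlope {x δ : ℝ} (hx : 0 < x) (hx1 : x < 1) (h0 : 0 < δ) (h : δ ≤ critDist x) :
    bhat (x ^ 2 / (1 + x ^ 2)) ≤ entSlope δ := by
  have := neg_log_critDist hx
  have h3 := critDist_lt hx hx1
  have h1 := Real.log_le_log h0 h
  have h2 := Real.log_le_log (by linarith : 0 < 1 - critDist x) (by linarith : 1 - critDist x ≤ 1 - δ)
  rw [entSlope]; linarith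

theorem ErrorLowerBound.mono_rate {p R R' X : ℝ} (h : ErrorLowerBound p R X) (hR : R ≤ R') :
    ErrorLowerBound p R' X := by
  intro ε hε
  obtain ⟨N, hN⟩ := h ε hε
  refine ⟨N, fun n hn C hC => hN n hn C (le_trans ?_ hC)⟩
  gcongr

theorem errorLowerBound_of_forall_add {p R X : ℝ} (h : ∀ ε > 0, ErrorLowerBound p R (X + ε)) :
    ErrorLowerBound p R X := by
  intro ε hε
  obtain ⟨N, hN⟩ := h (ε / 2) (by linarith) (ε / 2) (by linarith)
  refine ⟨N, fun n hn C hC => ?_⟩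
  have := hN n hn C hC
  rwa [show X + ε / 2 + ε / 2 = X + ε by ring] at this

section

variable {x α τ r δ X : ℝ}

theorem errorLowerBound_of_critDist_le (hx : 0 < x) (hx1 : x < 1) (hτ : 0 < τ)
    (hτα : τ < α) (hα : α < 1 / 2) (hL : Real.log 2 - Real.binEntropy α + Real.binEntropy τ < r)
    (hG : Gfun α τ = δ) (hδ : δ < 1 / 2) (hδx : critDist x ≤ δ) (hX0 : 0 ≤ X)
    (hX : OverlapBound (x ^ 2 / (1 + x ^ 2)) δ X) (hU : unionExp (x ^ 2 / (1 + x ^ 2)) r δ ≤ X) :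
    ErrorLowerBound (x ^ 2 / (1 + x ^ 2)) r X := by
  have hp0 : 0 < x ^ 2 / (1 + x ^ 2) := by positivity
  have hp : x ^ 2 / (1 + x ^ 2) < 1 / 2 := by
    rw [div_lt_div_iff₀ (by positivity) (by norm_num)]; nlinarith
  have hδ0 := (critDist_pos hx).trans_le hδx
  subst hG
  refine errorLowerBound_of_overlapBound hp0 hp hτ hτα hα hL hδ0 hδ hX0 hX fun ω h0 h1 => ?_
  have hs := entSlope_le_bhat hx hδx (by linarith)
  have := le_max_right 0 (r - Real.log 2 +
    Real.binEntropy (Gfun α τ) + entSlope (Gfun α τ) * (ω - Gfun α τ))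
  rw [unionExp] at hU
  nlinarith

theorem errorLowerBound_of_le_critDist (hx : 0 < x) (hx1 : x < 1) (hτ : 0 < τ)
    (hτα : τ < α) (hα : α < 1 / 2) (hL : Real.log 2 - Real.binEntropy α + Real.binEntropy τ < r)
    (hG : Gfun α τ = δ) (hδ0 : 0 < δ) (hδx : δ ≤ critDist x) (hX0 : 0 ≤ X)
    (hX : OverlapBound (x ^ 2 / (1 + x ^ 2)) δ X)
    (hU : bhat (x ^ 2 / (1 + x ^ 2)) * (δ - (r - Real.log 2 + Real.binEntropy δ) / entSlope δ) ≤ X) :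
    ErrorLowerBound (x ^ 2 / (1 + x ^ 2)) r X := by
  have hp0 : 0 < x ^ 2 / (1 + x ^ 2) := by positivity
  have hp : x ^ 2 / (1 + x ^ 2) < 1 / 2 := by
    rw [div_lt_div_iff₀ (by positivity) (by norm_num)]; nlinarith
  have hδ := hδx.trans_lt (critDist_lt hx hx1)
  have hb := bhat_pos hp0 hp
  subst hG
  refine errorLowerBound_of_overlapBound hp0 hp hτ hτα hα hL hδ0 hδ hX0 hX fun ω h0 h1 => ?_
  have hs := bhat_le_entSlope hx hx1 hδ0 hδx
  set S := entSlope (Gfun α τ) with hS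
  set b := bhat (x ^ 2 / (1 + x ^ 2))
  set D := (r - Real.log 2 + Real.binEntropy (Gfun α τ)) / S with hD
  have hDS : r - Real.log 2 + Real.binEntropy (Gfun α τ) = D * S := by
    rw [hD, div_mul_cancel₀]; linarith
  rw [hDS]
  have m1 := le_max_left 0 (D * S + S * (ω - Gfun α τ))
  have m2 := le_max_right 0 (D * S + S * (ω - Gfun α τ))
  rcases le_total ω (Gfun α τ - D) with h | h
  · nlinarith
  · nlinarith

theorem errorLowerBound_max_unionExp (hx : 0 < x) (hx1 : x < 1) (hτ : 0 ≤ τ) (hτα : τ ≤ α)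
    (hα : α ≤ 1 / 2) (hL : Real.log 2 - Real.binEntropy α + Real.binEntropy τ ≤ r)
    (hr : r < Real.log 2) (hG : Gfun α τ = δ) (hδ : δ < 1 / 2) (hδx : critDist x ≤ δ) (hX0 : 0 ≤ X)
    (hX : OverlapBound (x ^ 2 / (1 + x ^ 2)) δ X) :
    ErrorLowerBound (x ^ 2 / (1 + x ^ 2)) r (max (unionExp (x ^ 2 / (1 + x ^ 2)) r δ) X) := by
  have hp0 : 0 < x ^ 2 / (1 + x ^ 2) := by positivity
  have hp : x ^ 2 / (1 + x ^ 2) < 1 / 2 := by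
    rw [div_lt_div_iff₀ (by positivity) (by norm_num)]; nlinarith
  have hδ0 := (critDist_pos hx).trans_le hδx
  refine errorLowerBound_of_forall_add fun ε hε => ?_
  have c1 : Continuous fun d => unionExp (x ^ 2 / (1 + x ^ 2)) r d := by
    have := Real.binEntropy_continuous
    unfold unionExp; fun_prop
  have e1 : ∀ᶠ d in nhds δ, unionExp (x ^ 2 / (1 + x ^ 2)) r d < unionExp (x ^ 2 / (1 + x ^ 2)) r δ + ε :=
    (c1.tendsto δ).eventually_lt_const (by linarith)
  have c2 : Continuous fun d => X * (d / δ) := by fun_prop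
  have e2 : ∀ᶠ d in nhds δ, X * (d / δ) < X + ε := by
    refine (c2.tendsto δ).eventually_lt_const ?_
    rw [div_self hδ0.ne']; linarith
  have e3 : ∀ᶠ d in nhds δ, d < 1 / 2 := eventually_lt_nhds hδ
  have e4 : ∀ᶠ d in nhdsWithin δ (Set.Ioi δ), δ < d := eventually_mem_nhdsWithin
  obtain ⟨d, ⟨⟨h1, h2⟩, h3⟩, h4⟩ :=
    (((e1.and e2).and e3).filter_mono nhdsWithin_le_nhds |>.and e4).exists
  obtain ⟨α', τ', f1, f2, f3, f4, f5⟩ :=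
    exists_Gfun_eq_of_le hτ hτα hα hL hr (by rw [hG]; exact h4) h3
  have hd0 : 0 < d := hδ0.trans h4
  have hs := hX.scale hp0 hp (κ := δ / d) (by positivity) (by rw [div_le_one hd0]; exact h4.le)
    (by rw [div_div_cancel₀ hδ0.ne']; linarith)
  rw [div_div_cancel₀ hδ0.ne'] at hs
  have : X / (δ / d) = X * (d / δ) := by rw [div_div_eq_mul_div, mul_div_assoc]
  rw [this] at hs
  have m1 := le_max_left (unionExp (x ^ 2 / (1 + x ^ 2)) r δ) X
  have m2 := le_max_right (unionExp (x ^ 2 / (1 + x ^ 2)) r δ) X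
  exact errorLowerBound_of_critDist_le hx hx1 f1 f2 f3 f4 f5 h3 (hδx.trans h4.le) (by linarith)
    (hs.mono (by linarith)) (by linarith)

end

theorem binEntropy_div_one_add {y : ℝ} (hy : 0 < y) :
    Real.binEntropy (y / (1 + y)) = Real.log (1 + y) - y / (1 + y) * Real.log y := by
  have h : 1 - y / (1 + y) = 1 / (1 + y) := by field_simp; ring
  rw [Real.binEntropy, Real.log_inv, Real.log_inv, h, Real.log_div (by positivity) (by positivity),
    Real.log_div (by positivity) (by positivity), Real.log_one]
  field_simp
  ring

theorem binEntropy_sq_div {x : ℝ} (hx : 0 < x) :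
    Real.binEntropy (x ^ 2 / (1 + x ^ 2)) =
      Real.log (1 + x ^ 2) - 2 * (x ^ 2 / (1 + x ^ 2)) * Real.log x := by
  rw [binEntropy_div_one_add (by positivity), Real.log_pow]; push_cast; ring

/-- The value of the overlap exponent at its critical point. -/
noncomputable def critVal (x : ℝ) : ℝ :=
  overlapExp (x ^ 2 / (1 + x ^ 2)) (critDist x) (critDist x) (x ^ 2 / (1 + x) ^ 3) +
    bhat (x ^ 2 / (1 + x ^ 2)) * critDist x

theorem critVal_eq {x : ℝ} (hx : 0 < x) : critVal x = Real.log (1 + x) +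
    (1 - 3 / 2 * critDist x) * Real.log (1 - x + x ^ 2) -
    (1 - 2 * critDist x) * Real.log (1 + x ^ 2) - 2 * critDist x * Real.log 2 -
    (2 * x + x ^ 2) / (1 + x) ^ 2 * Real.log x := by
  have hq : 0 < 1 - x + x ^ 2 := by nlinarith [sq_nonneg (x - 1)]
  have e1 : phi (critDist x / 2) (x ^ 2 / (1 + x) ^ 3) =
      critDist x / 2 * Real.binEntropy (x / (1 + x)) := by
    rw [← phi_mul_right]; congr 1; rw [critDist]; field_simp
  have e2 : phi (critDist x - critDist x / 2) (critDist x / 2 - x ^ 2 / (1 + x) ^ 3) =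
      critDist x / 2 * Real.binEntropy (x / (1 + x)) := by
    rw [← e1, ← phi_symm (critDist x / 2)]; congr 1; ring
  have h13 : 1 + x ^ 3 = (1 + x) * (1 - x + x ^ 2) := by ring
  have e3 : phi (1 - critDist x - critDist x / 2)
      (x ^ 2 / (1 + x ^ 2) * (1 - critDist x) - x ^ 2 / (1 + x) ^ 3) =
      (1 - 3 / 2 * critDist x) * Real.binEntropy (x ^ 3 / (1 + x ^ 3)) := by
    have : 1 - critDist x - critDist x / 2 = 1 - 3 / 2 * critDist x := by ring
    rw [this, ← phi_mul_right]; congr 1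
    rw [one_sub_critDist hx, critDist, h13]; field_simp; ring
  rw [critVal, overlapExp, e1, e2, e3, bhat_eq hx, binEntropy_sq_div hx, binEntropy_div_one_add hx,
    binEntropy_div_one_add (by positivity : 0 < x ^ 3), h13, Real.log_mul (by positivity) hq.ne',
    Real.log_pow]
  push_cast
  have k : (x ^ 2 / (1 + x ^ 2) * (1 - critDist x)) = x ^ 2 / (1 + x) ^ 2 := by
    rw [one_sub_critDist hx]; field_simp
  have k2 : (1 - 3 / 2 * critDist x) * (x ^ 3 / ((1 + x) * (1 - x + x ^ 2))) = x ^ 3 / (1 + x) ^ 3 := by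
    rw [critDist]; field_simp; ring
  have k3 : 2 * (x ^ 2 / (1 + x) ^ 2) - 3 * (critDist x / 2 * (x / (1 + x))) -
      3 * (x ^ 3 / (1 + x) ^ 3) - critDist x = - ((2 * x + x ^ 2) / (1 + x) ^ 2) := by
    rw [critDist]; field_simp; ring
  linear_combination (2 * Real.log x) * k - 3 * Real.log x * k2 + Real.log x * k3

theorem mul_critVal_le {x g X : ℝ} (hx : 0 < x) (hx1 : x < 1) (hg0 : 0 < g) (hg : g ≤ critDist x)
    (h : OverlapBound (x ^ 2 / (1 + x ^ 2)) g X) : g / critDist x * critVal x ≤ X := by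
  have hw := critDist_pos hx
  have hw2 := critDist_lt hx hx1
  have hp0 : 0 < x ^ 2 / (1 + x ^ 2) := by positivity
  have hp : x ^ 2 / (1 + x ^ 2) < 1 / 2 := by
    rw [div_lt_div_iff₀ (by positivity) (by norm_num)]; nlinarith
  have k : (x ^ 2 / (1 + x ^ 2) * (1 - critDist x)) = x ^ 2 / (1 + x) ^ 2 := by
    rw [one_sub_critDist hx]; field_simp
  have hη : x ^ 2 / (1 + x) ^ 3 ≤ x ^ 2 / (1 + x) ^ 2 := by
    gcongr <;> linarith
  have hη2 : x ^ 2 / (1 + x) ^ 3 ≤ critDist x / 2 := by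
    rw [critDist, div_div, div_le_div_iff₀ (by positivity) (by positivity)]
    have : 0 ≤ x * (1 + x) ^ 2 := by positivity
    nlinarith
  have hκ1 : g / critDist x ≤ 1 := (div_le_one hw).2 hg
  have h3 : x ^ 2 / (1 + x) ^ 3 ≤ x ^ 2 / (1 + x ^ 2) * (1 - critDist x) := by rw [k]; exact hη
  have a := overlapExp_smul_le (p := x ^ 2 / (1 + x ^ 2)) (ω := critDist x) (l := critDist x)
    (η := x ^ 2 / (1 + x) ^ 3) (κ := g / critDist x) hp0.le (by linarith) (by positivity) hκ1
    h3 (by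
      have : 1 - critDist x - critDist x / 2 - (x ^ 2 / (1 + x) ^ 2 - x ^ 2 / (1 + x) ^ 3) =
          1 / (1 + x) ^ 3 := by rw [critDist]; field_simp; ring
      have : 0 < 1 / (1 + x) ^ 3 := by positivity
      rw [k]; linarith)
  rw [div_mul_cancel₀ _ hw.ne'] at a
  have b := h g g (g / critDist x * (x ^ 2 / (1 + x) ^ 3)) hg0 le_rfl le_rfl (by positivity)
    (by
      have := mul_le_mul_of_nonneg_left hη2 (by positivity : 0 ≤ g / critDist x)
      refine this.trans_eq ?_
      field_simp)
    (by
      have := mul_le_mul_of_nonneg_left h3 (by positivity : 0 ≤ g / critDist x)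
      have e : g / critDist x * (x ^ 2 / (1 + x ^ 2) * (1 - critDist x)) =
        x ^ 2 / (1 + x ^ 2) * (g / critDist x - g) := by field_simp
      rw [e] at this
      nlinarith)
  have e : g / critDist x * critVal x = g / critDist x *
      overlapExp (x ^ 2 / (1 + x ^ 2)) (critDist x) (critDist x) (x ^ 2 / (1 + x) ^ 3) +
      bhat (x ^ 2 / (1 + x ^ 2)) * g := by
    rw [critVal]; field_simp
  rw [e]; linarith

theorem klBin_eq {x ρ : ℝ} (hx : 0 < x) : klBin ρ (x ^ 2 / (1 + x ^ 2)) =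
    Real.log (1 + x ^ 2) - 2 * ρ * Real.log x - Real.binEntropy ρ := by
  have h : 1 - x ^ 2 / (1 + x ^ 2) = 1 / (1 + x ^ 2) := by field_simp; ring
  rw [klBin, h, Real.log_div (by positivity) (by positivity),
    Real.log_div (by positivity) (by positivity), Real.log_one, Real.log_pow]
  push_cast; ring

/-- The sphere-packing exponent at the critical rate. -/
noncomputable def critExp (x : ℝ) : ℝ := klBin (x / (1 + x)) (x ^ 2 / (1 + x ^ 2))

theorem critExp_eq {x : ℝ} (hx : 0 < x) : critExp x =
    Real.log (1 + x ^ 2) - Real.log (1 + x) - x / (1 + x) * Real.log x := by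
  rw [critExp, klBin_eq hx, binEntropy_div_one_add hx]; ring

theorem critVal_sub_critExp {x : ℝ} (hx : 0 < x) : critVal x - critExp x =
    (1 - 3 / 2 * critDist x) * Real.log (1 - 3 / 2 * critDist x) -
      2 * (1 - critDist x) * Real.log (1 - critDist x) - 2 * critDist x * Real.log 2 -
      critDist x / 2 * Real.log (critDist x / 2) := by
  have hq : 0 < 1 - x + x ^ 2 := by nlinarith [sq_nonneg (x - 1)]
  have h1 : 1 - 3 / 2 * critDist x = (1 - x + x ^ 2) / (1 + x) ^ 2 := by
    rw [critDist]; field_simp; ring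
  have h2 : critDist x / 2 = x / (1 + x) ^ 2 := by rw [critDist]; field_simp
  rw [critVal_eq hx, critExp_eq hx, h1, one_sub_critDist hx, h2,
    Real.log_div hq.ne' (by positivity), Real.log_div (by positivity) (by positivity),
    Real.log_div (by positivity) (by positivity), Real.log_pow]
  push_cast
  rw [critDist]
  field_simp
  ring

theorem critExp_le_critVal {x : ℝ} (hx : 0 < x) (hx1 : x < 1) : critExp x ≤ critVal x := by
  rw [← sub_nonneg, critVal_sub_critExp hx]
  have hw := critDist_pos hx
  have hw2 := critDist_lt hx hx1
  set w := critDist x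
  have key : ∀ a b : ℝ, 0 < a → 0 < b → a - b ≤ a * (Real.log a - Real.log b) := by
    intro a b ha hb
    have := Real.log_le_sub_one_of_pos (div_pos hb ha)
    rw [Real.log_div hb.ne' ha.ne'] at this
    have h := mul_le_mul_of_nonneg_left this ha.le
    rw [mul_sub a (b / a), mul_div_cancel₀ _ ha.ne'] at h
    linarith
  have k1 := key (1 - 3 / 2 * w) ((1 - w) ^ 2) (by linarith) (by nlinarith)
  have k2 := key (w / 2) (w ^ 2) (by linarith) (by positivity)
  have k3 := key (w / 2) (w * (1 - w)) (by linarith) (mul_pos hw (by linarith))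
  have e : Real.log (w / 2) = Real.log w - Real.log 2 := Real.log_div hw.ne' (by norm_num)
  rw [Real.log_pow] at k1 k2
  rw [Real.log_mul hw.ne' (by linarith)] at k3
  push_cast at k1 k2
  rw [e] at k2 k3 ⊢
  nlinarith

theorem critExp_nonneg {x : ℝ} (hx : 0 < x) : 0 ≤ critExp x := by
  refine klBin_nonneg (by positivity) ?_ (by positivity) ?_
  · rw [div_le_one (by positivity)]; linarith
  · rw [div_lt_one (by positivity)]; linarith

theorem critDist_shrink_nonneg {x a s : ℝ} (hx : 0 < x) (hx1 : x < 1)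
    (ha : a = (1 - x) / (1 + x ^ 2)) (hs0 : 0 ≤ s) (hs : s < 1) :
    klBin (x / (1 + x) * (1 - a * s)) (x ^ 2 / (1 + x ^ 2)) ≤
      Real.binEntropy (x / (1 + x) * (1 - a * s)) - Real.binEntropy (critDist x * (1 - s)) +
        bhat (x ^ 2 / (1 + x ^ 2)) * (critDist x * (1 - s)) := by
  have hw := critDist_pos hx
  have hw2 := critDist_lt hx hx1
  set w := critDist x with hwdef
  set q := x / (1 + x) with hq
  have hq0 : 0 < q := by positivity
  have hq1 : 1 - q = 1 / (1 + x) := by rw [hq]; field_simp; ring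
  have ha0 : 0 < a := by rw [ha]; exact div_pos (by linarith) (by positivity)
  have ha1 : a < 1 := by rw [ha, div_lt_one (by positivity)]; nlinarith
  set c := bhat (x ^ 2 / (1 + x ^ 2)) with hc
  set g : ℝ → ℝ := fun t => 2 * Real.binEntropy (q * (1 - a * t)) - Real.binEntropy (w * (1 - t)) +
    c * (w * (1 - t)) + 2 * (q * (1 - a * t)) * Real.log x with hg
  have hd : ∀ t, 0 ≤ t → t < 1 → HasDerivAt g (w * (Real.log (1 - w * (1 - t)) - Real.log (w * (1 - t)) - c) -
      2 * (q * a) * (Real.log (1 - q * (1 - a * t)) - Real.log (q * (1 - a * t)) + Real.log x)) t := by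
    intro t ht0 ht1
    have hat : a * t < 1 := by nlinarith
    have h1 : HasDerivAt (fun t => q * (1 - a * t)) (-(q * a)) t := by
      have := ((((hasDerivAt_id t).const_mul a).const_sub 1).const_mul q)
      exact this.congr_deriv (by simp; try ring)
    have h2 : HasDerivAt (fun t => w * (1 - t)) (-w) t := by
      have := (((hasDerivAt_id t).const_sub 1).const_mul w)
      exact this.congr_deriv (by simp; try ring)
    have n1 : q * (1 - a * t) ≠ 0 := (mul_pos hq0 (by linarith)).ne'
    have n2 : q * (1 - a * t) ≠ 1 := by
      have : 0 < 1 - q := by rw [hq1]; positivity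
      nlinarith [mul_nonneg hq0.le (mul_nonneg ha0.le ht0)]
    have n3 : w * (1 - t) ≠ 0 := (mul_pos hw (by linarith)).ne'
    have n4 : w * (1 - t) ≠ 1 := by nlinarith
    have k1 := (Real.hasDerivAt_binEntropy n1 n2).comp t h1
    have k2 := (Real.hasDerivAt_binEntropy n3 n4).comp t h2
    have := (((k1.const_mul 2).sub k2).add (h2.const_mul c)).add ((h1.const_mul 2).mul_const (Real.log x))
    exact this.congr_deriv (by simp; try ring)
  have hmono : MonotoneOn g (Set.Icc 0 s) := by
    apply monotoneOn_of_deriv_nonneg (convex_Icc 0 s)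
    · exact fun t ht => (hd t ht.1 (ht.2.trans_lt hs)).continuousAt.continuousWithinAt
    · intro t ht
      rw [interior_Icc] at ht
      exact (hd t ht.1.le (ht.2.trans hs)).differentiableAt.differentiableWithinAt
    · intro t ht
      rw [interior_Icc] at ht
      have ht0 := ht.1.le
      have ht1 := ht.2.trans hs
      rw [(hd t ht0 ht1).deriv]
      have hat : a * t < 1 := by nlinarith
      have e1 : 1 - w * (1 - t) = (1 - w) * (1 + 2 * x / (1 + x ^ 2) * t) := by
        rw [hwdef, one_sub_critDist hx, critDist]; field_simp; ring
      have e2 : 1 - q * (1 - a * t) = 1 / (1 + x) * (1 + x * a * t) := by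
        rw [hq]; field_simp; ring
      have hc' := neg_log_critDist hx
      have p1 : 0 < 1 + 2 * x / (1 + x ^ 2) * t := by positivity
      have p2 : 0 < 1 + x * a * t := by positivity
      rw [e1, e2, Real.log_mul (by linarith) p1.ne', Real.log_mul hw.ne' (by linarith),
        Real.log_mul (by positivity) p2.ne', Real.log_mul hq0.ne' (by linarith), hq,
        Real.log_div (by positivity) (by positivity), Real.log_div (by positivity) (by positivity),
        Real.log_one]
      have b1 : a * Real.log (1 - t) ≤ Real.log (1 - a * t) := by
        have := strictConcaveOn_log_Ioi.concaveOn.2 (Set.mem_Ioi.2 (by linarith : 0 < 1 - t))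
          (Set.mem_Ioi.2 one_pos) ha0.le (by linarith : 0 ≤ 1 - a) (by ring)
        simp only [smul_eq_mul, Real.log_one, mul_zero, add_zero] at this
        rwa [show a * (1 - t) + (1 - a) * 1 = 1 - a * t by ring] at this
      have hxa : x * a ≤ 2 * x / (1 + x ^ 2) := by
        rw [ha, ← mul_div_assoc]; refine div_le_div_of_nonneg_right ?_ (by positivity); nlinarith
      have b2 : Real.log (1 + x * a * t) ≤ Real.log (1 + 2 * x / (1 + x ^ 2) * t) :=
        Real.log_le_log p2 (by gcongr)
      have b0 : 0 ≤ Real.log (1 + x * a * t) := Real.log_nonneg (by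
        have : 0 ≤ x * a * t := by positivity
        linarith)
      have b3 : Real.log (1 - t) ≤ 0 := Real.log_nonpos (by linarith) (by linarith)
      have hqa : 2 * (x / (1 + x) * a) ≤ w := by
        rw [hwdef, critDist, ha, div_mul_div_comm, ← mul_div_assoc, div_le_div_iff₀ (by positivity) (by positivity)]
        have : 0 ≤ x ^ 3 * (1 + x) * 4 := by positivity
        nlinarith
      set A := Real.log (1 + x * a * t)
      set B := Real.log (1 + 2 * x / (1 + x ^ 2) * t)
      set C := Real.log (1 - t)
      set D := Real.log (1 - a * t)
      have hqa0 : 0 < 2 * (x / (1 + x) * a) := by positivity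
      set Q := 2 * (x / (1 + x) * a)
      have : w * (Real.log (1 - w) + B - (Real.log w + C) - c) = w * (B - C) := by
        congr 1; linarith
      rw [this]
      have r1 : Q * (A - D) ≤ Q * (B - C) := by
        apply mul_le_mul_of_nonneg_left _ hqa0.le
        nlinarith
      have r2 : Q * (B - C) ≤ w * (B - C) := mul_le_mul_of_nonneg_right hqa (by linarith)
      linarith
  have h := hmono ⟨le_rfl, hs0⟩ ⟨hs0, le_rfl⟩ hs0
  have h0 : g 0 = Real.log (1 + x ^ 2) := by
    simp only [hg, mul_zero, sub_zero, mul_one]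
    rw [hq, binEntropy_div_one_add hx]
    have := unionExp_critDist hx 0
    rw [unionExp, one_sub_critDist hx, Real.log_div (by positivity) (by positivity), Real.log_pow] at this
    push_cast at this
    linarith
  rw [h0] at h
  simp only [hg] at h
  rw [klBin_eq hx]
  linarith

theorem unionExp_anti {x r d δ : ℝ} (hx : 0 < x) (hx1 : x < 1) (h0 : 0 ≤ δ) (h : δ ≤ d)
    (hd0 : 0 < d) (hd : d ≤ critDist x) :
    unionExp (x ^ 2 / (1 + x ^ 2)) r d ≤ unionExp (x ^ 2 / (1 + x ^ 2)) r δ := by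
  have hw := critDist_lt hx hx1
  have a := binEntropy_le_cross h0 (by linarith) hd0 (by linarith : d < 1)
  have b := bhat_le_entSlope hx hx1 hd0 hd
  rw [entSlope] at b
  rw [unionExp, unionExp, Real.binEntropy, Real.log_inv, Real.log_inv]
  nlinarith

theorem continuous_klBin (p : ℝ) : Continuous fun ρ => klBin ρ p := by
  have := Real.binEntropy_continuous
  unfold klBin; fun_prop

theorem errorLowerBound_of_critRate_le {x r δ X : ℝ} (hx : 0 < x) (hx1 : x < 1) (hδ0 : 0 < δ)
    (hδ : δ ≤ critDist x) (hr : Real.log 2 - Real.binEntropy (x / (1 + x)) ≤ r)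
    (hr' : r < Real.log 2 - Real.binEntropy (x ^ 2 / (1 + x ^ 2)))
    (hX : OverlapBound (x ^ 2 / (1 + x ^ 2)) δ X) :
    ErrorLowerBound (x ^ 2 / (1 + x ^ 2)) r (max (unionExp (x ^ 2 / (1 + x ^ 2)) r δ) X) := by
  have hp0 : 0 < x ^ 2 / (1 + x ^ 2) := by positivity
  have hp : x ^ 2 / (1 + x ^ 2) < 1 / 2 := by
    rw [div_lt_div_iff₀ (by positivity) (by norm_num)]; nlinarith
  have hw := critDist_pos hx
  have hw2 := critDist_lt hx hx1
  have hq : x / (1 + x) < 1 / 2 := by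
    rw [div_lt_div_iff₀ (by positivity) (by norm_num)]; linarith
  have hH := Real.binEntropy_nonneg hp0.le (by linarith)
  have hH2 := Real.binEntropy_le_log_two (p := x / (1 + x))
  obtain ⟨ρ, h0, h1, hρ⟩ := exists_binEntropy_eq (y := Real.log 2 - r) (by linarith) (by linarith)
  have hpρ : x ^ 2 / (1 + x ^ 2) < ρ := lt_of_binEntropy_lt (by linarith) h0 (by linarith)
  have hρq : ρ ≤ x / (1 + x) := by
    by_contra hc
    have := binEntropy_lt_binEntropy (by positivity) (not_le.1 hc) h1
    linarith
  set a := (1 - x) / (1 + x ^ 2) with ha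
  have ha0 : 0 < a := div_pos (by linarith) (by positivity)
  have hqa : x / (1 + x) * (1 - a) = x ^ 2 / (1 + x ^ 2) := by rw [ha]; field_simp; ring
  obtain ⟨s, hs⟩ : ∃ s, ρ = x / (1 + x) * (1 - a * s) := by
    refine ⟨(1 - ρ / (x / (1 + x))) / a, ?_⟩
    rw [mul_div_cancel₀ _ ha0.ne']; field_simp; ring
  have hq0 : 0 < x / (1 + x) := by positivity
  have hqa0 : 0 < x / (1 + x) * a := by positivity
  have hs0 : 0 ≤ s := by
    by_contra hc
    have := mul_pos hqa0 (neg_pos.2 (not_le.1 hc))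
    nlinarith
  have hs1 : s < 1 := by
    by_contra hc
    have := mul_le_mul_of_nonneg_left (not_lt.1 hc) hqa0.le
    nlinarith
  have hkl : klBin ρ (x ^ 2 / (1 + x ^ 2)) ≤ max (unionExp (x ^ 2 / (1 + x ^ 2)) r δ) X := by
    rcases le_total (critDist x * (1 - s)) δ with h | h
    · refine le_trans ?_ (le_max_right _ _)
      have hE := critExp_nonneg hx
      have hEF := critExp_le_critVal hx hx1
      have hXF := mul_critVal_le hx hx1 hδ0 hδ hX
      have h2 : 1 - s ≤ δ / critDist x := by rw [le_div_iff₀ hw]; linarith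
      have h3 : (1 - s) * critExp x ≤ δ / critDist x * critVal x := by
        refine mul_le_mul h2 hEF hE (by positivity)
      refine le_trans ?_ (h3.trans hXF)
      have hconc := Real.strictConcave_binEntropy.concaveOn.2 (⟨hq0.le, by linarith⟩ : x / (1 + x) ∈ Set.Icc (0:ℝ) 1)
        (⟨hp0.le, by linarith⟩ : x ^ 2 / (1 + x ^ 2) ∈ Set.Icc (0:ℝ) 1) (by linarith : 0 ≤ 1 - s) hs0 (by ring)
      simp only [smul_eq_mul] at hconc
      have e : (1 - s) * (x / (1 + x)) + s * (x ^ 2 / (1 + x ^ 2)) = ρ := by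
        rw [← hqa, hs]; ring
      rw [e, binEntropy_sq_div hx] at hconc
      rw [critExp, klBin_eq hx, klBin_eq hx]
      have e' : ((1 - s) * (x / (1 + x)) + s * (x ^ 2 / (1 + x ^ 2))) * (2 * Real.log x) =
        ρ * (2 * Real.log x) := by rw [e]
      nlinarith
    · refine le_trans ?_ (le_max_left _ _)
      have hd0 : 0 < critDist x * (1 - s) := mul_pos hw (by linarith)
      refine le_trans ?_ (unionExp_anti hx hx1 hδ0.le h hd0 (by nlinarith))
      have := critDist_shrink_nonneg hx hx1 ha hs0 hs1
      rw [← hs] at this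
      rw [unionExp]
      linarith
  refine errorLowerBound_of_forall_add fun ε hε => ?_
  have e1 : ∀ᶠ y in nhds ρ, klBin y (x ^ 2 / (1 + x ^ 2)) < klBin ρ (x ^ 2 / (1 + x ^ 2)) + ε :=
    ((continuous_klBin _).tendsto ρ).eventually_lt_const (by linarith)
  have e3 : ∀ᶠ y in nhds ρ, y < 1 / 2 := eventually_lt_nhds (by linarith)
  have e4 : ∀ᶠ y in nhdsWithin ρ (Set.Ioi ρ), ρ < y := eventually_mem_nhdsWithin
  obtain ⟨y, ⟨h2, h3⟩, h4⟩ := ((e1.and e3).filter_mono nhdsWithin_le_nhds |>.and e4).exists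
  have := binEntropy_lt_binEntropy h0 h4 h3.le
  exact (errorLowerBound_sphere_packing hp0 hp (by linarith) h3 (by linarith)).mono (by linarith)

theorem critExp_eq_unionExp {x : ℝ} (hx : 0 < x) :
    unionExp (x ^ 2 / (1 + x ^ 2)) (Real.log 2 - Real.binEntropy (x / (1 + x))) (critDist x) =
      critExp x := by
  rw [unionExp_critDist hx, one_sub_critDist hx, critExp, klBin_eq hx, binEntropy_div_one_add hx,
    Real.log_div (by positivity) (by positivity), Real.log_pow]
  push_cast; ring

theorem errorLowerBound_of_lt_critRate {x α τ α' τ' r r' m : ℝ} (hx : 0 < x) (hx1 : x < 1)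
    (hτ : 0 ≤ τ) (hτα : τ ≤ α) (hα : α ≤ 1 / 2)
    (hL : Real.log 2 - Real.binEntropy α + Real.binEntropy τ ≤ r) (hG : Gfun α τ < critDist x)
    (hr : r < Real.log 2 - Real.binEntropy (x / (1 + x)))
    (hm : OverlapBound (x ^ 2 / (1 + x ^ 2)) (critDist x) m)
    (hτ' : 0 ≤ τ') (hτα' : τ' ≤ α') (hα' : α' ≤ 1 / 2)
    (hL' : Real.log 2 - Real.binEntropy α' + Real.binEntropy τ' ≤ r') (hG' : Gfun α' τ' ≤ critDist x)
    (hr' : 0 < m → r' < r) :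
    ErrorLowerBound (x ^ 2 / (1 + x ^ 2)) r
      (max (unionExp (x ^ 2 / (1 + x ^ 2)) r (critDist x)) (m - (r - r'))) := by
  have hp0 : 0 < x ^ 2 / (1 + x ^ 2) := by positivity
  have hp : x ^ 2 / (1 + x ^ 2) < 1 / 2 := by
    rw [div_lt_div_iff₀ (by positivity) (by norm_num)]; nlinarith
  have hw := critDist_pos hx
  have hw2 := critDist_lt hx hx1
  have hq : x / (1 + x) < 1 / 2 := by
    rw [div_lt_div_iff₀ (by positivity) (by norm_num)]; linarith
  have hq0 : 0 < x / (1 + x) := by positivity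
  have hHq := Real.binEntropy_nonneg hq0.le (by linarith)
  have hE := critExp_nonneg hx
  have hEF := critExp_le_critVal hx hx1
  have hF := mul_critVal_le hx hx1 hw le_rfl hm
  rw [div_self hw.ne', one_mul] at hF
  have hElin := critExp_eq_unionExp hx
  have hlin := unionExp_critDist hx r
  rw [unionExp_critDist hx] at hElin
  set w := critDist x with hwdef
  set p := x ^ 2 / (1 + x ^ 2)
  rw [hlin]
  rcases le_or_gt m (Real.log 2 - r + Real.log (1 - w)) with h | h
  · obtain ⟨a, b, f1, f2, f3, f4, f5⟩ := exists_Gfun_eq_of_le hτ hτα hα hL (by linarith) hG hw2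
    exact (errorLowerBound_of_critDist_le hx hx1 f1 f2 f3 f4 f5 hw2 le_rfl (by linarith) (hm.mono h)
      hlin.le).mono (le_max_left _ _)
  have hr'' := hr' (by linarith)
  set Q := max r' (Real.log 2 + Real.log (1 - w) - m) with hQ
  have hQ1 : r' ≤ Q := le_max_left _ _
  have hQ2 : Real.log 2 + Real.log (1 - w) - m ≤ Q := le_max_right _ _
  have hQr : Q < r := max_lt hr'' (by linarith)
  refine errorLowerBound_of_forall_add fun ε hε => ?_
  set κ := min ε (r - Q) with hκ
  have hκ0 : 0 < κ := lt_min hε (by linarith)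
  have hκ1 : κ ≤ ε := min_le_left _ _
  have hκ2 : κ ≤ r - Q := min_le_right _ _
  have base : ErrorLowerBound p (Q + κ / 2) m := by
    obtain ⟨a, b, f1, f2, f3, f4, f5⟩ := exists_Gfun_eq_of_lt (r := Q + κ / 2) hτ' hτα' hα' (by linarith)
      (by linarith) hG' hw2
    refine errorLowerBound_of_critDist_le hx hx1 f1 f2 f3 f4 f5 hw2 le_rfl (by linarith) hm ?_
    rw [unionExp_critDist hx]; linarith
  set D := Real.log 2 - Real.binEntropy (x / (1 + x)) - Q with hD
  have hD0 : 0 < D := by linarith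
  have hθD : (r - Q - κ) / D * D = r - Q - κ := div_mul_cancel₀ _ hD0.ne'
  have hθ0 : 0 ≤ (r - Q - κ) / D := div_nonneg (by linarith) hD0.le
  have hθ1 : (r - Q - κ) / D < 1 := by rw [div_lt_one hD0]; linarith
  set θ := (r - Q - κ) / D
  have := base.straight_line hp0 hp hq0 hq hθ0 hθ1 (by linarith) (R := r) (by
    have : Real.log 2 - Real.binEntropy (x / (1 + x)) = D + Q := by rw [hD]; ring
    rw [this]
    nlinarith)
  refine this.mono ?_
  have hcE : klBin (x / (1 + x)) p = critExp x := rfl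
  rw [hcE]
  have h3 : θ * D ≤ θ * (m - critExp x) := mul_le_mul_of_nonneg_left (by linarith) hθ0
  have h4 : m - r + Q ≤ max (Real.log 2 - r + Real.log (1 - w)) (m - (r - r')) := by
    rcases max_choice r' (Real.log 2 + Real.log (1 - w) - m) with hc | hc
    · exact le_trans (by rw [hQ, hc]; linarith) (le_max_right _ _)
    · exact le_trans (by rw [hQ, hc]; linarith) (le_max_left _ _)
  nlinarith

theorem binEntropy_sub_two_mul_monotoneOn :
    MonotoneOn (fun y => Real.binEntropy y - 2 * (y * (1 - y))) (Set.Icc 0 (1 / 2)) := by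
  have hd : ∀ y ∈ Set.Ioo (0:ℝ) (1 / 2), HasDerivAt (fun y => Real.binEntropy y - 2 * (y * (1 - y)))
      (Real.log (1 - y) - Real.log y - 2 * (1 - 2 * y)) y := by
    intro y hy
    have h1 := Real.hasDerivAt_binEntropy hy.1.ne' (by linarith [hy.2] : y ≠ 1)
    have h2 := ((hasDerivAt_id y).mul ((hasDerivAt_id y).const_sub 1)).const_mul 2
    exact (h1.sub h2).congr_deriv (by simp; ring)
  apply monotoneOn_of_deriv_nonneg (convex_Icc _ _)
  · have := Real.binEntropy_continuous
    fun_prop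
  · intro y hy
    rw [interior_Icc] at hy
    exact (hd y hy).differentiableAt.differentiableWithinAt
  · intro y hy
    rw [interior_Icc] at hy
    rw [(hd y hy).deriv, ← Real.log_div (by linarith [hy.2]) hy.1.ne']
    have := Real.le_log_one_add_of_nonneg (x := (1 - 2 * y) / y) (div_nonneg (by linarith [hy.2]) hy.1.le)
    have e1 : 1 + (1 - 2 * y) / y = (1 - y) / y := by field_simp [hy.1.ne']; ring
    have e2 : 2 * ((1 - 2 * y) / y) / ((1 - 2 * y) / y + 2) = 2 * (1 - 2 * y) := by
      have := hy.1.ne'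
      field_simp; ring
    rw [e1, e2] at this
    linarith

theorem sinh_half_log {y : ℝ} (h0 : 0 < y) (h1 : y < 1) :
    Real.sinh ((Real.log (1 - y) - Real.log y) / 2) = (1 - 2 * y) / (2 * Real.sqrt (y * (1 - y))) := by
  have hs : 0 < Real.sqrt (y * (1 - y)) := Real.sqrt_pos.2 (mul_pos h0 (by linarith))
  have hsq := Real.sq_sqrt (mul_nonneg h0.le (by linarith : 0 ≤ 1 - y))
  set σ := Real.sqrt (y * (1 - y))
  have e : Real.log σ = (Real.log y + Real.log (1 - y)) / 2 := by
    rw [← Real.log_mul h0.ne' (by linarith), ← hsq, Real.log_pow]; push_cast; ring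
  have e1 : Real.exp ((Real.log (1 - y) - Real.log y) / 2) = (1 - y) / σ := by
    rw [← Real.exp_log (div_pos (by linarith : 0 < 1 - y) hs), Real.log_div (by linarith) hs.ne', e]
    congr 1; ring
  rw [Real.sinh_eq, Real.exp_neg, e1]
  have h2 : 1 - y ≠ 0 := by linarith
  field_simp
  nlinarith

theorem sinh_le_of_le {s S : ℝ} (hs : 0 ≤ s) (hS : s ≤ S) (hS0 : 0 < S) :
    Real.sinh s ≤ s / S * Real.sinh S := by
  have hc : ConvexOn ℝ (Set.Ici 0) Real.sinh := by
    apply MonotoneOn.convexOn_of_deriv (convex_Ici 0) Real.continuous_sinh.continuousOn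
      Real.differentiable_sinh.differentiableOn
    intro a ha b hb hab
    rw [interior_Ici] at ha hb
    rw [Real.deriv_sinh]
    exact Real.cosh_le_cosh.2 (by rw [abs_of_pos ha, abs_of_pos hb]; exact hab)
  have := hc.2 (Set.mem_Ici.2 hS0.le) (Set.mem_Ici.2 le_rfl) (div_nonneg hs hS0.le)
    (by rw [sub_nonneg, div_le_one hS0]; exact hS : 0 ≤ 1 - s / S) (by ring)
  simp only [smul_eq_mul, mul_zero, add_zero, Real.sinh_zero] at this
  rwa [div_mul_cancel₀ _ hS0.ne'] at this

/-- Lower bound for the entropy increment in terms of the increment of `√(τ(1-τ))`. -/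
theorem mul_sqrt_sub_le_binEntropy {c w t τ : ℝ} (hw : 16 / 81 ≤ w) (hw2 : w < 1 / 2)
    (hc : c ≤ entSlope w) (hc0 : 0 ≤ c) (ht0 : 0 < t) (ht : t ≤ τ) (hτ : τ ≤ 1 / 2)
    (hσ : Real.sqrt (t * (1 - t)) = 1 / 2 - w) :
    c * (Real.sqrt (τ * (1 - τ)) - Real.sqrt (t * (1 - t))) ≤
      Real.binEntropy τ - Real.binEntropy t := by
  have hd : ∀ y ∈ Set.Ioo t (1 / 2), HasDerivAt
      (fun y => Real.binEntropy y - c * Real.sqrt (y * (1 - y)))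
      (Real.log (1 - y) - Real.log y - c * ((1 - 2 * y) / (2 * Real.sqrt (y * (1 - y))))) y := by
    intro y hy
    have hy0 := ht0.trans hy.1
    have h1 := Real.hasDerivAt_binEntropy hy0.ne' (by linarith [hy.2] : y ≠ 1)
    have h2 := (((hasDerivAt_id y).mul ((hasDerivAt_id y).const_sub 1)).sqrt
      (mul_pos hy0 (by simp; linarith [hy.2])).ne').const_mul c
    exact (h1.sub h2).congr_deriv (by simp; left; congr 1; ring)
  have hmono : MonotoneOn (fun y => Real.binEntropy y - c * Real.sqrt (y * (1 - y))) (Set.Icc t (1 / 2)) := by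
    apply monotoneOn_of_deriv_nonneg (convex_Icc _ _)
    · have := Real.binEntropy_continuous
      fun_prop
    · intro y hy
      rw [interior_Icc] at hy
      exact (hd y hy).differentiableAt.differentiableWithinAt
    · intro y hy
      rw [interior_Icc] at hy
      have hy0 := ht0.trans hy.1
      rw [(hd y hy).deriv, ← sinh_half_log hy0 (by linarith [hy.2])]
      set s := (Real.log (1 - y) - Real.log y) / 2 with hs
      set S := (Real.log (1 - t) - Real.log t) / 2 with hS
      have l1 := Real.log_le_log ht0 hy.1.le
      have l2 := Real.log_le_log (by linarith [hy.2] : 0 < 1 - y) (by linarith [hy.1] : 1 - y ≤ 1 - t)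
      have l3 := Real.log_le_log hy0 (by linarith [hy.2] : y ≤ 1 - y)
      have hs0 : 0 ≤ s := by linarith
      have hsS : s ≤ S := by linarith
      have e2 : Real.sqrt (w * (1 - w)) ^ 2 = w * (1 - w) := Real.sq_sqrt (by nlinarith)
      have e2' : 0 < Real.sqrt (w * (1 - w)) := Real.sqrt_pos.2 (by nlinarith)
      have e1 : Real.sinh S = Real.sqrt (w * (1 - w)) / (1 / 2 - w) := by
        rw [hS, sinh_half_log ht0 (by linarith [hy.1, hy.2]), hσ]
        have q := Real.sq_sqrt (by nlinarith [hy.1, hy.2] : 0 ≤ t * (1 - t))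
        rw [hσ] at q
        have : 1 - 2 * t = 2 * Real.sqrt (w * (1 - w)) := by
          rw [← pow_left_inj₀ (by linarith [hy.1, hy.2]) (by positivity) two_ne_zero, mul_pow, e2]
          nlinarith
        rw [this]
        have : 1 / 2 - w ≠ 0 := by linarith
        field_simp
      have hcs : c * Real.sinh S ≤ 2 := by
        have a := Real.self_le_sinh_iff.2 (by linarith : 0 ≤ c / 2)
        have b : Real.sinh (c / 2) ≤ Real.sinh ((Real.log (1 - w) - Real.log w) / 2) := by
          rw [entSlope] at hc
          exact Real.sinh_le_sinh.2 (by linarith)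
        rw [sinh_half_log (by linarith) (by linarith)] at b
        have hh : 0 < 1 / 2 - w := by linarith
        rw [e1, ← mul_div_assoc, div_le_iff₀ hh]
        have : c / 2 ≤ (1 - 2 * w) / (2 * Real.sqrt (w * (1 - w))) := a.trans b
        rw [le_div_iff₀ (by positivity)] at this
        linarith
      have hS1 : 1 ≤ S := by
        rw [← Real.sinh_le_sinh, e1, le_div_iff₀ (by linarith), Real.sinh_eq]
        have := Real.exp_one_lt_d9
        have h1 : (1 / 3 : ℝ) ≤ Real.exp (-1) := by
          rw [Real.exp_neg, le_inv_comm₀ (by norm_num) (Real.exp_pos _)]; linarith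
        have h2 : (39 / 100 : ℝ) ≤ Real.sqrt (w * (1 - w)) := Real.le_sqrt_of_sq_le (by nlinarith)
        nlinarith
      have := sinh_le_of_le hs0 hsS (by linarith)
      have h3 : c * Real.sinh s ≤ s / S * (c * Real.sinh S) := by
        have := mul_le_mul_of_nonneg_left this hc0
        linarith
      have h4 : s / S * (c * Real.sinh S) ≤ s / S * 2 := mul_le_mul_of_nonneg_left hcs (by positivity)
      have h5 : s / S ≤ s := div_le_self hs0 hS1
      linarith
  have := hmono ⟨le_rfl, by linarith⟩ ⟨ht, hτ⟩ ht
  simp only at this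
  linarith

theorem critDist_ge {x : ℝ} (hx : 1 / 8 ≤ x) (hx1 : x < 1) : 16 / 81 ≤ critDist x := by
  rw [critDist, div_le_div_iff₀ (by norm_num) (by positivity)]; nlinarith

theorem Gfun_mul {α τ : ℝ} (h0 : 0 ≤ τ) (h1 : τ ≤ 1) : Gfun α τ * (1 + 2 * Real.sqrt (τ * (1 - τ))) =
    2 * (α * (1 - α) - Real.sqrt (τ * (1 - τ)) ^ 2) := by
  have := Real.sqrt_nonneg (τ * (1 - τ))
  rw [Real.sq_sqrt (mul_nonneg h0 (by linarith)), Gfun, div_mul_cancel₀]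
  positivity

theorem exists_feasible {x α τ r δ m : ℝ} (hx : 1 / 8 ≤ x) (hx1 : x < 1)
    (hτ : 0 ≤ τ) (hτα : τ ≤ α) (hα : α ≤ 1 / 2)
    (hL : Real.log 2 - Real.binEntropy α + Real.binEntropy τ ≤ r) (hG : Gfun α τ = δ)
    (hδ : δ < critDist x) (hm0 : 0 ≤ m) (hm1 : m ≤ critDist x)
    (hm : m ≤ bhat (x ^ 2 / (1 + x ^ 2)) * critDist x) :
    ∃ α' τ', 0 ≤ τ' ∧ τ' ≤ α' ∧ α' ≤ 1 / 2 ∧ Real.log 2 - Real.binEntropy α' + Real.binEntropy τ' ≤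
      r - m / critDist x * (critDist x - δ) ∧ Gfun α' τ' ≤ critDist x := by
  have hx0 : 0 < x := by linarith
  have hw16 := critDist_ge hx hx1
  have hw := critDist_pos hx0
  have hw2 := critDist_lt hx0 hx1
  have hbs := bhat_le_entSlope hx0 hx1 hw le_rfl
  set w := critDist x with hwdef
  set c := bhat (x ^ 2 / (1 + x ^ 2))
  have hmw1 : m / w ≤ 1 := (div_le_one hw).2 hm1
  have hmwc : m / w ≤ c := (div_le_iff₀ hw).2 hm
  have hmw0 : 0 ≤ m / w := by positivity
  have hs0 := Real.sqrt_nonneg (τ * (1 - τ))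
  have hGα := Gfun_mul (α := α) hτ (by linarith)
  rw [hG] at hGα
  rcases le_or_gt w (Gfun (1 / 2) τ) with h | h
  · have hcont : ContinuousOn (fun a => Gfun a τ) (Set.Icc α (1 / 2)) :=
      (continuous_Gfun.comp (by fun_prop : Continuous fun a : ℝ => (a, τ))).continuousOn
    obtain ⟨a, ⟨ha1, ha2⟩, ha⟩ := intermediate_value_Icc hα hcont ⟨by linarith, h⟩
    simp only at ha
    refine ⟨a, τ, hτ, by linarith, ha2, ?_, ha.le⟩
    have hGa := Gfun_mul (α := a) hτ (by linarith)
    rw [ha] at hGa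
    have := binEntropy_sub_two_mul_monotoneOn ⟨by linarith, hα⟩ ⟨by linarith, ha2⟩ ha1
    simp only at this
    have h1 : m / w * (w - δ) ≤ 1 * (w - δ) := mul_le_mul_of_nonneg_right hmw1 (by linarith)
    nlinarith [mul_nonneg hs0 (by linarith : 0 ≤ w - δ)]
  · rw [Gfun_half hτ (by linarith)] at h
    have hcont : ContinuousOn (fun t : ℝ => Real.sqrt (t * (1 - t))) (Set.Icc 0 τ) := by fun_prop
    obtain ⟨t, ⟨ht1, ht2⟩, ht⟩ := intermediate_value_Icc hτ hcont
      (show 1 / 2 - w ∈ _ from ⟨by simp only [zero_mul, Real.sqrt_zero]; linarith, by linarith⟩)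
    simp only at ht
    have ht0 : 0 < t := by
      rcases ht1.eq_or_lt with h0 | h0
      · rw [← h0, zero_mul, Real.sqrt_zero] at ht; linarith
      · exact h0
    refine ⟨1 / 2, t, ht1, by linarith, le_rfl, ?_, ?_⟩
    swap
    · rw [Gfun_half ht1 (by linarith), ht]; linarith
    have h1 := mul_sqrt_sub_le_binEntropy hw16 hw2 (hmwc.trans hbs) hmw0 ht0 ht2 (by linarith) ht
    have h2 := binEntropy_sub_two_mul_monotoneOn ⟨by linarith, hα⟩ ⟨by norm_num, le_rfl⟩ hα
    simp only at h2
    rw [ht] at h1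
    set σ := Real.sqrt (τ * (1 - τ))
    have h4 : 0 ≤ 2 * (1 / 4 - α * (1 - α)) := by nlinarith [sq_nonneg (α - 1 / 2)]
    have h3 : (1 / 2 - σ - δ) ≤ 2 * (1 / 4 - α * (1 - α)) := by
      rcases le_total (1 / 2 - σ - δ) 0 with h0 | h0
      · linarith
      · nlinarith [mul_nonneg hs0 h0]
    have h5 : m / w * (2 * (1 / 4 - α * (1 - α))) ≤ 2 * (1 / 4 - α * (1 - α)) := by
      nlinarith
    have h6 : m / w * (1 / 2 - σ - δ) ≤ m / w * (2 * (1 / 4 - α * (1 - α))) :=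
      mul_le_mul_of_nonneg_left h3 hmw0
    nlinarith

theorem overlapBound_bhat_mul {p g : ℝ} (hp0 : 0 < p) (hp : p < 1 / 2) (hg : g ≤ 1 / 2) :
    OverlapBound p g (bhat p * g) := by
  intro ω l η h1 h2 h3 h4 h5 h6
  have := overlapExp_nonpos (p := p) (ω := ω) (l := l) (η := η) h4 h5 (by linarith) (by linarith) h6
    (by nlinarith)
  have := mul_le_mul_of_nonneg_left (h2.trans h3) (bhat_pos hp0 hp).le
  linarith

theorem bhat_le_one {x : ℝ} (hx : 1 / 5 ≤ x) (hx1 : x < 1) : bhat (x ^ 2 / (1 + x ^ 2)) ≤ 1 := by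
  have hx0 : 0 < x := by linarith
  rw [bhat_eq hx0, ← Real.log_div (by positivity) (by norm_num), ← Real.log_div (by positivity) hx0.ne',
    Real.log_le_iff_le_exp (by positivity), div_le_iff₀ hx0]
  have := Real.exp_one_gt_d9
  nlinarith

set_option maxHeartbeats 1000000 in
/-- The bound on the overlap exponent valid for `x ≤ 1/5`. -/
theorem overlapBound_critVal {x : ℝ} (hx : 0 < x) (hx1 : x ≤ 1 / 5) :
    OverlapBound (x ^ 2 / (1 + x ^ 2)) (critDist x) (critVal x) := by
  intro ω l η hl hlω hω hη hηl h3
  have hw := critDist_pos hx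
  have hw2 := critDist_lt hx (by linarith)
  have hq : 0 < 1 - x + x ^ 2 := by nlinarith [sq_nonneg (x - 1)]
  have hp0 : 0 < x ^ 2 / (1 + x ^ 2) := by positivity
  have hp : x ^ 2 / (1 + x ^ 2) < 1 / 2 := by
    rw [div_lt_div_iff₀ (by positivity) (by norm_num)]; nlinarith
  set p := x ^ 2 / (1 + x ^ 2) with hpdef
  have h13 : 1 + x ^ 3 = (1 + x) * (1 - x + x ^ 2) := by ring
  have a1 := phi_le_cross (r := x / (1 + x)) hη hηl (by positivity)
    (by rw [div_lt_one (by positivity)]; linarith)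
  have a2 := phi_le_cross (m := ω - l / 2) (k := ω / 2 - η) (r := 1 / (1 + x)) (by linarith) (by linarith)
    (by positivity) (by rw [div_lt_one (by positivity)]; linarith)
  have a3 := phi_le_cross (m := 1 - ω - l / 2) (k := p * (1 - ω) - η) (r := x ^ 3 / (1 + x ^ 3))
    (by linarith) (by nlinarith) (by positivity) (by rw [div_lt_one (by positivity)]; linarith [pow_pos hx 3])
  have e1 : 1 - x / (1 + x) = 1 / (1 + x) := by field_simp; ring
  have e2 : 1 - 1 / (1 + x) = x / (1 + x) := by field_simp; ring
  have e3 : 1 - x ^ 3 / (1 + x ^ 3) = 1 / (1 + x ^ 3) := by field_simp; ring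
  have f1 : Real.log (x / (1 + x)) = Real.log x - Real.log (1 + x) :=
    Real.log_div (by positivity) (by positivity)
  have f2 : Real.log (1 / (1 + x)) = - Real.log (1 + x) := by
    rw [Real.log_div (by positivity) (by positivity), Real.log_one, zero_sub]
  have f3 : Real.log (x ^ 3 / (1 + x ^ 3)) = 3 * Real.log x - (Real.log (1 + x) + Real.log (1 - x + x ^ 2)) := by
    rw [Real.log_div (by positivity) (by positivity), h13, Real.log_mul (by positivity) hq.ne', Real.log_pow]
    push_cast; ring
  have f4 : Real.log (1 / (1 + x ^ 3)) = - (Real.log (1 + x) + Real.log (1 - x + x ^ 2)) := by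
    rw [Real.log_div (by positivity) (by positivity), Real.log_one, h13, Real.log_mul (by positivity) hq.ne']
    ring
  rw [e1, f1, f2] at a1
  rw [e2, f1, f2] at a2
  rw [e3, f3, f4] at a3
  have hl2 := Real.log_pos one_lt_two
  have k1 : 0 ≤ 2 * Real.log (1 + x ^ 2) - 2 * Real.log 2 - Real.log x - Real.log (1 - x + x ^ 2) := by
    have : Real.log (2 ^ 2 * x * (1 - x + x ^ 2)) ≤ Real.log ((1 + x ^ 2) ^ 2) :=
      Real.log_le_log (by positivity) (by nlinarith [sq_nonneg ((1 - x) ^ 2)])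
    rw [Real.log_mul (by positivity) hq.ne', Real.log_mul (by positivity) hx.ne', Real.log_pow,
      Real.log_pow] at this
    push_cast at this
    linarith
  have k2 : 0 ≤ 2 * Real.log (1 + x ^ 2) - 2 * Real.log 2 - (1 - p) * Real.log x -
      3 / 2 * Real.log (1 - x + x ^ 2) := by
    have b1 : 0 ≤ Real.log (1 + x ^ 2) := Real.log_nonneg (by nlinarith)
    have b2 : Real.log (1 - x + x ^ 2) ≤ 0 := Real.log_nonpos hq.le (by nlinarith)
    have b3 : p ≤ 1 / 25 := by
      rw [hpdef, div_le_div_iff₀ (by positivity) (by norm_num)]; nlinarith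
    have b4 : Real.log x ≤ - Real.log 5 := by
      rw [← Real.log_inv]; exact Real.log_le_log hx (by norm_num; linarith)
    have b5 : (9:ℝ) * Real.log 2 ≤ 4 * Real.log 5 := by
      have : Real.log (2 ^ 9) ≤ Real.log (5 ^ 4) := Real.log_le_log (by norm_num) (by norm_num)
      rw [Real.log_pow, Real.log_pow] at this
      exact_mod_cast this
    have b6 : (1 - p) * Real.log x ≤ 24 / 25 * (- Real.log 5) := by
      have c1 := mul_nonneg (by linarith : 0 ≤ 1 - p) (by linarith : 0 ≤ - Real.log 5 - Real.log x)
      have c2 := mul_nonneg (by linarith : 0 ≤ 1 / 25 - p) (by linarith : 0 ≤ Real.log 5)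
      linarith
    linarith
  have g := binEntropy_sq_div hx
  have gb := bhat_eq hx
  rw [overlapExp, g, gb]
  have F := critVal_eq hx
  have w1 := neg_log_critDist hx
  have cw : critVal x = Real.log (1 + x) + Real.log (1 - x + x ^ 2) - Real.log (1 + x ^ 2) - p * Real.log x +
      critDist x * (2 * Real.log (1 + x ^ 2) - 2 * Real.log 2 - (1 - p) * Real.log x -
      3 / 2 * Real.log (1 - x + x ^ 2)) := by
    rw [F]
    have : (2 * x + x ^ 2) / (1 + x) ^ 2 = p + critDist x * (1 - p) := by
      rw [hpdef, critDist]; field_simp; ring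
    rw [this]; ring
  rw [cw]
  have m1 := mul_le_mul_of_nonneg_left hω k2
  have m2 := mul_le_mul_of_nonneg_left hlω k1
  linarith

theorem log_one_add_le_cubic {y : ℝ} (hy : 0 ≤ y) : Real.log (1 + y) ≤ y - y ^ 2 / 2 + y ^ 3 / 3 := by
  have hd : ∀ t : ℝ, 0 ≤ t → HasDerivAt (fun t => t - t ^ 2 / 2 + t ^ 3 / 3 - Real.log (1 + t))
      (t ^ 3 / (1 + t)) t := by
    intro t ht
    have h1 := (((hasDerivAt_id t).sub ((hasDerivAt_pow 2 t).div_const 2)).add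
      ((hasDerivAt_pow 3 t).div_const 3)).sub (((hasDerivAt_id t).const_add 1).log (by simp; linarith))
    refine h1.congr_deriv ?_
    have : 1 + t ≠ 0 := by linarith
    simp; field_simp; ring
  have hm : MonotoneOn (fun t => t - t ^ 2 / 2 + t ^ 3 / 3 - Real.log (1 + t)) (Set.Icc 0 y) := by
    apply monotoneOn_of_deriv_nonneg (convex_Icc _ _)
    · exact fun t ht => (hd t ht.1).continuousAt.continuousWithinAt
    · intro t ht
      rw [interior_Icc] at ht
      exact (hd t ht.1.le).differentiableAt.differentiableWithinAt
    · intro t ht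
      rw [interior_Icc] at ht
      have := ht.1
      rw [(hd t ht.1.le).deriv]; positivity
  have := hm ⟨le_rfl, hy⟩ ⟨hy, le_rfl⟩ hy
  norm_num at this
  linarith

theorem quadratic_le_log_one_add {y : ℝ} (hy : 0 ≤ y) : y - y ^ 2 / 2 ≤ Real.log (1 + y) := by
  refine le_trans ?_ (Real.le_log_one_add_of_nonneg hy)
  rw [le_div_iff₀ (by linarith)]
  nlinarith [pow_nonneg hy 3]

theorem log_one_sub_le {u : ℝ} (h0 : 0 ≤ u) (h1 : u < 1) : Real.log (1 - u) ≤ -u - u ^ 2 / 2 := by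
  have h := Real.hasSum_pow_div_log_of_abs_lt_one (x := u) (by rwa [abs_of_nonneg h0])
  have := sum_le_hasSum (Finset.range 2) (fun i _ => by positivity) h
  norm_num [Finset.sum_range_succ] at this
  linarith

theorem one_add_sq_mul_critVal {x : ℝ} (hx : 0 < x) : (1 + x) ^ 2 * critVal x =
    (1 + x) ^ 2 * Real.log (1 + x) + (1 - x + x ^ 2) * Real.log (1 - x + x ^ 2) -
      (1 - x) ^ 2 * Real.log (1 + x ^ 2) - 4 * x * Real.log 2 - (2 * x + x ^ 2) * Real.log x := by
  rw [critVal_eq hx, critDist]; field_simp; ring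

theorem critVal_le_critDist {x : ℝ} (hx : 1 / 8 ≤ x) (hx1 : x ≤ 1 / 5) : critVal x ≤ critDist x := by
  have hx0 : 0 < x := by linarith
  have hq : 0 < 1 - x + x ^ 2 := by nlinarith [sq_nonneg (x - 1)]
  have a1 := log_one_add_le_cubic hx0.le
  have a2 := log_one_sub_le (u := x - x ^ 2) (by nlinarith) (by nlinarith)
  rw [show 1 - (x - x ^ 2) = 1 - x + x ^ 2 by ring] at a2
  have a3 := quadratic_le_log_one_add (sq_nonneg x)
  have a4 := Real.one_sub_inv_le_log_of_pos (by linarith : 0 < 8 * x)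
  rw [Real.log_mul (by norm_num) hx0.ne', show (8:ℝ) = 2 ^ 3 by norm_num, Real.log_pow] at a4
  push_cast at a4
  have l1 := Real.log_two_gt_d9
  have l2 := Real.log_two_lt_d9
  have h := one_add_sq_mul_critVal hx0
  have b4 : - ((2 * x + x ^ 2) * Real.log x) ≤ (2 * x + x ^ 2) * (3 * Real.log 2 - 1) + (2 + x) / 8 := by
    have := mul_le_mul_of_nonneg_left a4 (by positivity : 0 ≤ 2 * x + x ^ 2)
    have e : (2 * x + x ^ 2) * (1 - (2 ^ 3 * x)⁻¹) = (2 * x + x ^ 2) - (2 + x) / 8 := by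
      field_simp; ring
    rw [e] at this
    linarith
  have b1 := mul_le_mul_of_nonneg_left a1 (by positivity : 0 ≤ (1 + x) ^ 2)
  have b2 := mul_le_mul_of_nonneg_left a2 hq.le
  have b3 := mul_le_mul_of_nonneg_left a3 (by positivity : 0 ≤ (1 - x) ^ 2)
  have : (1 + x) ^ 2 * critVal x ≤ (1 + x) ^ 2 * critDist x := by
    have e : (1 + x) ^ 2 * critDist x = 2 * x := by rw [critDist]; field_simp
    rw [e, h]
    have c1 : (2 * x + x ^ 2) * (3 * Real.log 2 - 1) - 4 * x * Real.log 2 ≤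
      (2 * x + x ^ 2) * (3 * 0.69315 - 1) - 4 * x * 0.69315 := by nlinarith
    obtain ⟨y, rfl⟩ : ∃ y, x = 1 / 8 + y := ⟨x - 1 / 8, by ring⟩
    have hy0 : 0 ≤ y := by linarith
    have hy1 : y ≤ 3 / 40 := by linarith
    have p2 : 0 ≤ y * (3 / 40 - y) := mul_nonneg hy0 (by linarith)
    have p3 := mul_nonneg p2 hy0
    have p4 := mul_nonneg p3 hy0
    have p5 := mul_nonneg p4 hy0
    nlinarith
  exact le_of_mul_le_mul_left this (by positivity)

theorem errorLowerBound_of_eighth_le {x α τ r δ M : ℝ} (hx : 1 / 8 ≤ x) (hx1 : x < 1)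
    (hτ : 0 ≤ τ) (hτα : τ ≤ α) (hα : α ≤ 1 / 2)
    (hL : Real.log 2 - Real.binEntropy α + Real.binEntropy τ ≤ r) (hG : Gfun α τ = δ)
    (hδ0 : 0 < δ) (hδ : δ < critDist x) (hr : r < Real.log 2 - Real.binEntropy (x / (1 + x)))
    (hM : 0 ≤ M) (hO : OverlapBound (x ^ 2 / (1 + x ^ 2)) δ M) :
    ErrorLowerBound (x ^ 2 / (1 + x ^ 2)) r (max (unionExp (x ^ 2 / (1 + x ^ 2)) r δ) M) := by
  have hx0 : 0 < x := by linarith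
  have hw := critDist_pos hx0
  have hw2 := critDist_lt hx0 hx1
  have hp0 : 0 < x ^ 2 / (1 + x ^ 2) := by positivity
  have hp : x ^ 2 / (1 + x ^ 2) < 1 / 2 := by
    rw [div_lt_div_iff₀ (by positivity) (by norm_num)]; nlinarith
  set w := critDist x with hwdef
  have o1 : OverlapBound (x ^ 2 / (1 + x ^ 2)) w (M * w / δ) := by
    have := hO.scale hp0 hp (κ := δ / w) (by positivity) ((div_le_one hw).2 hδ.le)
      (by rw [div_div_cancel₀ hδ0.ne']; linarith)
    rwa [div_div_cancel₀ hδ0.ne', div_div_eq_mul_div] at this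
  have o2 := overlapBound_bhat_mul hp0 hp hw2.le
  have o3 : OverlapBound (x ^ 2 / (1 + x ^ 2)) w w := by
    rcases le_total (1 / 5) x with h | h
    · exact o2.mono (by nlinarith [bhat_le_one h hx1])
    · exact (overlapBound_critVal hx0 h).mono (critVal_le_critDist hx h)
  obtain ⟨m, hm, m1, m2, m3, m0⟩ : ∃ m, OverlapBound (x ^ 2 / (1 + x ^ 2)) w m ∧ m ≤ M * w / δ ∧
      m ≤ bhat (x ^ 2 / (1 + x ^ 2)) * w ∧ m ≤ w ∧ 0 ≤ m := by
    refine ⟨min (M * w / δ) (min (bhat (x ^ 2 / (1 + x ^ 2)) * w) w), ?_, min_le_left _ _,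
      (min_le_right _ _).trans (min_le_left _ _), (min_le_right _ _).trans (min_le_right _ _), ?_⟩
    · rcases min_choice (M * w / δ) (min (bhat (x ^ 2 / (1 + x ^ 2)) * w) w) with h | h
      · rwa [h]
      · rw [h]
        rcases min_choice (bhat (x ^ 2 / (1 + x ^ 2)) * w) w with h | h <;> rwa [h]
    · exact le_min (by positivity) (le_min (mul_nonneg (bhat_pos hp0 hp).le hw.le) hw.le)
  obtain ⟨α', τ', a1, a2, a3, a4, a5⟩ := exists_feasible hx hx1 hτ hτα hα hL hG hδ m0 m3 m2
  have key := errorLowerBound_of_lt_critRate hx0 hx1 hτ hτα hα hL (by rw [hG]; exact hδ) hr hm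
    a1 a2 a3 a4 a5 (fun h => by
      have : 0 < m / critDist x * (critDist x - δ) := mul_pos (div_pos h hw) (by linarith)
      linarith)
  refine key.mono (max_le_max ?_ ?_)
  · exact unionExp_critDist_le hx0 hx1 r hδ0.le (by linarith)
  · rw [← hwdef]
    have : m - (r - (r - m / w * (w - δ))) = m * δ / w := by field_simp; ring
    rw [this, div_le_iff₀ hw]
    rwa [le_div_iff₀ hδ0] at m1

theorem le_log_one_sub {u : ℝ} (h0 : 0 ≤ u) (h1 : u ≤ 1 / 6) :
    -u - u ^ 2 / 2 - 2 / 5 * u ^ 3 ≤ Real.log (1 - u) := by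
  have hd : ∀ t : ℝ, t ≤ 1 / 6 → HasDerivAt (fun t => Real.log (1 - t) + t + t ^ 2 / 2 + 2 / 5 * t ^ 3)
      (t ^ 2 * (1 / 5 - 6 / 5 * t) / (1 - t)) t := by
    intro t ht
    have h1 := (((((hasDerivAt_id t).const_sub 1).log (by simp; linarith)).add (hasDerivAt_id t)).add
      ((hasDerivAt_pow 2 t).div_const 2)).add ((hasDerivAt_pow 3 t).const_mul (2 / 5 : ℝ))
    refine h1.congr_deriv ?_
    have : 1 - t ≠ 0 := by linarith
    simp; field_simp; ring
  have hm : MonotoneOn (fun t => Real.log (1 - t) + t + t ^ 2 / 2 + 2 / 5 * t ^ 3) (Set.Icc 0 u) := by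
    apply monotoneOn_of_deriv_nonneg (convex_Icc _ _)
    · exact fun t ht => (hd t (ht.2.trans h1)).continuousAt.continuousWithinAt
    · intro t ht
      rw [interior_Icc] at ht
      exact (hd t (ht.2.le.trans h1)).differentiableAt.differentiableWithinAt
    · intro t ht
      rw [interior_Icc] at ht
      have := ht.1
      have h2 : t ≤ 1 / 6 := ht.2.le.trans h1
      rw [(hd t h2).deriv]
      exact div_nonneg (mul_nonneg (by positivity) (by linarith)) (by linarith)
  have := hm ⟨le_rfl, h0⟩ ⟨h0, le_rfl⟩ h0
  norm_num at this
  linarith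

theorem mul_bhat_le_critVal {x : ℝ} (hx : 0 < x) (hx1 : x ≤ 1 / 8) :
    17 / 25 * (bhat (x ^ 2 / (1 + x ^ 2)) * critDist x) ≤ critVal x := by
  have hq : 0 < 1 - x + x ^ 2 := by nlinarith [sq_nonneg (x - 1)]
  have a1 := Real.le_log_one_add_of_nonneg hx.le
  have hu0 : 0 ≤ x - x ^ 2 := by nlinarith
  have hu1 : x - x ^ 2 ≤ 1 / 6 := by nlinarith
  have a2 := le_log_one_sub hu0 hu1
  rw [show 1 - (x - x ^ 2) = 1 - x + x ^ 2 by ring] at a2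
  have a3 : Real.log (1 + x ^ 2) ≤ x ^ 2 := by
    have := Real.log_le_sub_one_of_pos (by positivity : 0 < 1 + x ^ 2); linarith
  have a4 := Real.log_le_sub_one_of_pos (by linarith : 0 < 8 * x)
  rw [Real.log_mul (by norm_num) hx.ne', show (8:ℝ) = 2 ^ 3 by norm_num, Real.log_pow] at a4
  push_cast at a4
  have l2 := Real.log_two_lt_d9
  have h := one_add_sq_mul_critVal hx
  have b1 : x + 3 / 2 * x ^ 2 + x ^ 3 / 4 - x ^ 4 / 8 ≤ (1 + x) ^ 2 * Real.log (1 + x) := by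
    refine le_trans ?_ (mul_le_mul_of_nonneg_left a1 (by positivity))
    rw [mul_div_assoc', le_div_iff₀ (by positivity)]
    nlinarith [pow_pos hx 5]
  have b2 : -(x - x ^ 2) + (x - x ^ 2) ^ 2 / 2 ≤ (1 - x + x ^ 2) * Real.log (1 - x + x ^ 2) := by
    refine le_trans ?_ (mul_le_mul_of_nonneg_left a2 hq.le)
    nlinarith [pow_nonneg hu0 3, pow_nonneg hu0 4]
  have b3 : (1 - x) ^ 2 * Real.log (1 + x ^ 2) ≤ (1 - x) ^ 2 * x ^ 2 :=
    mul_le_mul_of_nonneg_left a3 (by positivity)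
  have b4 := mul_le_mul_of_nonneg_left a4 (by positivity : 0 ≤ 16 / 25 * x + x ^ 2)
  have b5 := mul_le_mul_of_nonneg_left a3 hx.le
  have b6 := mul_nonneg (mul_nonneg hx.le (by linarith : 0 ≤ 18 / 25 - 3 * x))
    (by linarith : 0 ≤ 0.69315 - Real.log 2)
  have e : (1 + x) ^ 2 * critDist x = 2 * x := by rw [critDist]; field_simp
  have hfin : 0 ≤ x * ((0.64 - 0.72 * 0.69315) + (3 * 0.69315 - 2.12) * x - 8.11 * x ^ 2 - 0.625 * x ^ 3) := by
    refine mul_nonneg hx.le ?_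
    have : x ^ 2 ≤ 1 / 64 := by nlinarith
    have : x ^ 3 ≤ 1 / 512 := by nlinarith
    linarith
  have : (1 + x) ^ 2 * (17 / 25 * (bhat (x ^ 2 / (1 + x ^ 2)) * critDist x)) ≤ (1 + x) ^ 2 * critVal x := by
    have : (1 + x) ^ 2 * (17 / 25 * (bhat (x ^ 2 / (1 + x ^ 2)) * critDist x)) =
      17 / 25 * bhat (x ^ 2 / (1 + x ^ 2)) * ((1 + x) ^ 2 * critDist x) := by ring
    rw [this, e, bhat_eq hx, h]
    linarith
  exact le_of_mul_le_mul_left this (by positivity)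

theorem entSlope_mul_le {y z : ℝ} (hy : 0 < y) (hyz : y ≤ z) (hz : z ≤ 1 / 2) :
    entSlope z * (1 - 2 * y) ≤ entSlope y * (1 - 2 * z) := by
  have key : ∀ u : ℝ, 0 < u → u ≤ 1 / 2 → HasSum (fun k : ℕ => (2 : ℝ) * (1 / (2 * k + 1)) * (1 - 2 * u) ^ (2 * k + 1))
      (entSlope u) := by
    intro u hu hu1
    have h := Real.hasSum_log_sub_log_of_abs_lt_one (x := 1 - 2 * u)
      (by rw [abs_of_nonneg (by linarith)]; linarith)
    have e : Real.log (1 + (1 - 2 * u)) - Real.log (1 - (1 - 2 * u)) = entSlope u := by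
      rw [show 1 + (1 - 2 * u) = 2 * (1 - u) by ring, show 1 - (1 - 2 * u) = 2 * u by ring,
        Real.log_mul (by norm_num) (by linarith), Real.log_mul (by norm_num) hu.ne', entSlope]
      ring
    rwa [e] at h
  refine hasSum_le (fun k => ?_) ((key z (hy.trans_le hyz) hz).mul_right (1 - 2 * y))
    ((key y hy (hyz.trans hz)).mul_right (1 - 2 * z))
  have h1 : (1 - 2 * z) ^ (2 * k) ≤ (1 - 2 * y) ^ (2 * k) :=
    pow_le_pow_left₀ (by linarith) (by linarith) _
  have h2 : 0 ≤ 2 * (1 / (2 * (k:ℝ) + 1)) * ((1 - 2 * z) * (1 - 2 * y)) :=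
    mul_nonneg (by positivity) (mul_nonneg (by linarith) (by linarith))
  have := mul_le_mul_of_nonneg_left h1 h2
  rw [pow_succ, pow_succ]
  linarith

/-- The coefficient `D r = entSlope r / (1 - 2 r)` for which `H - D y(1-y)` is stationary at `r`. -/
noncomputable def entCurv (r : ℝ) : ℝ := entSlope r / (1 - 2 * r)

theorem entCurv_nonneg {r : ℝ} (h0 : 0 < r) (h1 : r < 1 / 2) : 0 ≤ entCurv r := by
  refine div_nonneg ?_ (by linarith)
  rw [entSlope, sub_nonneg]
  exact Real.log_le_log h0 (by linarith)

theorem hasDerivAt_binEntropy_sub_entCurv {r y : ℝ} (h0 : 0 < y) (h1 : y < 1) :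
    HasDerivAt (fun y => Real.binEntropy y - entCurv r * (y * (1 - y)))
      (entSlope y - entCurv r * (1 - 2 * y)) y := by
  have h1 := Real.hasDerivAt_binEntropy h0.ne' (by linarith : y ≠ 1)
  have h2 := ((hasDerivAt_id y).mul ((hasDerivAt_id y).const_sub 1)).const_mul (entCurv r)
  exact (h1.sub h2).congr_deriv (by simp only [id_eq, entSlope]; ring)

theorem monotoneOn_binEntropy_sub_entCurv {r : ℝ} (h0 : 0 < r) (h1 : r < 1 / 2) :
    MonotoneOn (fun y => Real.binEntropy y - entCurv r * (y * (1 - y))) (Set.Icc 0 r) := by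
  apply monotoneOn_of_deriv_nonneg (convex_Icc _ _)
  · have := Real.binEntropy_continuous
    fun_prop
  · intro y hy
    rw [interior_Icc] at hy
    exact (hasDerivAt_binEntropy_sub_entCurv hy.1
      (by linarith [hy.2])).differentiableAt.differentiableWithinAt
  · intro y hy
    rw [interior_Icc] at hy
    rw [(hasDerivAt_binEntropy_sub_entCurv hy.1 (by linarith [hy.2])).deriv, entCurv, sub_nonneg,
      div_mul_eq_mul_div, div_le_iff₀ (by linarith)]
    exact entSlope_mul_le hy.1 hy.2.le h1.le

theorem antitoneOn_binEntropy_sub_entCurv {r : ℝ} (h0 : 0 < r) (h1 : r < 1 / 2) :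
    AntitoneOn (fun y => Real.binEntropy y - entCurv r * (y * (1 - y))) (Set.Icc r (1 / 2)) := by
  apply antitoneOn_of_deriv_nonpos (convex_Icc _ _)
  · have := Real.binEntropy_continuous
    fun_prop
  · intro y hy
    rw [interior_Icc] at hy
    exact (hasDerivAt_binEntropy_sub_entCurv (h0.trans hy.1)
      (by linarith [hy.2])).differentiableAt.differentiableWithinAt
  · intro y hy
    rw [interior_Icc] at hy
    rw [(hasDerivAt_binEntropy_sub_entCurv (h0.trans hy.1) (by linarith [hy.2])).deriv, entCurv,
      sub_nonpos, div_mul_eq_mul_div, le_div_iff₀ (by linarith)]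
    exact entSlope_mul_le h0 hy.1.le hy.2.le

theorem binEntropy_sub_le_entCurv_mul {t τ α K d : ℝ} (ht : 0 < t) (ht1 : t < 1 / 2) (htτ : t ≤ τ)
    (hτα : τ ≤ α) (hα : α ≤ 1 / 2) (hd : entCurv t ≤ d) (hK : α * (1 - α) - τ * (1 - τ) ≤ K) :
    Real.binEntropy α - Real.binEntropy τ ≤ d * K := by
  have h := antitoneOn_binEntropy_sub_entCurv ht ht1 ⟨htτ, by linarith⟩ ⟨by linarith, hα⟩ hτα
  simp only at h
  have h0 : 0 ≤ α * (1 - α) - τ * (1 - τ) := by nlinarith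
  have h1 := mul_le_mul hd hK h0 ((entCurv_nonneg ht ht1).trans hd)
  linarith

theorem binEntropy_sub_le_of_le {t τ α r K d d' q : ℝ} (ht : 0 ≤ t) (htτ : t ≤ τ) (hτr : τ ≤ r)
    (hr0 : 0 < r) (hr1 : r < 1 / 2)
    (hτα : τ ≤ α) (hα : α ≤ 1 / 2) (hd : entCurv r ≤ d) (hd' : d' ≤ entCurv r)
    (hK : α * (1 - α) - τ * (1 - τ) ≤ K) (hq : Real.binEntropy r - Real.binEntropy t ≤ q) :
    Real.binEntropy α - Real.binEntropy τ ≤ q + d * K - d' * (r * (1 - r) - t * (1 - t)) := by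
  have h1 := monotoneOn_binEntropy_sub_entCurv hr0 hr1 ⟨ht, by linarith⟩ ⟨by linarith, hτr⟩ htτ
  have h2 : Real.binEntropy α - entCurv r * (α * (1 - α)) ≤ Real.binEntropy r - entCurv r * (r * (1 - r)) := by
    rcases le_total α r with h | h
    · exact monotoneOn_binEntropy_sub_entCurv hr0 hr1 ⟨by linarith, h⟩ ⟨hr0.le, le_rfl⟩ h
    · exact antitoneOn_binEntropy_sub_entCurv hr0 hr1 ⟨le_rfl, by linarith⟩ ⟨h, hα⟩ h
  simp only at h1
  have h0 : 0 ≤ α * (1 - α) - τ * (1 - τ) := by nlinarith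
  have h3 := mul_le_mul hd hK h0 ((entCurv_nonneg hr0 hr1).trans hd)
  have h4 := mul_le_mul_of_nonneg_right hd' (show 0 ≤ r * (1 - r) - t * (1 - t) by nlinarith)
  linarith

theorem binEntropy_sub_le_binEntropy {τ α r : ℝ} (hτ : 0 ≤ τ) (hτα : τ ≤ α) (hα : α ≤ 1 / 2)
    (hr0 : 0 < r) (hr1 : r < 1 / 2) (h : α * (1 - α) - τ * (1 - τ) ≤ r * (1 - r)) :
    Real.binEntropy α - Real.binEntropy τ ≤ Real.binEntropy r := by
  rcases le_total τ r with h1 | h1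
  · have := binEntropy_sub_le_of_le le_rfl hτ h1 hr0 hr1 hτα hα le_rfl le_rfl h le_rfl
    simp only [Real.binEntropy_zero] at this
    linarith
  · have h2 := binEntropy_sub_le_entCurv_mul hr0 hr1 h1 hτα hα le_rfl h
    have h3 := monotoneOn_binEntropy_sub_entCurv hr0 hr1 ⟨le_rfl, hr0.le⟩ ⟨hr0.le, le_rfl⟩ hr0.le
    simp only [Real.binEntropy_zero] at h3
    linarith

theorem le_of_mul_one_sub_le {x y : ℝ} (hx : x ≤ 1 / 2) (hy : y ≤ 1 / 2)
    (h : x * (1 - x) ≤ y * (1 - y)) : x ≤ y := by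
  by_contra! hlt
  nlinarith

theorem binEntropy_eq (y : ℝ) : Real.binEntropy y = - (y * Real.log y) - (1 - y) * Real.log (1 - y) := by
  rw [Real.binEntropy_eq_negMulLog_add_negMulLog_one_sub, Real.negMulLog, Real.negMulLog]; ring

/-- Numerical values of logarithms. -/
theorem log_numerics : 0.693147 ≤ Real.log 2 ∧ Real.log 2 ≤ 0.693148 ∧ 1.098612 ≤ Real.log 3 ∧
    Real.log 3 ≤ 1.098613 ∧ 1.609437 ≤ Real.log 5 ∧ Real.log 5 ≤ 1.609438 := by
  have := Real.log_two_gt_d9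
  have := Real.log_two_lt_d9
  have := Real.log_three_gt_d9
  have := Real.log_three_lt_d9
  have := Real.log_five_gt_d9
  have := Real.log_five_lt_d9
  refine ⟨?_, ?_, ?_, ?_, ?_, ?_⟩ <;> linarith

theorem log_prime_smul (a b c : ℤ) : Real.log (2 ^ a * 3 ^ b * 5 ^ c) =
    a * Real.log 2 + b * Real.log 3 + c * Real.log 5 := by
  rw [Real.log_mul (by positivity) (by positivity), Real.log_mul (by positivity) (by positivity),
    Real.log_zpow, Real.log_zpow, Real.log_zpow]

theorem binEntropy_fifth : 0.5003 ≤ Real.binEntropy (1 / 5) ∧ Real.binEntropy (1 / 5) ≤ 0.50041 := by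
  obtain ⟨_, _, _, _, _, _⟩ := log_numerics
  have h1 := log_prime_smul 0 0 (-1)
  have h2 := log_prime_smul 2 0 (-1)
  norm_num at h1 h2
  rw [binEntropy_eq]
  norm_num
  rw [h2]
  constructor <;> linarith

theorem binEntropy_tenth : 0.325 ≤ Real.binEntropy (1 / 10) ∧ Real.binEntropy (1 / 10) ≤ 0.32509 := by
  obtain ⟨_, _, _, _, _, _⟩ := log_numerics
  have h1 := log_prime_smul (-1) 0 (-1)
  have h2 := log_prime_smul (-1) 2 (-1)
  norm_num at h1 h2
  rw [binEntropy_eq]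
  norm_num
  rw [h2, h1]
  constructor <;> linarith

theorem le_binEntropy_twentyfifth : 0.1679 ≤ Real.binEntropy (1 / 25) := by
  obtain ⟨_, _, _, _, _, _⟩ := log_numerics
  have h1 := log_prime_smul 0 0 (-2)
  have h2 := log_prime_smul 3 1 (-2)
  norm_num at h1 h2
  rw [binEntropy_eq]
  norm_num
  rw [h2, h1]
  linarith

theorem le_binEntropy_hundredth : 0.0559 ≤ Real.binEntropy (1 / 100) := by
  obtain ⟨_, _, _, _, _, _⟩ := log_numerics
  have h1 := log_prime_smul (-2) 0 (-2)
  have h2 := Real.log_le_sub_one_of_pos (by norm_num : (0:ℝ) < 99 / 100)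
  norm_num at h1 h2
  rw [binEntropy_eq]
  norm_num
  linarith

theorem le_binEntropy_fiftieth : 0.0978 ≤ Real.binEntropy (1 / 50) := by
  obtain ⟨_, _, _, _, _, _⟩ := log_numerics
  have h1 := log_prime_smul (-1) 0 (-2)
  have h2 := Real.log_le_sub_one_of_pos (by norm_num : (0:ℝ) < 49 / 50)
  norm_num at h1 h2
  rw [binEntropy_eq]
  norm_num
  linarith

theorem le_binEntropy_fifteenth : 0.2427 ≤ Real.binEntropy (1 / 15) := by
  obtain ⟨_, _, _, _, _, _⟩ := log_numerics
  have h1 := log_prime_smul 0 (-1) (-1)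
  have h2 := Real.log_le_sub_one_of_pos (by norm_num : (0:ℝ) < 14 / 15)
  norm_num at h1 h2
  rw [binEntropy_eq]
  norm_num
  linarith

theorem entCurv_le_of_log {t d L : ℝ} (h0 : 0 < t) (h1 : t < 1 / 2) (hL : Real.log ((1 - t) / t) ≤ L)
    (h : L ≤ d * (1 - 2 * t)) : entCurv t ≤ d := by
  rw [entCurv, entSlope, ← Real.log_div (by linarith) h0.ne', div_le_iff₀ (by linarith)]
  linarith

theorem entCurv_fifth : 2.31049 ≤ entCurv (1 / 5) ∧ entCurv (1 / 5) ≤ 2.3105 := by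
  obtain ⟨_, _, _, _, _, _⟩ := log_numerics
  have h1 := log_prime_smul 2 0 0
  norm_num at h1
  rw [entCurv, entSlope, ← Real.log_div (by norm_num) (by norm_num)]
  norm_num
  rw [h1]
  constructor <;> linarith

theorem entCurv_tenth : 2.7465 ≤ entCurv (1 / 10) ∧ entCurv (1 / 10) ≤ 2.74654 := by
  obtain ⟨_, _, _, _, _, _⟩ := log_numerics
  have h1 := log_prime_smul 0 2 0
  norm_num at h1
  rw [entCurv, entSlope, ← Real.log_div (by norm_num) (by norm_num)]
  norm_num
  rw [h1]
  constructor <;> linarith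

theorem entCurv_hundredth : entCurv (1 / 100) ≤ 4.7 := by
  obtain ⟨_, _, _, _, _, _⟩ := log_numerics
  have h1 := log_prime_smul 2 0 2
  norm_num at h1
  refine entCurv_le_of_log (by norm_num) (by norm_num)
    ((Real.log_le_log (by norm_num) (by norm_num : _ ≤ (100:ℝ))).trans h1.le) ?_
  linarith

theorem entCurv_fiftieth : entCurv (1 / 50) ≤ 4.08 := by
  obtain ⟨_, _, _, _, _, _⟩ := log_numerics
  have h1 := log_prime_smul 1 0 2
  norm_num at h1
  refine entCurv_le_of_log (by norm_num) (by norm_num)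
    ((Real.log_le_log (by norm_num) (by norm_num : _ ≤ (50:ℝ))).trans h1.le) ?_
  linarith

theorem entCurv_twentyfifth : entCurv (1 / 25) ≤ 3.5 := by
  obtain ⟨_, _, _, _, _, _⟩ := log_numerics
  have h1 := log_prime_smul 0 0 2
  norm_num at h1
  refine entCurv_le_of_log (by norm_num) (by norm_num)
    ((Real.log_le_log (by norm_num) (by norm_num : _ ≤ (25:ℝ))).trans h1.le) ?_
  linarith

theorem entCurv_fifteenth : entCurv (1 / 15) ≤ 3.13 := by
  obtain ⟨_, _, _, _, _, _⟩ := log_numerics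
  have h1 := log_prime_smul 0 1 1
  norm_num at h1
  refine entCurv_le_of_log (by norm_num) (by norm_num)
    ((Real.log_le_log (by norm_num) (by norm_num : _ ≤ (15:ℝ))).trans h1.le) ?_
  linarith

/-- Chord lower bound for the entropy. -/
theorem le_binEntropy_of_mem {a b A B c s g : ℝ} (ha : 0 ≤ a) (hb : b ≤ 1) (hab : a < b)
    (hA : A ≤ Real.binEntropy a) (hB : B ≤ Real.binEntropy b) (h1 : c + s * a ≤ A) (h2 : c + s * b ≤ B)
    (hag : a ≤ g) (hgb : g ≤ b) : c + s * g ≤ Real.binEntropy g := by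
  have hba : 0 < b - a := by linarith
  have := Real.strictConcave_binEntropy.concaveOn.2 (show a ∈ Set.Icc (0:ℝ) 1 from ⟨ha, by linarith⟩)
    (show b ∈ Set.Icc (0:ℝ) 1 from ⟨by linarith, hb⟩)
    (div_nonneg (by linarith : 0 ≤ b - g) hba.le)
    (div_nonneg (by linarith : 0 ≤ g - a) hba.le) (by field_simp; ring)
  simp only [smul_eq_mul] at this
  have e : (b - g) / (b - a) * a + (g - a) / (b - a) * b = g := by field_simp; ring
  rw [e] at this
  refine le_trans ?_ this
  have m1 := mul_le_mul_of_nonneg_left (h1.trans hA) (div_nonneg (by linarith : 0 ≤ b - g) hba.le)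
  have m2 := mul_le_mul_of_nonneg_left (h2.trans hB) (div_nonneg (by linarith : 0 ≤ g - a) hba.le)
  refine le_trans (le_of_eq ?_) (add_le_add m1 m2)
  field_simp; ring

/-- The entropy gap allowed at designed distance `g`. -/
noncomputable def entGap (g : ℝ) : ℝ := 17 / 25 * Real.binEntropy g - 8 / 25 * Real.log (1 - g)

theorem le_entGap {g t : ℝ} (h0 : 0 ≤ g) (h1 : g < 1) :
    17 / 25 * Real.binEntropy g + 8 / 25 * (g + t * g - t ^ 2 / 2) ≤ entGap g := by
  have := log_one_sub_le h0 h1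
  rw [entGap]
  nlinarith [sq_nonneg (g - t)]

theorem le_entGap_of_le {g : ℝ} (h0 : 0 ≤ g) (h1 : g ≤ 1 / 25) : 3.15 * g ≤ entGap g := by
  have h := le_binEntropy_of_mem (A := 0) (c := 0) (s := 4.1975) (g := g) le_rfl (by norm_num)
    (by norm_num : (0:ℝ) < 1 / 25) (by simp) le_binEntropy_twentyfifth (by norm_num) (by norm_num) h0 h1
  have := le_entGap (t := 0) h0 (by linarith)
  linarith

theorem le_entGap_of_mem {g : ℝ} (h0 : 1 / 25 ≤ g) (h1 : g ≤ 1 / 10) : 0.0421 + 2.122 * g ≤ entGap g := by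
  have h := le_binEntropy_of_mem (c := 0.06316) (s := 2.6183) (g := g) (by norm_num) (by norm_num)
    (by norm_num : (1 / 25:ℝ) < 1 / 10) le_binEntropy_twentyfifth binEntropy_tenth.1
    (by norm_num) (by norm_num) h0 h1
  have := le_entGap (t := 7 / 100) (by linarith : 0 ≤ g) (by linarith)
  linarith

theorem le_entGap_of_ge {g : ℝ} (h0 : 1 / 10 ≤ g) (h1 : g ≤ 1 / 5) : 0.0981 + 1.56 * g ≤ entGap g := by
  have h := le_binEntropy_of_mem (c := 0.1497) (s := 1.753) (g := g) (by norm_num) (by norm_num)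
    (by norm_num : (1 / 10:ℝ) < 1 / 5) binEntropy_tenth.1 binEntropy_fifth.1
    (by norm_num) (by norm_num) h0 h1
  have := le_entGap (t := 15 / 100) (by linarith : 0 ≤ g) (by linarith)
  linarith

theorem binEntropy_le_entGap {g r : ℝ} (hg : 0 < g) (hg1 : g ≤ 1 / 10) (hr0 : 0 ≤ r)
    (hr : r ≤ 0.642 * g) : Real.binEntropy r ≤ entGap g := by
  have h1 := binEntropy_le_binEntropy hr0 hr (by linarith)
  refine h1.trans ?_
  have h2 : Real.log (0.642 * g) = Real.log 0.642 + Real.log g := Real.log_mul (by norm_num) hg.ne'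
  have h3 : -0.558 ≤ Real.log 0.642 := le_trans (by norm_num) (Real.one_sub_inv_le_log_of_pos (by norm_num))
  have h4 := Real.one_sub_inv_le_log_of_pos (by linarith : 0 < 1 - 0.642 * g)
  have h4' : -(0.642 * g) ≤ (1 - 0.642 * g) * Real.log (1 - 0.642 * g) := by
    have := mul_le_mul_of_nonneg_left h4 (by linarith : 0 ≤ 1 - 0.642 * g)
    have e : (1 - 0.642 * g) * (1 - (1 - 0.642 * g)⁻¹) = -(0.642 * g) := by
      have : 1 - 0.642 * g ≠ 0 := by linarith
      field_simp; ring
    rwa [e] at this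
  have h5 := Real.log_le_sub_one_of_pos (by linarith : 0 < 1 - g)
  have h6 : Real.log g ≤ - 2.3 := by
    have h := Real.log_le_log hg hg1
    have h7 := log_prime_smul (-1) 0 (-1)
    obtain ⟨_, _, _, _, _, _⟩ := log_numerics
    norm_num at h7 h
    linarith
  rw [entGap, binEntropy_eq, binEntropy_eq, h2]
  have m1 := mul_le_mul_of_nonneg_left h3 hg.le
  have m2 := mul_le_mul_of_nonneg_left h6 hg.le
  have m3 := mul_le_mul_of_nonneg_left h5 (by linarith : 0 ≤ 17 / 25 * (1 - g))
  nlinarith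

set_option maxHeartbeats 2000000 in
theorem binEntropy_sub_le_entGap {τ α g : ℝ} (hτ : 0 ≤ τ) (hτα : τ ≤ α) (hα : α ≤ 1 / 2) (hG : Gfun α τ = g)
    (hg0 : 0 < g) (hg1 : g ≤ 1 / 5) : Real.binEntropy α - Real.binEntropy τ ≤ entGap g := by
  have hmul := Gfun_mul (α := α) hτ (by linarith)
  rw [hG] at hmul
  have hs0 := Real.sqrt_nonneg (τ * (1 - τ))
  have hsq := Real.sq_sqrt (mul_nonneg hτ (by linarith : 0 ≤ 1 - τ))
  set σ := Real.sqrt (τ * (1 - τ))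
  have hσg : σ ≤ 1 / 2 - g := by nlinarith [sq_nonneg (α - 1 / 2)]
  have hK : α * (1 - α) - τ * (1 - τ) = g * (1 / 2 + σ) := by rw [← hsq]; linarith
  have hKle : ∀ k : ℝ, 1 / 2 + σ ≤ k → α * (1 - α) - τ * (1 - τ) ≤ k * g := by
    intro k hk; rw [hK]; nlinarith
  have hτle : ∀ r : ℝ, r ≤ 1 / 2 → σ ^ 2 ≤ r * (1 - r) → τ ≤ r := fun r h1 h2 =>
    le_of_mul_one_sub_le (by linarith) h1 (by linarith)
  have hleτ : ∀ r : ℝ, r ≤ 1 / 2 → r * (1 - r) ≤ σ ^ 2 → r ≤ τ := fun r h1 h2 =>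
    le_of_mul_one_sub_le h1 (by linarith) (by linarith)
  have c1 := fun h => le_entGap_of_le hg0.le (g := g) h
  have c2 := fun h h' => le_entGap_of_mem (g := g) h h'
  have c3 := fun h => le_entGap_of_ge (g := g) h hg1
  have H5 := binEntropy_fifth.2
  have H10 := binEntropy_tenth.2
  rcases le_total σ 0.1 with s1 | s1
  · have hk := hKle 0.6 (by linarith)
    rcases le_total g (1 / 10) with g1 | g1
    · refine (binEntropy_sub_le_binEntropy (r := 0.642 * g) hτ hτα hα (by linarith) (by linarith) ?_).trans
        (binEntropy_le_entGap hg0 g1 (by linarith) le_rfl)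
      nlinarith
    · have := binEntropy_sub_le_of_le (r := 1 / 10) (q := 0.32509) le_rfl hτ
        (hτle _ (by norm_num) (by nlinarith)) (by norm_num) (by norm_num) hτα hα entCurv_tenth.2
        entCurv_tenth.1 hk (by rw [Real.binEntropy_zero]; linarith)
      linarith [c3 g1]
  rcases le_total σ 0.15 with s2 | s2
  · have hk := hKle 0.65 (by linarith)
    have ht : 1 / 100 ≤ τ := hleτ _ (by norm_num) (by nlinarith)
    have hr : τ ≤ 1 / 10 := hτle _ (by norm_num) (by nlinarith)
    rcases le_total g (1 / 25) with g1 | g1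
    · linarith [c1 g1, binEntropy_sub_le_entCurv_mul (by norm_num) (by norm_num) ht hτα hα
        entCurv_hundredth hk]
    have := binEntropy_sub_le_of_le (by norm_num) ht hr (by norm_num) (by norm_num) hτα hα entCurv_tenth.2
        entCurv_tenth.1 hk (sub_le_sub H10 le_binEntropy_hundredth)
    rcases le_total g (1 / 10) with g2 | g2
    · linarith [c2 g1 g2]
    · linarith [c3 g2]
  rcases le_total σ 0.2 with s3 | s3
  · have hk := hKle 0.7 (by linarith)
    have ht : 1 / 50 ≤ τ := hleτ _ (by norm_num) (by nlinarith)
    have hr : τ ≤ 1 / 10 := hτle _ (by norm_num) (by nlinarith)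
    rcases le_total g (1 / 25) with g1 | g1
    · linarith [c1 g1, binEntropy_sub_le_entCurv_mul (by norm_num) (by norm_num) ht hτα hα
        entCurv_fiftieth hk]
    rcases le_total g (1 / 10) with g2 | g2
    · linarith [c2 g1 g2, binEntropy_sub_le_of_le (by norm_num) ht hr (by norm_num) (by norm_num) hτα hα
        entCurv_tenth.2 entCurv_tenth.1 hk (sub_le_sub H10 le_binEntropy_fiftieth)]
    · linarith [c3 g2, binEntropy_sub_le_of_le (by norm_num) ht (hr.trans (by norm_num : (1 / 10:ℝ) ≤ 1 / 5))
        (by norm_num) (by norm_num) hτα hα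
        entCurv_fifth.2 entCurv_fifth.1 hk (sub_le_sub H5 le_binEntropy_fiftieth)]
  rcases le_total σ 0.25 with s4 | s4
  · have hk := hKle 0.75 (by linarith)
    have ht : 1 / 25 ≤ τ := hleτ _ (by norm_num) (by nlinarith)
    have hr : τ ≤ 1 / 5 := hτle _ (by norm_num) (by nlinarith)
    rcases le_total g (1 / 25) with g1 | g1
    · linarith [c1 g1, binEntropy_sub_le_entCurv_mul (by norm_num) (by norm_num) ht hτα hα
        entCurv_twentyfifth hk]
    have := binEntropy_sub_le_of_le (by norm_num) ht hr (by norm_num) (by norm_num) hτα hα entCurv_fifth.2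
        entCurv_fifth.1 hk (sub_le_sub H5 le_binEntropy_twentyfifth)
    rcases le_total g (1 / 10) with g2 | g2
    · linarith [c2 g1 g2]
    · linarith [c3 g2]
  rcases le_total σ 0.3 with s5 | s5
  · have hk := hKle 0.8 (by linarith)
    have ht : 1 / 15 ≤ τ := hleτ _ (by norm_num) (by nlinarith)
    have hr : τ ≤ 1 / 5 := hτle _ (by norm_num) (by nlinarith)
    rcases le_total g (1 / 25) with g1 | g1
    · linarith [c1 g1, binEntropy_sub_le_entCurv_mul (by norm_num) (by norm_num) ht hτα hα
        entCurv_fifteenth hk]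
    have := binEntropy_sub_le_of_le (by norm_num) ht hr (by norm_num) (by norm_num) hτα hα entCurv_fifth.2
        entCurv_fifth.1 hk (sub_le_sub H5 le_binEntropy_fifteenth)
    rcases le_total g (1 / 10) with g2 | g2
    · linarith [c2 g1 g2]
    · linarith [c3 g2]
  rcases le_total σ 0.4 with s6 | s6
  · have hk := hKle 0.9 (by linarith)
    have ht : 1 / 10 ≤ τ := hleτ _ (by norm_num) (by nlinarith)
    have hr : τ ≤ 1 / 5 := hτle _ (by norm_num) (by nlinarith)
    have := binEntropy_sub_le_entCurv_mul (by norm_num) (by norm_num) ht hτα hα entCurv_tenth.2 hk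
    rcases le_total g (1 / 25) with g1 | g1
    · linarith [c1 g1]
    rcases le_total g (1 / 10) with g2 | g2
    · linarith [c2 g1 g2]
    have hk' : α * (1 - α) - τ * (1 - τ) ≤ 0.7 * g + 0.0225 := by
      rw [hK]; nlinarith [sq_nonneg (g - 0.15)]
    linarith [c3 g2, binEntropy_sub_le_of_le (by norm_num) ht hr (by norm_num) (by norm_num) hτα hα
      entCurv_fifth.2 entCurv_fifth.1 hk' (sub_le_sub H5 binEntropy_tenth.1)]
  · have hk := hKle 1 (by linarith)
    have ht : 1 / 5 ≤ τ := hleτ _ (by norm_num) (by nlinarith)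
    have := binEntropy_sub_le_entCurv_mul (by norm_num) (by norm_num) ht hτα hα entCurv_fifth.2 hk
    rcases le_total g (1 / 25) with g1 | g1
    · linarith [c1 g1]
    · linarith [c2 g1 (by linarith)]

theorem errorLowerBound_of_le_eighth {x α τ r δ M : ℝ} (hx : 0 < x) (hx1 : x ≤ 1 / 8)
    (hτ : 0 ≤ τ) (hτα : τ ≤ α) (hα : α ≤ 1 / 2)
    (hL : Real.log 2 - Real.binEntropy α + Real.binEntropy τ ≤ r) (hr : r < Real.log 2)
    (hG : Gfun α τ = δ) (hδ0 : 0 < δ) (hδ : δ < critDist x)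
    (hM : 0 ≤ M) (hO : OverlapBound (x ^ 2 / (1 + x ^ 2)) δ M) :
    ErrorLowerBound (x ^ 2 / (1 + x ^ 2)) r M := by
  have hw := critDist_pos hx
  have hw2 := critDist_lt hx (by linarith)
  have hw16 : critDist x ≤ 1 / 5 := by
    rw [critDist, div_le_div_iff₀ (by positivity) (by norm_num)]; nlinarith
  have hp0 : 0 < x ^ 2 / (1 + x ^ 2) := by positivity
  have hp : x ^ 2 / (1 + x ^ 2) < 1 / 2 := by
    rw [div_lt_div_iff₀ (by positivity) (by norm_num)]; nlinarith
  refine errorLowerBound_of_forall_add fun ε hε => ?_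
  obtain ⟨g, hg1, hg2, hg3⟩ : ∃ g, δ < g ∧ g ≤ critDist x ∧ M * g / δ ≤ M + ε := by
    refine ⟨min (critDist x) (δ * (1 + ε / (M + 1))), lt_min hδ ?_, min_le_left _ _, ?_⟩
    · have : 0 < ε / (M + 1) := by positivity
      nlinarith
    · rw [div_le_iff₀ hδ0]
      refine (mul_le_mul_of_nonneg_left (min_le_right _ _) hM).trans ?_
      have : M * (ε / (M + 1)) ≤ ε := by
        rw [mul_div_assoc', div_le_iff₀ (by positivity)]; nlinarith
      nlinarith
  have hg0 : 0 < g := hδ0.trans hg1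
  obtain ⟨α', τ', a1, a2, a3, a4, a5⟩ := exists_Gfun_eq_of_le hτ hτα hα hL hr (by rw [hG]; exact hg1)
    (by linarith : g < 1 / 2)
  have o1 : OverlapBound (x ^ 2 / (1 + x ^ 2)) g (M * g / δ) := by
    have := hO.scale hp0 hp (κ := δ / g) (by positivity) ((div_le_one hg0).2 hg1.le)
      (by rw [div_div_cancel₀ hδ0.ne']; linarith)
    rwa [div_div_cancel₀ hδ0.ne', div_div_eq_mul_div] at this
  refine (errorLowerBound_of_le_critDist hx (by linarith) a1 a2 a3 a4 a5 hg0 hg2 (by positivity) o1 ?_).mono hg3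
  refine le_trans ?_ (mul_critVal_le hx (by linarith) hg0 hg2 o1)
  have hc := bhat_pos hp0 hp
  have hF : 17 / 25 * (bhat (x ^ 2 / (1 + x ^ 2)) * g) ≤ g / critDist x * critVal x := by
    have := mul_le_mul_of_nonneg_left (mul_bhat_le_critVal hx hx1) (by positivity : 0 ≤ g / critDist x)
    refine le_trans (le_of_eq ?_) this
    field_simp
  refine le_trans ?_ hF
  have hJ := binEntropy_sub_le_entGap a1.le a2.le a3.le a5 hg0 (hg2.trans hw16)
  have hS : 0 < entSlope g := hc.trans_le (bhat_le_entSlope hx (by linarith) hg0 hg2)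
  have : 8 / 25 * g ≤ (r - Real.log 2 + Real.binEntropy g) / entSlope g := by
    rw [le_div_iff₀ hS, entSlope]
    rw [entGap] at hJ
    have := binEntropy_eq g
    linarith
  nlinarith

theorem reliability_le_max {p R : ℝ} (hp0 : 0 < p) (hp : p < 1 / 2) (hR0 : 0 < R)
    (hR1 : R < 1 - binEnt p) :
    reliability p R ≤ max (1 - R - binEnt (deltaJPL R) - Aexp p (deltaJPL R))
      (sSup {e : ℝ | ∃ l ω : ℝ, 0 ≤ l ∧ l ≤ ω ∧ ω ≤ deltaJPL R ∧ e = Bexp p ω l - Aexp p l}) := by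
  have hl2 := Real.log_pos one_lt_two
  have hHp : R * Real.log 2 < Real.log 2 - Real.binEntropy p := by
    rw [binEntropy_eq_binEnt_mul]; nlinarith
  have hHp0 : 0 ≤ Real.binEntropy p := Real.binEntropy_nonneg hp0.le (by linarith)
  have hR : R < 1 := by
    by_contra! h
    nlinarith
  obtain ⟨α, τ, h1, h2, h3, h4, h5, h6, h7⟩ := deltaJPL_spec hR0 hR
  obtain ⟨hM0, hM⟩ := overlapBound_sSup hp0 hp h6.le h7.le
  have hU : Real.log 2 * (1 - R - binEnt (deltaJPL R) - Aexp p (deltaJPL R)) =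
      unionExp p (R * Real.log 2) (deltaJPL R) := by
    rw [unionExp, binEntropy_eq_binEnt_mul, Aexp, bhat, Real.logb]
    field_simp
    ring
  set S := sSup {e : ℝ | ∃ l ω : ℝ, 0 ≤ l ∧ l ≤ ω ∧ ω ≤ deltaJPL R ∧ e = Bexp p ω l - Aexp p l}
  set δ := deltaJPL R
  have hM0' : 0 ≤ Real.log 2 * S := mul_nonneg hl2.le hM0
  suffices h : ErrorLowerBound p (R * Real.log 2) (max (unionExp p (R * Real.log 2) δ) (Real.log 2 * S)) by
    refine (reliability_le_of_errorLowerBound hp0 hp (hM0'.trans (le_max_right _ _)) h).trans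
      (le_of_eq ?_)
    rw [← hU, ← mul_max_of_nonneg _ _ hl2.le, mul_div_cancel_left₀ _ hl2.ne']
  obtain ⟨x, hx, hx1, rfl⟩ := exists_sq_div hp0 hp
  rcases le_or_gt (critDist x) δ with hw | hw
  · exact errorLowerBound_max_unionExp hx hx1 h1 h2 h3 h4.le (by linarith) h5 h7 hw hM0' hM
  rcases le_or_gt (Real.log 2 - Real.binEntropy (x / (1 + x))) (R * Real.log 2) with hr | hr
  · exact errorLowerBound_of_critRate_le hx hx1 h6 hw.le hr hHp hM
  rcases le_total (1 / 8) x with hx8 | hx8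
  · exact errorLowerBound_of_eighth_le hx8 hx1 h1 h2 h3 h4.le h5 h6 hw hr hM0' hM
  · exact (errorLowerBound_of_le_eighth hx hx8 h1 h2 h3 h4.le (by linarith) h5 h6 hw hM0' hM).mono
      (le_max_right _ _)

theorem reliability_upper_bounds_jpl
    (p : ℝ) (hp0 : 0 < p) (hp : p < 1 / 2)
    (R : ℝ) (hR0 : 0 < R) (hR1 : R < 1 - binEnt p) :
    (sSup {e : ℝ | ∃ l ω : ℝ, 0 ≤ l ∧ l ≤ ω ∧ ω ≤ deltaJPL R ∧
          e = Bexp p ω l - Aexp p l}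
        ≤ 1 - R - binEnt (deltaJPL R) - Aexp p (deltaJPL R) →
      reliability p R ≤ 1 - R - binEnt (deltaJPL R) - Aexp p (deltaJPL R))
    ∧ (1 - R - binEnt (deltaJPL R) - Aexp p (deltaJPL R)
        ≤ sSup {e : ℝ | ∃ l ω : ℝ, 0 ≤ l ∧ l ≤ ω ∧ ω ≤ deltaJPL R ∧
            e = Bexp p ω l - Aexp p l} →
      reliability p R ≤ sSup {e : ℝ | ∃ l ω : ℝ, 0 ≤ l ∧ l ≤ ω ∧ ω ≤ deltaJPL R ∧
        e = Bexp p ω l - Aexp p l}) := by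
  have h := reliability_le_max hp0 hp hR0 hR1
  exact ⟨fun h1 => h.trans (max_eq_left h1).le, fun h1 => h.trans (max_eq_right h1).le⟩
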